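/- Absence of splash singularities for two-fluid interfaces (Main Theorem): Under the stated assumptions, the qualitative condition inf_{α,β∈ℝ, t∈[0,T]} F(z)(α,β,t) > 0 implies the quantitative bound inf_{α,β∈ℝ, t∈[0,T]} F(z)(α,β,t) ≥ c for some constant c > 0 depending only on A, T, σ, g, ρ¹, ρ². -/

import Mathlib

noncomputable section
open Set MeasureTheory Filter

/-- The plane `ℝ²` with the Euclidean norm. -/
abbrev E2 : Type := EuclideanSpace ℝ (Fin 2)

/-- The real inner product on `ℝ²`. -/
def rinner (x y : E2) : ℝ := inner ℝ x y

/-- The vector `(1,0)`. -/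
def xvec : E2 := (EuclideanSpace.equiv (Fin 2) ℝ).symm ![1, 0]

/-- The vector `(0,1)`. -/
def e2vec : E2 := (EuclideanSpace.equiv (Fin 2) ℝ).symm ![0, 1]

/-- The period vector `(2π, 0)`. -/
def transl : E2 := (EuclideanSpace.equiv (Fin 2) ℝ).symm ![2 * Real.pi, 0]

/-- The rotation of a vector by `π/2`: `(x,y)^⊥ = (-y,x)`. -/
def perpv (w : E2) : E2 := (EuclideanSpace.equiv (Fin 2) ℝ).symm ![-(w 1), w 0]

/-- The chord-arc function `F(z)` of a time-dependent curve. -/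
def chordArcT (z : ℝ → ℝ → E2) (α β t : ℝ) : ℝ :=
  if α = β then ‖deriv (fun a => z a t) α‖ else ‖z α t - z β t‖ / |α - β|

/-- The two-fluid interface system on the time interval `[0,T]`, in the `2π`-periodic setting,
with densities `ρ1, ρ2`, surface tension coefficient `σ`, gravity constant `grav`, and
quantitative bounds measured by the constant `A`. -/
structure TwoFluid (ρ1 ρ2 σ grav T A : ℝ) where
  /-- the parametrization of the interface -/
  z : ℝ → ℝ → E2
  /-- the domain of the first fluid -/
  Ω1 : ℝ → Set E2
  /-- the domain of the second fluid -/
  Ω2 : ℝ → Set E2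
  /-- the velocity field of the first fluid -/
  u1 : E2 → ℝ → E2
  /-- the velocity field of the second fluid -/
  u2 : E2 → ℝ → E2
  /-- the pressure of the first fluid -/
  P1 : E2 → ℝ → ℝ
  /-- the pressure of the second fluid -/
  P2 : E2 → ℝ → ℝ
  hΩ1_open : ∀ t ∈ Icc (0:ℝ) T, IsOpen (Ω1 t)
  hΩ2_open : ∀ t ∈ Icc (0:ℝ) T, IsOpen (Ω2 t)
  hΩ1_conn : ∀ t ∈ Icc (0:ℝ) T, IsConnected (Ω1 t)
  hΩ2_conn : ∀ t ∈ Icc (0:ℝ) T, IsConnected (Ω2 t)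
  hΩ1_sc : ∀ t ∈ Icc (0:ℝ) T, SimplyConnectedSpace (Ω1 t)
  hΩ2_sc : ∀ t ∈ Icc (0:ℝ) T, SimplyConnectedSpace (Ω2 t)
  /-- `ℝ²` is the disjoint union of `Ω1 t`, `Ω2 t` and the interface `Γ_t` -/
  hUnion : ∀ t ∈ Icc (0:ℝ) T, Ω1 t ∪ Ω2 t ∪ range (fun α => z α t) = univ
  hDisj12 : ∀ t ∈ Icc (0:ℝ) T, Disjoint (Ω1 t) (Ω2 t)
  hDisj1Γ : ∀ t ∈ Icc (0:ℝ) T, Disjoint (Ω1 t) (range (fun α => z α t))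
  hDisj2Γ : ∀ t ∈ Icc (0:ℝ) T, Disjoint (Ω2 t) (range (fun α => z α t))
  hFront1 : ∀ t ∈ Icc (0:ℝ) T, frontier (Ω1 t) = range (fun α => z α t)
  hFront2 : ∀ t ∈ Icc (0:ℝ) T, frontier (Ω2 t) = range (fun α => z α t)
  /-- `Ω1` contains a lower half-plane and `Ω2` an upper half-plane -/
  hStrip : ∃ a : ℝ, 1 ≤ a ∧ ∀ t ∈ Icc (0:ℝ) T,
      {x : E2 | x 1 ≤ -a} ⊆ Ω1 t ∧ {x : E2 | a ≤ x 1} ⊆ Ω2 t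
  /-- `u1(·,t)` is `C³` on the closure of `Ω1 t` -/
  hu1_reg : ∀ t ∈ Icc (0:ℝ) T, ContDiffOn ℝ 3 (fun x => u1 x t) (closure (Ω1 t))
  hu2_reg : ∀ t ∈ Icc (0:ℝ) T, ContDiffOn ℝ 3 (fun x => u2 x t) (closure (Ω2 t))
  hP1_reg : ∀ t ∈ Icc (0:ℝ) T, ContDiffOn ℝ 1 (fun x => P1 x t) (closure (Ω1 t))
  hP2_reg : ∀ t ∈ Icc (0:ℝ) T, ContDiffOn ℝ 1 (fun x => P2 x t) (closure (Ω2 t))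
  /-- Euler's equation in `Ω1 t` -/
  hEuler1 : ∀ t ∈ Icc (0:ℝ) T, ∀ x ∈ Ω1 t,
      ρ1 • (deriv (fun s => u1 x s) t + fderiv ℝ (fun y => u1 y t) x (u1 x t)) =
        -gradient (fun y => P1 y t) x - (grav * ρ1) • e2vec
  /-- Euler's equation in `Ω2 t` -/
  hEuler2 : ∀ t ∈ Icc (0:ℝ) T, ∀ x ∈ Ω2 t,
      ρ2 • (deriv (fun s => u2 x s) t + fderiv ℝ (fun y => u2 y t) x (u2 x t)) =
        -gradient (fun y => P2 y t) x - (grav * ρ2) • e2vec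
  /-- incompressibility of the first fluid -/
  hdiv1 : ∀ t ∈ Icc (0:ℝ) T, ∀ x ∈ Ω1 t,
      fderiv ℝ (fun y => u1 y t) x (EuclideanSpace.single 0 1) 0 +
        fderiv ℝ (fun y => u1 y t) x (EuclideanSpace.single 1 1) 1 = 0
  hdiv2 : ∀ t ∈ Icc (0:ℝ) T, ∀ x ∈ Ω2 t,
      fderiv ℝ (fun y => u2 y t) x (EuclideanSpace.single 0 1) 0 +
        fderiv ℝ (fun y => u2 y t) x (EuclideanSpace.single 1 1) 1 = 0
  /-- irrotationality of the first fluid -/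
  hcurl1 : ∀ t ∈ Icc (0:ℝ) T, ∀ x ∈ Ω1 t,
      fderiv ℝ (fun y => u1 y t) x (EuclideanSpace.single 0 1) 1 -
        fderiv ℝ (fun y => u1 y t) x (EuclideanSpace.single 1 1) 0 = 0
  hcurl2 : ∀ t ∈ Icc (0:ℝ) T, ∀ x ∈ Ω2 t,
      fderiv ℝ (fun y => u2 y t) x (EuclideanSpace.single 0 1) 1 -
        fderiv ℝ (fun y => u2 y t) x (EuclideanSpace.single 1 1) 0 = 0
  /-- kinematic boundary condition for the first fluid -/
  hkin1 : ∀ t ∈ Icc (0:ℝ) T, ∀ α : ℝ,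
      rinner (deriv (fun s => z α s) t - u1 (z α t) t) (perpv (deriv (fun a => z a t) α)) = 0
  hkin2 : ∀ t ∈ Icc (0:ℝ) T, ∀ α : ℝ,
      rinner (deriv (fun s => z α s) t - u2 (z α t) t) (perpv (deriv (fun a => z a t) α)) = 0
  /-- the pressure jump at the interface is given by the surface tension times the curvature -/
  hjump : ∀ t ∈ Icc (0:ℝ) T, ∀ α : ℝ,
      P2 (z α t) t - P1 (z α t) t =
        -σ * (deriv (fun a => z a t) α 0 * deriv (fun a => deriv (fun b => z b t) a) α 1 -
              deriv (fun a => z a t) α 1 * deriv (fun a => deriv (fun b => z b t) a) α 0) /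
          ((deriv (fun a => z a t) α 0) ^ 2 + (deriv (fun a => z a t) α 1) ^ 2) ^ ((3:ℝ)/2)
  /-- `2π`-periodicity -/
  hper_z : ∀ t ∈ Icc (0:ℝ) T, ∀ α : ℝ, z (α + 2 * Real.pi) t = z α t + transl
  hper_Ω1 : ∀ t ∈ Icc (0:ℝ) T, (fun x => x + transl) '' Ω1 t = Ω1 t
  hper_Ω2 : ∀ t ∈ Icc (0:ℝ) T, (fun x => x + transl) '' Ω2 t = Ω2 t
  hper_u1 : ∀ t ∈ Icc (0:ℝ) T, ∀ x ∈ Ω1 t, u1 (x + transl) t = u1 x t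
  hper_u2 : ∀ t ∈ Icc (0:ℝ) T, ∀ x ∈ Ω2 t, u2 (x + transl) t = u2 x t
  /-- finite kinetic energy in a period -/
  hL2_1 : ∀ t ∈ Icc (0:ℝ) T,
      IntegrableOn (fun x => ‖u1 x t‖ ^ 2) (Ω1 t ∩ {x : E2 | x 0 ∈ Icc 0 (2 * Real.pi)})
  hL2_2 : ∀ t ∈ Icc (0:ℝ) T,
      IntegrableOn (fun x => ‖u2 x t‖ ^ 2) (Ω2 t ∩ {x : E2 | x 0 ∈ Icc 0 (2 * Real.pi)})
  /-- `z(α,t) - (α,0)` is `C⁴` with all derivatives of order `≤ 4` bounded by `A` -/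
  hz_smooth : ContDiffOn ℝ 4 (fun p : ℝ × ℝ => z p.1 p.2 - p.1 • xvec) (univ ×ˢ Icc (0:ℝ) T)
  hz_bound : ∀ p ∈ (univ ×ˢ Icc (0:ℝ) T : Set (ℝ × ℝ)), ∀ i : ℕ, i ≤ 4 →
      ‖iteratedFDerivWithin ℝ i (fun p : ℝ × ℝ => z p.1 p.2 - p.1 • xvec)
          (univ ×ˢ Icc (0:ℝ) T) p‖ ≤ A
  /-- the parametrization is regular -/
  hz_lower : ∀ t ∈ Icc (0:ℝ) T, ∀ α : ℝ, A⁻¹ ≤ ‖deriv (fun a => z a t) α‖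
  /-- `v¹(α,t) = u¹(z(α,t),t)` is `C³` with all derivatives of order `≤ 3` bounded by `A` -/
  hv1_smooth : ContDiffOn ℝ 3 (fun p : ℝ × ℝ => u1 (z p.1 p.2) p.2) (univ ×ˢ Icc (0:ℝ) T)
  hv1_bound : ∀ p ∈ (univ ×ˢ Icc (0:ℝ) T : Set (ℝ × ℝ)), ∀ i : ℕ, i ≤ 3 →
      ‖iteratedFDerivWithin ℝ i (fun p : ℝ × ℝ => u1 (z p.1 p.2) p.2)
          (univ ×ˢ Icc (0:ℝ) T) p‖ ≤ A
  /-- the chord-arc condition at time `0` -/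
  hchord0 : ∀ α β : ℝ, A⁻¹ ≤ chordArcT z α β 0
  /-- `u²` is bounded by `A` on the interface at time `0` -/
  hu2_init : ∀ α : ℝ, ‖u2 (z α 0) 0‖ ≤ A


namespace NS
open Complex Topology Metric

lemma MP {U : Set ℂ} {G : ℂ → ℂ} {y0 : ℂ} {ρ M c : ℝ} (hU : IsOpen U) (hρ : 0 < ρ)
    (hy : ∀ x ∈ U, ρ ≤ ‖x - y0‖) (hG : DifferentiableOn ℂ G U) (hM : ∀ x ∈ U, (G x).re ≤ M)
    (hb : ∀ x ∈ frontier U, ∀ ε > 0, ∀ᶠ y in 𝓝[U] x, (G y).re ≤ c + ε) :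
    ∀ x ∈ U, (G x).re ≤ c := by
  intro x1 hx1
  by_contra! hc
  set δ := ((G x1).re - c) / 2 with hδ
  have hδ0 : 0 < δ := by simp only [hδ]; linarith
  clear_value δ
  have key : ∀ N : ℕ, 0 < N → Real.exp (N * δ) ≤ ‖x1 - y0‖ / ρ := by
    intro N hN
    have hN' : (0:ℝ) < N := by exact_mod_cast hN
    set F : ℂ → ℂ := fun x => Complex.exp (N * (G x - c)) * (ρ / (x - y0)) with hF
    have hn : ∀ x, ‖F x‖ = Real.exp (N * ((G x).re - c)) * (ρ / ‖x - y0‖) := by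
      intro x; simp [hF, Complex.norm_exp, abs_of_pos hρ]
    have hFd : DifferentiableOn ℂ F U := by
      apply DifferentiableOn.mul
      · exact ((hG.sub_const _).const_mul _).cexp
      · apply DifferentiableOn.div (by fun_prop) (by fun_prop)
        intro x hx h0
        have := hy x hx
        rw [h0, norm_zero] at this; linarith
    have hle1 : ∀ x ∈ U, ρ / ‖x - y0‖ ≤ 1 := fun x hx => by
      have := hy x hx; rw [div_le_one (by linarith)]; exact this
    set V := {y ∈ U | Real.exp (N * δ) < ‖F y‖} with hV
    have hVo : IsOpen V := (hFd.continuousOn.norm).isOpen_inter_preimage hU isOpen_Ioi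
    have hcl : closure V ⊆ U := by
      intro x hx
      have hxc : x ∈ closure U := closure_mono (fun y hy => hy.1) hx
      by_contra hxU
      have hxf : x ∈ frontier U := by rw [hU.frontier_eq]; exact ⟨hxc, hxU⟩
      have h1 := hb x hxf (δ/2) (by linarith)
      rw [mem_closure_iff_frequently] at hx
      rw [eventually_nhdsWithin_iff] at h1
      obtain ⟨y, hyV, hy1⟩ := (hx.and_eventually h1).exists
      have h2 := hy1 hyV.1
      have h3 := hyV.2
      rw [hn] at h3
      have h4 : Real.exp (N * ((G y).re - c)) ≤ Real.exp (N * δ) :=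
        Real.exp_le_exp.2 (by nlinarith)
      have := hle1 y hyV.1
      have h5 : 0 ≤ ρ / ‖y - y0‖ := by positivity
      nlinarith [Real.exp_pos (N * ((G y).re - c))]
    have hVb : Bornology.IsBounded V := by
      refine (isBounded_closedBall (x := y0) (r := Real.exp (N * (M - c)) * ρ)).subset ?_
      intro y hyV
      have h3 := hyV.2
      rw [hn] at h3
      have hp : 0 < ‖y - y0‖ := lt_of_lt_of_le hρ (hy y hyV.1)
      have h4 : Real.exp (N * ((G y).re - c)) ≤ Real.exp (N * (M - c)) :=
        Real.exp_le_exp.2 (by nlinarith [hM y hyV.1])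
      have h6 : (1:ℝ) ≤ Real.exp (N*δ) := Real.one_le_exp (by positivity)
      rw [mem_closedBall, dist_eq_norm]
      rw [← mul_div_assoc, lt_div_iff₀ hp] at h3
      nlinarith
    have hmax : ∀ y ∈ closure V, ‖F y‖ ≤ Real.exp (N*δ) := by
      intro y hyV
      refine Complex.norm_le_of_forall_mem_frontier_norm_le hVb ?_ ?_ hyV
      · exact ⟨hFd.mono (subset_closure.trans hcl), hFd.continuousOn.mono hcl⟩
      · intro w hw
        rw [hVo.frontier_eq] at hw
        by_contra! hlt
        exact hw.2 ⟨hcl hw.1, hlt⟩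
    have hx1V : ‖F x1‖ ≤ Real.exp (N*δ) := by
      by_contra! hlt
      exact absurd (hmax x1 (subset_closure ⟨hx1, hlt⟩)) (not_le.2 hlt)
    rw [hn] at hx1V
    have hp : 0 < ‖x1 - y0‖ := lt_of_lt_of_le hρ (hy x1 hx1)
    have h7 : (N:ℝ) * ((G x1).re - c) = N * δ + N * δ := by simp only [hδ]; ring
    rw [h7, Real.exp_add, ← mul_div_assoc, div_le_iff₀ hp] at hx1V
    rw [le_div_iff₀ hρ]
    nlinarith [Real.exp_pos (N*δ)]
  obtain ⟨N, hN⟩ := exists_nat_gt (‖x1 - y0‖ / ρ / δ)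
  have h0 : (0:ℝ) ≤ ‖x1 - y0‖ / ρ / δ := by positivity
  have hN0 : 0 < N := by
    have : (0:ℝ) < N := by linarith
    exact_mod_cast this
  have := key N hN0
  rw [div_lt_iff₀ hδ0] at hN
  linarith [Real.add_one_le_exp (N*δ)]

/-- derivative bound from a bound of the imaginary part -/
lemma deriv_im {h : ℂ → ℂ} {x : ℂ} {r S c : ℝ} (hr : 0 < r) (hS : 0 ≤ S)
    (hh : DifferentiableOn ℂ h (ball x r)) (hb : ∀ y ∈ ball x r, |(h y).im - c| ≤ S) :
    ‖deriv h x‖ ≤ 16 * S / r := by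
  suffices H : ∀ S' > S, ‖deriv h x‖ ≤ 16 * S' / r by
    refine le_of_forall_gt_imp_ge_of_dense fun a ha => ?_
    have h1 : S < a * r / 16 := by rw [lt_div_iff₀ (by norm_num)]; rw [div_lt_iff₀ hr] at ha; linarith
    refine (H _ h1).trans (le_of_eq ?_)
    field_simp
  intro S' hS'
  have hS0 : 0 < S' := by linarith
  set E : ℂ → ℂ := fun y => Complex.exp (I * (h y - c * I) / S') with hE
  have hEn : ∀ y, ‖E y‖ = Real.exp (-((h y).im - c) / S') := by
    intro y
    rw [hE]; simp only [Complex.norm_exp]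
    congr 1
    rw [div_ofReal_re]
    simp
  have hd : HasDerivAt h (deriv h x) x :=
    ((hh x (mem_ball_self hr)).differentiableAt (isOpen_ball.mem_nhds (mem_ball_self hr))).hasDerivAt
  have hEd : DifferentiableOn ℂ E (ball x r) := by
    simp only [hE]
    exact (((hh.sub_const _).const_mul _).div_const _).cexp
  have hE' : HasDerivAt E (E x * (I * deriv h x / S')) x := by
    have := (((hd.sub_const (c * I)).const_mul I).div_const (S':ℂ)).cexp
    simpa [hE] using this
  have he : Real.exp 1 ≤ 2.8 := by linarith [Real.exp_one_lt_d9]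
  have hc : ‖deriv E x‖ ≤ Real.exp 1 / (r/2) := by
    refine Complex.norm_deriv_le_of_forall_mem_sphere_norm_le (by linarith) ?_ ?_
    · exact hEd.diffContOnCl_ball (closedBall_subset_ball (by linarith))
    · intro y hy
      rw [hEn]
      apply Real.exp_le_exp.2
      have hyb : y ∈ ball x r := by rw [mem_sphere] at hy; rw [mem_ball]; linarith
      rw [div_le_one hS0]
      linarith [(abs_le.1 (hb y hyb)).1]
  rw [hE'.deriv, norm_mul, norm_div, norm_mul, norm_I, one_mul, Complex.norm_real, Real.norm_of_nonneg hS0.le] at hc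
  have hlow : Real.exp (-1) ≤ ‖E x‖ := by
    rw [hEn]
    apply Real.exp_le_exp.2
    rw [le_div_iff₀ hS0]
    linarith [(abs_le.1 (hb x (mem_ball_self hr))).2]
  have h3 : Real.exp (-1) * (‖deriv h x‖ / S') ≤ Real.exp 1 / (r/2) :=
    (mul_le_mul_of_nonneg_right hlow (by positivity)).trans hc
  rw [Real.exp_neg, inv_mul_eq_div, div_div, div_le_div_iff₀ (by positivity) (by positivity)] at h3
  rw [le_div_iff₀ hr]
  have : Real.exp 1 * (S' * Real.exp 1) ≤ 8 * S' := by
    have h8 : Real.exp 1 * Real.exp 1 ≤ 8 := by nlinarith [Real.exp_pos 1]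
    nlinarith
  nlinarith

end NS

namespace NS
open Complex Topology Metric

lemma barCore {U : Set ℂ} {g B : ℂ → ℂ} {y0 : ℂ} {ρ M c0 e0 : ℝ} (hU : IsOpen U) (hρ : 0 < ρ)
    (hy : ∀ x ∈ U, ρ ≤ ‖x - y0‖) (hg : DifferentiableOn ℂ g U) (hM : ∀ x ∈ U, |(g x).im| ≤ M)
    (hB : DifferentiableOn ℂ B U) (hB0 : ∀ x ∈ U, 0 ≤ (B x).re)
    (hb : ∀ x ∈ frontier U, ∀ ε > 0, ∀ᶠ y in 𝓝[U] x, |(g y).im - c0| ≤ (B y).re + e0 + ε) :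
    ∀ x ∈ U, |(g x).im - c0| ≤ (B x).re + e0 := by
  have h1 := MP (G := fun x => -I * g x - B x) (M := M) (c := c0 + e0) hU hρ hy
    ((hg.const_mul _).sub hB)
    (fun x hx => by
      have := (abs_le.1 (hM x hx)).2; have := hB0 x hx; simp; linarith)
    (fun x hx ε hε => (hb x hx ε hε).mono fun y hy => by
      have := (abs_le.1 hy).2; simp; linarith)
  have h2 := MP (G := fun x => I * g x - B x) (M := M) (c := -c0 + e0) hU hρ hy
    ((hg.const_mul _).sub hB)
    (fun x hx => by
      have := (abs_le.1 (hM x hx)).1; have := hB0 x hx; simp; linarith)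
    (fun x hx ε hε => (hb x hx ε hε).mono fun y hy => by
      have := (abs_le.1 hy).1; simp; linarith)
  intro x hx
  have a1 := h1 x hx
  have a2 := h2 x hx
  simp at a1 a2
  rw [abs_le]; constructor <;> linarith

def wB (x0 n : ℂ) (ρ : ℝ) (x : ℂ) : ℂ := (x - x0) / (x - (x0 - ρ * n))

lemma wB_facts {x x0 n : ℂ} {ρ : ℝ} (hn : ‖n‖ = 1) (hρ : 0 < ρ) (hx : ρ ≤ ‖x - (x0 - ρ * n)‖) :
    ‖wB x0 n ρ x‖ ^ 2 ≤ 2 * (wB x0 n ρ x).re ∧ ‖wB x0 n ρ x‖ ≤ ‖x - x0‖ / ρ ∧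
    min 1 ‖x - x0‖ ≤ (1 + ρ) * ‖wB x0 n ρ x‖ := by
  have hp : 0 < ‖x - (x0 - ρ * n)‖ := by linarith
  have hne : x - (x0 - ρ * n) ≠ 0 := norm_pos_iff.1 hp
  have h1 : ‖1 - wB x0 n ρ x‖ ≤ 1 := by
    have : 1 - wB x0 n ρ x = ρ * n / (x - (x0 - ρ * n)) := by
      rw [wB]; field_simp; ring
    rw [this, norm_div, norm_mul, hn, mul_one, Complex.norm_real, Real.norm_of_nonneg hρ.le,
      div_le_one hp]; exact hx
  refine ⟨?_, ?_, ?_⟩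
  · have h2 : ‖1 - wB x0 n ρ x‖ ^ 2 ≤ 1 := by nlinarith [norm_nonneg (1 - wB x0 n ρ x)]
    rw [← Complex.normSq_eq_norm_sq, Complex.normSq_apply] at *
    simp at h2 ⊢; nlinarith
  · rw [wB, norm_div]; gcongr
  · have h3 : ‖x - (x0 - ρ * n)‖ ≤ ‖x - x0‖ + ρ := by
      calc _ = ‖(x - x0) + ρ * n‖ := by ring_nf
        _ ≤ _ := norm_add_le _ _
        _ = _ := by simp [hn, abs_of_pos hρ]
    rw [wB, norm_div, ← mul_div_assoc, le_div_iff₀ hp]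
    have := norm_nonneg (x - x0)
    rcases le_total 1 ‖x - x0‖ with h | h
    · rw [min_eq_left h]; nlinarith
    · rw [min_eq_right h]; nlinarith

lemma wB_diff {U : Set ℂ} {x0 n : ℂ} {ρ : ℝ} (hρ : 0 < ρ)
    (hy : ∀ x ∈ U, ρ ≤ ‖x - (x0 - ρ * n)‖) : DifferentiableOn ℂ (wB x0 n ρ) U := by
  apply DifferentiableOn.div (by fun_prop) (by fun_prop)
  intro x hx h0
  have := hy x hx
  rw [h0, norm_zero] at this; linarith

/-- linear barrier -/
lemma barW {U : Set ℂ} {g : ℂ → ℂ} {x0 n : ℂ} {ρ M c0 N : ℝ} (hU : IsOpen U) (hρ : 0 < ρ)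
    (hn : ‖n‖ = 1) (hy : ∀ x ∈ U, ρ ≤ ‖x - (x0 - ρ * n)‖) (hg : DifferentiableOn ℂ g U)
    (hM : ∀ x ∈ U, |(g x).im| ≤ M) (hN : 0 ≤ N)
    (hb : ∀ x ∈ frontier U, ∀ ε > 0, ∀ᶠ y in 𝓝[U] x, |(g y).im - c0| ≤ N * min 1 ‖y - x0‖ ^ 2 + ε) :
    ∀ x ∈ U, |(g x).im - c0| ≤ 2 * N * (1 + ρ) ^ 2 / ρ * ‖x - x0‖ := by
  have key := barCore (g := g) (B := fun x => (2 * N * (1 + ρ) ^ 2 : ℝ) * wB x0 n ρ x) (e0 := 0) (c0 := c0) hU hρ hy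
    hg hM ((wB_diff hρ hy).const_mul _)
    (fun x hx => by
      have := (wB_facts hn hρ (hy x hx)).1
      rw [re_ofReal_mul]; have : 0 ≤ (wB x0 n ρ x).re := by nlinarith [sq_nonneg ‖wB x0 n ρ x‖]
      positivity)
    (fun x hx ε hε => by
      filter_upwards [hb x hx ε hε, self_mem_nhdsWithin] with y h1 h2
      obtain ⟨f1, f2, f3⟩ := wB_facts hn hρ (hy y h2)
      refine h1.trans ?_
      rw [re_ofReal_mul]
      have h4 : min 1 ‖y - x0‖ ^ 2 ≤ ((1 + ρ) * ‖wB x0 n ρ y‖) ^ 2 :=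
        pow_le_pow_left₀ (by positivity) f3 2
      have h5 : N * min 1 ‖y - x0‖ ^ 2 ≤ N * ((1 + ρ) ^ 2 * (2 * (wB x0 n ρ y).re)) := by
        gcongr; refine h4.trans ?_; rw [mul_pow]; gcongr
      linarith)
  intro x hx
  refine (key x hx).trans ?_
  obtain ⟨f1, f2, f3⟩ := wB_facts hn hρ (hy x hx)
  rw [re_ofReal_mul, add_zero, div_mul_eq_mul_div, mul_div_assoc]
  have : (wB x0 n ρ x).re ≤ ‖x - x0‖ / ρ := (Complex.re_le_norm _).trans f2
  gcongr

/-- square root barrier -/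
lemma barH {U : Set ℂ} {g : ℂ → ℂ} {x0 n : ℂ} {ρ M c0 N e0 : ℝ} (hU : IsOpen U) (hρ : 0 < ρ)
    (hn : ‖n‖ = 1) (hy : ∀ x ∈ U, ρ ≤ ‖x - (x0 - ρ * n)‖) (hx0 : x0 ∉ U) (hg : DifferentiableOn ℂ g U)
    (hM : ∀ x ∈ U, |(g x).im| ≤ M) (hN : 0 ≤ N)
    (hb : ∀ x ∈ frontier U, ∀ ε > 0, ∀ᶠ y in 𝓝[U] x,
      |(g y).im - c0| ≤ N * √(min 1 ‖y - x0‖) + e0 + ε) :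
    ∀ x ∈ U, |(g x).im - c0| ≤ 2 * N * √((1 + ρ) / ρ) * √‖x - x0‖ + e0 := by
  have hpos : ∀ x ∈ U, 0 < (wB x0 n ρ x).re := by
    intro x hx
    obtain ⟨f1, f2, f3⟩ := wB_facts hn hρ (hy x hx)
    have hd : 0 < ‖x - x0‖ := norm_pos_iff.2 (sub_ne_zero.2 fun h => hx0 (h ▸ hx))
    have : 0 < ‖wB x0 n ρ x‖ := by
      have : 0 < min 1 ‖x - x0‖ := lt_min one_pos hd
      by_contra! h; nlinarith
    nlinarith
  set s : ℂ → ℂ := fun x => (wB x0 n ρ x) ^ ((1:ℂ)/2) with hs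
  have hsd : DifferentiableOn ℂ s U := (wB_diff hρ hy).cpow_const fun x hx => Or.inl (hpos x hx)
  have hs2 : ∀ x, s x ^ 2 = wB x0 n ρ x := by
    intro x; rw [hs]; simp only; rw [← Complex.cpow_nat_mul]; simp
  have hsn : ∀ x, ‖s x‖ = √‖wB x0 n ρ x‖ := by
    intro x; rw [← hs2, norm_pow, Real.sqrt_sq (norm_nonneg _)]
  have hsr : ∀ x ∈ U, ‖s x‖ ≤ 2 * (s x).re := by
    intro x hx
    have h1 : 0 ≤ (s x).re := by
      have hw0 : wB x0 n ρ x ≠ 0 := fun h => by have := hpos x hx; simp [h] at this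
      rw [hs]; simp only [Complex.cpow_def, hw0, if_false, Complex.exp_re]
      refine mul_nonneg (Real.exp_pos _).le ?_
      apply Real.cos_nonneg_of_mem_Icc
      have h2 := Complex.abs_arg_le_pi (wB x0 n ρ x)
      have := abs_le.1 h2
      simp [Complex.log_im]
      constructor <;> linarith
    have h2 : ((s x)^2).re = 2 * (s x).re ^ 2 - ‖s x‖ ^ 2 := by
      rw [← Complex.normSq_eq_norm_sq, Complex.normSq_apply, sq (s x), Complex.mul_re]; ring
    have h3 := hpos x hx
    rw [← hs2, h2] at h3
    nlinarith [norm_nonneg (s x)]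
  have key := barCore (g := g) (B := fun x => (2 * N * √(1 + ρ) : ℝ) * s x) (c0 := c0) (e0 := e0) hU hρ hy
    hg hM (hsd.const_mul _)
    (fun x hx => by
      rw [re_ofReal_mul]; have : 0 ≤ (s x).re := by linarith [hsr x hx, norm_nonneg (s x)]
      positivity)
    (fun x hx ε hε => by
      filter_upwards [hb x hx ε hε, self_mem_nhdsWithin] with y h1 h2
      obtain ⟨f1, f2, f3⟩ := wB_facts hn hρ (hy y h2)
      refine h1.trans ?_
      rw [re_ofReal_mul]
      have h4 : √(min 1 ‖y - x0‖) ≤ √(1 + ρ) * (2 * (s y).re) := by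
        refine (Real.sqrt_le_sqrt f3).trans ?_
        rw [Real.sqrt_mul (by linarith), ← hsn]
        gcongr; exact hsr y h2
      have := mul_le_mul_of_nonneg_left h4 hN
      linarith)
  intro x hx
  refine (key x hx).trans ?_
  obtain ⟨f1, f2, f3⟩ := wB_facts hn hρ (hy x hx)
  rw [re_ofReal_mul]
  have h5 : (s x).re ≤ √‖x - x0‖ / √ρ := by
    refine (Complex.re_le_norm _).trans ?_
    rw [hsn, ← Real.sqrt_div (norm_nonneg _)]
    exact Real.sqrt_le_sqrt f2
  rw [Real.sqrt_div (by linarith)]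
  have := mul_le_mul_of_nonneg_left h5 (show 0 ≤ 2 * N * √(1 + ρ) by positivity)
  calc _ ≤ 2 * N * √(1 + ρ) * (√‖x - x0‖ / √ρ) + e0 := by linarith
    _ = _ := by ring

/-- envelope lemma -/
lemma ENV {X : Type*} [TopologicalSpace X] {K : Set X} (hK : IsCompact K) {T : ℝ} (G : X → ℝ → ℝ)
    (hG : ContinuousOn (fun p : X × ℝ => G p.1 p.2) (K ×ˢ Icc 0 T)) (h0 : ∀ x ∈ K, G x 0 ≤ 0)
    (hd : ∀ t ∈ Ioo 0 T, ∀ x ∈ K, 0 < G x t → (∀ y ∈ K, G y t ≤ G x t) →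
      ∃ g' < 0, HasDerivAt (G x) g' t) :
    ∀ t ∈ Icc 0 T, ∀ x ∈ K, G x t ≤ 0 := by
  have main : ∀ t1 ∈ Ico 0 T, ∀ x ∈ K, G x t1 ≤ 0 := by
    intro t1 ht1 x1 hx1
    by_contra! hc
    have hcK : IsCompact (K ×ˢ Icc 0 t1) := hK.prod isCompact_Icc
    obtain ⟨⟨xs, ts⟩, ⟨hxs, hts⟩, hmax⟩ := hcK.exists_isMaxOn ⟨(x1, t1), hx1, ht1.1, le_rfl⟩
      (hG.mono (prod_mono subset_rfl (Icc_subset_Icc_right ht1.2.le)))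
    simp only at hxs hts
    have hpos : 0 < G xs ts := lt_of_lt_of_le hc (hmax (show (x1, t1) ∈ _ from ⟨hx1, ht1.1, le_rfl⟩))
    have hts0 : 0 < ts := by
      rcases hts.1.lt_or_eq with h | h
      · exact h
      · rw [← h] at hpos; linarith [h0 xs hxs]
    obtain ⟨g', hg', hder⟩ := hd ts ⟨hts0, lt_of_le_of_lt hts.2 ht1.2⟩ xs hxs hpos
      (fun y hy => hmax (show (y, ts) ∈ _ from ⟨hy, hts⟩))
    have h2 : ∀ᶠ t in 𝓝[<] ts, G xs ts < G xs t := by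
      have := (hasDerivAt_iff_tendsto_slope.1 hder).mono_left (nhdsWithin_mono ts (fun t (ht : t < ts) => ht.ne))
      filter_upwards [this (Iio_mem_nhds hg'), self_mem_nhdsWithin] with t h3 h4
      simp only [mem_preimage, mem_Iio, slope_def_field] at h3 h4
      rw [div_lt_iff_of_neg (by linarith)] at h3
      linarith
    obtain ⟨t, ht, ht2⟩ := (h2.and (Ioo_mem_nhdsLT hts0)).exists
    have := hmax (show (xs, t) ∈ _ from ⟨hxs, ht2.1.le, ht2.2.le.trans hts.2⟩)
    simp only at this
    have this : G xs t ≤ G xs ts := this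
    linarith
  intro t ht x hx
  rcases ht.2.lt_or_eq with h | h
  · exact main t ⟨ht.1, h⟩ x hx
  · rcases ht.1.lt_or_eq with h1 | h1
    · subst h
      have hc : ContinuousWithinAt (fun s => G x s) (Icc 0 t) t :=
        (hG (x, t) ⟨hx, ht⟩).comp (f := fun s => (x, s)) (by fun_prop) (fun s hs => ⟨hx, hs⟩)
      have := (hc.mono Ico_subset_Icc_self)
      have hne : (𝓝[Ico 0 t] t).NeBot := by
        rw [← mem_closure_iff_nhdsWithin_neBot, closure_Ico h1.ne]; exact ht
      exact le_of_tendsto this (by filter_upwards [self_mem_nhdsWithin] with s hs using main s hs x hx)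
    · rw [← h1]; exact h0 x hx

end NS

namespace NS
open Complex Topology Metric

def DC : Type := ℂ
instance instDCtop : TopologicalSpace DC := ⊥
instance instDCdisc : DiscreteTopology DC := ⟨rfl⟩

lemma prim {U : Set ℂ} {f : ℂ → ℂ} (hU : IsOpen U) (hs : SimplyConnectedSpace U)
    (hf : DifferentiableOn ℂ f U) : ∃ W : ℂ → ℂ, ∀ x ∈ U, HasDerivAt W (f x) x := by
  classical
  have h1 : ∀ i : U, ∃ r > 0, ball (i:ℂ) r ⊆ U := fun i => Metric.isOpen_iff.1 hU i i.2
  choose r hr hrU using h1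
  have h2 : ∀ i : U, ∃ W : ℂ → ℂ, ∀ x ∈ ball (i:ℂ) (r i), HasDerivAt W (f x) x :=
    fun i => (hf.mono (hrU i)).isExactOn_ball
  choose W hW using h2
  let Z : FiberBundleCore U U DC :=
    { baseSet := fun i => {x : U | (x:ℂ) ∈ ball (i:ℂ) (r i)}
      isOpen_baseSet := fun i => isOpen_ball.preimage continuous_subtype_val
      indexAt := id
      mem_baseSet_at := fun x => mem_ball_self (hr x)
      coordChange := fun i j x (c : ℂ) => (c + W i x - W j x : ℂ)
      coordChange_self := fun i x _ v => by
        change (show ℂ from v) + W i x - W i x = (show ℂ from v); ring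
      continuousOn_coordChange := by
        rintro i j ⟨x0, v0⟩ ⟨⟨hi, hj⟩, -⟩
        apply ContinuousAt.continuousWithinAt
        refine ContinuousAt.congr (f := fun _ => (show DC from ((show ℂ from v0) + W i x0 - W j x0 : ℂ)))
          continuousAt_const ?_
        have hm : {p : U × DC | (p.1:ℂ) ∈ ball (i:ℂ) (r i) ∩ ball (j:ℂ) (r j) ∧ p.2 = v0} ∈ 𝓝 (x0, v0) := by
          have : IsOpen ({x : U | (x:ℂ) ∈ ball (i:ℂ) (r i) ∩ ball (j:ℂ) (r j)} ×ˢ ({v0} : Set DC)) :=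
            ((isOpen_ball.inter isOpen_ball).preimage continuous_subtype_val).prod (isOpen_discrete _)
          exact this.mem_nhds ⟨⟨hi, hj⟩, rfl⟩
        filter_upwards [hm] with p hp
        obtain ⟨hp1, hp2⟩ := hp
        have hc : Convex ℝ (ball (i:ℂ) (r i) ∩ ball (j:ℂ) (r j)) := (convex_ball _ _).inter (convex_ball _ _)
        have key : W i p.1 - W j p.1 = W i x0 - W j x0 := by
          refine hc.is_const_of_fderivWithin_eq_zero (𝕜 := ℂ) (f := fun x => W i x - W j x) ?_ ?_ hp1 ⟨hi, hj⟩
          · exact fun x hx => ((hW i x hx.1).sub (hW j x hx.2)).differentiableAt.differentiableWithinAt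
          · intro x hx
            have h3 := (hW i x hx.1).sub (hW j x hx.2)
            rw [sub_self] at h3
            rw [fderivWithin_of_isOpen (isOpen_ball.inter isOpen_ball) hx]
            have h4 := h3.hasFDerivAt.fderiv
            exact h4.trans (by ext; simp)
        change ((show ℂ from v0) + W i x0 - W j x0 : ℂ) = ((show ℂ from p.2) + W i p.1 - W j p.1 : ℂ)
        rw [hp2, add_sub_assoc, add_sub_assoc, key]
      coordChange_comp := fun i j k x _ v => by
        change ((show ℂ from v) + W i x - W j x) + W j x - W k x = (show ℂ from v) + W i x - W k x
        ring }
  have hcov : IsCoveringMap (Bundle.TotalSpace.proj : Bundle.TotalSpace DC Z.Fiber → U) :=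
    FiberBundle.isCoveringMap
  have := hU.locallyPathConnectedSpace
  obtain ⟨a0⟩ : Nonempty U := inferInstance
  obtain ⟨s, ⟨-, hs2⟩, -⟩ := hcov.existsUnique_continuousMap_lifts (ContinuousMap.id U) a0
    ⟨a0, (show DC from (0:ℂ))⟩ rfl
  have hsp : ∀ x, (s x).1 = x := fun x => congrFun hs2 x
  let V : U → ℂ := fun x => (show ℂ from (Z.localTriv x (s x)).2) + W x x
  refine ⟨fun x => if hx : x ∈ U then V ⟨x, hx⟩ else 0, fun x hx => ?_⟩
  set i : U := ⟨x, hx⟩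
  have hc : ContinuousAt (fun y => (Z.localTriv i (s y)).2) i := by
    have hsrc : s i ∈ (Z.localTriv i).source := by
      rw [(Z.localTriv i).mem_source]
      change (s i).1 ∈ Z.baseSet i
      rw [hsp]; exact Z.mem_baseSet_at i
    exact continuous_snd.continuousAt.comp (((Z.localTriv i).continuousAt hsrc).comp s.continuous.continuousAt)
  have hev : ∀ᶠ y in 𝓝 i, (Z.localTriv i (s y)).2 = (Z.localTriv i (s i)).2 :=
    hc.eventually ((isOpen_discrete {(Z.localTriv i (s i)).2}).mem_nhds rfl)
  have hV : ∀ᶠ y in 𝓝 i, V y = (show ℂ from (Z.localTriv i (s i)).2) + W i y := by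
    filter_upwards [hev] with y hy
    rw [← hy]
    change ((show ℂ from (s y).2) + W (s y).1 (s y).1 - W y (s y).1) + W y y =
      ((show ℂ from (s y).2) + W (s y).1 (s y).1 - W i (s y).1) + W i y
    rw [hsp]; ring
  have hV2 : ∀ᶠ y in 𝓝 x, (if hx : y ∈ U then V ⟨y, hx⟩ else 0) =
      (show ℂ from (Z.localTriv i (s i)).2) + W i y := by
    have h5 : ∀ᶠ y in 𝓝[U] x, (if hx : y ∈ U then V ⟨y, hx⟩ else 0) =
      (show ℂ from (Z.localTriv i (s i)).2) + W i y := by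
      rw [nhdsWithin_eq_map_subtype_coe hx, eventually_map]
      filter_upwards [hV] with y hy
      simpa using hy
    rwa [hU.nhdsWithin_eq hx] at h5
  exact ((hW i x (mem_ball_self (hr i))).const_add _).congr_of_eventuallyEq hV2

end NS

namespace NS
open Complex Topology Metric

lemma circ_le {h : ℂ → ℂ} {x : ℂ} {r : ℝ} (hr : 0 < r) (hd : DiffContOnCl ℂ h (ball x r)) :
    4 * ‖h x‖ₑ ≤ ∫⁻ θ in Ioo (-Real.pi) Real.pi, ‖h (circleMap x r θ)‖ₑ := by
  have h1 := DiffContOnCl.circleAverage (f := h) (c := x) (R := r) (by rwa [abs_of_pos hr])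
  rw [Real.circleAverage_def] at h1
  have hp : Function.Periodic (fun θ => h (circleMap x r θ)) (2 * Real.pi) :=
    fun θ => by simp only [periodic_circleMap x r θ]
  have h2 := hp.intervalIntegral_add_eq 0 (-Real.pi)
  rw [zero_add, show -Real.pi + 2 * Real.pi = Real.pi by ring] at h2
  rw [h2, intervalIntegral.integral_of_le (by linarith [Real.pi_pos]), integral_Ioc_eq_integral_Ioo] at h1
  have h3 : 4 * ‖h x‖ ≤ ‖∫ θ in Ioo (-Real.pi) Real.pi, h (circleMap x r θ)‖ := by
    rw [← h1, norm_smul, norm_inv, Real.norm_of_nonneg (by positivity)]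
    have h5 := norm_nonneg (∫ θ in Ioo (-Real.pi) Real.pi, h (circleMap x r θ))
    rw [← mul_assoc]
    have : 4 * (2 * Real.pi)⁻¹ ≤ 1 := by
      rw [← div_eq_mul_inv, div_le_one (by positivity)]; linarith [Real.pi_gt_three]
    nlinarith
  refine le_trans ?_ (enorm_integral_le_lintegral_enorm _)
  rw [← ofReal_norm, ← ofReal_norm, show (4:ENNReal) = ENNReal.ofReal 4 by norm_num, ← ENNReal.ofReal_mul (by norm_num)]
  exact ENNReal.ofReal_le_ofReal h3

lemma amv {h : ℂ → ℂ} {x : ℂ} (hd : DifferentiableOn ℂ h (ball x 1)) :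
    ‖h x‖ₑ ≤ ∫⁻ y in ball x 1, ‖h y‖ₑ := by
  set g : ℂ → ENNReal := fun y => (ball x 1).indicator (fun y => ‖h y‖ₑ) (y + x) with hg
  have e1 : ∫⁻ y in ball x 1, ‖h y‖ₑ = ∫⁻ y, g y := by
    rw [← lintegral_indicator measurableSet_ball]
    exact (lintegral_add_right_eq_self (fun y => (ball x 1).indicator (fun y => ‖h y‖ₑ) y) x).symm
  have hgm : Measurable g := by
    have : Measurable ((ball x 1).indicator (fun y => ‖h y‖ₑ)) := by
      refine measurable_of_restrict_of_restrict_compl (measurableSet_ball (x := x) (ε := 1)) ?_ ?_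
      · have h1 := (continuousOn_iff_continuous_domRestrict.1 hd.continuousOn.enorm).measurable
        convert h1 using 1
        funext y; exact indicator_of_mem y.2 _
      · convert (measurable_const (a := (0:ENNReal))) using 1
        funext y; exact indicator_of_notMem y.2 _
    exact this.comp (measurable_add_const x)
  rw [e1, ← Complex.lintegral_comp_polarCoord_symm, show polarCoord.target = Ioi (0:ℝ) ×ˢ Ioo (-Real.pi) Real.pi from rfl]
  have hpm : Measurable fun p : ℝ × ℝ => Complex.polarCoord.symm p := by
    simp only [Complex.polarCoord_symm_apply]; fun_prop
  rw [show (volume : Measure (ℝ × ℝ)) = volume.prod volume from rfl, setLIntegral_prod]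
  swap
  · exact ((ENNReal.measurable_ofReal.comp measurable_fst).smul (hgm.comp hpm)).aemeasurable
  calc ‖h x‖ₑ = ∫⁻ r in Ioo (1/2:ℝ) 1, 2 * ‖h x‖ₑ := by
        rw [setLIntegral_const, Real.volume_Ioo, mul_comm, ← mul_assoc, show (1:ℝ) - 1/2 = 2⁻¹ by norm_num,
          ENNReal.ofReal_inv_of_pos (by norm_num)]
        rw [ENNReal.ofReal_ofNat, ENNReal.inv_mul_cancel (by norm_num) (by norm_num), one_mul]
    _ ≤ ∫⁻ r in Ioo (1/2:ℝ) 1, ∫⁻ θ in Ioo (-Real.pi) Real.pi, ENNReal.ofReal r • g (Complex.polarCoord.symm (r, θ)) := by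
        refine setLIntegral_mono' measurableSet_Ioo fun r hr => ?_
        have hr0 : 0 < r := by linarith [hr.1]
        have h1 := circ_le hr0 (hd.diffContOnCl_ball (closedBall_subset_ball hr.2))
        calc 2 * ‖h x‖ₑ = ENNReal.ofReal (1/2) * (4 * ‖h x‖ₑ) := by
              rw [← mul_assoc]; congr 1
              rw [show (4:ENNReal) = ENNReal.ofReal 4 by norm_num, ← ENNReal.ofReal_mul (by norm_num)]; norm_num
          _ ≤ ENNReal.ofReal r * ∫⁻ θ in Ioo (-Real.pi) Real.pi, ‖h (circleMap x r θ)‖ₑ := by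
              gcongr; exact hr.1.le
          _ = ∫⁻ θ in Ioo (-Real.pi) Real.pi, ENNReal.ofReal r * ‖h (circleMap x r θ)‖ₑ := by
              rw [lintegral_const_mul' _ _ ENNReal.ofReal_ne_top]
          _ = _ := by
              refine setLIntegral_congr_fun measurableSet_Ioo fun θ hθ => ?_
              simp only [smul_eq_mul, hg]
              have e3 : Complex.polarCoord.symm (r, θ) + x = circleMap x r θ := by
                rw [Complex.polarCoord_symm_apply, circleMap, Complex.exp_mul_I]; push_cast; ring
              rw [e3, indicator_of_mem]
              rw [mem_ball, dist_eq_norm, circleMap_sub_center, norm_circleMap_zero, abs_of_pos hr0]; exact hr.2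
    _ ≤ _ := lintegral_mono_set (fun r hr => lt_trans (by norm_num) hr.1)

lemma decay {f : ℂ → ℂ} {a : ℝ} (hd : DifferentiableOn ℂ f {x | a < x.im})
    (hper : ∀ x : ℂ, a < x.im → f (x + 2 * Real.pi) = f x)
    (hI : IntegrableOn (fun x => ‖f x‖ ^ 2) ({x : ℂ | a < x.im} ∩ {x | x.re ∈ Icc 0 (2 * Real.pi)})) :
    ∃ C b : ℝ, 0 ≤ C ∧ ∀ x : ℂ, b ≤ x.im → ‖f x‖ ≤ C * Real.exp (-x.im) := by
  classical
  set F : ℂ → ℂ := fun x => if a < x.im then f x else 0 with hF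
  have hFp : Function.Periodic F ((2 * Real.pi : ℝ) : ℂ) := by
    intro x
    simp only [hF]
    have : (x + ((2 * Real.pi : ℝ) : ℂ)).im = x.im := by rw [add_im, ofReal_im, add_zero]
    rw [this]
    split_ifs with h
    · rw [← hper x h]; push_cast; rfl
    · rfl
  have hop : IsOpen {x : ℂ | a < x.im} := isOpen_lt continuous_const continuous_im
  have hFd : ∀ x : ℂ, a < x.im → DifferentiableAt ℂ F x := by
    intro x hx
    refine ((hd x hx).differentiableAt (hop.mem_nhds hx)).congr_of_eventuallyEq ?_
    filter_upwards [hop.mem_nhds hx] with y hy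
    simp only [hF, if_pos (show a < y.im from hy)]
  have hev : ∀ᶠ x : ℂ in comap im atTop, a < x.im := (eventually_gt_atTop a).comap im
  set S : ℝ → Set ℂ := fun n => {x : ℂ | n < x.im} ∩ {x | x.re ∈ Icc 0 (2 * Real.pi)} with hS
  have hSm : ∀ n, MeasurableSet (S n) := fun n =>
    (isOpen_lt continuous_const continuous_im).measurableSet.inter (measurableSet_Icc.preimage measurable_re)
  have hanti : Antitone S := fun n n' h x hx => ⟨lt_of_le_of_lt h hx.1, hx.2⟩
  have hIF : IntegrableOn (fun x => ‖F x‖ ^ 2) (S a) := by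
    refine hI.congr_fun (fun x hx => ?_) (hSm a)
    simp only [hF]; rw [if_pos (show a < x.im from hx.1)]
  have hJ := tendsto_setIntegral_of_antitone hSm hanti ⟨a, hIF⟩
  have hemp : ⋂ n, S n = ∅ := by
    ext x; simp only [mem_iInter, mem_empty_iff_false, iff_false, not_forall]
    exact ⟨x.im, fun h => lt_irrefl _ (show x.im < x.im from h.1)⟩
  rw [hemp, setIntegral_empty] at hJ
  -- pointwise bound
  have hb : ∀ x : ℂ, a + 1 < x.im → ‖F x‖ ^ 2 ≤ 3 * ∫ y in S (x.im - 1), ‖F y‖ ^ 2 := by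
    have hb0 : ∀ x : ℂ, a + 1 < x.im → x.re ∈ Ico 0 (2 * Real.pi) → ‖F x‖ ^ 2 ≤ 3 * ∫ y in S (x.im - 1), ‖F y‖ ^ 2 := by
      intro x hx hxr
      have hint : IntegrableOn (fun x => ‖F x‖ ^ 2) (S (x.im - 1)) := hIF.mono_set (hanti (by linarith))
      have hL : ENNReal.ofReal (∫ y in S (x.im - 1), ‖F y‖ ^ 2) = ∫⁻ y in S (x.im - 1), ‖F y * F y‖ₑ := by
        rw [ofReal_integral_eq_lintegral_ofReal hint (ae_of_all _ fun y => by positivity)]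
        refine lintegral_congr fun y => ?_
        rw [← ofReal_norm, norm_mul, sq]
      have hshift : ∀ c : ℂ, (∀ y, F (y + c) = F y) →
          ∫⁻ y in (fun y => y + c) ⁻¹' S (x.im - 1), ‖F y * F y‖ₑ = ∫⁻ y in S (x.im - 1), ‖F y * F y‖ₑ := by
        intro c hc
        have := (measurePreserving_add_right volume c).setLIntegral_comp_preimage_emb
          (MeasurableEquiv.addRight c).measurableEmbedding (fun y => ‖F y * F y‖ₑ) (S (x.im - 1))
        simpa only [hc] using this
      have h1 := amv (h := fun y => F y * F y) (x := x) (by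
        have : DifferentiableOn ℂ F (ball x 1) := fun y hy => by
          refine (hFd y ?_).differentiableWithinAt
          have := (abs_im_le_norm (y - x)).trans_lt (mem_ball_iff_norm.1 hy)
          rw [sub_im, abs_lt] at this; linarith
        exact this.mul this)
      have hp : ∀ y, F (y - ((2 * Real.pi : ℝ) : ℂ)) = F y := fun y => hFp.sub_eq y
      have hp' : ∀ y, F (y + (-((2 * Real.pi : ℝ) : ℂ))) = F y := fun y => by rw [← sub_eq_add_neg]; exact hp y
      have hcov : ball x 1 ⊆ S (x.im - 1) ∪ ((fun y => y + ((2 * Real.pi : ℝ) : ℂ)) ⁻¹' S (x.im - 1) ∪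
          (fun y => y + (-((2 * Real.pi : ℝ) : ℂ))) ⁻¹' S (x.im - 1)) := by
        intro y hy
        have hi := (abs_im_le_norm (y - x)).trans_lt (mem_ball_iff_norm.1 hy)
        have hr := (abs_re_le_norm (y - x)).trans_lt (mem_ball_iff_norm.1 hy)
        rw [sub_im, abs_lt] at hi
        rw [sub_re, abs_lt] at hr
        have := Real.pi_gt_three
        by_cases c1 : y.re < 0
        · right; left
          refine ⟨?_, ?_, ?_⟩ <;> simp <;> linarith [hxr.1, hxr.2]
        · by_cases c2 : y.re ≤ 2 * Real.pi
          · left; exact ⟨by simp; linarith, by linarith, c2⟩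
          · right; right
            refine ⟨?_, ?_, ?_⟩ <;> simp <;> linarith [hxr.1, hxr.2]
      have h2 : ‖F x * F x‖ₑ ≤ 3 * ENNReal.ofReal (∫ y in S (x.im - 1), ‖F y‖ ^ 2) := by
        refine h1.trans ((lintegral_mono_set hcov).trans ((lintegral_union_le _ _ _).trans ?_))
        refine (add_le_add le_rfl (lintegral_union_le _ _ _)).trans ?_
        rw [hshift _ hFp, hshift _ hp', hL]
        apply le_of_eq; ring
      rw [show (3:ENNReal) = ENNReal.ofReal 3 by norm_num, ← ENNReal.ofReal_mul (by norm_num), ← ofReal_norm, norm_mul, ← sq] at h2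
      exact (ENNReal.ofReal_le_ofReal_iff (mul_nonneg (by norm_num) (setIntegral_nonneg (hSm _) fun y _ => by positivity))).1 h2
    intro x hx
    obtain ⟨k, hk, -⟩ := existsUnique_sub_zsmul_mem_Ico (show 0 < 2 * Real.pi by positivity) x.re 0
    have h3 := hb0 (x - k • ((2 * Real.pi : ℝ) : ℂ)) (by simpa using hx) (by simpa using hk)
    rw [hFp.sub_zsmul_eq] at h3
    simpa using h3
  have hz : ZeroAtFilter (comap im atTop) F := by
    rw [ZeroAtFilter, tendsto_zero_iff_norm_tendsto_zero]
    have h4 : Tendsto (fun x : ℂ => ‖F x‖ ^ 2) (comap im atTop) (𝓝 0) := by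
      have h5 : Tendsto (fun x : ℂ => 3 * ∫ y in S (x.im - 1), ‖F y‖ ^ 2) (comap im atTop) (𝓝 0) := by
        have := (hJ.const_mul 3).comp ((tendsto_atTop_add_const_right atTop (-1) tendsto_id).comp
          (tendsto_comap (f := im) (x := atTop)))
        rw [mul_zero] at this
        exact this
      refine squeeze_zero' (Eventually.of_forall fun x => by positivity) ?_ h5
      filter_upwards [(eventually_gt_atTop (a+1)).comap im] with x hx using hb x hx
    have := h4.sqrt
    simpa [Real.sqrt_sq] using this
  have hO := Function.Periodic.exp_decay_of_zero_at_inf (show 0 < 2 * Real.pi by positivity) hFp (hev.mono hFd) hz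
  obtain ⟨C, hC⟩ := hO.bound
  rw [eventually_comap] at hC
  obtain ⟨b, hb'⟩ := eventually_atTop.1 (hC.and (eventually_gt_atTop a))
  refine ⟨|C|, b, abs_nonneg C, fun x hx => ?_⟩
  obtain ⟨h6, h7⟩ := hb' x.im hx
  have h8 := h6 x rfl
  simp only [hF, if_pos h7] at h8
  refine h8.trans ?_
  have e5 : -2 * Real.pi * x.im / (2 * Real.pi) = -x.im := by field_simp
  rw [e5, Real.norm_of_nonneg (Real.exp_pos _).le]
  exact mul_le_mul_of_nonneg_right (le_abs_self C) (Real.exp_pos _).le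

end NS

namespace NS
open Complex Topology Metric

lemma lip1 {E : Type*} [NormedAddCommGroup E] [NormedSpace ℝ E] {g g' : ℝ → E} {C : ℝ} {s : Set ℝ} (hs : Convex ℝ s)
    (h : ∀ x ∈ s, HasDerivWithinAt g (g' x) s x) (hC : ∀ x ∈ s, ‖g' x‖ ≤ C) : ∀ x ∈ s, ∀ y ∈ s, ‖g y - g x‖ ≤ C * |y - x| :=
  fun _ hx _ hy => hs.norm_image_sub_le_of_norm_hasDerivWithin_le h hC hx hy

lemma tay1 {E : Type*} [NormedAddCommGroup E] [NormedSpace ℝ E] {g g' : ℝ → E} {C : ℝ} (hC0 : 0 ≤ C) {s : Set ℝ} (hs : Convex ℝ s)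
    (h : ∀ x ∈ s, HasDerivWithinAt g (g' x) s x) (hC : ∀ x ∈ s, ∀ y ∈ s, ‖g' y - g' x‖ ≤ C * |y - x|) :
    ∀ x ∈ s, ∀ y ∈ s, ‖g y - g x - (y - x) • g' x‖ ≤ C * |y - x| ^ 2 := by
  intro x hx y hy
  have hsub : uIcc x y ⊆ s := hs.ordConnected.uIcc_subset hx hy
  have h1 := lip1 (g := fun w => g w - (w - x) • g' x) (g' := fun w => g' w - g' x) (C := C * |y - x|) (convex_uIcc x y)
    (fun w hw => by
      have h2 := ((h w (hsub hw)).mono hsub).sub ((((hasDerivWithinAt_id w _).sub_const x).smul_const (g' x)))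
      simp only [one_smul] at h2
      exact h2)
    (fun w hw => (hC x hx w (hsub hw)).trans (mul_le_mul_of_nonneg_left (by
      exact abs_sub_left_of_mem_uIcc hw) hC0))
    x left_mem_uIcc y right_mem_uIcc
  simp only [sub_self, zero_smul, sub_zero] at h1
  rw [show g y - g x - (y - x) • g' x = g y - (y - x) • g' x - g x by abel]
  exact h1.trans (le_of_eq (by ring))

open ComplexConjugate

lemma nsq (d e : ℂ) : ‖d - e‖ ^ 2 = ‖d‖ ^ 2 - 2 * (d * conj e).re + ‖e‖ ^ 2 := by
  simp only [Complex.sq_norm, normSq_apply, sub_re, sub_im, mul_re, conj_re, conj_im]; ring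

structure CG (A m a : ℝ) (z za zaa : ℝ → ℂ) (Ω Ω' : Set ℂ) : Prop where
  hA : 1 ≤ A
  hm : 0 < m
  hm1 : m ≤ 1
  hz : ∀ α, HasDerivAt z (za α) α
  hza : ∀ α, HasDerivAt za (zaa α) α
  ba : ∀ α, ‖za α‖ ≤ A
  baa : ∀ α, ‖zaa α‖ ≤ A
  chord : ∀ α β, m * |α - β| ≤ ‖z α - z β‖
  per : ∀ α, z (α + 2 * Real.pi) = z α + 2 * Real.pi
  o1 : IsOpen Ω
  o2 : IsOpen Ω'
  c1 : IsConnected Ω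
  c2 : IsConnected Ω'
  un : Ω ∪ Ω' ∪ range z = univ
  dj : Disjoint Ω Ω'
  f1 : frontier Ω = range z
  f2 : frontier Ω' = range z
  s1 : ∀ x : ℂ, a ≤ x.im → x ∈ Ω
  s2 : ∀ x : ℂ, x.im ≤ -a → x ∈ Ω'

def rho (A m : ℝ) : ℝ := m ^ 2 / (4 * A)

namespace CG
variable {A m a : ℝ} {z za zaa : ℝ → ℂ} {Ω Ω' : Set ℂ} (G : CG A m a z za zaa Ω Ω')
include G

lemma rp : 0 < rho A m := by have := G.hA; have := G.hm; unfold rho; positivity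

lemma low (α : ℝ) : m ≤ ‖za α‖ := by
  have h1 := (G.hz α).tendsto_slope.norm
  refine ge_of_tendsto h1 ?_
  filter_upwards [self_mem_nhdsWithin] with b hb
  rw [slope_def_module, norm_smul, norm_inv, Real.norm_eq_abs, inv_mul_eq_div, le_div_iff₀ (abs_pos.2 (sub_ne_zero.2 hb))]
  exact G.chord b α

lemma za0 (α : ℝ) : za α ≠ 0 := fun h => by have := G.low α; rw [h, norm_zero] at this; linarith [G.hm]

lemma lipza (α β : ℝ) : ‖za β - za α‖ ≤ A * |β - α| :=
  lip1 convex_univ (fun x _ => (G.hza x).hasDerivWithinAt) (fun x _ => G.baa x) α trivial β trivial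

lemma lipz (α β : ℝ) : ‖z β - z α‖ ≤ A * |β - α| :=
  lip1 convex_univ (fun x _ => (G.hz x).hasDerivWithinAt) (fun x _ => G.ba x) α trivial β trivial

lemma tay (α β : ℝ) : ‖z β - z α - (β - α) * za α‖ ≤ A * |β - α| ^ 2 := by
  have := tay1 (by linarith [G.hA]) convex_univ (fun x _ => (G.hz x).hasDerivWithinAt) (fun x _ y _ => G.lipza x y) α trivial β trivial
  simpa using this

lemma tb {α : ℝ} {e : ℂ} (he : ‖e‖ = 1) (ho : (za α * conj e).re = 0) (β : ℝ) :
    rho A m ^ 2 + ‖z β - z α‖ ^ 2 / 2 ≤ ‖z β - (z α + rho A m * e)‖ ^ 2 := by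
  have hA := G.hA
  have hr := G.rp
  set d := z β - z α with hd
  rw [show z β - (z α + rho A m * e) = d - rho A m * e by rw [hd]; ring, nsq d ((rho A m : ℂ) * e)]
  have htay := G.tay α β
  have hch := G.chord β α
  rw [← hd] at htay hch
  clear_value d
  have h1 : ‖(rho A m : ℂ) * e‖ = rho A m := by rw [norm_mul, he, mul_one, Complex.norm_real, Real.norm_of_nonneg hr.le]
  have h2 : (d * conj ((rho A m : ℂ) * e)).re = rho A m * (d * conj e).re := by
    rw [map_mul, conj_ofReal, show d * ((rho A m : ℂ) * conj e) = (rho A m : ℂ) * (d * conj e) by ring, re_ofReal_mul]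
  have h3 : (d * conj e).re ≤ A * |β - α| ^ 2 := by
    have e1 : (d * conj e).re = ((d - (β - α) * za α) * conj e).re := by
      rw [sub_mul d, sub_re (d * _), mul_assoc, ← ofReal_sub, re_ofReal_mul, ho, mul_zero, sub_zero]
    rw [e1]
    refine (re_le_norm _).trans ?_
    rw [norm_mul, RCLike.norm_conj, he, mul_one]; exact htay
  have h4 : (m * |β - α|) ^ 2 ≤ ‖d‖ ^ 2 := pow_le_pow_left₀ (by have := G.hm; positivity) hch 2
  rw [h1, h2]
  have h5 : rho A m * (A * |β - α| ^ 2) = (m * |β - α|) ^ 2 / 4 := by unfold rho; field_simp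
  nlinarith [mul_le_mul_of_nonneg_left h3 hr.le]

lemma miss {S : Set ℂ} (hS : IsPreconnected S) (hd : ∀ x ∈ S, x ∉ range z) {x : ℂ} (hx : x ∈ S) (hxΩ : x ∈ Ω) : S ⊆ Ω := by
  refine hS.subset_left_of_subset_union G.o1 G.o2 G.dj (fun y hy => ?_) ⟨x, hx, hxΩ⟩
  have : y ∈ Ω ∪ Ω' ∪ range z := by rw [G.un]; trivial
  rcases this with h | h
  · exact h
  · exact absurd h (hd y hy)

lemma swap' : (∀ x, x ∈ Ω ∨ x ∈ Ω' ∨ x ∈ range z) := fun x => by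
  have : x ∈ Ω ∪ Ω' ∪ range z := by rw [G.un]; trivial
  rcases this with (h | h) | h <;> tauto

lemma miss' {S : Set ℂ} (hS : IsPreconnected S) (hd : ∀ x ∈ S, x ∉ range z) {x : ℂ} (hx : x ∈ S) (hxΩ : x ∈ Ω') : S ⊆ Ω' := by
  refine hS.subset_right_of_subset_union G.o1 G.o2 G.dj (fun y hy => ?_) ⟨x, hx, hxΩ⟩
  rcases G.swap' y with h | h | h
  · exact Or.inl h
  · exact Or.inr h
  · exact absurd h (hd y hy)

lemma cl : IsClosed (range z) := by rw [← G.f1]; exact isClosed_frontier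

lemma nf {x : ℂ} (hx : x ∈ Ω) : x ∉ range z := by rw [← G.f1, G.o1.frontier_eq]; exact fun h => h.2 hx
lemma nf' {x : ℂ} (hx : x ∈ Ω') : x ∉ range z := by rw [← G.f2, G.o2.frontier_eq]; exact fun h => h.2 hx

/-- nearest point -/
lemma near {x : ℂ} (hx : x ∉ range z) : ∃ α, 0 < ‖x - z α‖ ∧ (∀ β, ‖x - z α‖ ≤ ‖x - z β‖) ∧
    (za α * conj (x - z α)).re = 0 := by
  obtain ⟨y, ⟨α, rfl⟩, hy⟩ := G.cl.exists_infDist_eq_dist ⟨_, mem_range_self 0⟩ x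
  have hmin : ∀ β, ‖x - z α‖ ≤ ‖x - z β‖ := fun β => by
    rw [← dist_eq_norm, ← dist_eq_norm, ← hy]; exact infDist_le_dist_of_mem ⟨β, rfl⟩
  refine ⟨α, ?_, hmin, ?_⟩
  · rw [norm_pos_iff, sub_ne_zero]; rintro rfl; exact hx ⟨α, rfl⟩
  · have h1 : IsLocalMin (fun β => ‖x - z β‖ ^ 2) α := Eventually.of_forall fun β =>
      pow_le_pow_left₀ (norm_nonneg _) (hmin β) 2
    have h2 : HasDerivAt (fun β => ‖x - z β‖ ^ 2) (2 * inner ℝ (x - z α) (0 - za α)) α :=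
      ((hasDerivAt_const α x).sub (G.hz α)).norm_sq
    have h3 := h1.hasDerivAt_eq_zero h2
    rw [zero_sub, inner_neg_right, real_inner_comm, Complex.inner] at h3
    have e : ((x - z α) * conj (za α)).re = (za α * conj (x - z α)).re := by
      simp only [mul_re, conj_re, conj_im]; ring
    rw [e] at h3; linarith

omit G in
lemma ballmiss {x : ℂ} {α : ℝ} (h : ∀ β, ‖x - z α‖ ≤ ‖x - z β‖) : ∀ y ∈ ball x ‖x - z α‖, y ∉ range z := by
  rintro _ hy ⟨β, rfl⟩
  rw [mem_ball, dist_comm, dist_eq_norm] at hy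
  linarith [h β]

lemma tbmiss {α : ℝ} {e : ℂ} (he : ‖e‖ = 1) (ho : (za α * conj e).re = 0) :
    ∀ y ∈ ball (z α + rho A m * e) (rho A m), y ∉ range z := by
  rintro _ hy ⟨β, rfl⟩
  have := G.tb he ho β
  rw [mem_ball, dist_eq_norm] at hy
  have := pow_lt_pow_left₀ hy (norm_nonneg _) two_ne_zero
  nlinarith [sq_nonneg ‖z β - z α‖]

end CG

def tau (za : ℝ → ℂ) (α : ℝ) : ℂ := za α / ‖za α‖

namespace CG
variable {A m a : ℝ} {z za zaa : ℝ → ℂ} {Ω Ω' : Set ℂ} (G : CG A m a z za zaa Ω Ω')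
include G

lemma taun (α : ℝ) : ‖tau za α‖ = 1 := by
  unfold tau; rw [norm_div, Complex.norm_real, norm_norm, div_self (norm_ne_zero_iff.2 (G.za0 α))]

lemma zatau (α : ℝ) : za α = ‖za α‖ * tau za α := by
  unfold tau; rw [mul_div_cancel₀]; exact_mod_cast (norm_ne_zero_iff.2 (G.za0 α))

lemma tauc : Continuous (tau za) := by
  have h1 : Continuous za := continuous_iff_continuousAt.2 fun α => (G.hza α).continuousAt
  exact h1.div (continuous_ofReal.comp h1.norm) fun α => by exact_mod_cast (norm_ne_zero_iff.2 (G.za0 α))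

lemma perp {α : ℝ} {v : ℂ} (h : (za α * conj v).re = 0) : ∃ r : ℝ, v = r * (I * tau za α) ∧ |r| = ‖v‖ := by
  have h1 : (tau za α * conj v).re = 0 := by
    rw [G.zatau α, mul_assoc, re_ofReal_mul] at h
    exact (mul_eq_zero.1 h).resolve_left (norm_ne_zero_iff.2 (G.za0 α))
  have h2 : tau za α * conj (tau za α) = 1 := by rw [mul_conj, normSq_eq_norm_sq, G.taun]; simp
  set w := tau za α * conj v with hw
  have h3 : w = (w.im : ℂ) * I := by apply Complex.ext <;> simp [h1]
  have h4 : v = ((-w.im : ℝ) : ℂ) * (I * tau za α) := by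
    have h5 : conj w * tau za α = v := by rw [hw, map_mul, conj_conj]; linear_combination v * h2
    rw [← h5, h3]; simp; ring
  refine ⟨-w.im, h4, ?_⟩
  conv_rhs => rw [h4, norm_mul, norm_mul, G.taun, norm_I]
  simp

lemma perpn (α : ℝ) (c : ℝ) : (za α * conj ((c:ℂ) * (I * tau za α))).re = 0 := by
  rw [G.zatau α]
  have h2 : tau za α * conj (tau za α) = 1 := by rw [mul_conj, normSq_eq_norm_sq, G.taun]; simp
  have : (‖za α‖ : ℂ) * tau za α * conj ((c:ℂ) * (I * tau za α)) = ((-(‖za α‖ * c) : ℝ) : ℂ) * I := by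
    rw [map_mul, map_mul, conj_I, conj_ofReal]; push_cast; linear_combination (-(‖za α‖ : ℂ) * c * I) * h2
  rw [this]; simp

lemma side (α : ℝ) {ε : ℝ} (hε : |ε| = 1) : ball (z α + rho A m * (ε * (I * tau za α))) (rho A m) ⊆ Ω ∨
    ball (z α + rho A m * (ε * (I * tau za α))) (rho A m) ⊆ Ω' := by
  have he : ‖(ε:ℂ) * (I * tau za α)‖ = 1 := by simp [G.taun, hε]
  have hm := G.tbmiss he (G.perpn α ε)
  have hc := mem_ball_self (x := z α + rho A m * (ε * (I * tau za α))) G.rp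
  rcases G.swap' (z α + rho A m * (ε * (I * tau za α))) with h | h | h
  · exact Or.inl (G.miss (convex_ball _ _).isPreconnected hm hc h)
  · exact Or.inr (G.miss' (convex_ball _ _).isPreconnected hm hc h)
  · exact absurd h (hm _ hc)

lemma nearball {x : ℂ} (hx : x ∉ range z) {α : ℝ} (hd : ‖x - z α‖ < rho A m) :
    ∃ (β r ε : ℝ), |ε| = 1 ∧ 0 < r ∧ r ≤ ‖x - z α‖ ∧ x = z β + r * (ε * (I * tau za β)) ∧
      (∀ γ, r ≤ ‖x - z γ‖) ∧ x ∈ ball (z β + rho A m * (ε * (I * tau za β))) (rho A m) := by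
  obtain ⟨β, h0, h1, h2⟩ := G.near hx
  obtain ⟨s, hs, hs2⟩ := G.perp h2
  have hs0 : s ≠ 0 := fun h => by rw [h, abs_zero] at hs2; linarith
  have hk : x = z β + (|s|:ℝ) * ((s / |s| : ℝ) * (I * tau za β)) := by
    have : ((|s|:ℝ):ℂ) ≠ 0 := by exact_mod_cast abs_ne_zero.2 hs0
    rw [← mul_assoc]; push_cast; rw [mul_div_cancel₀ _ this, ← hs]; ring
  have hu : ‖((s / |s| : ℝ) : ℂ) * (I * tau za β)‖ = 1 := by
    rw [norm_mul, norm_mul, G.taun, norm_I, Complex.norm_real, Real.norm_eq_abs, abs_div, abs_abs, div_self (abs_ne_zero.2 hs0)]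
    norm_num
  refine ⟨β, |s|, s / |s|, by rw [abs_div, abs_abs, div_self (abs_ne_zero.2 hs0)], abs_pos.2 hs0, by rw [hs2]; exact h1 α, hk,
    fun γ => by rw [hs2]; exact h1 γ, ?_⟩
  have hsl : |s| < rho A m := by rw [hs2]; exact (h1 α).trans_lt hd
  rw [mem_ball, dist_eq_norm]
  conv_lhs => rw [hk]
  rw [add_sub_add_left_eq_sub, ← sub_mul, norm_mul, hu, mul_one, ← ofReal_sub, Complex.norm_real, Real.norm_eq_abs, abs_lt]
  constructor <;> linarith [abs_pos.2 hs0]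

lemma geo : ∃ ε : ℝ, |ε| = 1 ∧ (∀ α, ball (z α + rho A m * (ε * (I * tau za α))) (rho A m) ⊆ Ω) ∧
    (∀ α, ball (z α - rho A m * (ε * (I * tau za α))) (rho A m) ⊆ Ω') ∧
    (∀ x ∈ Ω, ∀ α, ‖x - z α‖ < rho A m → ∃ (β r : ℝ), 0 < r ∧ r ≤ ‖x - z α‖ ∧
      x = z β + r * (ε * (I * tau za β)) ∧ ∀ γ, r ≤ ‖x - z γ‖) := by
  have hzc : Continuous z := continuous_iff_continuousAt.2 fun α => (G.hz α).continuousAt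
  have hcc : ∀ ε : ℝ, Continuous fun α => z α + rho A m * (ε * (I * tau za α)) := fun ε => by
    have := G.tauc; fun_prop
  have hin : ∀ (ε : ℝ) (α : ℝ), z α + rho A m * (ε * (I * tau za α)) ∈ ball (z α + rho A m * (ε * (I * tau za α))) (rho A m) :=
    fun ε α => mem_ball_self G.rp
  have habs : ∀ e : ℝ, |e| = 1 → e = 1 ∨ e = -1 := fun e he => by
    rcases abs_choice e with h | h <;> rw [h] at he
    · left; exact he
    · right; linarith
  set p : ℝ → ℝ → Prop := fun ε α => z α + rho A m * (ε * (I * tau za α)) ∈ Ω with hp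
  set q : ℝ → ℝ → Prop := fun ε α => z α + rho A m * (ε * (I * tau za α)) ∈ Ω' with hq
  have hpo : ∀ ε, IsOpen {α | p ε α} := fun ε => G.o1.preimage (hcc ε)
  have hqo : ∀ ε, IsOpen {α | q ε α} := fun ε => G.o2.preimage (hcc ε)
  have pq : ∀ ε α, |ε| = 1 → p ε α ∨ q ε α := fun ε α hε =>
    (G.side α hε).imp (fun h => h (hin ε α)) (fun h => h (hin ε α))
  have npq : ∀ ε α, p ε α → ¬ q ε α := fun ε α h h' => disjoint_left.1 G.dj h h'
  have hconst : ∀ ε, |ε| = 1 → (∀ α, p ε α) ∨ (∀ α, q ε α) := by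
    intro ε hε
    have hcl : IsClopen {α | p ε α} := ⟨by
      rw [← isOpen_compl_iff]
      convert hqo ε using 1
      ext α; exact ⟨fun h => (pq ε α hε).resolve_left h, fun h h' => npq ε α h' h⟩, hpo ε⟩
    rcases isClopen_iff.1 hcl with h | h
    · right; intro α
      refine (pq ε α hε).resolve_left fun h' => ?_
      have : α ∈ {α | p ε α} := h'
      rw [h] at this; exact this
    · left; intro α
      have : α ∈ {α | p ε α} := by rw [h]; trivial
      exact this
  have sp : ∀ ε α, |ε| = 1 → p ε α → ball (z α + rho A m * (ε * (I * tau za α))) (rho A m) ⊆ Ω := fun ε α hε h =>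
    (G.side α hε).resolve_right fun h' => npq ε α h (h' (hin ε α))
  have sq : ∀ ε α, |ε| = 1 → q ε α → ball (z α + rho A m * (ε * (I * tau za α))) (rho A m) ⊆ Ω' := fun ε α hε h =>
    (G.side α hε).resolve_left fun h' => npq ε α (h' (hin ε α)) h
  have hfr : ∀ S : Set ℂ, frontier S = range z → ∃ x ∈ S, ‖x - z 0‖ < rho A m := by
    intro S hS
    have : z 0 ∈ closure S := frontier_subset_closure (by rw [hS]; exact ⟨0, rfl⟩)
    obtain ⟨x, hx, hd⟩ := Metric.mem_closure_iff.1 this _ G.rp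
    exact ⟨x, hx, by rwa [← dist_eq_norm, dist_comm]⟩
  have a1 : |(1:ℝ)| = 1 := abs_one
  have a2 : |(-1:ℝ)| = 1 := by simp
  have main : ∃ ε : ℝ, |ε| = 1 ∧ (∀ α, p ε α) ∧ ∀ α, q (-ε) α := by
    rcases hconst 1 a1 with h | h <;> rcases hconst (-1) a2 with h' | h'
    · obtain ⟨x, hx, hd⟩ := hfr Ω' G.f2
      obtain ⟨β, r, ε, he, -, -, -, -, hb⟩ := G.nearball (G.nf' hx) hd
      exfalso
      refine disjoint_left.1 G.dj (sp ε β he ?_ hb) hx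
      rcases habs ε he with rfl | rfl
      · exact h β
      · exact h' β
    · exact ⟨1, a1, h, h'⟩
    · exact ⟨-1, a2, h', by rw [neg_neg]; exact h⟩
    · obtain ⟨x, hx, hd⟩ := hfr Ω G.f1
      obtain ⟨β, r, ε, he, -, -, -, -, hb⟩ := G.nearball (G.nf hx) hd
      exfalso
      refine disjoint_left.1 G.dj hx (sq ε β he ?_ hb)
      rcases habs ε he with rfl | rfl
      · exact h β
      · exact h' β
  obtain ⟨ε, he, h1, h2⟩ := main
  refine ⟨ε, he, fun α => sp ε α he (h1 α), fun α => ?_, ?_⟩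
  · have := sq (-ε) α (by rwa [abs_neg]) (h2 α)
    convert this using 2
    push_cast; ring
  · intro x hx α hd
    obtain ⟨β, r, e, he', h3, h4, h5, h6, h7⟩ := G.nearball (G.nf hx) hd
    refine ⟨β, r, h3, h4, ?_, h6⟩
    have : e = ε := by
      by_contra hne
      have : e = -ε := by
        rcases habs e he' with rfl | rfl <;> rcases habs ε he with rfl | rfl <;> first | (exact absurd rfl hne) | norm_num
      rw [this] at h7
      exact disjoint_left.1 G.dj hx (sq (-ε) β (by rwa [abs_neg]) (h2 β) h7)
    rw [← this]; exact h5

end CG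
end NS

namespace NS
open Complex Topology Metric ComplexConjugate

structure SF (A m a q0 : ℝ) (z za zaa : ℝ → ℂ) (Ω Ω' : Set ℂ) (f : ℂ → ℂ) : Prop extends
    CG A m a z za zaa Ω Ω' where
  sc : SimplyConnectedSpace Ω
  fd : DifferentiableOn ℂ f Ω
  fc : ContinuousOn f (closure Ω)
  pΩ : ∀ x : ℂ, x ∈ Ω ↔ x + 2 * Real.pi ∈ Ω
  pf : ∀ x ∈ Ω, f (x + 2 * Real.pi) = f x
  dec : ∃ C b : ℝ, 0 ≤ C ∧ ∀ x : ℂ, b ≤ x.im → ‖f x‖ ≤ C * Real.exp (-x.im)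
  q0p : 0 ≤ q0
  hq : ∀ α, |(f (z α) * za α).im| ≤ q0
  hqL : ∀ α β, |(f (z β) * za β).im - (f (z α) * za α).im| ≤ q0 * |β - α|

lemma perred {Ω : Set ℂ} (pΩ : ∀ x : ℂ, x ∈ Ω ↔ x + 2 * Real.pi ∈ Ω) {F : ℂ → ℂ}
    (pF : ∀ x ∈ Ω, F (x + 2 * Real.pi) = F x) {p : ℂ → Prop} (hp : ∀ x, x ∈ Ω → x.re ∈ Icc 0 (2 * Real.pi) → p (F x)) :
    ∀ x ∈ Ω, p (F x) := by
  have h1 : ∀ k : ℕ, ∀ x : ℂ, x ∈ Ω → x + k * (2 * Real.pi) ∈ Ω ∧ F (x + k * (2 * Real.pi)) = F x := by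
    intro k; induction k with
    | zero => intro x hx; simpa using hx
    | succ k ih =>
      intro x hx
      obtain ⟨h1, h2⟩ := ih x hx
      have e : x + ((k+1:ℕ):ℂ) * (2 * Real.pi) = x + k * (2 * Real.pi) + 2 * Real.pi := by push_cast; ring
      rw [e, pF _ h1, ← pΩ]; exact ⟨h1, h2⟩
  have h2 : ∀ k : ℕ, ∀ x : ℂ, x ∈ Ω → x - k * (2 * Real.pi) ∈ Ω ∧ F (x - k * (2 * Real.pi)) = F x := by
    intro k; induction k with
    | zero => intro x hx; simpa using hx
    | succ k ih =>
      intro x hx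
      obtain ⟨h1, h2⟩ := ih x hx
      have e : x - k * (2 * Real.pi) = x - ((k+1:ℕ):ℂ) * (2 * Real.pi) + 2 * Real.pi := by push_cast; ring
      rw [e, ← pΩ] at h1
      refine ⟨h1, ?_⟩
      rw [← h2, e, pF _ h1]
  intro x hx
  obtain ⟨k, hk, -⟩ := existsUnique_sub_zsmul_mem_Ico (show 0 < 2 * Real.pi by positivity) x.re 0
  rw [zero_add] at hk
  obtain ⟨n, rfl | rfl⟩ := k.eq_nat_or_neg
  · obtain ⟨h3, h4⟩ := h2 n x hx
    rw [← h4]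
    refine hp _ h3 ?_
    have : (x - n * (2 * Real.pi)).re = x.re - (n:ℤ) • (2 * Real.pi) := by simp
    rw [this]; exact ⟨hk.1, hk.2.le⟩
  · obtain ⟨h3, h4⟩ := h1 n x hx
    rw [← h4]
    refine hp _ h3 ?_
    have : (x + n * (2 * Real.pi)).re = x.re - (-(n:ℤ)) • (2 * Real.pi) := by simp
    rw [this]; exact ⟨hk.1, hk.2.le⟩

namespace SF
variable {A m a q0 : ℝ} {z za zaa : ℝ → ℂ} {Ω Ω' : Set ℂ} {f : ℂ → ℂ} (S : SF A m a q0 z za zaa Ω Ω' f)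
include S

lemma clI {x : ℂ} (hx : x ∈ closure Ω) : -a ≤ x.im := by
  by_contra! h
  have h1 : x ∈ Ω' := S.s2 x h.le
  obtain ⟨y, hy1, hy2⟩ := mem_closure_iff.1 hx Ω' S.o2 h1
  exact disjoint_left.1 S.dj hy2 hy1

lemma boxc (b : ℝ) : IsCompact (closure Ω ∩ {x : ℂ | x.re ∈ Icc 0 (2 * Real.pi) ∧ x.im ≤ b}) := by
  refine Metric.isCompact_of_isClosed_isBounded (isClosed_closure.inter ?_) ?_
  · exact ((isClosed_Icc.preimage continuous_re)).inter (isClosed_le continuous_im continuous_const)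
  · refine (isBounded_closedBall (x := (0:ℂ)) (r := 2 * Real.pi + (|a| + |b|))).subset ?_
    rintro x ⟨h1, h2, h3⟩
    rw [mem_closedBall_zero_iff]
    refine (norm_le_abs_re_add_abs_im x).trans (add_le_add ?_ ?_)
    · rw [abs_of_nonneg h2.1]; exact h2.2
    · have := S.clI h1
      rw [abs_le]; constructor
      · linarith [le_abs_self a, abs_nonneg b]
      · linarith [le_abs_self b, abs_nonneg a]

lemma bdd : ∃ M, 0 ≤ M ∧ ∀ x ∈ closure Ω, ‖f x‖ ≤ M := by
  obtain ⟨C, b, hC, hd⟩ := S.dec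
  obtain ⟨M, hM⟩ := (S.boxc b).exists_bound_of_continuousOn (S.fc.mono inter_subset_left)
  refine ⟨max M (C * Real.exp (-b)), le_max_of_le_right (by positivity), fun x hx => ?_⟩
  refine le_on_closure ?_ S.fc.norm continuousOn_const hx
  refine perred S.pΩ S.pf (p := fun w => ‖w‖ ≤ max M (C * Real.exp (-b))) fun x hx hr => ?_
  by_cases h : b ≤ x.im
  · refine le_max_of_le_right ((hd x h).trans ?_)
    gcongr
  · exact le_max_of_le_left (hM x ⟨subset_closure hx, hr, by linarith⟩)

lemma exW : ∃ W : ℂ → ℂ, (∀ x ∈ Ω, HasDerivAt W (f x) x) ∧ (∀ x ∈ Ω, W (x + 2 * Real.pi) = W x) ∧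
    (∃ M, ∀ x ∈ Ω, ‖W x‖ ≤ M) := by
  obtain ⟨W, hW⟩ := prim S.o1 S.sc S.fd
  have hWc : ContinuousOn W Ω := fun x hx => (hW x hx).continuousAt.continuousWithinAt
  obtain ⟨C, b, hC, hd⟩ := S.dec
  obtain ⟨M, hM0, hM⟩ := S.bdd
  set b' := max a b
  have hconv : ∀ y : ℝ, Convex ℝ {x : ℂ | y ≤ x.im} := fun y => convex_halfSpace_im_ge y
  have hshift : ∀ x ∈ Ω, HasDerivAt (fun x => W (x + 2 * Real.pi)) (f x) x := fun x hx => by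
    have := (hW _ ((S.pΩ x).1 hx)).comp_add_const x (2 * Real.pi : ℂ)
    rwa [S.pf x hx] at this
  have hzero : ∀ x ∈ Ω, HasDerivAt (fun x => W (x + 2 * Real.pi) - W x) 0 x := fun x hx => by
    have := (hshift x hx).sub (hW x hx)
    rwa [sub_self] at this
  have hcst : ∃ c, ∀ x ∈ Ω, W (x + 2 * Real.pi) - W x = c := by
    obtain ⟨x0, hx0⟩ := S.c1.nonempty
    refine ⟨W (x0 + 2 * Real.pi) - W x0, fun x hx => ?_⟩
    refine S.o1.is_const_of_fderiv_eq_zero (𝕜 := ℂ) S.c1.isPreconnected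
      (f := fun x => W (x + 2 * Real.pi) - W x) ?_ ?_ hx hx0
    · exact fun y hy => (hzero y hy).differentiableAt.differentiableWithinAt
    · intro y hy
      exact (hzero y hy).hasFDerivAt.fderiv.trans (by ext; simp)
  obtain ⟨c, hc⟩ := hcst
  have hc0 : c = 0 := by
    have h1 : ∀ y ≥ b', ‖c‖ ≤ C * Real.exp (-y) * (2 * Real.pi) := by
      intro y hy
      have hya : a ≤ y := (le_max_left _ _).trans hy
      have hyb : b ≤ y := (le_max_right _ _).trans hy
      have hin : ((y:ℂ) * I) ∈ Ω := S.s1 _ (by simpa using hya)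
      rw [← hc _ hin]
      have hm1 : (y:ℂ) * I ∈ {x : ℂ | y ≤ x.im} := show y ≤ ((y:ℂ) * I).im by simp
      have hm2 : (y:ℂ) * I + 2 * Real.pi ∈ {x : ℂ | y ≤ x.im} := show y ≤ ((y:ℂ) * I + 2 * Real.pi).im by simp
      have := (hconv y).norm_image_sub_le_of_norm_hasDerivWithin_le (f := W) (f' := f) (C := C * Real.exp (-y))
        (fun x hx => (hW x (S.s1 x (hya.trans hx))).hasDerivWithinAt)
        (fun x hx => (hd x (hyb.trans hx)).trans (by
          have : y ≤ x.im := hx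
          gcongr)) hm1 hm2
      refine this.trans (le_of_eq ?_)
      congr 1
      rw [add_sub_cancel_left, show (2 * Real.pi : ℂ) = ((2 * Real.pi : ℝ) : ℂ) by push_cast; rfl, Complex.norm_real,
        Real.norm_of_nonneg (by positivity)]
    have h2 : Tendsto (fun y : ℝ => C * Real.exp (-y) * (2 * Real.pi)) atTop (𝓝 0) := by
      have := ((Real.tendsto_exp_neg_atTop_nhds_zero).const_mul C).mul_const (2 * Real.pi)
      simpa using this
    have h3 : ‖c‖ ≤ 0 := ge_of_tendsto h2 (by filter_upwards [eventually_ge_atTop b'] with y hy using h1 y hy)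
    exact norm_le_zero_iff.1 h3
  have hper : ∀ x ∈ Ω, W (x + 2 * Real.pi) = W x := fun x hx => by
    have := hc x hx; rw [hc0] at this; exact sub_eq_zero.1 this
  refine ⟨W, hW, hper, ?_⟩
  -- high part
  have hhigh : ∀ x : ℂ, b' ≤ x.im → ‖W x - W (x.re + b' * I)‖ ≤ C * Real.exp (-b') := by
    intro x hx
    have hder : ∀ s ≥ b', HasDerivAt (fun s : ℝ => W (x.re + s * I)) (f (x.re + s * I) * I) s := by
      intro s hs
      have h1 : HasDerivAt (fun s : ℝ => (x.re : ℂ) + s * I) I s := by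
        have := ((hasDerivAt_id s).ofReal_comp.mul_const I).const_add (x.re : ℂ)
        simpa using this
      have h2 := hW (x.re + s * I) (S.s1 _ (by simpa using (le_max_left _ _).trans hs))
      exact h2.comp s h1
    have := image_norm_le_of_norm_deriv_right_le_deriv_boundary (a := b') (b := x.im)
      (f := fun s : ℝ => W (x.re + s * I) - W (x.re + b' * I)) (f' := fun s => f (x.re + s * I) * I)
      (B := fun s => C * Real.exp (-b') - C * Real.exp (-s)) (B' := fun s => C * Real.exp (-s))
      (fun s hs => ((hder s hs.1).sub_const _).continuousAt.continuousWithinAt)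
      (fun s hs => ((hder s hs.1).sub_const _).hasDerivWithinAt)
      (by simp) (fun s => by
        have := (((hasDerivAt_id s).neg.exp).const_mul C).const_sub (C * Real.exp (-b'))
        simpa using this) (fun s hs => by
          rw [norm_mul, norm_I, mul_one]
          have := hd (x.re + s * I) (by simpa using (le_max_right a b).trans hs.1)
          simpa using this) (x := x.im) ⟨hx, le_rfl⟩
    rw [re_add_im] at this
    refine this.trans ?_
    have : 0 ≤ C * Real.exp (-x.im) := by positivity
    linarith
  set ρ := rho A m
  have hρ : 0 < ρ := S.rp
  have hΓ : (range z).Nonempty := ⟨_, mem_range_self 0⟩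
  set K := (closure Ω ∩ {x : ℂ | x.re ∈ Icc 0 (2 * Real.pi) ∧ x.im ≤ b'}) ∩ {x | ρ / 2 ≤ infDist x (range z)} with hK
  have hKc : IsCompact K := (S.boxc b').inter_right (isClosed_le continuous_const (continuous_infDist_pt _))
  have hin : ∀ x ∈ closure Ω, 0 < infDist x (range z) → x ∈ Ω := fun x hx h => by
    by_contra hn
    have : x ∈ frontier Ω := by rw [S.o1.frontier_eq]; exact ⟨hx, hn⟩
    rw [S.f1] at this
    rw [infDist_zero_of_mem this] at h; exact lt_irrefl _ h
  have hKΩ : K ⊆ Ω := fun x hx => hin x hx.1.1 (by have : ρ / 2 ≤ infDist x (range z) := hx.2; linarith)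
  obtain ⟨M1, hM1⟩ := hKc.exists_bound_of_continuousOn (hWc.mono hKΩ)
  have hL : IsCompact ((fun s : ℝ => (s:ℂ) + b' * I) '' Icc 0 (2 * Real.pi)) := isCompact_Icc.image (by fun_prop)
  obtain ⟨M2, hM2⟩ := hL.exists_bound_of_continuousOn (hWc.mono (by
    rintro _ ⟨s, -, rfl⟩; exact S.s1 _ (by simp [b'])))
  have hgood : ∀ x ∈ Ω, ρ / 2 ≤ infDist x (range z) → ‖W x‖ ≤ max M1 (M2 + C * Real.exp (-b')) := by
    intro x hx
    set Ω2 := {x ∈ Ω | ρ / 2 ≤ infDist x (range z)} with hΩ2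
    have hpz : ∀ y : ℂ, infDist (y + 2 * Real.pi) (range z) = infDist y (range z) := by
      intro y
      have e : range z = (fun w : ℂ => w + 2 * Real.pi) '' range z := by
        ext w; constructor
        · rintro ⟨α, rfl⟩
          refine ⟨z (α - 2 * Real.pi), ⟨_, rfl⟩, ?_⟩
          have := S.per (α - 2 * Real.pi)
          rw [sub_add_cancel] at this; exact this.symm
        · rintro ⟨_, ⟨α, rfl⟩, rfl⟩; exact ⟨α + 2 * Real.pi, S.per α⟩
      conv_lhs => rw [e]
      exact infDist_image (isometry_add_right (2 * Real.pi : ℂ))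
    have h1 : ∀ x ∈ Ω2, ‖W x‖ ≤ max M1 (M2 + C * Real.exp (-b')) := by
      refine perred (Ω := Ω2) (fun y => ?_) (fun y hy => hper y hy.1) (p := fun w => ‖w‖ ≤ max M1 (M2 + C * Real.exp (-b'))) ?_
      · simp only [hΩ2, mem_setOf_eq, hpz]; rw [← S.pΩ]
      · intro y hy hr
        by_cases h : b' ≤ y.im
        · refine le_max_of_le_right ?_
          have h2 := hhigh y h
          have h3 := hM2 (y.re + b' * I) ⟨y.re, hr, rfl⟩
          have := norm_sub_norm_le (W y) (W (y.re + b' * I))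
          linarith
        · exact le_max_of_le_left (hM1 y ⟨⟨subset_closure hy.1, hr, by linarith⟩, hy.2⟩)
    exact fun h => h1 x ⟨hx, h⟩
  obtain ⟨ε, hε, hb1, -, hn⟩ := S.geo
  refine ⟨max M1 (M2 + C * Real.exp (-b')) + M * (2 * ρ), fun x hx => ?_⟩
  by_cases h : ρ / 2 ≤ infDist x (range z)
  · have := hgood x hx h
    have : 0 ≤ M * (2 * ρ) := by positivity
    linarith
  · push Not at h
    obtain ⟨_, ⟨α, rfl⟩, hα⟩ := (infDist_lt_iff hΓ).1 h
    rw [dist_eq_norm] at hα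
    obtain ⟨β, r, hr, hr1, hxe, -⟩ := hn x hx α (by linarith)
    have hu : ‖(ε:ℂ) * (I * tau za β)‖ = 1 := by simp [S.taun, hε]
    set y := z β + ρ * (ε * (I * tau za β)) with hy
    have hyΩ : ball y ρ ⊆ Ω := hb1 β
    have hxy : x ∈ ball y ρ := by
      rw [mem_ball, dist_eq_norm, hxe, hy, add_sub_add_left_eq_sub, ← sub_mul, norm_mul, hu, mul_one, ← ofReal_sub,
        Complex.norm_real, Real.norm_eq_abs, abs_lt]
      constructor <;> linarith
    have hyd : ρ / 2 ≤ infDist y (range z) := by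
      by_contra! h'
      obtain ⟨w, hw, hw2⟩ := (infDist_lt_iff hΓ).1 h'
      exact S.nf (hyΩ (by rw [mem_ball, dist_comm]; linarith)) hw
    have h5 := hgood y (hyΩ (mem_ball_self hρ)) hyd
    have h6 := (convex_ball y ρ).norm_image_sub_le_of_norm_hasDerivWithin_le (f := W) (f' := f) (C := M)
      (fun w hw => (hW w (hyΩ hw)).hasDerivWithinAt) (fun w hw => hM w (subset_closure (hyΩ hw))) (mem_ball_self hρ) hxy
    have h7 : ‖x - y‖ ≤ 2 * ρ := by rw [← dist_eq_norm]; linarith [mem_ball.1 hxy]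
    have := norm_sub_norm_le (W x) (W y)
    nlinarith

end SF
end NS

namespace NS
open Complex Topology Metric ComplexConjugate

def XX (z za : ℝ → ℂ) (ε r α : ℝ) : ℂ := z α + r * (ε * (I * za α))
def r1 (A m : ℝ) : ℝ := rho A m / A

structure GE (A m : ℝ) (z za : ℝ → ℂ) (Ω Ω' : Set ℂ) (ε : ℝ) : Prop where
  e : |ε| = 1
  b : ∀ α r, 0 < r → r ≤ r1 A m → ball (XX z za ε r α) (r * m) ⊆ Ω
  x : ∀ x ∈ Ω, ∀ α, rho A m ≤ ‖x - (z α - rho A m * (ε * (I * tau za α)))‖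
  nr : ∀ x ∈ Ω, ∀ α, ‖x - z α‖ < m * r1 A m → ∃ β r, 0 < r ∧ r ≤ r1 A m ∧ r * m ≤ ‖x - z α‖ ∧ x = XX z za ε r β ∧
    m * |β - α| ≤ 2 * ‖x - z α‖
  o : ∀ α, ball (z α - rho A m * (ε * (I * tau za α))) (rho A m) ⊆ Ω'

namespace CG
variable {A m a : ℝ} {z za zaa : ℝ → ℂ} {Ω Ω' : Set ℂ} (G : CG A m a z za zaa Ω Ω')
include G

lemma r1p : 0 < r1 A m := div_pos G.rp (by linarith [G.hA])

lemma exGE : ∃ ε, GE A m z za Ω Ω' ε := by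
  obtain ⟨ε, he, h1, h2, h3⟩ := G.geo
  have hA := G.hA
  have hm := G.hm
  have hrp := G.rp
  have hr1 : r1 A m * A = rho A m := by unfold r1; field_simp
  have hcast : ∀ α (r : ℝ), XX z za ε r α = z α + (r * ‖za α‖ : ℝ) * (ε * (I * tau za α)) := fun α r => by
    unfold XX; conv_lhs => rw [G.zatau α]
    push_cast; ring
  have hn : ∀ α, ‖(ε:ℂ) * (I * tau za α)‖ = 1 := fun α => by simp [G.taun, he]
  refine ⟨ε, he, fun α r hr hr' => ?_, fun x hx α => ?_, fun x hx α hd => ?_, h2⟩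
  · refine subset_trans (ball_subset_ball' ?_) (h1 α)
    have hs : r * ‖za α‖ ≤ rho A m := by
      rw [← hr1]; exact mul_le_mul hr' (G.ba α) (norm_nonneg _) (hr.le.trans hr')
    have hs2 : r * m ≤ r * ‖za α‖ := mul_le_mul_of_nonneg_left (G.low α) hr.le
    rw [hcast, dist_eq_norm, show z α + ((r * ‖za α‖ : ℝ):ℂ) * (ε * (I * tau za α)) - (z α + rho A m * (ε * (I * tau za α)))
      = ((r * ‖za α‖ - rho A m : ℝ) : ℂ) * (ε * (I * tau za α)) by push_cast; ring, norm_mul, hn, mul_one, Complex.norm_real,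
      Real.norm_eq_abs, abs_of_nonpos (by linarith)]
    linarith
  · by_contra! hc
    exact disjoint_left.1 G.dj hx (h2 α (by rwa [mem_ball, dist_eq_norm]))
  · have hz : ‖x - z α‖ < rho A m := hd.trans_le (by
      have := G.r1p
      have := G.hm1
      nlinarith)
    obtain ⟨β, s, hs, hs1, hs2, hs3⟩ := h3 x hx α hz
    have hl := G.low β
    have hzb : 0 < ‖za β‖ := by linarith
    have e1 : s / ‖za β‖ * ‖za β‖ = s := by field_simp
    have hsm : s / ‖za β‖ * m ≤ ‖x - z α‖ :=
      (mul_le_mul_of_nonneg_left hl (div_pos hs hzb).le).trans (e1.trans_le hs1)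
    refine ⟨β, s / ‖za β‖, div_pos hs hzb, ?_, hsm, ?_, ?_⟩
    · nlinarith
    · rw [hcast, e1]; exact hs2
    · refine (G.chord β α).trans ?_
      have : ‖x - z β‖ = s := by
        rw [hs2, add_sub_cancel_left, norm_mul, hn, mul_one, Complex.norm_real, Real.norm_of_nonneg hs.le]
      calc ‖z β - z α‖ = ‖(x - z α) - (x - z β)‖ := by congr 1; ring
        _ ≤ ‖x - z α‖ + ‖x - z β‖ := norm_sub_le _ _
        _ ≤ 2 * ‖x - z α‖ := by linarith

end CG

namespace SF
variable {A m a q0 : ℝ} {z za zaa : ℝ → ℂ} {Ω Ω' : Set ℂ} {f : ℂ → ℂ} (S : SF A m a q0 z za zaa Ω Ω' f)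
include S

lemma XXd (ε r α : ℝ) : HasDerivAt (XX z za ε r) (za α + r * (ε * (I * zaa α))) α :=
  (S.hz α).add ((((S.hza α).const_mul I).const_mul _).const_mul _)

lemma zcl (α : ℝ) : z α ∈ closure Ω := by
  have : z α ∈ frontier Ω := by rw [S.f1]; exact mem_range_self _
  exact this.1

lemma XXin {ε : ℝ} (E : GE A m z za Ω Ω' ε) {r : ℝ} (hr : 0 < r) (hr' : r ≤ r1 A m) (α : ℝ) : XX z za ε r α ∈ Ω :=
  E.b α r hr hr' (mem_ball_self (mul_pos hr S.hm))

lemma XXn {ε : ℝ} (E : GE A m z za Ω Ω' ε) {r : ℝ} (α : ℝ) : ‖XX z za ε r α - z α‖ ≤ A * |r| := by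
  rw [XX, add_sub_cancel_left, norm_mul, norm_mul, norm_mul]
  simp only [Complex.norm_real, Real.norm_eq_abs, E.e, norm_I, one_mul]
  rw [mul_comm]; exact mul_le_mul_of_nonneg_right (S.ba α) (abs_nonneg _)

lemma XXtend {ε : ℝ} (E : GE A m z za Ω Ω' ε) (α : ℝ) : Tendsto (fun r => XX z za ε r α) (𝓝[>] 0) (𝓝[Ω] (z α)) := by
  refine tendsto_nhdsWithin_iff.2 ⟨?_, ?_⟩
  · have : Continuous (fun r : ℝ => XX z za ε r α) := by unfold XX; fun_prop
    have := (this.tendsto 0).mono_left (nhdsWithin_le_nhds (s := Ioi 0))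
    simpa [XX] using this
  · filter_upwards [Ioc_mem_nhdsGT S.r1p] with r hr using S.XXin E hr.1 hr.2 α

/-- boundary values of the potential -/
lemma exWb {W : ℂ → ℂ} (hW : ∀ x ∈ Ω, HasDerivAt W (f x) x) (hp : ∀ x ∈ Ω, W (x + 2 * Real.pi) = W x)
    {ε : ℝ} (E : GE A m z za Ω Ω' ε) :
    ∃ Wb : ℝ → ℂ, (∀ α, HasDerivAt Wb (f (z α) * za α) α) ∧ (∀ α, Wb (α + 2 * Real.pi) = Wb α) ∧
     ∀ M, (∀ x ∈ closure Ω, ‖f x‖ ≤ M) → ∀ x ∈ Ω, ∀ α, ‖x - z α‖ < m * r1 A m →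
      ‖W x - Wb α‖ ≤ M * (3 * A / m) * ‖x - z α‖ := by
  have hA := S.hA
  have hm := S.hm
  have lip : ∀ M, (∀ x ∈ closure Ω, ‖f x‖ ≤ M) → ∀ α, ∀ r ∈ Ioc 0 (r1 A m), ∀ s ∈ Ioc 0 (r1 A m),
      ‖W (XX z za ε s α) - W (XX z za ε r α)‖ ≤ M * A * |s - r| := by
    intro M hM α
    have hd : ∀ r ∈ Ioc 0 (r1 A m), HasDerivWithinAt (fun r : ℝ => W (XX z za ε r α)) (f (XX z za ε r α) * (ε * (I * za α))) (Ioc 0 (r1 A m)) r := by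
      intro r hr
      have h1 : HasDerivAt (fun r : ℝ => XX z za ε r α) (ε * (I * za α)) r := by
        unfold XX
        simpa using ((hasDerivAt_id r).ofReal_comp.mul_const ((ε:ℂ) * (I * za α))).const_add (z α)
      exact ((hW _ (S.XXin E hr.1 hr.2 α)).comp r h1).hasDerivWithinAt
    refine lip1 (convex_Ioc _ _) hd fun r hr => ?_
    rw [norm_mul, norm_mul, norm_mul]
    simp only [Complex.norm_real, Real.norm_eq_abs, E.e, norm_I, one_mul]
    exact mul_le_mul (hM _ (subset_closure (S.XXin E hr.1 hr.2 α))) (S.ba α) (norm_nonneg _) ((norm_nonneg _).trans (hM _ (S.zcl 0)))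
  obtain ⟨M0, hM0, hM⟩ := S.bdd
  have ex : ∀ α, ∃ l, Tendsto (fun r => W (XX z za ε r α)) (𝓝[>] 0) (𝓝 l) := by
    intro α
    refine cauchy_map_iff_exists_tendsto.1 ?_
    rw [Metric.cauchy_iff]
    refine ⟨inferInstance, fun δ hδ => ?_⟩
    have hr0 : 0 < min (r1 A m) (δ / (2 * (M0 * A + 1))) := lt_min S.r1p (by positivity)
    refine ⟨_, image_mem_map (Ioc_mem_nhdsGT hr0), ?_⟩
    rintro _ ⟨r, hr, rfl⟩ _ ⟨s, hs, rfl⟩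
    have h1 := lip M0 hM α s ⟨hs.1, hs.2.trans (min_le_left _ _)⟩ r ⟨hr.1, hr.2.trans (min_le_left _ _)⟩
    rw [dist_eq_norm]
    have h2 : |r - s| ≤ δ / (2 * (M0 * A + 1)) := by
      rw [abs_le]
      have := hr.2.trans (min_le_right _ _); have := hs.2.trans (min_le_right _ _)
      constructor <;> linarith [hr.1, hs.1]
    refine h1.trans_lt ?_
    have h3 : (M0 * A + 1) * (δ / (2 * (M0 * A + 1))) = δ / 2 := by field_simp
    have : M0 * A * |r - s| ≤ (M0 * A + 1) * (δ / (2 * (M0 * A + 1))) := by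
      gcongr; linarith
    linarith
  choose Wb hWb using ex
  have hder : ∀ α, HasDerivAt Wb (f (z α) * za α) α := by
    intro α
    rw [hasDerivAt_iff_isLittleO, Asymptotics.isLittleO_iff]
    intro c hc
    have hfc : ContinuousWithinAt f (closure Ω) (z α) := S.fc _ (S.zcl α)
    -- joint continuity
    let K : ℝ × ℝ → ℂ := fun p => XX z za ε p.1 p.2
    have hzc : Continuous z := continuous_iff_continuousAt.2 fun α => (S.hz α).continuousAt
    have hzac : Continuous za := continuous_iff_continuousAt.2 fun α => (S.hza α).continuousAt
    have hK : Continuous K := by simp only [K, XX]; fun_prop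
    have hK0 : K (0, α) = z α := by simp [K, XX]
    have hle : Tendsto K (𝓝[Ioc 0 (r1 A m) ×ˢ univ] (0, α)) (𝓝[closure Ω] (z α)) := by
      refine tendsto_nhdsWithin_iff.2 ⟨by rw [← hK0]; exact hK.continuousWithinAt, ?_⟩
      filter_upwards [self_mem_nhdsWithin] with p hp using subset_closure (S.XXin E hp.1.1 hp.1.2 _)
    have h1 : Tendsto (fun p : ℝ × ℝ => f (K p) * za p.2) (𝓝[Ioc 0 (r1 A m) ×ˢ univ] (0, α)) (𝓝 (f (z α) * za α)) :=
      (hfc.tendsto.comp hle).mul (by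
        have : Continuous fun p : ℝ × ℝ => za p.2 := by fun_prop
        exact (this.continuousWithinAt (x := ((0:ℝ), α))).tendsto)
    have h2 := Metric.tendsto_nhds.1 h1 (c / 2) (by linarith)
    rw [eventually_nhdsWithin_iff, Metric.eventually_nhds_iff] at h2
    obtain ⟨δ, hδ, h2⟩ := h2
    filter_upwards [Metric.ball_mem_nhds α hδ] with β hβ
    rw [mem_ball, Real.dist_eq] at hβ
    have key : ∀ r ∈ Ioo 0 (min (min (r1 A m) δ) (c / (2 * (M0 * A + 1)))),
        ‖(W (XX z za ε r β) - (β - α) * (f (z α) * za α)) - (W (XX z za ε r α) - (α - α) * (f (z α) * za α))‖ ≤ c * |β - α| := by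
      intro r hr
      have hra : r ≤ r1 A m := (hr.2.le.trans (min_le_left _ _)).trans (min_le_left _ _)
      have hrd : r < δ := (hr.2.trans_le (min_le_left _ _)).trans_le (min_le_right _ _)
      have hrc : r < c / (2 * (M0 * A + 1)) := hr.2.trans_le (min_le_right _ _)
      have hd : ∀ γ ∈ uIcc α β, HasDerivWithinAt (fun γ : ℝ => W (XX z za ε r γ) - (γ - α) * (f (z α) * za α))
          (f (XX z za ε r γ) * (za γ + r * (ε * (I * zaa γ))) - 1 * (f (z α) * za α)) (uIcc α β) γ := by
        intro γ _
        refine (HasDerivAt.sub ((hW _ (S.XXin E hr.1 hra γ)).comp γ (S.XXd ε r γ)) ?_).hasDerivWithinAt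
        exact ((hasDerivAt_id γ).ofReal_comp.sub_const _).mul_const _
      refine lip1 (convex_uIcc _ _) hd (fun γ hγ => ?_) α left_mem_uIcc β right_mem_uIcc
      have hγ' : |γ - α| < δ := (abs_sub_left_of_mem_uIcc hγ).trans_lt hβ
      have h3 := h2 (y := (r, γ)) (by rw [Prod.dist_eq]; simp [Real.dist_eq, abs_of_pos hr.1, hrd, hγ']) ⟨⟨hr.1, hra⟩, trivial⟩
      rw [dist_eq_norm] at h3
      have h4 : ‖f (XX z za ε r γ) * (r * (ε * (I * zaa γ)))‖ ≤ c / 2 := by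
        simp only [norm_mul, Complex.norm_real, Real.norm_eq_abs, E.e, norm_I, one_mul, abs_of_pos hr.1]
        have h5 : r * (M0 * A + 1) ≤ c / 2 := by
          rw [lt_div_iff₀ (by positivity)] at hrc; linarith
        have h6 := hM _ (subset_closure (S.XXin E hr.1 hra γ))
        have h7 : ‖f (XX z za ε r γ)‖ * (r * ‖zaa γ‖) ≤ M0 * (r * A) := by
          have := hr.1.le
          gcongr
          exact S.baa γ
        linarith [hr.1]
      calc _ = ‖(f (XX z za ε r γ) * za γ - f (z α) * za α) + f (XX z za ε r γ) * (r * (ε * (I * zaa γ)))‖ := by congr 1; ring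
        _ ≤ c := (norm_add_le _ _).trans (by simp only [K] at h3; linarith)
    have hlim := (((hWb β).sub_const ((β - α) * (f (z α) * za α))).sub ((hWb α).sub_const ((α - α) * (f (z α) * za α)))).norm
    have h5 := le_of_tendsto hlim (by
      filter_upwards [Ioo_mem_nhdsGT (show (0:ℝ) < min (min (r1 A m) δ) (c / (2 * (M0 * A + 1))) from
        lt_min (lt_min S.r1p hδ) (by positivity))] with r hr using key r hr)
    rw [Real.norm_eq_abs]
    refine le_trans (le_of_eq ?_) h5
    congr 1; simp; ring
  refine ⟨Wb, hder, fun α => ?_, fun M hM x hx α hd => ?_⟩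
  · have hza : za (α + 2 * Real.pi) = za α := by
      have h1 := (S.hz (α + 2 * Real.pi)).comp_add_const α (2 * Real.pi)
      have h2 : HasDerivAt (fun x => z (x + 2 * Real.pi)) (za α) α := by
        simp only [S.per]; exact (S.hz α).add_const _
      exact h1.unique h2
    refine tendsto_nhds_unique (hWb (α + 2 * Real.pi)) ((hWb α).congr' ?_)
    filter_upwards [Ioc_mem_nhdsGT S.r1p] with r hr
    rw [← hp _ (S.XXin E hr.1 hr.2 α)]
    congr 1; unfold XX; rw [S.per, hza]; ring
  · obtain ⟨β, r, hr, hr1, hr2, rfl, hβ⟩ := E.nr x hx α hd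
    set d := ‖XX z za ε r β - z α‖
    have hM0 : 0 ≤ M := (norm_nonneg _).trans (hM _ (S.zcl 0))
    have h1 : ‖W (XX z za ε r β) - Wb β‖ ≤ M * A * r := by
      refine le_of_tendsto ((tendsto_const_nhds.sub (hWb β)).norm) ?_
      filter_upwards [Ioc_mem_nhdsGT hr] with s hs
      refine (lip M hM β s ⟨hs.1, hs.2.trans hr1⟩ r ⟨hr, hr1⟩).trans ?_
      gcongr; rw [abs_of_nonneg (by linarith [hs.2])]; linarith [hs.1]
    have h2 : ‖Wb β - Wb α‖ ≤ M * A * |β - α| :=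
      lip1 convex_univ (fun γ _ => (hder γ).hasDerivWithinAt) (fun γ _ => by
        rw [norm_mul]; exact mul_le_mul (hM _ (S.zcl γ)) (S.ba γ) (norm_nonneg _) hM0) α trivial β trivial
    have h3 : r + |β - α| ≤ 3 / m * d := by
      rw [div_mul_eq_mul_div, le_div_iff₀ hm]; nlinarith
    calc _ ≤ ‖W (XX z za ε r β) - Wb β‖ + ‖Wb β - Wb α‖ := norm_sub_le_norm_sub_add_norm_sub _ _ _
      _ ≤ M * A * (r + |β - α|) := by linarith
      _ ≤ M * A * (3 / m * d) := by gcongr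
      _ = _ := by ring

end SF
end NS

namespace NS
open Complex Topology Metric ComplexConjugate

namespace SF
variable {A m a q0 : ℝ} {z za zaa : ℝ → ℂ} {Ω Ω' : Set ℂ} {f : ℂ → ℂ} (S : SF A m a q0 z za zaa Ω Ω' f)
include S

lemma Qd {Wb : ℝ → ℂ} (h : ∀ α, HasDerivAt Wb (f (z α) * za α) α) (α : ℝ) :
    HasDerivAt (fun α => (Wb α).im) (f (z α) * za α).im α := by
  have := (imCLM.hasFDerivAt (x := Wb α)).comp_hasDerivAt α (h α)
  exact this

lemma wx {ε : ℝ} (E : GE A m z za Ω Ω' ε) (α α0 : ℝ) : rho A m ≤ ‖z α - (z α0 - rho A m * (ε * (I * tau za α0)))‖ := by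
  by_contra! hc
  exact S.nf' (E.o α0 (show z α ∈ _ by rwa [mem_ball, dist_eq_norm])) (mem_range_self α)

lemma nn {ε : ℝ} (E : GE A m z za Ω Ω' ε) (α : ℝ) : ‖(ε:ℂ) * (I * tau za α)‖ = 1 := by simp [S.taun, E.e]

def C1 (A m q0 : ℝ) : ℝ := 2 * (2 * Real.pi * q0 + 2 * (rho A m * q0 / m) + ((q0 + q0 * A / m) / m ^ 2 + q0 / (m * rho A m))) * (1 + rho A m) ^ 2 / rho A m + q0 / m

set_option maxHeartbeats 800000 in
lemma L2 {W : ℂ → ℂ} (hW : ∀ x ∈ Ω, HasDerivAt W (f x) x) (hbd : ∃ M, ∀ x ∈ Ω, ‖W x‖ ≤ M) {Wb : ℝ → ℂ}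
    (hWb : ∀ α, HasDerivAt Wb (f (z α) * za α) α) (hp : ∀ α, Wb (α + 2 * Real.pi) = Wb α)
    (hT : ∀ α, Tendsto W (𝓝[Ω] (z α)) (𝓝 (Wb α))) {ε : ℝ} (E : GE A m z za Ω Ω' ε) :
    ∀ x ∈ Ω, ∀ α, |(W x).im - (Wb α).im| ≤ C1 A m q0 * ‖x - z α‖ := by
  have hA := S.hA
  have hm := S.hm
  have hq0 := S.q0p
  have hr := S.rp
  set ρ := rho A m with hρ
  intro x hx α0
  set n : ℂ := ε * (I * tau za α0) with hn
  have hn1 : ‖n‖ = 1 := S.nn E α0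
  set q := (f (z α0) * za α0).im with hq
  set κ : ℝ := -ε * ρ * q / ‖za α0‖ with hκ
  have hl := S.low α0
  have hzp : 0 < ‖za α0‖ := by linarith
  have hκb : |κ| ≤ ρ * q0 / m := by
    rw [hκ, abs_div, abs_mul, abs_mul, abs_neg, E.e, abs_of_pos hr, abs_norm, one_mul]
    exact div_le_div₀ (by positivity) (mul_le_mul_of_nonneg_left (S.hq α0) hr.le) hm hl
  set N1 : ℝ := (q0 + q0 * A / m) / m ^ 2 + q0 / (m * ρ) with hN1
  have hN1p : 0 ≤ N1 := by positivity
  set N := 2 * Real.pi * q0 + 2 * (ρ * q0 / m) + N1 with hN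
  have hNp : 0 ≤ N := by positivity
  set w := wB (z α0) n ρ with hw
  have hlip : ∀ α β, |(Wb β).im - (Wb α).im| ≤ q0 * |β - α| := fun α β =>
    lip1 convex_univ (fun x _ => (S.Qd hWb x).hasDerivWithinAt) (fun x _ => S.hq x) α trivial β trivial
  have hbd1 : ∀ α, |(Wb α).im - (Wb α0).im| ≤ 2 * Real.pi * q0 := by
    intro α
    have hP : Function.Periodic (fun α => (Wb α).im) (2 * Real.pi) := fun α => by simp [hp]
    obtain ⟨y, hy, e1⟩ := hP.exists_mem_Ico₀ (by positivity) α
    obtain ⟨y', hy', e2⟩ := hP.exists_mem_Ico₀ (by positivity) α0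
    change (Wb α).im = (Wb y).im at e1
    change (Wb α0).im = (Wb y').im at e2
    rw [e1, e2, mul_comm]
    refine (hlip y' y).trans (mul_le_mul_of_nonneg_left ?_ hq0)
    rw [abs_le]; constructor <;> linarith [hy.1, hy.2, hy'.1, hy'.2]
  have hfr : ∀ α, |(Wb α - κ * w (z α)).im - (Wb α0).im| ≤ N * min 1 ‖z α - z α0‖ ^ 2 := by
    intro α
    obtain ⟨w1, w2, w3⟩ := wB_facts hn1 hr (S.wx E α α0)
    rcases le_total 1 ‖z α - z α0‖ with h1 | h1
    · rw [min_eq_left h1]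
      have w4 : ‖w (z α)‖ ≤ 2 := by
        have := re_le_norm (w (z α)); simp only [← hw] at w1 w2
        by_contra! hc; nlinarith
      have : |(κ * w (z α)).im| ≤ 2 * (ρ * q0 / m) := by
        refine (abs_im_le_norm _).trans ?_
        rw [norm_mul, Complex.norm_real, Real.norm_eq_abs]
        nlinarith [norm_nonneg (w (z α)), abs_nonneg κ]
      have h3 := hbd1 α
      rw [sub_im, abs_le] at *
      constructor <;> nlinarith
    · rw [min_eq_right h1]
      set u := z α - z α0 with hu
      have hch := S.chord α α0
      rw [← hu] at hch
      have t1 := tay1 (g := fun α => (Wb α).im) hq0 convex_univ (fun x _ => (S.Qd hWb x).hasDerivWithinAt)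
        (fun x _ y _ => S.hqL x y) α0 trivial α trivial
      have t2 := S.tay α0 α
      rw [← hu] at t2
      have hden : z α - (z α0 - ρ * n) = u + ρ * n := by rw [hu]; ring
      have hd1 := S.wx E α α0
      rw [← hρ, ← hn, hden] at hd1
      have hdne : u + ρ * n ≠ 0 := norm_pos_iff.1 (by linarith)
      have hne : n ≠ 0 := norm_pos_iff.1 (by linarith)
      have hρne : (ρ:ℂ) ≠ 0 := by exact_mod_cast hr.ne'
      have hεε : (ε:ℂ) * ε = 1 := by
        have : ε * ε = 1 := by rw [← abs_mul_abs_self, E.e]; norm_num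
        exact_mod_cast this
      have hmain : (κ:ℂ) * (za α0 / (ρ * n)) = I * q := by
        have hτ : tau za α0 ≠ 0 := norm_pos_iff.1 (by rw [S.taun]; norm_num)
        have hε0 : (ε:ℂ) ≠ 0 := fun h => by rw [h] at hεε; simp at hεε
        rw [hn, hκ]; nth_rewrite 2 [S.zatau α0]
        have : (‖za α0‖:ℂ) ≠ 0 := by exact_mod_cast hzp.ne'
        push_cast
        field_simp
        linear_combination (-q:ℂ) * I_sq
      have hdec : (κ:ℂ) * w (z α) = I * q * (α - α0) + κ * ((u - (α - α0) * za α0) / (ρ * n)) - κ * (u ^ 2 / ((u + ρ * n) * (ρ * n))) := by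
        rw [← hmain, hw, wB, hden, ← hu]; field_simp; ring
      have hnn : ‖(ρ:ℂ) * n‖ = ρ := by rw [norm_mul, hn1, mul_one, Complex.norm_real, Real.norm_of_nonneg hr.le]
      have b1 : ‖(κ:ℂ) * ((u - (α - α0) * za α0) / (ρ * n))‖ ≤ (ρ * q0 / m) * (A * |α - α0| ^ 2 / ρ) := by
        rw [norm_mul, norm_div, hnn, Complex.norm_real, Real.norm_eq_abs]; gcongr
      have b2 : ‖(κ:ℂ) * (u ^ 2 / ((u + ρ * n) * (ρ * n)))‖ ≤ (ρ * q0 / m) * (‖u‖ ^ 2 / (ρ * ρ)) := by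
        rw [norm_mul, norm_div, norm_mul, hnn, Complex.norm_real, Real.norm_eq_abs, norm_pow]; gcongr
      have e1 : (Wb α - κ * w (z α)).im - (Wb α0).im = ((Wb α).im - (Wb α0).im - (α - α0) * q)
          - ((κ:ℂ) * ((u - (α - α0) * za α0) / (ρ * n))).im + ((κ:ℂ) * (u ^ 2 / ((u + ρ * n) * (ρ * n)))).im := by
        rw [hdec]; simp; ring
      have c1 := (abs_im_le_norm _).trans b1
      have c2 := (abs_im_le_norm _).trans b2
      have t1' : |(Wb α).im - (Wb α0).im - (α - α0) * q| ≤ q0 * |α - α0| ^ 2 := t1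
      have hs : |α - α0| ^ 2 ≤ ‖u‖ ^ 2 / m ^ 2 := by
        rw [le_div_iff₀ (by positivity), ← mul_pow]; gcongr; linarith
      have tot : |(Wb α - κ * w (z α)).im - (Wb α0).im| ≤ (q0 + q0 * A / m) * |α - α0| ^ 2 + q0 / (m * ρ) * ‖u‖ ^ 2 := by
        rw [e1]
        refine (abs_add_le _ _).trans ((add_le_add_left (abs_sub _ _) _).trans ?_)
        refine (add_le_add (add_le_add t1' c1) c2).trans (le_of_eq ?_)
        field_simp
      refine tot.trans ?_
      have : (q0 + q0 * A / m) * |α - α0| ^ 2 ≤ (q0 + q0 * A / m) * (‖u‖ ^ 2 / m ^ 2) := by gcongr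
      have h8 : (q0 + q0 * A / m) * (‖u‖ ^ 2 / m ^ 2) + q0 / (m * ρ) * ‖u‖ ^ 2 = N1 * ‖u‖ ^ 2 := by rw [hN1]; ring
      have h9 : N1 ≤ N := by rw [hN]; linarith [show 0 ≤ 2 * Real.pi * q0 + 2 * (ρ * q0 / m) by positivity]
      have h10 : N1 * ‖u‖ ^ 2 ≤ N * ‖u‖ ^ 2 := mul_le_mul_of_nonneg_right h9 (sq_nonneg _)
      linarith
  obtain ⟨M, hM⟩ := hbd
  have hyy : ∀ x ∈ Ω, ρ ≤ ‖x - (z α0 - ρ * n)‖ := fun x hx => E.x x hx α0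
  have hwd : DifferentiableOn ℂ w Ω := wB_diff hr hyy
  have hwb : ∀ x ∈ Ω, ‖w x‖ ≤ 2 := fun x hx => by
    obtain ⟨w1, -, -⟩ := wB_facts hn1 hr (hyy x hx)
    have := re_le_norm (w x)
    by_contra! hc; nlinarith
  have key := barW (U := Ω) (g := fun x => W x - κ * w x) (x0 := z α0) (n := n) (c0 := (Wb α0).im) (N := N) (M := M + |κ| * 2) S.o1 hr hn1 hyy
    ((show DifferentiableOn ℂ W Ω from fun x hx => (hW x hx).differentiableAt.differentiableWithinAt).sub (hwd.const_mul _))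
    (fun x hx => (abs_im_le_norm _).trans ((norm_sub_le _ _).trans (add_le_add (hM x hx) (by
      rw [norm_mul, Complex.norm_real, Real.norm_eq_abs]; exact mul_le_mul_of_nonneg_left (hwb x hx) (abs_nonneg _))))) hNp ?_ x hx
  · have e : (W x).im - (Wb α0).im = ((W x - κ * w x).im - (Wb α0).im) + (κ * w x).im := by simp; ring
    have h2 : |(κ * w x).im| ≤ q0 / m * ‖x - z α0‖ := by
      refine (abs_im_le_norm _).trans ?_
      rw [norm_mul, Complex.norm_real, Real.norm_eq_abs]
      calc _ ≤ (ρ * q0 / m) * (‖x - z α0‖ / ρ) := by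
            gcongr; exact (wB_facts hn1 hr (hyy x hx)).2.1
        _ = _ := by field_simp
    rw [e]
    refine (abs_add_le _ _).trans ((add_le_add key h2).trans (le_of_eq ?_))
    unfold C1; ring
  · rw [S.f1]
    rintro _ ⟨α, rfl⟩ e he
    have hden : z α - (z α0 - ρ * n) ≠ 0 := norm_pos_iff.1 (hr.trans_le (S.wx E α α0))
    have hwc : ContinuousAt w (z α) := by
      have : ContinuousAt (fun x => (x - z α0) / (x - (z α0 - ρ * n))) (z α) :=
        ContinuousAt.div (by fun_prop) (by fun_prop) hden
      exact this
    have hlim : Tendsto (fun y => |(W y - κ * w y).im - (Wb α0).im| - N * min 1 ‖y - z α0‖ ^ 2) (𝓝[Ω] (z α))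
        (𝓝 (|(Wb α - κ * w (z α)).im - (Wb α0).im| - N * min 1 ‖z α - z α0‖ ^ 2)) := by
      refine Tendsto.sub (Tendsto.abs (Tendsto.sub_const ((continuous_im.tendsto _).comp ((hT α).sub ((hwc.tendsto.mono_left nhdsWithin_le_nhds).const_mul _))) _)) ?_
      have : Continuous fun y : ℂ => N * min 1 ‖y - z α0‖ ^ 2 := by fun_prop
      exact (this.tendsto _).mono_left nhdsWithin_le_nhds
    filter_upwards [hlim.eventually (gt_mem_nhds (show _ < e by linarith [hfr α]))] with y hy
    linarith

end SF
end NS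

namespace NS
open Complex Topology Metric ComplexConjugate

def M1 (A m q0 : ℝ) : ℝ := 32 * A * SF.C1 A m q0 / m
def H3 (A m q0 : ℝ) : ℝ := 2 * ((q0 + M1 A m q0 * A) / m + 2 * M1 A m q0 * A) * √((1 + rho A m) / rho A m)
def D3 (A m q0 : ℝ) : ℝ := 32 * H3 A m q0 * √(2 * A) / m ^ 2
def H4 (A m q0 : ℝ) : ℝ := (4 * A + 1) * D3 A m q0 * √(8 * A / m) + 2 * M1 A m q0 / √(r1 A m * m / (8 * A))

structure ST (C A m : ℝ) (z za : ℝ → ℂ) (Ω : Set ℂ) (f W : ℂ → ℂ) (Wb : ℝ → ℂ) : Prop where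
  hW : ∀ x ∈ Ω, HasDerivAt W (f x) x
  Wbd : ∃ M, ∀ x ∈ Ω, ‖W x‖ ≤ M
  Wb' : ∀ α, HasDerivAt Wb (f (z α) * za α) α
  Wbp : ∀ α, Wb (α + 2 * Real.pi) = Wb α
  Wb0 : Wb 0 = 0
  fb : ∀ x ∈ closure Ω, ‖f x‖ ≤ C
  lim : ∀ x ∈ Ω, ∀ α, ‖x - z α‖ < m * r1 A m → ‖W x - Wb α‖ ≤ C * ‖x - z α‖
  fH : ∀ x ∈ Ω, ∀ α, ‖f x - f (z α)‖ ≤ C * √‖x - z α‖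
  fHb : ∀ α β, ‖f (z β) - f (z α)‖ ≤ C * √|β - α|
  tay : ∀ x ∈ Ω, ∀ α, ‖x - z α‖ < m * r1 A m → ‖W x - Wb α - f (z α) * (x - z α)‖ ≤ C * (‖x - z α‖ * √‖x - z α‖)

namespace SF
variable {A m a q0 : ℝ} {z za zaa : ℝ → ℂ} {Ω Ω' : Set ℂ} {f : ℂ → ℂ} (S : SF A m a q0 z za zaa Ω Ω' f)
include S

lemma C1p : 0 ≤ C1 A m q0 := by
  have := S.hA; have := S.hm; have := S.q0p; have := S.rp
  unfold C1; positivity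
lemma M1p : 0 ≤ M1 A m q0 := by
  have := S.hA; have := S.hm; have := S.C1p
  unfold M1; positivity
lemma H3p : 0 ≤ H3 A m q0 := by
  have := S.hA; have := S.hm; have := S.q0p; have := S.rp; have := S.M1p
  unfold H3; positivity
lemma D3p : 0 ≤ D3 A m q0 := by
  have := S.hA; have := S.hm; have := S.H3p
  unfold D3; positivity
lemma H4p : 0 ≤ H4 A m q0 := by
  have := S.hA; have := S.hm; have := S.D3p; have := S.M1p
  unfold H4; positivity

lemma r1le : r1 A m ≤ 1 := by
  have hA := S.hA; have hm := S.hm; have := S.hm1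
  unfold r1 rho
  rw [div_div, div_le_one (by positivity)]; nlinarith

lemma XXball {ε : ℝ} (E : GE A m z za Ω Ω' ε) {r : ℝ} (hr : 0 < r) (α : ℝ) {y : ℂ} (hy : y ∈ ball (XX z za ε r α) (r * m)) :
    ‖y - z α‖ ≤ 2 * A * r := by
  have hA := S.hA; have := S.hm1
  rw [mem_ball, dist_eq_norm] at hy
  have h1 := S.XXn E (r := r) α
  rw [abs_of_pos hr] at h1
  have := norm_add_le (y - XX z za ε r α) (XX z za ε r α - z α)
  rw [sub_add_sub_cancel] at this
  nlinarith

lemma frc (α : ℝ) : Tendsto f (𝓝[Ω] (z α)) (𝓝 (f (z α))) :=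
  (S.fc _ (S.zcl α)).tendsto.mono_left (nhdsWithin_mono _ subset_closure)

lemma fbd {W : ℂ → ℂ} (hW : ∀ x ∈ Ω, HasDerivAt W (f x) x) {Wb : ℝ → ℂ} {ε : ℝ} (E : GE A m z za Ω Ω' ε)
    (h2 : ∀ x ∈ Ω, ∀ α, |(W x).im - (Wb α).im| ≤ C1 A m q0 * ‖x - z α‖) :
    ∀ x ∈ closure Ω, ‖f x‖ ≤ M1 A m q0 := by
  have hA := S.hA; have hm := S.hm; have hC := S.C1p
  have h3 : ∀ α, ‖f (z α)‖ ≤ M1 A m q0 := by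
    intro α
    refine le_of_tendsto ((S.frc α).comp (S.XXtend E α)).norm ?_
    filter_upwards [Ioc_mem_nhdsGT S.r1p] with r hr
    have hr0 := hr.1
    have hb := E.b α r hr.1 hr.2
    have := deriv_im (h := W) (x := XX z za ε r α) (r := r * m) (S := C1 A m q0 * (2 * A * r)) (c := (Wb α).im) (by positivity)
      (by positivity) (fun y hy => (hW y (hb hy)).differentiableAt.differentiableWithinAt)
      (fun y hy => (h2 y (hb hy) α).trans (mul_le_mul_of_nonneg_left (S.XXball E hr0 α hy) hC))
    rw [(hW _ (S.XXin E hr.1 hr.2 α)).deriv] at this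
    refine this.trans (le_of_eq ?_)
    unfold M1; field_simp; ring
  refine fun x hx => le_on_closure (fun x hx => ?_) S.fc.norm continuousOn_const hx
  obtain ⟨M, hM0, hM⟩ := S.bdd
  by_cases h0 : f x = 0
  · rw [h0, norm_zero]; exact S.M1p
  set c : ℂ := conj (f x) / ‖f x‖ with hc
  have hcn : ‖c‖ = 1 := by rw [hc, norm_div, Complex.norm_real, norm_norm, RCLike.norm_conj, div_self (norm_ne_zero_iff.2 h0)]
  have := MP (U := Ω) (G := fun y => c * f y) (M := M) (c := M1 A m q0) S.o1 S.rp (fun x hx => E.x x hx 0) (S.fd.const_mul _)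
    (fun y hy => (re_le_norm _).trans (by rw [norm_mul, hcn, one_mul]; exact hM y (subset_closure hy))) (by
      rw [S.f1]; rintro _ ⟨α, rfl⟩ e he
      filter_upwards [((S.frc α).norm).eventually (gt_mem_nhds (show _ < M1 A m q0 + e by linarith [h3 α]))] with y hy
      exact (re_le_norm _).trans (by rw [norm_mul, hcn, one_mul]; exact hy.le)) x hx
  have e1 : (c * f x).re = ‖f x‖ := by
    have : c * f x = (‖f x‖ : ℂ) := by
      rw [hc, div_mul_eq_mul_div, mul_comm, mul_conj, normSq_eq_norm_sq]
      have : (‖f x‖:ℂ) ≠ 0 := by exact_mod_cast norm_ne_zero_iff.2 h0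
      push_cast; field_simp
    rw [this, ofReal_re]
  rwa [e1] at this

lemma L3 {ε : ℝ} (E : GE A m z za Ω Ω' ε) (hb : ∀ x ∈ closure Ω, ‖f x‖ ≤ M1 A m q0) :
    ∀ x ∈ Ω, ∀ α, |(f x * za α).im - (f (z α) * za α).im| ≤ H3 A m q0 * √‖x - z α‖ := by
  have hA := S.hA; have hm := S.hm; have hM := S.M1p; have hq := S.q0p
  intro x hx α0
  set N := (q0 + M1 A m q0 * A) / m + 2 * M1 A m q0 * A
  have hN : 0 ≤ N := by positivity
  have hb' : ∀ x ∈ closure Ω, |(f x * za α0).im| ≤ M1 A m q0 * A := fun x hx =>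
    (abs_im_le_norm _).trans (by rw [norm_mul]; exact mul_le_mul (hb x hx) (S.ba α0) (norm_nonneg _) hM)
  have hfr : ∀ α, |(f (z α) * za α0).im - (f (z α0) * za α0).im| ≤ N * √(min 1 ‖z α - z α0‖) := by
    intro α
    rcases le_total 1 ‖z α - z α0‖ with h1 | h1
    · rw [min_eq_left h1, Real.sqrt_one, mul_one]
      have c1 := abs_le.1 (hb' _ (S.zcl α)); have c2 := abs_le.1 (hb' _ (S.zcl α0))
      have : 0 ≤ (q0 + M1 A m q0 * A) / m := by positivity
      rw [abs_le]; constructor <;> simp only [N] <;> linarith [c1.1, c1.2, c2.1, c2.2]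
    · rw [min_eq_right h1]
      have hs : ‖z α - z α0‖ ≤ √‖z α - z α0‖ := Real.le_sqrt_of_sq_le (by nlinarith [norm_nonneg (z α - z α0)])
      have hch := S.chord α α0
      have e : (f (z α) * za α0).im - (f (z α0) * za α0).im = ((f (z α) * za α).im - (f (z α0) * za α0).im) - (f (z α) * (za α - za α0)).im := by
        rw [mul_sub, sub_im]; ring
      have h2 : |(f (z α) * (za α - za α0)).im| ≤ M1 A m q0 * (A * |α - α0|) :=
        (abs_im_le_norm _).trans (by rw [norm_mul]; exact mul_le_mul (hb _ (S.zcl α)) (S.lipza α0 α) (norm_nonneg _) hM)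
      have h3 : |α - α0| ≤ ‖z α - z α0‖ / m := by rw [le_div_iff₀ hm]; linarith
      rw [e]
      calc _ ≤ q0 * |α - α0| + M1 A m q0 * (A * |α - α0|) := (abs_sub _ _).trans (add_le_add (S.hqL α0 α) h2)
        _ = (q0 + M1 A m q0 * A) * |α - α0| := by ring
        _ ≤ (q0 + M1 A m q0 * A) * (‖z α - z α0‖ / m) := by gcongr
        _ = (q0 + M1 A m q0 * A) / m * ‖z α - z α0‖ := by ring
        _ ≤ N * ‖z α - z α0‖ := by
          refine mul_le_mul_of_nonneg_right ?_ (norm_nonneg _)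
          have : 0 ≤ 2 * M1 A m q0 * A := by positivity
          simp only [N]; linarith
        _ ≤ _ := mul_le_mul_of_nonneg_left hs hN
  have := barH (U := Ω) (g := fun x => f x * za α0) (x0 := z α0) (n := ε * (I * tau za α0)) (c0 := (f (z α0) * za α0).im) (N := N) (e0 := 0) (M := M1 A m q0 * A)
    S.o1 S.rp (S.nn E α0) (fun x hx => E.x x hx α0) (fun h => S.nf h (mem_range_self _)) (S.fd.mul_const _)
    (fun x hx => hb' x (subset_closure hx)) hN ?_ x hx
  · simpa [H3] using this
  · rw [S.f1]
    rintro _ ⟨α, rfl⟩ e he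
    have hlim : Tendsto (fun y => |(f y * za α0).im - (f (z α0) * za α0).im| - N * √(min 1 ‖y - z α0‖)) (𝓝[Ω] (z α))
        (𝓝 (|(f (z α) * za α0).im - (f (z α0) * za α0).im| - N * √(min 1 ‖z α - z α0‖))) := by
      refine Tendsto.sub (Tendsto.abs (Tendsto.sub_const ((continuous_im.tendsto _).comp ((S.frc α).mul_const _)) _)) ?_
      have : Continuous fun y : ℂ => N * √(min 1 ‖y - z α0‖) := by fun_prop
      exact (this.tendsto _).mono_left nhdsWithin_le_nhds
    filter_upwards [hlim.eventually (gt_mem_nhds (show _ < e by linarith [hfr α]))] with y hy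
    linarith

lemma L3d {ε : ℝ} (E : GE A m z za Ω Ω' ε) (h3 : ∀ x ∈ Ω, ∀ α, |(f x * za α).im - (f (z α) * za α).im| ≤ H3 A m q0 * √‖x - z α‖)
    {r : ℝ} (hr : 0 < r) (hr' : r ≤ r1 A m) (α : ℝ) {y : ℂ} (hy : y ∈ ball (XX z za ε r α) (r * m / 2)) :
    ‖deriv f y‖ ≤ D3 A m q0 * (√r / r) := by
  have hA := S.hA; have hm := S.hm; have hH := S.H3p
  have hsub : ball y (r * m / 2) ⊆ ball (XX z za ε r α) (r * m) := ball_subset_ball' (by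
    rw [mem_ball] at hy; linarith)
  have hb := E.b α r hr hr'
  have hd : DifferentiableOn ℂ f (ball y (r * m / 2)) := S.fd.mono (hsub.trans hb)
  have h := deriv_im (h := fun x => f x * za α) (x := y) (r := r * m / 2) (S := H3 A m q0 * (√(2 * A) * √r)) (c := (f (z α) * za α).im) (by positivity)
    (by positivity) (hd.mul_const _) (fun x hx => (h3 x (hb (hsub hx)) α).trans (mul_le_mul_of_nonneg_left (by
      rw [← Real.sqrt_mul (by linarith)]; exact Real.sqrt_le_sqrt (S.XXball E hr α (hsub hx))) hH))
  have hda : DifferentiableAt ℂ f y := hd.differentiableAt (ball_mem_nhds _ (by positivity))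
  rw [deriv_mul_const hda, norm_mul] at h
  have h1 : ‖deriv f y‖ * m ≤ 16 * (H3 A m q0 * (√(2 * A) * √r)) / (r * m / 2) :=
    (mul_le_mul_of_nonneg_left (S.low α) (norm_nonneg _)).trans h
  rw [← le_div_iff₀ hm] at h1
  refine h1.trans (le_of_eq ?_)
  unfold D3; field_simp; ring

lemma L4 {ε : ℝ} (E : GE A m z za Ω Ω' ε) (h3 : ∀ x ∈ Ω, ∀ α, |(f x * za α).im - (f (z α) * za α).im| ≤ H3 A m q0 * √‖x - z α‖)
    {r : ℝ} (hr : 0 < r) (hr' : r ≤ r1 A m) (α : ℝ) : ‖f (XX z za ε r α) - f (z α)‖ ≤ 2 * A * D3 A m q0 * √r := by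
  have hA := S.hA; have hm := S.hm; have hD := S.D3p
  refine le_of_tendsto (tendsto_const_nhds.sub ((S.frc α).comp (S.XXtend E α))).norm ?_
  filter_upwards [Ioc_mem_nhdsGT hr] with s hs
  have hd : ∀ v ∈ Icc (√s) (√r), HasDerivWithinAt (fun v : ℝ => f (XX z za ε (v ^ 2) α))
      (deriv f (XX z za ε (v ^ 2) α) * ((2 * v : ℝ) * (ε * (I * za α)))) (Icc (√s) (√r)) v ∧
      ‖deriv f (XX z za ε (v ^ 2) α) * ((2 * v : ℝ) * (ε * (I * za α)))‖ ≤ 2 * A * D3 A m q0 := by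
    intro v hv
    have hv0 : 0 < v := (Real.sqrt_pos.2 hs.1).trans_le hv.1
    have hv1 : v ^ 2 ≤ r1 A m := (Real.le_sqrt hv0.le hr.le).1 hv.2 |>.trans hr'
    have hin := S.XXin E (pow_pos hv0 2) hv1 α
    have h1 : HasDerivAt (fun v : ℝ => XX z za ε (v ^ 2) α) ((2 * v : ℝ) * (ε * (I * za α))) v := by
      unfold XX
      have := (((hasDerivAt_pow 2 v).ofReal_comp.mul_const ((ε:ℂ) * (I * za α))).const_add (z α))
      simpa using this
    refine ⟨(((S.fd.differentiableAt (S.o1.mem_nhds hin)).hasDerivAt).comp v h1).hasDerivWithinAt, ?_⟩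
    have h2 := S.L3d E h3 (pow_pos hv0 2) hv1 α (mem_ball_self (by positivity))
    rw [Real.sqrt_sq hv0.le] at h2
    simp only [norm_mul, Complex.norm_real, Real.norm_eq_abs, E.e, norm_I, one_mul, abs_of_pos hv0, Nat.abs_ofNat]
    calc _ ≤ D3 A m q0 * (v / v ^ 2) * (2 * v * A) := by gcongr; exact S.ba α
      _ = _ := by field_simp
  have := lip1 (convex_Icc _ _) (fun v hv => (hd v hv).1) (fun v hv => (hd v hv).2) (√s) (left_mem_Icc.2 (Real.sqrt_le_sqrt hs.2)) (√r) (right_mem_Icc.2 (Real.sqrt_le_sqrt hs.2))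
  rw [Real.sq_sqrt hr.le, Real.sq_sqrt hs.1.le] at this
  refine this.trans ?_
  gcongr
  rw [abs_of_nonneg (by linarith [Real.sqrt_le_sqrt hs.2])]; linarith [Real.sqrt_nonneg s]

lemma L5 {ε : ℝ} (E : GE A m z za Ω Ω' ε) (hb : ∀ x ∈ closure Ω, ‖f x‖ ≤ M1 A m q0) (h3 : ∀ x ∈ Ω, ∀ α, |(f x * za α).im - (f (z α) * za α).im| ≤ H3 A m q0 * √‖x - z α‖)
    (α β : ℝ) : ‖f (z β) - f (z α)‖ ≤ H4 A m q0 * √|β - α| := by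
  have hA := S.hA; have hm := S.hm; have hD := S.D3p; have hM := S.M1p; have hr1 := S.r1p
  rcases eq_or_ne β α with rfl | hne
  · simp
  have hδ : 0 < |β - α| := abs_pos.2 (sub_ne_zero.2 hne)
  set δ := |β - α|
  rcases le_or_gt (8 * A / m * δ) (r1 A m) with h | h
  · set R := 8 * A / m * δ with hR
    have hRp : 0 < R := by positivity
    have hRm : R * m = 8 * A * δ := by rw [hR]; field_simp
    have hcl : ‖XX z za ε R β - XX z za ε R α‖ ≤ 2 * A * δ := by
      refine (lip1 (C := 2 * A) convex_univ (fun x _ => (S.XXd ε R x).hasDerivWithinAt) (fun x _ => ?_) α trivial β trivial)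
      refine (norm_add_le _ _).trans ?_
      simp only [norm_mul, Complex.norm_real, Real.norm_eq_abs, E.e, norm_I, one_mul, abs_of_pos hRp]
      have h7 : R * ‖zaa x‖ ≤ 1 * A := mul_le_mul (h.trans S.r1le) (S.baa x) (norm_nonneg _) zero_le_one
      linarith [S.ba x]
    have hmem : XX z za ε R β ∈ ball (XX z za ε R α) (R * m / 2) := by
      rw [mem_ball, dist_eq_norm, hRm]; nlinarith
    have h1 : ‖f (XX z za ε R β) - f (XX z za ε R α)‖ ≤ D3 A m q0 * (√R / R) * ‖XX z za ε R β - XX z za ε R α‖ :=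
      (convex_ball _ _).norm_image_sub_le_of_norm_deriv_le (fun x hx => S.fd.differentiableAt (S.o1.mem_nhds
        (E.b α R hRp h (ball_subset_ball (by have := mul_pos hRp hm; linarith) hx)))) (fun x hx => S.L3d E h3 hRp h α hx) (mem_ball_self (by positivity)) hmem
    have h2 : D3 A m q0 * (√R / R) * ‖XX z za ε R β - XX z za ε R α‖ ≤ D3 A m q0 * √R := by
      calc _ ≤ D3 A m q0 * (√R / R) * R := by
            gcongr; have := S.hm1; nlinarith
        _ = _ := by field_simp
    have h4 := S.L4 E h3 hRp h α
    have h5 := S.L4 E h3 hRp h β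
    have e : f (z β) - f (z α) = -(f (XX z za ε R β) - f (z β)) + (f (XX z za ε R β) - f (XX z za ε R α)) + (f (XX z za ε R α) - f (z α)) := by ring
    have h6 : ‖f (z β) - f (z α)‖ ≤ (4 * A + 1) * D3 A m q0 * √R := by
      rw [e]; refine (norm_add₃_le).trans ?_
      rw [norm_neg]; linarith
    refine h6.trans ?_
    rw [hR, Real.sqrt_mul (by positivity), H4, add_mul]
    have : 0 ≤ 2 * M1 A m q0 / √(r1 A m * m / (8 * A)) * √δ := by positivity
    linarith
  · have h1 : ‖f (z β) - f (z α)‖ ≤ 2 * M1 A m q0 := (norm_sub_le _ _).trans (by linarith [hb _ (S.zcl α), hb _ (S.zcl β)])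
    have hp : 0 < √(r1 A m * m / (8 * A)) := Real.sqrt_pos.2 (by positivity)
    have h2 : √(r1 A m * m / (8 * A)) ≤ √δ := Real.sqrt_le_sqrt (by
      rw [div_le_iff₀ (by positivity)]
      rw [div_mul_eq_mul_div, lt_div_iff₀ hm] at h; linarith)
    have h4 : 2 * M1 A m q0 ≤ 2 * M1 A m q0 / √(r1 A m * m / (8 * A)) * √δ := by
      rw [div_mul_eq_mul_div, le_div_iff₀ hp]; gcongr
    rw [H4, add_mul]
    have : 0 ≤ (4 * A + 1) * D3 A m q0 * √(8 * A / m) * √δ := by positivity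
    linarith

end SF
end NS

namespace NS
open Complex Topology Metric ComplexConjugate

lemma stat (A m q0 : ℝ) : ∃ C, 0 < C ∧ ∀ (a : ℝ) (z za zaa : ℝ → ℂ) (Ω Ω' : Set ℂ) (f : ℂ → ℂ),
    SF A m a q0 z za zaa Ω Ω' f → ∀ ε, GE A m z za Ω Ω' ε → ∃ W Wb, ST C A m z za Ω f W Wb := by
  refine ⟨max 1 (M1 A m q0 + M1 A m q0 * (3 * A / m) + H4 A m q0 + ((2 * A * D3 A m q0 + H4 A m q0) * √(2 / m) + 2 * M1 A m q0 / √(m * r1 A m))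
    + (2 * A ^ 2 * D3 A m q0 + 2 * A * H4 A m q0) * (2 / m * √(2 / m))), lt_max_of_lt_left one_pos, ?_⟩
  intro a z za zaa Ω Ω' f S ε E
  have hA := S.hA; have hm := S.hm; have hD := S.D3p; have hM := S.M1p; have hr1 := S.r1p; have hH4 := S.H4p
  obtain ⟨W, hW, hWp, B, hB⟩ := S.exW
  obtain ⟨Wb, hWb, hWbp, hlim⟩ := S.exWb hW hWp E
  obtain ⟨M0, hM00, hM0⟩ := S.bdd
  have hT : ∀ α, Tendsto W (𝓝[Ω] (z α)) (𝓝 (Wb α)) := by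
    intro α
    rw [tendsto_iff_norm_sub_tendsto_zero]
    have h0 : Tendsto (fun y => M0 * (3 * A / m) * ‖y - z α‖) (𝓝[Ω] (z α)) (𝓝 0) := by
      have : Continuous fun y => M0 * (3 * A / m) * ‖y - z α‖ := by fun_prop
      have := (this.tendsto (z α)).mono_left (nhdsWithin_le_nhds (s := Ω))
      simpa using this
    refine squeeze_zero' (Eventually.of_forall fun _ => norm_nonneg _) ?_ h0
    filter_upwards [self_mem_nhdsWithin, nhdsWithin_le_nhds (ball_mem_nhds (z α) (mul_pos hm hr1))] with y hy hy2
    exact hlim M0 hM0 y hy α (by rwa [mem_ball, dist_eq_norm] at hy2)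
  have h2 := S.L2 hW ⟨B, hB⟩ hWb hWbp hT E
  have hb := S.fbd hW E h2
  have h3 := S.L3 E hb
  have h5 := S.L5 E hb h3
  set C := max 1 (M1 A m q0 + M1 A m q0 * (3 * A / m) + H4 A m q0 + ((2 * A * D3 A m q0 + H4 A m q0) * √(2 / m) + 2 * M1 A m q0 / √(m * r1 A m))
    + (2 * A ^ 2 * D3 A m q0 + 2 * A * H4 A m q0) * (2 / m * √(2 / m)))
  have p1 : 0 ≤ M1 A m q0 * (3 * A / m) := by positivity
  have p2 : 0 ≤ (2 * A * D3 A m q0 + H4 A m q0) * √(2 / m) := by positivity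
  have p3 : 0 ≤ 2 * M1 A m q0 / √(m * r1 A m) := by positivity
  have p4 : 0 ≤ (2 * A ^ 2 * D3 A m q0 + 2 * A * H4 A m q0) * (2 / m * √(2 / m)) := by positivity
  have hC : M1 A m q0 + M1 A m q0 * (3 * A / m) + H4 A m q0 + ((2 * A * D3 A m q0 + H4 A m q0) * √(2 / m) + 2 * M1 A m q0 / √(m * r1 A m))
    + (2 * A ^ 2 * D3 A m q0 + 2 * A * H4 A m q0) * (2 / m * √(2 / m)) ≤ C := le_max_right _ _
  refine ⟨fun x => W x - Wb 0, fun α => Wb α - Wb 0, fun x hx => (hW x hx).sub_const _, ⟨B + ‖Wb 0‖, fun x hx => (norm_sub_le _ _).trans (by linarith [hB x hx])⟩,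
    fun α => (hWb α).sub_const _, fun α => by rw [hWbp], sub_self _, fun x hx => (hb x hx).trans (by linarith), fun x hx α hd => ?_, fun x hx α => ?_,
    fun α β => (h5 α β).trans (mul_le_mul_of_nonneg_right (by linarith) (Real.sqrt_nonneg _)), fun x hx α hd => ?_⟩
  · rw [sub_sub_sub_cancel_right]
    exact (hlim _ hb x hx α hd).trans (mul_le_mul_of_nonneg_right (by linarith) (norm_nonneg _))
  · rcases lt_or_ge ‖x - z α‖ (m * r1 A m) with hd | hd
    · obtain ⟨β, r, hr, hr1, hr2, rfl, hβ⟩ := E.nr x hx α hd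
      set d := ‖XX z za ε r β - z α‖
      have hs : ∀ s, 0 ≤ s → s * m ≤ 2 * d → √s ≤ √(2 / m) * √d := fun s _ hs => by
        rw [← Real.sqrt_mul (by positivity)]; refine Real.sqrt_le_sqrt ?_
        rw [div_mul_eq_mul_div, le_div_iff₀ hm]; exact hs
      have hs1 := hs r hr.le (by linarith [norm_nonneg (XX z za ε r β - z α)])
      have hs2 := hs |β - α| (abs_nonneg _) (by linarith)
      calc _ ≤ ‖f (XX z za ε r β) - f (z β)‖ + ‖f (z β) - f (z α)‖ := norm_sub_le_norm_sub_add_norm_sub _ _ _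
        _ ≤ 2 * A * D3 A m q0 * (√(2 / m) * √d) + H4 A m q0 * (√(2 / m) * √d) :=
          add_le_add ((S.L4 E h3 hr hr1 β).trans (by gcongr)) ((h5 α β).trans (by gcongr))
        _ = (2 * A * D3 A m q0 + H4 A m q0) * √(2 / m) * √d := by ring
        _ ≤ _ := mul_le_mul_of_nonneg_right (by linarith) (Real.sqrt_nonneg _)
    · have hp : 0 < √(m * r1 A m) := Real.sqrt_pos.2 (by positivity)
      calc _ ≤ 2 * M1 A m q0 := (norm_sub_le _ _).trans (by linarith [hb _ (S.zcl α), hb _ (subset_closure hx)])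
        _ = 2 * M1 A m q0 / √(m * r1 A m) * √(m * r1 A m) := by field_simp
        _ ≤ 2 * M1 A m q0 / √(m * r1 A m) * √‖x - z α‖ := by gcongr
        _ ≤ _ := mul_le_mul_of_nonneg_right (by linarith) (Real.sqrt_nonneg _)
  · obtain ⟨β, r, hr, hr1, hr2, rfl, hβ⟩ := E.nr x hx α hd
    set d := ‖XX z za ε r β - z α‖ with hdd
    set δ := 2 / m * d with hδ
    have hd0 : 0 ≤ d := norm_nonneg _
    have hs : ∀ s, s * m ≤ 2 * d → s ≤ δ := fun s hs => by
      rw [hδ, div_mul_eq_mul_div, le_div_iff₀ hm]; exact hs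
    have hrδ := hs r (by linarith)
    have hβδ := hs |β - α| (by linarith)
    have hXβ : ‖XX z za ε r β - z β‖ ≤ A * r := by have := S.XXn E (r := r) β; rwa [abs_of_pos hr] at this
    have t1 : ‖W (XX z za ε r β) - Wb β - f (z β) * (XX z za ε r β - z β)‖ ≤ 2 * A ^ 2 * D3 A m q0 * (δ * √δ) := by
      have hl1 : Tendsto (fun s => ‖(W (XX z za ε r β) - f (z β) * (XX z za ε r β - z β)) - (W (XX z za ε s β) - f (z β) * (XX z za ε s β - z β))‖)
          (𝓝[>] 0) (𝓝 ‖(W (XX z za ε r β) - f (z β) * (XX z za ε r β - z β)) - (Wb β - f (z β) * (z β - z β))‖) := by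
        have hx := S.XXtend E β
        exact (tendsto_const_nhds.sub (((hT β).comp hx).sub (((hx.mono_right nhdsWithin_le_nhds).sub_const _).const_mul _))).norm
      rw [show W (XX z za ε r β) - Wb β - f (z β) * (XX z za ε r β - z β) = (W (XX z za ε r β) - f (z β) * (XX z za ε r β - z β)) - (Wb β - f (z β) * (z β - z β)) by ring]
      refine le_of_tendsto hl1 ?_
      filter_upwards [Ioc_mem_nhdsGT hr] with s hs'
      have hd : ∀ v ∈ Icc s r, HasDerivWithinAt (fun v : ℝ => W (XX z za ε v β) - f (z β) * (XX z za ε v β - z β))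
          ((f (XX z za ε v β) - f (z β)) * (ε * (I * za β))) (Icc s r) v ∧ ‖(f (XX z za ε v β) - f (z β)) * (ε * (I * za β))‖ ≤ 2 * A ^ 2 * D3 A m q0 * √δ := by
        intro v hv
        have hv0 : 0 < v := hs'.1.trans_le hv.1
        have h1 : HasDerivAt (fun v : ℝ => XX z za ε v β) (ε * (I * za β)) v := by
          unfold XX
          simpa using ((hasDerivAt_id v).ofReal_comp.mul_const ((ε:ℂ) * (I * za β))).const_add (z β)
        refine ⟨?_, ?_⟩
        · rw [sub_mul]
          exact (((hW _ (S.XXin E hv0 (hv.2.trans hr1) β)).comp v h1).sub ((h1.sub_const _).const_mul _)).hasDerivWithinAt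
        · simp only [norm_mul, Complex.norm_real, Real.norm_eq_abs, E.e, norm_I, one_mul]
          calc _ ≤ 2 * A * D3 A m q0 * √v * A := mul_le_mul (S.L4 E h3 hv0 (hv.2.trans hr1) β) (S.ba β) (norm_nonneg _) (by positivity)
            _ ≤ 2 * A * D3 A m q0 * √δ * A := by gcongr; linarith [hv.2]
            _ = _ := by ring
      refine (lip1 (convex_Icc _ _) (fun v hv => (hd v hv).1) (fun v hv => (hd v hv).2) s (left_mem_Icc.2 hs'.2) r (right_mem_Icc.2 hs'.2)).trans ?_
      rw [mul_comm δ, ← mul_assoc]; gcongr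
      rw [abs_of_nonneg (by linarith [hs'.2])]; linarith [hs'.1]
    have t2 : ‖Wb β - Wb α - f (z α) * (z β - z α)‖ ≤ A * H4 A m q0 * (δ * √δ) := by
      have hd : ∀ v ∈ uIcc α β, HasDerivWithinAt (fun v : ℝ => Wb v - f (z α) * (z v - z α)) ((f (z v) - f (z α)) * za v) (uIcc α β) v := fun v _ => by
        rw [sub_mul]; exact ((hWb v).sub (((S.hz v).sub_const _).const_mul _)).hasDerivWithinAt
      have := lip1 (C := A * H4 A m q0 * √δ) (convex_uIcc _ _) hd (fun v hv => by
        rw [norm_mul]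
        calc _ ≤ H4 A m q0 * √|v - α| * A := mul_le_mul (h5 α v) (S.ba v) (norm_nonneg _) (by positivity)
          _ ≤ H4 A m q0 * √δ * A := by gcongr; exact (abs_sub_left_of_mem_uIcc hv).trans hβδ
          _ = _ := by ring) α left_mem_uIcc β right_mem_uIcc
      rw [sub_self, mul_zero, sub_zero] at this
      rw [show Wb β - Wb α - f (z α) * (z β - z α) = Wb β - f (z α) * (z β - z α) - Wb α by ring]
      refine this.trans ?_
      rw [mul_comm δ, ← mul_assoc]; gcongr
    have t3 : ‖(f (z β) - f (z α)) * (XX z za ε r β - z β)‖ ≤ A * H4 A m q0 * (δ * √δ) := by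
      rw [norm_mul]
      calc _ ≤ H4 A m q0 * √|β - α| * (A * r) := mul_le_mul (h5 α β) hXβ (norm_nonneg _) (by positivity)
        _ ≤ H4 A m q0 * √δ * (A * δ) := by gcongr
        _ = _ := by ring
    have e : W (XX z za ε r β) - Wb 0 - (Wb α - Wb 0) - f (z α) * (XX z za ε r β - z α) = (W (XX z za ε r β) - Wb β - f (z β) * (XX z za ε r β - z β))
      + (Wb β - Wb α - f (z α) * (z β - z α)) + (f (z β) - f (z α)) * (XX z za ε r β - z β) := by ring
    rw [e]
    refine norm_add₃_le.trans ?_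
    have e2 : δ * √δ = 2 / m * √(2 / m) * (d * √d) := by rw [hδ, Real.sqrt_mul (by positivity)]; ring
    calc _ ≤ (2 * A ^ 2 * D3 A m q0 + 2 * A * H4 A m q0) * (δ * √δ) := by linarith
      _ = (2 * A ^ 2 * D3 A m q0 + 2 * A * H4 A m q0) * (2 / m * √(2 / m)) * (d * √d) := by rw [e2]; ring
      _ ≤ _ := mul_le_mul_of_nonneg_right (by linarith) (by positivity)

end NS

namespace NS
open Complex Topology Metric ComplexConjugate

structure OF (A m a q0 T : ℝ) (z za zaa zt zat : ℝ → ℝ → ℂ) (qt : ℝ → ℝ → ℝ) (Ω Ω' : ℝ → Set ℂ) (f : ℝ → ℂ → ℂ)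
    (B : ℝ → ℂ → ℝ) : Prop where
  T0 : 0 < T
  sf : ∀ t ∈ Icc 0 T, SF A m a q0 (z t) (za t) (zaa t) (Ω t) (Ω' t) (f t)
  hzt : ∀ α, ∀ t ∈ Icc 0 T, HasDerivWithinAt (fun s => z s α) (zt t α) (Icc 0 T) t
  bt : ∀ t ∈ Icc 0 T, ∀ α, ‖zt t α‖ ≤ A
  ztt : ∀ s ∈ Icc 0 T, ∀ t ∈ Icc 0 T, ∀ α, ‖zt s α - zt t α‖ ≤ A * |s - t|
  zta : ∀ t ∈ Icc 0 T, ∀ α β, ‖zt t β - zt t α‖ ≤ A * |β - α|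
  hzat : ∀ α, ∀ t ∈ Icc 0 T, HasDerivWithinAt (fun s => za s α) (zat t α) (Icc 0 T) t
  bat : ∀ t ∈ Icc 0 T, ∀ α, ‖zat t α‖ ≤ A
  qtc : ∀ t ∈ Icc 0 T, Continuous (qt t)
  qtb : ∀ t ∈ Icc 0 T, ∀ α, |qt t α| ≤ q0
  qtt : ∀ s ∈ Icc 0 T, ∀ t ∈ Icc 0 T, ∀ α,
    |(f s (z s α) * za s α).im - (f t (z t α) * za t α).im - (s - t) * qt t α| ≤ q0 * (s - t) ^ 2
  Bc : ∀ t ∈ Ioo 0 T, ContinuousOn (B t) (closure (Ω t))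
  Bd : ∀ t ∈ Ioo 0 T, ∀ x ∈ Ω t, ∀ k, HasDerivAt (fun s => f s x) k t → HasFDerivAt (B t) (-(reCLM ∘L (ContinuousLinearMap.mul ℝ ℂ k))) x

structure OD (C A m a q0 T : ℝ) (z za zaa zt zat : ℝ → ℝ → ℂ) (qt : ℝ → ℝ → ℝ) (Ω Ω' : ℝ → Set ℂ) (f : ℝ → ℂ → ℂ)
    (B : ℝ → ℂ → ℝ) (ε : ℝ → ℝ) (W : ℝ → ℂ → ℂ) (Wb : ℝ → ℝ → ℂ) : Prop extends OF A m a q0 T z za zaa zt zat qt Ω Ω' f B where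
  C0 : 0 < C
  ge : ∀ t ∈ Icc 0 T, GE A m (z t) (za t) (Ω t) (Ω' t) (ε t)
  st : ∀ t ∈ Icc 0 T, ST C A m (z t) (za t) (Ω t) (f t) (W t) (Wb t)

lemma pathK {O : Set ℂ} (ho : IsOpen O) (hc : IsConnected O) {x y : ℂ} (hx : x ∈ O) (hy : y ∈ O) :
    ∃ K, IsCompact K ∧ IsPreconnected K ∧ K ⊆ O ∧ x ∈ K ∧ y ∈ K := by
  obtain ⟨γ, hγ⟩ := ((ho.isConnected_iff_isPathConnected).1 hc).joinedIn x hx y hy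
  refine ⟨range γ, isCompact_range γ.continuous, isPreconnected_range γ.continuous, range_subset_iff.2 hγ, ⟨0, γ.source⟩, ⟨1, γ.target⟩⟩

lemma exOD {A m a q0 T : ℝ} {z za zaa zt zat : ℝ → ℝ → ℂ} {qt : ℝ → ℝ → ℝ} {Ω Ω' : ℝ → Set ℂ} {f : ℝ → ℂ → ℂ}
    {B : ℝ → ℂ → ℝ} (O : OF A m a q0 T z za zaa zt zat qt Ω Ω' f B) : ∃ C ε W Wb, OD C A m a q0 T z za zaa zt zat qt Ω Ω' f B ε W Wb := by
  obtain ⟨C, hC, h⟩ := stat A m q0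
  have h1 : ∀ t, ∃ ε : ℝ, ∃ W Wb, t ∈ Icc 0 T → GE A m (z t) (za t) (Ω t) (Ω' t) ε ∧ ST C A m (z t) (za t) (Ω t) (f t) W Wb := by
    intro t
    by_cases ht : t ∈ Icc 0 T
    · obtain ⟨ε, hε⟩ := (O.sf t ht).exGE
      obtain ⟨W, Wb, hw⟩ := h _ _ _ _ _ _ _ (O.sf t ht) ε hε
      exact ⟨ε, W, Wb, fun _ => ⟨hε, hw⟩⟩
    · exact ⟨0, 0, 0, fun h => absurd h ht⟩
  choose ε W Wb h2 using h1
  exact ⟨C, ε, W, Wb, ⟨O, hC, fun t ht => (h2 t ht).1, fun t ht => (h2 t ht).2⟩⟩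

namespace OD
variable {C A m a q0 T : ℝ} {z za zaa zt zat : ℝ → ℝ → ℂ} {qt : ℝ → ℝ → ℝ} {Ω Ω' : ℝ → Set ℂ} {f : ℝ → ℂ → ℂ}
    {B : ℝ → ℂ → ℝ} {ε : ℝ → ℝ} {W : ℝ → ℂ → ℂ} {Wb : ℝ → ℝ → ℂ} (O : OD C A m a q0 T z za zaa zt zat qt Ω Ω' f B ε W Wb)
include O

lemma A1 : 1 ≤ A := (O.sf 0 ⟨le_rfl, O.T0.le⟩).hA
lemma m0 : 0 < m := (O.sf 0 ⟨le_rfl, O.T0.le⟩).hm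
lemma q00 : 0 ≤ q0 := (O.sf 0 ⟨le_rfl, O.T0.le⟩).q0p
lemma rr : 0 < r1 A m := (O.sf 0 ⟨le_rfl, O.T0.le⟩).r1p

lemma zL {s t : ℝ} (hs : s ∈ Icc 0 T) (ht : t ∈ Icc 0 T) (α : ℝ) : ‖z s α - z t α‖ ≤ A * |s - t| :=
  lip1 (convex_Icc 0 T) (fun t ht => O.hzt α t ht) (fun t ht => O.bt t ht α) t ht s hs

lemma zT {s t : ℝ} (hs : s ∈ Icc 0 T) (ht : t ∈ Icc 0 T) (α : ℝ) : ‖z s α - z t α - (s - t) * zt t α‖ ≤ A * |s - t| ^ 2 := by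
  have := tay1 (by linarith [O.A1]) (convex_Icc 0 T) (fun t ht => O.hzt α t ht) (fun t ht s hs => O.ztt s hs t ht α) t ht s hs
  simpa using this

lemma stayK {t : ℝ} (ht : t ∈ Icc 0 T) {K : Set ℂ} (hK : IsCompact K) (hd : ∀ x ∈ K, x ∉ range (z t)) :
    ∃ δ > 0, ∀ s ∈ Icc 0 T, |s - t| < δ → ∀ x ∈ K, x ∉ range (z s) := by
  have hA := O.A1
  obtain ⟨δ, hδ, h⟩ := (Set.disjoint_left.2 hd).exists_thickenings hK (O.sf t ht).cl
  refine ⟨δ / A, by positivity, fun s hs hst x hx => ?_⟩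
  rintro ⟨α, rfl⟩
  refine disjoint_left.1 h (self_subset_thickening hδ _ hx) ?_
  rw [mem_thickening_iff]
  refine ⟨z t α, mem_range_self _, ?_⟩
  rw [dist_eq_norm]
  refine (O.zL hs ht α).trans_lt ?_
  rw [lt_div_iff₀ (by positivity)] at hst; linarith

lemma openΩ {t : ℝ} (ht : t ∈ Icc 0 T) {x : ℂ} (hx : x ∈ Ω t) : ∃ δ > 0, ∀ s ∈ Icc 0 T, |s - t| < δ → x ∈ Ω s := by
  have ha : (a * I : ℂ) ∈ Ω t := (O.sf t ht).s1 _ (by simp)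
  obtain ⟨K, h1, h2, h3, h4, h5⟩ := pathK (O.sf t ht).o1 (O.sf t ht).c1 hx ha
  obtain ⟨δ, hδ, h⟩ := O.stayK ht h1 (fun x hx => (O.sf t ht).nf (h3 hx))
  exact ⟨δ, hδ, fun s hs hst => (O.sf s hs).miss h2 (h s hs hst) h5 ((O.sf s hs).s1 _ (by simp)) h4⟩

lemma openΩ' {t : ℝ} (ht : t ∈ Icc 0 T) {x : ℂ} (hx : x ∈ Ω' t) : ∃ δ > 0, ∀ s ∈ Icc 0 T, |s - t| < δ → x ∈ Ω' s := by
  have ha : (-a * I : ℂ) ∈ Ω' t := (O.sf t ht).s2 _ (by simp)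
  obtain ⟨K, h1, h2, h3, h4, h5⟩ := pathK (O.sf t ht).o2 (O.sf t ht).c2 hx ha
  obtain ⟨δ, hδ, h⟩ := O.stayK ht h1 (fun x hx => (O.sf t ht).nf' (h3 hx))
  exact ⟨δ, hδ, fun s hs hst => (O.sf s hs).miss' h2 (h s hs hst) h5 ((O.sf s hs).s2 _ (by simp)) h4⟩

lemma stay {s t : ℝ} (hs : s ∈ Icc 0 T) (ht : t ∈ Icc 0 T) {x : ℂ} (hx : x ∈ Ω t) (hd : ∀ α, A * |s - t| < ‖x - z t α‖) : x ∈ Ω s := by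
  have hA := O.A1
  have hsub : uIcc t s ⊆ Icc 0 T := (convex_Icc 0 T).ordConnected.uIcc_subset ht hs
  have hnot : ∀ τ ∈ uIcc t s, x ∉ range (z τ) := by
    rintro τ hτ ⟨α, rfl⟩
    have h1 := O.zL (hsub hτ) ht α
    have h2 : |τ - t| ≤ |s - t| := abs_sub_left_of_mem_uIcc hτ
    have := hd α
    nlinarith
  have key := isPreconnected_uIcc (a := t) (b := s)
  rw [isPreconnected_iff_preconnectedSpace] at key
  let U : Set (uIcc t s) := {τ | x ∈ Ω τ}
  have hcl : IsClopen U := by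
    constructor
    · rw [← isOpen_compl_iff, Metric.isOpen_iff]
      intro τ hτ
      have hτ' : x ∈ Ω' τ := by
        rcases (O.sf τ (hsub τ.2)).swap' x with h | h | h
        · exact absurd h hτ
        · exact h
        · exact absurd h (hnot τ τ.2)
      obtain ⟨δ, hδ, h⟩ := O.openΩ' (hsub τ.2) hτ'
      refine ⟨δ, hδ, fun τ' hτ2 h3 => ?_⟩
      exact disjoint_left.1 (O.sf τ' (hsub τ'.2)).dj h3 (h τ' (hsub τ'.2) hτ2)
    · rw [Metric.isOpen_iff]
      intro τ hτ
      obtain ⟨δ, hδ, h⟩ := O.openΩ (hsub τ.2) hτ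
      exact ⟨δ, hδ, fun τ' hτ2 => h τ' (hsub τ'.2) hτ2⟩
  have := hcl.eq_univ ⟨⟨t, left_mem_uIcc⟩, hx⟩
  have h2 : (⟨s, right_mem_uIcc⟩ : uIcc t s) ∈ U := by rw [this]; trivial
  exact h2

end OD
end NS

namespace NS
open Complex Topology Metric ComplexConjugate

def Qt (qt : ℝ → ℝ → ℝ) (t α : ℝ) : ℝ := ∫ x in (0:ℝ)..α, qt t x
def ee (z zt : ℝ → ℝ → ℂ) (qt : ℝ → ℝ → ℝ) (f : ℝ → ℂ → ℂ) (t β : ℝ) : ℝ := Qt qt t β - (f t (z t β) * zt t β).im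

lemma hre {g : ℝ → ℂ} {g' : ℂ} {x : ℝ} (h : HasDerivAt g g' x) : HasDerivAt (fun x => (g x).re) g'.re x :=
  reCLM.hasFDerivAt.comp_hasDerivAt x h
lemma him {g : ℝ → ℂ} {g' : ℂ} {x : ℝ} (h : HasDerivAt g g' x) : HasDerivAt (fun x => (g x).im) g'.im x :=
  imCLM.hasFDerivAt.comp_hasDerivAt x h

namespace OD
variable {C A m a q0 T : ℝ} {z za zaa zt zat : ℝ → ℝ → ℂ} {qt : ℝ → ℝ → ℝ} {Ω Ω' : ℝ → Set ℂ} {f : ℝ → ℂ → ℂ}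
    {B : ℝ → ℂ → ℝ} {ε : ℝ → ℝ} {W : ℝ → ℂ → ℂ} {Wb : ℝ → ℝ → ℂ} (O : OD C A m a q0 T z za zaa zt zat qt Ω Ω' f B ε W Wb)
include O

lemma Qtd {t : ℝ} (ht : t ∈ Icc 0 T) (α : ℝ) : HasDerivAt (Qt qt t) (qt t α) α :=
  (Continuous.integral_hasStrictDerivAt (O.qtc t ht) 0 α).hasDerivAt

lemma Q1 {s t : ℝ} (hs : s ∈ Icc 0 T) (ht : t ∈ Icc 0 T) (α : ℝ) :
    |(Wb s α).im - (Wb t α).im - (s - t) * Qt qt t α| ≤ q0 * (s - t) ^ 2 * |α| := by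
  have := lip1 (g := fun α => (Wb s α).im - (Wb t α).im - (s - t) * Qt qt t α) convex_univ
    (fun x _ => (((him ((O.st s hs).Wb' x)).sub (him ((O.st t ht).Wb' x))).sub ((O.Qtd ht x).const_mul (s - t))).hasDerivWithinAt)
    (fun x _ => O.qtt s hs t ht x) 0 (mem_univ _) α (mem_univ _)
  simpa [(O.st s hs).Wb0, (O.st t ht).Wb0, Qt] using this

lemma Qtp {t : ℝ} (ht : t ∈ Icc 0 T) (α : ℝ) : Qt qt t (α + 2 * Real.pi) = Qt qt t α := by
  have hT := O.T0
  have hq := O.q00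
  obtain ⟨τ, hτ, hτ'⟩ : ∃ τ ∈ Icc 0 T, τ ≠ t := by
    rcases eq_or_ne t 0 with h | h
    · exact ⟨T, ⟨hT.le, le_rfl⟩, by rw [h]; exact hT.ne'⟩
    · exact ⟨0, ⟨le_rfl, hT.le⟩, h.symm⟩
  by_contra hne
  set D := Qt qt t (α + 2 * Real.pi) - Qt qt t α
  have hD : 0 < |D| := abs_pos.2 (sub_ne_zero.2 hne)
  set R := |α + 2 * Real.pi| + |α|
  have hpos : 0 < |τ - t| := abs_pos.2 (sub_ne_zero.2 hτ')
  set Y := q0 * |τ - t| * R + |D|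
  have hY : 0 < Y := by positivity
  have hY1 : |D| / (2 * Y) ≤ 1 := by rw [div_le_one (by positivity)]; simp only [Y]; have : 0 ≤ q0 * |τ - t| * R := by positivity
                                     linarith
  have hs : t + |D| / (2 * Y) * (τ - t) ∈ Icc 0 T := by
    have := (convex_Icc 0 T).add_smul_sub_mem ht hτ (t := |D| / (2 * Y)) ⟨by positivity, hY1⟩
    simpa using this
  have h1 := O.Q1 hs ht (α + 2 * Real.pi)
  have h2 := O.Q1 hs ht α
  rw [(O.st _ hs).Wbp, (O.st t ht).Wbp] at h1
  set θ := |D| / (2 * Y)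
  have hθ : 0 < θ := by positivity
  rw [add_sub_cancel_left] at h1 h2
  have h3 : |θ * (τ - t) * D| ≤ q0 * (θ * (τ - t)) ^ 2 * R := by
    have e : θ * (τ - t) * D = ((Wb (t + θ * (τ - t)) α).im - (Wb t α).im - θ * (τ - t) * Qt qt t α) -
      ((Wb (t + θ * (τ - t)) α).im - (Wb t α).im - θ * (τ - t) * Qt qt t (α + 2 * Real.pi)) := by simp only [D]; ring
    rw [e]; refine (abs_sub _ _).trans ((add_le_add h2 h1).trans (le_of_eq ?_)); simp only [R]; ring
  rw [abs_mul, abs_mul, abs_of_pos hθ] at h3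
  have h4 : (θ * (τ - t)) ^ 2 = θ * |τ - t| * (θ * |τ - t|) := by rw [mul_pow, ← sq_abs (τ - t)]; ring
  rw [h4] at h3
  have h5 : |D| ≤ θ * (q0 * |τ - t| * R) := by
    have : 0 < θ * |τ - t| := by positivity
    refine le_of_mul_le_mul_left ?_ this
    linarith
  have h6 : θ * Y = |D| / 2 := by simp only [θ]; field_simp
  have h7 : Y = q0 * |τ - t| * R + |D| := rfl
  nlinarith

lemma Q2 {s t : ℝ} (hs : s ∈ Icc 0 T) (ht : t ∈ Icc 0 T) (α : ℝ) :
    |(Wb s α).im - (Wb t α).im - (s - t) * Qt qt t α| ≤ 7 * q0 * (s - t) ^ 2 ∧ |Qt qt t α| ≤ 7 * q0 := by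
  have hper : Function.Periodic (fun α => ((Wb s α).im - (Wb t α).im - (s - t) * Qt qt t α, Qt qt t α)) (2 * Real.pi) := fun α => by
    simp only [(O.st _ hs).Wbp, (O.st t ht).Wbp, O.Qtp ht]
  obtain ⟨y, hy, he⟩ := hper.exists_mem_Ico₀ (by positivity) α
  simp only [Prod.mk.injEq] at he
  have hq := O.q00
  have hy7 : |y| ≤ 7 := by rw [abs_of_nonneg hy.1]; linarith [hy.2, Real.pi_lt_d2]
  rw [he.1, he.2]
  constructor
  · refine (O.Q1 hs ht y).trans ?_
    nlinarith [mul_nonneg hq (sq_nonneg (s - t))]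
  · have := lip1 convex_univ (fun x _ => (O.Qtd ht x).hasDerivWithinAt) (fun x _ => O.qtb t ht x) 0 (mem_univ _) y (mem_univ _)
    simp only [Qt, intervalIntegral.integral_same, sub_zero] at this
    refine this.trans ?_
    nlinarith

/-- frontier of a triple intersection -/
lemma FR {s s' t h : ℝ} (hs : s ∈ Icc 0 T) (hs' : s' ∈ Icc 0 T) (ht : t ∈ Icc 0 T) (h0 : 0 < h) (h1 : |s - t| ≤ h) (h2 : |s' - t| ≤ h)
    {x : ℂ} (hx : x ∈ frontier (Ω s ∩ Ω t ∩ Ω s')) : ∃ β, ∀ᶠ y in 𝓝[Ω s ∩ Ω t ∩ Ω s'] x, y ∈ Ω s ∩ Ω t ∩ Ω s' ∧ ‖y - z t β‖ ≤ 2 * A * h := by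
  have hA := O.A1
  have key : ∃ β, ‖x - z t β‖ ≤ A * h := by
    have aux : ∀ τ ∈ Icc 0 T, |τ - t| ≤ h → x ∈ frontier (Ω τ) → ∃ β, ‖x - z t β‖ ≤ A * h := by
      intro τ hτ h3 h4
      rw [(O.sf τ hτ).f1] at h4
      obtain ⟨β, rfl⟩ := h4
      exact ⟨β, (O.zL hτ ht β).trans (by gcongr)⟩
    rcases frontier_inter_subset _ _ hx with h3 | h3
    · rcases frontier_inter_subset _ _ h3.1 with h4 | h4
      · exact aux s hs h1 h4.1
      · exact aux t ht (by simpa using h0.le) h4.2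
    · exact aux s' hs' h2 h3.2
  obtain ⟨β, hβ⟩ := key
  refine ⟨β, ?_⟩
  filter_upwards [self_mem_nhdsWithin, nhdsWithin_le_nhds (ball_mem_nhds x (show 0 < A * h by positivity))] with y hy hy2
  refine ⟨hy, (norm_sub_le_norm_sub_add_norm_sub y x _).trans ?_⟩
  rw [mem_ball, dist_eq_norm] at hy2; linarith

lemma tri {s s' t : ℝ} (hs : s ∈ Icc 0 T) (hs' : s' ∈ Icc 0 T) (ht : t ∈ Icc 0 T) : IsOpen (Ω s ∩ Ω t ∩ Ω s') :=
  ((O.sf s hs).o1.inter (O.sf t ht).o1).inter (O.sf s' hs').o1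

lemma psi5 : ∃ K h0, 0 < K ∧ 0 < h0 ∧ ∀ s ∈ Icc 0 T, ∀ t ∈ Icc 0 T, |s - t| < h0 → ∀ y ∈ Ω s, y ∈ Ω t → |(W s y - W t y).im| ≤ K * |s - t| := by
  have hA := O.A1; have hm := O.m0; have hq := O.q00; have hr := O.rr; have hC := O.C0; have hT := O.T0
  refine ⟨5 * A * C + 7 * q0 * T + 7 * q0, m * r1 A m / (3 * A), by positivity, by positivity, fun s hs t ht hst y hy hy' => ?_⟩
  rcases eq_or_ne s t with rfl | hne
  · simp
  have h0 : 0 < |s - t| := abs_pos.2 (sub_ne_zero.2 hne)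
  rw [lt_div_iff₀ (by positivity)] at hst
  obtain ⟨M, hM⟩ := (O.st s hs).Wbd
  obtain ⟨M', hM'⟩ := (O.st t ht).Wbd
  have := barCore (U := Ω s ∩ Ω t ∩ Ω t) (g := fun y => W s y - W t y) (B := fun _ => 0) (c0 := 0) (M := M + M') (O.tri hs ht ht) (O.sf t ht).rp
    (fun x hx => (O.ge t ht).x x hx.2 0) (fun x hx => (((O.st s hs).hW x hx.1.1).sub ((O.st t ht).hW x hx.2)).differentiableAt.differentiableWithinAt)
    (fun x hx => (abs_im_le_norm _).trans ((norm_sub_le _ _).trans (add_le_add (hM x hx.1.1) (hM' x hx.2)))) (differentiableOn_const _)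
    (by simp) (e0 := (5 * A * C + 7 * q0 * T + 7 * q0) * |s - t|) (fun x hx ε hε => by
      obtain ⟨β, hβ⟩ := O.FR hs ht ht h0 le_rfl (by simp) hx
      refine hβ.mono fun y ⟨hy, hd⟩ => ?_
      have hd' : ‖y - z s β‖ ≤ 3 * A * |s - t| := by
        refine (norm_sub_le_norm_sub_add_norm_sub y (z t β) _).trans ?_
        have := O.zL hs ht β
        rw [norm_sub_rev] at this; linarith
      have e1 := (O.st s hs).lim y hy.1.1 β (by linarith)
      have e2 := (O.st t ht).lim y hy.2 β (by nlinarith)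
      obtain ⟨e3, e4⟩ := O.Q2 hs ht β
      have e5 : |(Wb s β).im - (Wb t β).im| ≤ 7 * q0 * (s - t) ^ 2 + |s - t| * (7 * q0) := by
        have : (Wb s β).im - (Wb t β).im = ((Wb s β).im - (Wb t β).im - (s - t) * Qt qt t β) + (s - t) * Qt qt t β := by ring
        rw [this]; refine (abs_add_le _ _).trans (add_le_add e3 ?_)
        rw [abs_mul]; gcongr
      have e6 : |s - t| ≤ T := abs_sub_le_iff.2 ⟨by linarith [hs.2, ht.1], by linarith [ht.2, hs.1]⟩
      have e7 : (s - t) ^ 2 ≤ T * |s - t| := by rw [← sq_abs, sq]; gcongr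
      have e8 : (W s y - W t y).im = (W s y - Wb s β).im - (W t y - Wb t β).im + ((Wb s β).im - (Wb t β).im) := by simp; ring
      have e9 : |(W s y - Wb s β).im| ≤ C * (3 * A * |s - t|) := (abs_im_le_norm _).trans (e1.trans (by gcongr))
      have e10 : |(W t y - Wb t β).im| ≤ C * (2 * A * |s - t|) := (abs_im_le_norm _).trans (e2.trans (by gcongr))
      have e11 : 7 * q0 * (s - t) ^ 2 ≤ 7 * q0 * (T * |s - t|) := by gcongr
      simp only [sub_zero, e8, zero_re, zero_add]
      refine (abs_add_le _ _).trans ((add_le_add ((abs_sub _ _).trans (add_le_add e9 e10)) e5).trans ?_)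
      linarith) y ⟨⟨hy, hy'⟩, hy'⟩
  simpa using this

lemma XXb {s t r : ℝ} (hs : s ∈ Icc 0 T) (ht : t ∈ Icc 0 T) (hr : 0 < r) (hr1 : r ≤ r1 A m) (hd : 2 * A * |s - t| < r * m) (α : ℝ) :
    ball (XX (z t) (za t) (ε t) r α) (r * m / 2) ⊆ Ω s := by
  intro y hy
  have hm := O.m0
  have hb := (O.ge t ht).b α r hr hr1
  refine O.stay hs ht (hb (ball_subset_ball (by nlinarith) hy)) fun β => ?_
  by_contra hc
  push Not at hc
  have : z t β ∈ ball (XX (z t) (za t) (ε t) r α) (r * m) := by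
    rw [mem_ball, dist_eq_norm] at *
    have := norm_sub_le_norm_sub_add_norm_sub (z t β) y (XX (z t) (za t) (ε t) r α)
    rw [norm_sub_rev (z t β) y] at this
    linarith
  exact (O.sf t ht).nf (hb this) (mem_range_self _)

lemma f5b : ∃ K h0, 0 < K ∧ 0 < h0 ∧ ∀ s ∈ Icc 0 T, ∀ t ∈ Icc 0 T, |s - t| < h0 → ∀ α, ‖f s (z s α) - f t (z t α)‖ ≤ K * √√|s - t| := by
  have hA := O.A1; have hm := O.m0; have hq := O.q00; have hr := O.rr; have hC := O.C0; have hT := O.T0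
  obtain ⟨K, h0, hK, hh0, h5⟩ := O.psi5
  refine ⟨32 * K / m + C * √A + C * √(2 * A), min (min h0 1) (min (r1 A m ^ 2) ((m / (2 * A)) ^ 2)), by positivity, by positivity, fun s hs t ht hst α => ?_⟩
  simp only [lt_min_iff] at hst
  obtain ⟨⟨h1, h2⟩, h3, h4⟩ := hst
  set h := |s - t|
  rcases (abs_nonneg (s - t)).eq_or_lt with he | hh
  · have : s = t := by rw [eq_comm, abs_eq_zero, sub_eq_zero] at he; exact he
    subst this; simp; positivity
  set r := √h with hrdef
  have hrr : 0 < r := Real.sqrt_pos.2 hh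
  have hr1 : r ≤ r1 A m := Real.sqrt_le_iff.2 ⟨hr.le, h3.le⟩
  have hr2 : r < m / (2 * A) := (Real.sqrt_lt' (by positivity)).2 h4
  have hr3 : r ≤ 1 := Real.sqrt_le_iff.2 ⟨by norm_num, by linarith⟩
  have hrh : h = r * r := (Real.mul_self_sqrt hh.le).symm
  have hsub := O.XXb hs ht hrr hr1 (by
    rw [lt_div_iff₀ (by positivity)] at hr2
    change 2 * A * h < _; rw [hrh]; nlinarith) α
  set X := XX (z t) (za t) (ε t) r α with hX
  have hsub' : ball X (r * m / 2) ⊆ Ω t := (ball_subset_ball (by nlinarith)).trans ((O.ge t ht).b α r hrr hr1)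
  have hXs : X ∈ Ω s := hsub (mem_ball_self (by positivity))
  have hXt : X ∈ Ω t := hsub' (mem_ball_self (by positivity))
  have e1 := deriv_im (h := fun y => W s y - W t y) (x := X) (r := r * m / 2) (S := K * h) (c := 0) (by positivity) (by positivity)
    (fun y hy => (((O.st s hs).hW y (hsub hy)).sub ((O.st t ht).hW y (hsub' hy))).differentiableAt.differentiableWithinAt)
    (fun y hy => by simpa using h5 s hs t ht h1 y (hsub hy) (hsub' hy))
  change ‖deriv (W s - W t) X‖ ≤ _ at e1
  rw [(((O.st s hs).hW X hXs).sub ((O.st t ht).hW X hXt)).deriv] at e1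
  have n1 : ‖X - z t α‖ ≤ A * r := by have := (O.sf t ht).XXn (O.ge t ht) (r := r) α; rwa [abs_of_pos hrr] at this
  have n2 : ‖X - z s α‖ ≤ 2 * A * r := by
    refine (norm_sub_le_norm_sub_add_norm_sub X (z t α) _).trans ?_
    have := O.zL hs ht α
    rw [norm_sub_rev] at this
    have : h ≤ r := by rw [hrh]; nlinarith
    nlinarith
  have e2 := (O.st t ht).fH X hXt α
  have e3 := (O.st s hs).fH X hXs α
  have e4 : C * √‖X - z t α‖ ≤ C * √A * √r := by
    rw [mul_assoc, ← Real.sqrt_mul (by positivity)]; gcongr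
  have e5 : C * √‖X - z s α‖ ≤ C * √(2 * A) * √r := by
    rw [mul_assoc, ← Real.sqrt_mul (by positivity)]; gcongr
  have e6 : 16 * (K * h) / (r * m / 2) = 32 * K / m * r := by rw [hrh]; field_simp; ring
  have e7 : r ≤ √r := by
    refine Real.le_sqrt_of_sq_le ?_; nlinarith
  rw [e6] at e1
  have e8 : 32 * K / m * r ≤ 32 * K / m * √r := by gcongr
  have : f s (z s α) - f t (z t α) = -(f s X - f s (z s α)) + (f s X - f t X) + (f t X - f t (z t α)) := by ring
  rw [this]
  refine norm_add₃_le.trans ?_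
  rw [norm_neg]; linarith

end OD
end NS

namespace NS
open Complex Topology Metric ComplexConjugate

lemma sq4 {h : ℝ} (h0 : 0 ≤ h) (h1 : h ≤ 1) : √h ≤ √√h ∧ h ≤ √√h ∧ h ≤ √h := by
  have a : h ≤ √h := Real.le_sqrt_of_sq_le (by nlinarith)
  have b : √h ≤ 1 := Real.sqrt_le_iff.2 ⟨by norm_num, by linarith⟩
  have c : √h ≤ √√h := Real.le_sqrt_of_sq_le (by nlinarith [Real.sqrt_nonneg h])
  exact ⟨c, a.trans c, a⟩

namespace OD
variable {C A m a q0 T : ℝ} {z za zaa zt zat : ℝ → ℝ → ℂ} {qt : ℝ → ℝ → ℝ} {Ω Ω' : ℝ → Set ℂ} {f : ℝ → ℂ → ℂ}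
    {B : ℝ → ℂ → ℝ} {ε : ℝ → ℝ} {W : ℝ → ℂ → ℂ} {Wb : ℝ → ℝ → ℂ} (O : OD C A m a q0 T z za zaa zt zat qt Ω Ω' f B ε W Wb)
include O

lemma e6a0 (R : ℝ) (hR : 0 ≤ R) : ∃ K h0, 0 < K ∧ 0 < h0 ∧ ∀ s ∈ Icc 0 T, ∀ t ∈ Icc 0 T, |s - t| < h0 → ∀ y ∈ Ω s, y ∈ Ω t → ∀ β, ‖y - z t β‖ ≤ R * |s - t| →
    ‖W s y - W t y - (Wb s β - Wb t β) + (s - t) * (f t (z t β) * zt t β)‖ ≤ K * (|s - t| * √√|s - t|) := by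
  have hA := O.A1; have hm := O.m0; have hr := O.rr; have hC := O.C0; have hT := O.T0
  obtain ⟨K, h0, hK, hh0, h5⟩ := O.f5b
  set R' := R + A
  have hR' : 0 < R' := by positivity
  refine ⟨R' * C * √R' + R' * C * √R' + R' * K + C * A, min (min h0 1) (m * r1 A m / R'), by positivity, by positivity,
    fun s hs t ht hst y hy hy' β hd => ?_⟩
  simp only [lt_min_iff] at hst
  obtain ⟨⟨h1, h2⟩, h3⟩ := hst
  have hω := sq4 (abs_nonneg (s - t)) h2.le
  have e1 := O.zL hs ht β
  have e2 := O.zT hs ht β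
  have e4 := h5 s hs t ht h1 β
  have e5 := (O.st t ht).fb _ ((O.sf t ht).zcl β)
  have hd' : ‖y - z s β‖ ≤ R' * |s - t| := by
    refine (norm_sub_le_norm_sub_add_norm_sub y (z t β) _).trans ?_
    rw [norm_sub_rev] at e1; simp only [R']; linarith
  have hd2 : ‖y - z t β‖ ≤ R' * |s - t| := hd.trans (by gcongr; simp only [R']; linarith)
  rw [lt_div_iff₀ (by positivity)] at h3
  have e6 := (O.st s hs).tay y hy β (by linarith)
  have e7 := (O.st t ht).tay y hy' β (by linarith)
  have key : W s y - W t y - (Wb s β - Wb t β) + (s - t) * (f t (z t β) * zt t β) = (W s y - Wb s β - f s (z s β) * (y - z s β)) - (W t y - Wb t β - f t (z t β) * (y - z t β))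
     + (f s (z s β) - f t (z t β)) * (y - z s β) - f t (z t β) * (z s β - z t β - (s - t) * zt t β) := by ring
  rw [key]
  set h := |s - t|
  have hh : 0 ≤ h := abs_nonneg _
  set w := √√h
  have hw : 0 ≤ w := Real.sqrt_nonneg _
  have b0 : ∀ d, 0 ≤ d → d ≤ R' * h → C * (d * √d) ≤ R' * C * √R' * (h * w) := fun d h0 hd => by
    calc C * (d * √d) ≤ C * ((R' * h) * √(R' * h)) := by gcongr
      _ = R' * C * √R' * (h * √h) := by rw [Real.sqrt_mul (by positivity)]; ring
      _ ≤ _ := by gcongr; exact hω.1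
  have b4 : ‖(f s (z s β) - f t (z t β)) * (y - z s β)‖ ≤ R' * K * (h * w) := by
    rw [norm_mul]
    calc _ ≤ (K * w) * (R' * h) := by gcongr
      _ = _ := by ring
  have b5 : ‖f t (z t β) * (z s β - z t β - (s - t) * zt t β)‖ ≤ C * A * (h * w) := by
    rw [norm_mul]
    calc _ ≤ C * (A * (h * w)) := by
          gcongr; refine e2.trans ?_; rw [sq]; gcongr; exact hω.2.1
      _ = _ := by ring
  refine (norm_sub_le _ _).trans ((add_le_add ((norm_add_le _ _).trans (add_le_add ((norm_sub_le _ _).trans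
    (add_le_add (e6.trans (b0 _ (norm_nonneg _) hd')) (e7.trans (b0 _ (norm_nonneg _) hd2)))) b4)) b5).trans ?_)
  linarith

lemma e6a : ∃ K h0, 0 < K ∧ 0 < h0 ∧ ∀ s ∈ Icc 0 T, ∀ t ∈ Icc 0 T, |s - t| < h0 → ∀ y ∈ Ω s, y ∈ Ω t → ∀ β, ‖y - z t β‖ ≤ 2 * A * |s - t| →
    |(W s y - W t y).im - (s - t) * ee z zt qt f t β| ≤ K * (|s - t| * √√|s - t|) := by
  have hA := O.A1; have hq := O.q00
  obtain ⟨K, h0, hK, hh0, h⟩ := O.e6a0 (2 * A) (by positivity)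
  refine ⟨K + 7 * q0, min h0 1, by positivity, by positivity, fun s hs t ht hst y hy hy' β hd => ?_⟩
  rw [lt_min_iff] at hst
  have hω := sq4 (abs_nonneg (s - t)) hst.2.le
  have e1 := (abs_im_le_norm _).trans (h s hs t ht hst.1 y hy hy' β hd)
  have e3 := (O.Q2 hs ht β).1
  have hsq : (s - t) ^ 2 = |s - t| * |s - t| := by rw [← sq_abs, sq]
  have b3 : 7 * q0 * (s - t) ^ 2 ≤ 7 * q0 * (|s - t| * √√|s - t|) := by
    rw [hsq]; gcongr; exact hω.2.1
  have key : (W s y - W t y).im - (s - t) * ee z zt qt f t β = (W s y - W t y - (Wb s β - Wb t β) + (s - t) * (f t (z t β) * zt t β)).im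
     + ((Wb s β).im - (Wb t β).im - (s - t) * Qt qt t β) := by
    simp only [ee, sub_im, mul_im, sub_re, mul_re, ofReal_im, ofReal_re, add_im]; ring
  rw [key]
  refine (abs_add_le _ _).trans ?_
  linarith

lemma e6b : ∃ K, 0 < K ∧ ∀ t ∈ Icc 0 T, ∀ α β, |ee z zt qt f t β - ee z zt qt f t α| ≤ K * √(min 1 |β - α|) := by
  have hA := O.A1; have hq := O.q00; have hC := O.C0
  refine ⟨14 * q0 + 2 * C * A, by positivity, fun t ht α β => ?_⟩
  have hf : ∀ α, ‖f t (z t α)‖ ≤ C := fun α => (O.st t ht).fb _ ((O.sf t ht).zcl α)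
  rcases le_or_gt |β - α| 1 with h | h
  · rw [min_eq_right h]
    have b : |β - α| ≤ √|β - α| := Real.le_sqrt_of_sq_le (by nlinarith [abs_nonneg (β - α)])
    have e1 := lip1 convex_univ (fun x _ => (O.Qtd ht x).hasDerivWithinAt) (fun x _ => O.qtb t ht x) α (mem_univ _) β (mem_univ _)
    have e2 : ‖f t (z t β) * zt t β - f t (z t α) * zt t α‖ ≤ C * √|β - α| * A + C * (A * |β - α|) := by
      have : f t (z t β) * zt t β - f t (z t α) * zt t α = (f t (z t β) - f t (z t α)) * zt t β + f t (z t α) * (zt t β - zt t α) := by ring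
      rw [this]
      refine (norm_add_le _ _).trans ?_
      rw [norm_mul, norm_mul]
      gcongr
      · exact (O.st t ht).fHb α β
      · exact O.bt t ht β
      · exact hf α
      · exact O.zta t ht α β
    have e3 := (abs_im_le_norm _).trans e2
    have : ee z zt qt f t β - ee z zt qt f t α = (Qt qt t β - Qt qt t α) - (f t (z t β) * zt t β - f t (z t α) * zt t α).im := by simp only [ee, sub_im]; ring
    rw [this]
    refine (abs_sub _ _).trans ((add_le_add e1 e3).trans ?_)
    have : q0 * |β - α| ≤ q0 * √|β - α| := by gcongr
    have : C * (A * |β - α|) ≤ C * (A * √|β - α|) := by gcongr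
    have : 0 ≤ q0 * √|β - α| := by positivity
    linarith
  · rw [min_eq_left h.le, Real.sqrt_one]
    have hb : ∀ α, |ee z zt qt f t α| ≤ 7 * q0 + C * A := fun α => by
      refine (abs_sub _ _).trans (add_le_add (O.Q2 ht ht α).2 ((abs_im_le_norm _).trans ?_))
      rw [norm_mul]; gcongr
      · exact hf α
      · exact O.bt t ht α
    refine (abs_sub _ _).trans ((add_le_add (hb _) (hb _)).trans (by linarith))

lemma Dg {s t : ℝ} (hs : s ∈ Icc 0 T) (ht : t ∈ Icc 0 T) {x : ℂ} (hx : x ∈ Ω s) (hx' : x ∈ Ω t) :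
    HasDerivAt (fun y => (W s y - W t y) / (s - t : ℂ)) ((f s x - f t x) / (s - t : ℂ)) x :=
  (((O.st s hs).hW x hx).sub ((O.st t ht).hW x hx')).div_const _

lemma Dim {s t : ℝ} (y : ℂ) : ((W s y - W t y) / (s - t : ℂ)).im = (W s y - W t y).im / (s - t) := by
  rw [← ofReal_sub, div_ofReal_im]

lemma DM {s t : ℝ} (hs : s ∈ Icc 0 T) (ht : t ∈ Icc 0 T) : ∃ M, ∀ x ∈ Ω s, x ∈ Ω t → |((W s x - W t x) / (s - t : ℂ)).im| ≤ M := by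
  obtain ⟨M, hM⟩ := (O.st s hs).Wbd
  obtain ⟨M', hM'⟩ := (O.st t ht).Wbd
  refine ⟨(M + M') / ‖(s - t : ℂ)‖, fun x h h' => (abs_im_le_norm _).trans ?_⟩
  rw [norm_div]; gcongr
  exact (norm_sub_le _ _).trans (add_le_add (hM x h) (hM' x h'))

lemma e6c : ∃ K h0, 0 < K ∧ 0 < h0 ∧ ∀ s ∈ Icc 0 T, ∀ t ∈ Icc 0 T, s ≠ t → |s - t| < h0 → ∀ y ∈ Ω s, y ∈ Ω t → ∀ α,
    |((W s y - W t y) / (s - t : ℂ)).im - ee z zt qt f t α| ≤ K * (√‖y - z t α‖ + √√|s - t|) := by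
  have hA := O.A1; have hm := O.m0; have hr := O.rr
  obtain ⟨K, h0, hK, hh0, ha⟩ := O.e6a
  obtain ⟨N, hN, hb⟩ := O.e6b
  have hρ := (O.sf 0 ⟨le_rfl, O.T0.le⟩).rp
  set N1 := N * √(1 / m)
  refine ⟨2 * N1 * √((1 + rho A m) / rho A m) + K + N1 * √(2 * A), min h0 1, by positivity, by positivity, fun s hs t ht hne hst y hy hy' α => ?_⟩
  simp only [lt_min_iff] at hst
  have hp : 0 < |s - t| := abs_pos.2 (sub_ne_zero.2 hne)
  have hω := sq4 (abs_nonneg (s - t)) hst.2.le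
  obtain ⟨M, hM⟩ := O.DM hs ht
  have := barH (U := Ω s ∩ Ω t ∩ Ω t) (g := fun y => (W s y - W t y) / (s - t : ℂ)) (x0 := z t α) (n := ε t * (I * tau (za t) α)) (c0 := ee z zt qt f t α)
    (M := M) (O.tri hs ht ht) hρ ((O.sf t ht).nn (O.ge t ht) α) (fun x hx => (O.ge t ht).x x hx.2 α) (fun h => (O.sf t ht).nf h.2 (mem_range_self _))
    (fun x hx => (O.Dg hs ht hx.1.1 hx.2).differentiableAt.differentiableWithinAt) (fun x hx => hM x hx.1.1 hx.2) (N := N1) (by positivity)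
    (e0 := (K + N1 * √(2 * A)) * √√|s - t|) (fun x hx ε hε => by
      obtain ⟨β, hβ⟩ := O.FR hs ht ht hp le_rfl (by simp) hx
      refine hβ.mono fun y ⟨hy, hd⟩ => ?_
      have e1 := ha s hs t ht hst.1 y hy.1.1 hy.2 β hd
      have e2 : |((W s y - W t y) / (s - t : ℂ)).im - ee z zt qt f t β| ≤ K * √√|s - t| := by
        rw [O.Dim]
        have : (W s y - W t y).im / (s - t) - ee z zt qt f t β = ((W s y - W t y).im - (s - t) * ee z zt qt f t β) / (s - t) := by
          have := sub_ne_zero.2 hne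
          field_simp
        rw [this, abs_div, div_le_iff₀ hp]; linarith
      have e3 := hb t ht α β
      have e4 : √(min 1 |β - α|) ≤ √(1 / m) * √(min 1 ‖y - z t α‖) + √(1 / m) * (√(2 * A) * √√|s - t|) := by
        have c1 := (O.sf t ht).chord β α
        have c2 := norm_sub_le_norm_sub_add_norm_sub (z t β) y (z t α)
        rw [norm_sub_rev (z t β) y] at c2
        have c3 : min 1 |β - α| ≤ (1 / m) * (min 1 ‖y - z t α‖ + 2 * A * |s - t|) := by
          rw [div_mul_eq_mul_div, one_mul, le_div_iff₀ hm]
          have m1 := (O.sf t ht).hm1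
          have p1 : 0 ≤ 2 * A * |s - t| := by positivity
          rcases le_total 1 ‖y - z t α‖ with h | h
          · rw [min_eq_left h]; have := min_le_left 1 |β - α|; nlinarith
          · rw [min_eq_right h]; have := min_le_right 1 |β - α|; nlinarith
        have c4 : √(min 1 ‖y - z t α‖ + 2 * A * |s - t|) ≤ √(min 1 ‖y - z t α‖) + √(2 * A * |s - t|) := by
          have p0 : 0 ≤ min 1 ‖y - z t α‖ := le_min zero_le_one (norm_nonneg _)
          have p1 : 0 ≤ 2 * A * |s - t| := by positivity
          refine Real.sqrt_le_iff.2 ⟨by positivity, ?_⟩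
          nlinarith [Real.sq_sqrt p0, Real.sq_sqrt p1, Real.sqrt_nonneg (min 1 ‖y - z t α‖), Real.sqrt_nonneg (2 * A * |s - t|), mul_nonneg (Real.sqrt_nonneg (min 1 ‖y - z t α‖)) (Real.sqrt_nonneg (2 * A * |s - t|))]
        calc _ ≤ √(1 / m) * √(min 1 ‖y - z t α‖ + 2 * A * |s - t|) := by rw [← Real.sqrt_mul (by positivity)]; gcongr
          _ ≤ √(1 / m) * (√(min 1 ‖y - z t α‖) + √(2 * A * |s - t|)) := by gcongr
          _ = √(1 / m) * √(min 1 ‖y - z t α‖) + √(1 / m) * (√(2 * A) * √|s - t|) := by rw [Real.sqrt_mul (by positivity)]; ring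
          _ ≤ _ := by gcongr; exact hω.2.2
      have e5 : N * √(min 1 |β - α|) ≤ N1 * √(min 1 ‖y - z t α‖) + N1 * √(2 * A) * √√|s - t| := by
        refine (mul_le_mul_of_nonneg_left e4 hN.le).trans (le_of_eq ?_); simp only [N1]; ring
      refine (abs_sub_le _ (ee z zt qt f t β) _).trans ?_
      linarith) y ⟨⟨hy, hy'⟩, hy'⟩
  refine this.trans ?_
  have p1 : 0 ≤ (K + N1 * √(2 * A)) * √‖y - z t α‖ := by positivity
  have p2 : 0 ≤ 2 * N1 * √((1 + rho A m) / rho A m) * √√|s - t| := by positivity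
  linarith

lemma e6d : ∃ K h0, 0 < K ∧ 0 < h0 ∧ ∀ s ∈ Icc 0 T, ∀ s' ∈ Icc 0 T, ∀ t ∈ Icc 0 T, s ≠ t → s' ≠ t → ∀ h < h0, |s - t| ≤ h → |s' - t| ≤ h →
    ∀ y ∈ Ω s, y ∈ Ω t → y ∈ Ω s' → |((W s y - W t y) / (s - t : ℂ) - (W s' y - W t y) / (s' - t : ℂ)).im| ≤ K * √√h := by
  have hA := O.A1
  obtain ⟨K, h0, hK, hh0, hc⟩ := O.e6c
  refine ⟨2 * (K * (√(2 * A) + 1)), min h0 1, by positivity, by positivity, fun s hs s' hs' t ht hn hn' h hh h1 h2 y hy hyt hy' => ?_⟩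
  simp only [lt_min_iff] at hh
  have hp : 0 < h := (abs_pos.2 (sub_ne_zero.2 hn)).trans_le h1
  have hω := sq4 hp.le hh.2.le
  obtain ⟨M, hM⟩ := O.DM hs ht
  obtain ⟨M', hM'⟩ := O.DM hs' ht
  have := barCore (U := Ω s ∩ Ω t ∩ Ω s') (g := fun y => (W s y - W t y) / (s - t : ℂ) - (W s' y - W t y) / (s' - t : ℂ)) (B := fun _ => 0) (c0 := 0) (M := M + M')
    (O.tri hs hs' ht) (O.sf t ht).rp (fun x hx => (O.ge t ht).x x hx.1.2 0)
    (fun x hx => ((O.Dg hs ht hx.1.1 hx.1.2).sub (O.Dg hs' ht hx.2 hx.1.2)).differentiableAt.differentiableWithinAt)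
    (fun x hx => by rw [sub_im]; exact (abs_sub _ _).trans (add_le_add (hM x hx.1.1 hx.1.2) (hM' x hx.2 hx.1.2))) (differentiableOn_const _)
    (by simp) (e0 := 2 * (K * (√(2 * A) + 1)) * √√h) (fun x hx ε hε => by
      obtain ⟨β, hβ⟩ := O.FR hs hs' ht hp h1 h2 hx
      refine hβ.mono fun y ⟨hy, hd⟩ => ?_
      have aux : ∀ σ, |σ - t| ≤ h → K * (√‖y - z t β‖ + √√|σ - t|) ≤ K * (√(2 * A) + 1) * √√h := by
        intro σ hσ
        rw [mul_assoc]
        gcongr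
        rw [add_mul, one_mul]
        gcongr
        calc √‖y - z t β‖ ≤ √(2 * A * h) := by gcongr
          _ = √(2 * A) * √h := Real.sqrt_mul (by positivity) _
          _ ≤ _ := by gcongr; exact hω.2.2
      have e1 := (hc s hs t ht hn (h1.trans_lt hh.1) y hy.1.1 hy.1.2 β).trans (aux s h1)
      have e2 := (hc s' hs' t ht hn' (h2.trans_lt hh.1) y hy.2 hy.1.2 β).trans (aux s' h2)
      rw [sub_zero, zero_re, sub_im, zero_add]
      refine (abs_sub_le _ (ee z zt qt f t β) _).trans ?_
      rw [abs_sub_comm _ (ee z zt qt f t β)] at e1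
      rw [abs_sub_comm] at e1
      rw [abs_sub_comm (ee z zt qt f t β)]
      linarith) y ⟨⟨hy, hyt⟩, hy'⟩
  simpa using this

end OD
end NS

namespace NS
open Complex Topology Metric ComplexConjugate

namespace OD
variable {C A m a q0 T : ℝ} {z za zaa zt zat : ℝ → ℝ → ℂ} {qt : ℝ → ℝ → ℝ} {Ω Ω' : ℝ → Set ℂ} {f : ℝ → ℂ → ℂ}
    {B : ℝ → ℂ → ℝ} {ε : ℝ → ℝ} {W : ℝ → ℂ → ℂ} {Wb : ℝ → ℝ → ℂ} (O : OD C A m a q0 T z za zaa zt zat qt Ω Ω' f B ε W Wb)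
include O

lemma bsub {s t r : ℝ} (hs : s ∈ Icc 0 T) (ht : t ∈ Icc 0 T) {x : ℂ} (hx : x ∈ Ω t) (hr : 0 < r) (hd : ∀ β, r ≤ ‖x - z t β‖)
    (hst : 2 * A * |s - t| < r) : ball x (r / 2) ⊆ Ω s := by
  have h1 : ball x r ⊆ Ω t := (O.sf t ht).miss (convex_ball x r).isPreconnected (fun y hy => by
    rintro ⟨β, rfl⟩
    have := hd β
    rw [mem_ball, dist_eq_norm, norm_sub_rev] at hy; linarith) (mem_ball_self hr) hx
  intro y hy
  refine O.stay hs ht (h1 (ball_subset_ball (by linarith) hy)) fun β => ?_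
  rw [mem_ball, dist_eq_norm, norm_sub_rev] at hy
  have := norm_sub_le_norm_sub_add_norm_sub x y (z t β)
  linarith [hd β]

lemma e6e : ∃ K h0, 0 < K ∧ 0 < h0 ∧ ∀ t ∈ Ioo 0 T, ∀ x ∈ Ω t, ∀ r > 0, (∀ β, r ≤ ‖x - z t β‖) → ∃ k, HasDerivAt (fun s => f s x) k t ∧
    ∀ s ∈ Icc 0 T, s ≠ t → |s - t| < h0 → 2 * A * |s - t| < r → ‖(f s x - f t x) / (s - t : ℂ) - k‖ ≤ K * √√|s - t| / r := by
  have hA := O.A1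
  obtain ⟨K, h0, hK, hh0, hd⟩ := O.e6d
  refine ⟨32 * K, h0, by positivity, by positivity, fun t ht x hx r hr hdist => ?_⟩
  have ht' := Ioo_subset_Icc_self ht
  have est : ∀ s ∈ Icc 0 T, ∀ s' ∈ Icc 0 T, s ≠ t → s' ≠ t → ∀ h < h0, |s - t| ≤ h → |s' - t| ≤ h → 2 * A * h < r →
      ‖(f s x - f t x) / (s - t : ℂ) - (f s' x - f t x) / (s' - t : ℂ)‖ ≤ 32 * K * √√h / r := by
    intro s hs s' hs' hn hn' h hh h1 h2 h3
    have b1 := O.bsub hs ht' hx hr hdist ((by gcongr : 2 * A * |s - t| ≤ 2 * A * h).trans_lt h3)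
    have b2 := O.bsub hs' ht' hx hr hdist ((by gcongr : 2 * A * |s' - t| ≤ 2 * A * h).trans_lt h3)
    have b3 := O.bsub ht' ht' hx hr hdist (by simpa using hr)
    have e := deriv_im (h := fun y => (W s y - W t y) / (s - t : ℂ) - (W s' y - W t y) / (s' - t : ℂ)) (x := x) (r := r / 2) (S := K * √√h) (c := 0)
      (by positivity) (by positivity) (fun y hy => ((O.Dg hs ht' (b1 hy) (b3 hy)).sub (O.Dg hs' ht' (b2 hy) (b3 hy))).differentiableAt.differentiableWithinAt)
      (fun y hy => by rw [sub_zero]; exact hd s hs s' hs' t ht' hn hn' h hh h1 h2 y (b1 hy) (b3 hy) (b2 hy))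
    have hxx : x ∈ ball x (r / 2) := mem_ball_self (by positivity)
    refine (le_of_eq (congrArg _ (HasDerivAt.deriv ((O.Dg hs ht' (b1 hxx) (b3 hxx)).sub (O.Dg hs' ht' (b2 hxx) (b3 hxx)))).symm)).trans (e.trans (le_of_eq ?_))
    field_simp; ring
  have ev : ∀ δ > 0, ∀ᶠ s in 𝓝[≠] t, s ∈ Icc 0 T ∧ s ≠ t ∧ |s - t| < δ := fun δ hδ => by
    filter_upwards [self_mem_nhdsWithin, nhdsWithin_le_nhds (Icc_mem_nhds ht.1 ht.2), nhdsWithin_le_nhds (ball_mem_nhds t hδ)] with s h1 h2 h3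
    exact ⟨h2, h1, h3⟩
  have tω : Tendsto (fun h => 32 * K * √√h / r) (𝓝[>] 0) (𝓝 0) := by
    have : Continuous fun h => 32 * K * √√h / r := by fun_prop
    simpa using (this.tendsto 0).mono_left (nhdsWithin_le_nhds (s := Ioi 0))
  have hc : Cauchy (map (fun s : ℝ => (f s x - f t x) / (s - t : ℂ)) (𝓝[≠] t)) := by
    rw [Metric.cauchy_iff]
    refine ⟨inferInstance, fun η hη => ?_⟩
    have := (tω.eventually (gt_mem_nhds hη)).and ((Ioo_mem_nhdsGT (lt_min hh0 (show 0 < r / (2 * A) by positivity)) : ∀ᶠ h in 𝓝[>] (0:ℝ), h ∈ Ioo 0 (min h0 (r / (2 * A)))))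
    obtain ⟨h, hh, h2⟩ := this.exists
    rw [lt_min_iff, lt_div_iff₀ (by positivity)] at h2
    refine ⟨_, image_mem_map (ev h h2.1), ?_⟩
    rintro _ ⟨s, ⟨a1, a2, a3⟩, rfl⟩ _ ⟨s', ⟨c1, c2, c3⟩, rfl⟩
    rw [dist_eq_norm]
    exact (est s a1 s' c1 a2 c2 h h2.2.1 a3.le c3.le (by linarith)).trans_lt hh
  obtain ⟨k, hk⟩ := cauchy_map_iff_exists_tendsto.1 hc
  refine ⟨k, ?_, fun s hs hn h1 h2 => ?_⟩
  · rw [hasDerivAt_iff_tendsto_slope]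
    refine hk.congr fun s => ?_
    simp only [slope, vsub_eq_sub, real_smul]; push_cast; field_simp
  · refine le_of_tendsto ((tendsto_const_nhds.sub hk).norm) ?_
    filter_upwards [ev |s - t| (abs_pos.2 (sub_ne_zero.2 hn))] with s' hs'
    exact est s hs s' hs'.1 hn hs'.2.1 |s - t| h1 le_rfl hs'.2.2.le h2

lemma WbL : ∃ K h0, 0 < K ∧ 0 < h0 ∧ ∀ s ∈ Icc 0 T, ∀ t ∈ Icc 0 T, |s - t| < h0 → ∀ α, ‖Wb s α - Wb t α‖ ≤ K * √√|s - t| * |α| := by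
  have hA := O.A1; have hC := O.C0
  obtain ⟨K, h0, hK, hh0, h⟩ := O.f5b
  refine ⟨K * A + C * A, min h0 1, by positivity, by positivity, fun s hs t ht hst α => ?_⟩
  rw [lt_min_iff] at hst
  have hω := sq4 (abs_nonneg (s - t)) hst.2.le
  have := lip1 (g := fun α => Wb s α - Wb t α) (C := (K * A + C * A) * √√|s - t|) convex_univ
    (fun x _ => (((O.st s hs).Wb' x).sub ((O.st t ht).Wb' x)).hasDerivWithinAt) (fun x _ => by
      have e1 := lip1 (convex_Icc 0 T) (fun t ht => O.hzat x t ht) (fun t ht => O.bat t ht x) t ht s hs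
      have : f s (z s x) * za s x - f t (z t x) * za t x = (f s (z s x) - f t (z t x)) * za s x + f t (z t x) * (za s x - za t x) := by ring
      rw [this]
      refine (norm_add_le _ _).trans ?_
      rw [norm_mul, norm_mul]
      calc _ ≤ (K * √√|s - t|) * A + C * (A * √√|s - t|) := by
            gcongr
            · exact h s hs t ht hst.1 x
            · exact (O.sf s hs).ba x
            · exact (O.st t ht).fb _ ((O.sf t ht).zcl x)
            · refine e1.trans ?_; gcongr; exact hω.2.1
        _ = _ := by ring) 0 (mem_univ _) α (mem_univ _)
  simpa [(O.st s hs).Wb0, (O.st t ht).Wb0] using this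

end OD
end NS

namespace NS
open Complex Topology Metric ComplexConjugate

lemma s44 {r : ℝ} (h : 0 ≤ r) : (√√r) ^ 4 = r := by
  rw [show (√√r) ^ 4 = ((√√r) ^ 2) ^ 2 by ring, Real.sq_sqrt (Real.sqrt_nonneg _), Real.sq_sqrt h]

namespace OD
variable {C A m a q0 T : ℝ} {z za zaa zt zat : ℝ → ℝ → ℂ} {qt : ℝ → ℝ → ℝ} {Ω Ω' : ℝ → Set ℂ} {f : ℝ → ℂ → ℂ}
    {B : ℝ → ℂ → ℝ} {ε : ℝ → ℝ} {W : ℝ → ℂ → ℂ} {Wb : ℝ → ℝ → ℂ} (O : OD C A m a q0 T z za zaa zt zat qt Ω Ω' f B ε W Wb)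
include O

lemma e7a : ∃ K h0, 0 < K ∧ 0 < h0 ∧ ∀ s ∈ Icc 0 T, ∀ t ∈ Icc 0 T, s ≠ t → |s - t| < h0 → ∀ β, ∀ v0 > 0, v0 ^ 4 ≤ r1 A m → 3 * A / m * |s - t| ≤ v0 ^ 4 →
    ‖(W s (XX (z t) (za t) (ε t) (v0 ^ 4) β) - W t (XX (z t) (za t) (ε t) (v0 ^ 4) β)) / (s - t : ℂ) -
      (W s (XX (z t) (za t) (ε t) (3 * A / m * |s - t|) β) - W t (XX (z t) (za t) (ε t) (3 * A / m * |s - t|) β)) / (s - t : ℂ)‖ ≤ K * v0 := by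
  have hA := O.A1; have hm := O.m0
  obtain ⟨K, h0, hK, hh0, hc⟩ := O.e6c
  set K' := K * (√(2 * A) + 1)
  refine ⟨128 * K' * A / m, h0, by positivity, hh0, fun s hs t ht hne hst β v0 hv0 hv1 hv2 => ?_⟩
  have S := O.sf t ht
  have hm1 := S.hm1
  have hr1 := S.r1le
  set h := |s - t|
  have hh : 0 < h := abs_pos.2 (sub_ne_zero.2 hne)
  set r := 3 * A / m * h with hr
  have hrp : 0 < r := by positivity
  have hhr : h ≤ r := by
    have : 1 ≤ 3 * A / m := by rw [le_div_iff₀ hm]; linarith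
    nlinarith
  have hrm : 2 * A * h < r * m := by rw [hr]; field_simp; nlinarith
  set vh := √√r
  have hvh : vh ^ 4 = r := s44 hrp.le
  have hvp : 0 < vh := Real.sqrt_pos.2 (Real.sqrt_pos.2 hrp)
  have hle : vh ≤ v0 := by
    by_contra hcon
    push Not at hcon
    have := pow_lt_pow_left₀ hcon hv0.le (n := 4) (by norm_num)
    linarith
  have hv01 : v0 ≤ 1 := by
    by_contra hcon
    push Not at hcon
    have := pow_lt_pow_left₀ hcon zero_le_one (n := 4) (by norm_num)
    linarith
  have facts : ∀ v ∈ Icc vh v0, 0 < v ∧ v ≤ 1 ∧ v ^ 4 ≤ r1 A m ∧ r ≤ v ^ 4 := fun v hv => by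
    have p : 0 < v := hvp.trans_le hv.1
    exact ⟨p, hv.2.trans hv01, (pow_le_pow_left₀ p.le hv.2 4).trans hv1, hvh ▸ pow_le_pow_left₀ hvp.le hv.1 4⟩
  have hsub : ∀ v ∈ Icc vh v0, ball (XX (z t) (za t) (ε t) (v ^ 4) β) (v ^ 4 * m / 2) ⊆ Ω s ∩ Ω t := fun v hv => by
    obtain ⟨p, q, u, w⟩ := facts v hv
    refine subset_inter (O.XXb hs ht (by positivity) u (by nlinarith) β) ((ball_subset_ball ?_).trans ((O.ge t ht).b β _ (by positivity) u))
    have : 0 < v ^ 4 * m := by positivity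
    linarith
  have cen : ∀ v ∈ Icc vh v0, XX (z t) (za t) (ε t) (v ^ 4) β ∈ Ω s ∩ Ω t := fun v hv => hsub v hv (mem_ball_self (by have := (facts v hv).1; positivity))
  have := lip1 (g := fun v : ℝ => (W s (XX (z t) (za t) (ε t) (v ^ 4) β) - W t (XX (z t) (za t) (ε t) (v ^ 4) β)) / (s - t : ℂ)) (C := 128 * K' * A / m) (convex_Icc vh v0)
    (g' := fun v => (f s (XX (z t) (za t) (ε t) (v ^ 4) β) - f t (XX (z t) (za t) (ε t) (v ^ 4) β)) / (s - t : ℂ) * (((4 * v ^ 3 : ℝ) : ℂ) * (ε t * (I * za t β))))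
    (fun v hv => by
      have d1 : HasDerivAt (fun v : ℝ => XX (z t) (za t) (ε t) (v ^ 4) β) (((4 * v ^ 3 : ℝ) : ℂ) * (ε t * (I * za t β))) v := by
        have := (((hasDerivAt_pow 4 v).ofReal_comp).mul_const (ε t * (I * za t β) : ℂ)).const_add (z t β)
        simpa [XX] using this
      exact ((O.Dg hs ht (cen v hv).1 (cen v hv).2).comp v d1).hasDerivWithinAt)
    (fun v hv => by
      obtain ⟨p, q, u, w⟩ := facts v hv
      have e := deriv_im (h := fun y => (W s y - W t y) / (s - t : ℂ)) (x := XX (z t) (za t) (ε t) (v ^ 4) β) (r := v ^ 4 * m / 2) (S := K' * v) (c := ee z zt qt f t β)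
        (by positivity) (by positivity) (fun y hy => (O.Dg hs ht (hsub v hv hy).1 (hsub v hv hy).2).differentiableAt.differentiableWithinAt)
        (fun y hy => by
          refine (hc s hs t ht hne hst y (hsub v hv hy).1 (hsub v hv hy).2 β).trans ?_
          have hy' : ‖y - z t β‖ ≤ 2 * A * v ^ 4 := S.XXball (O.ge t ht) (by positivity) β (ball_subset_ball (half_le_self (by positivity)) hy)
          have a1 : √‖y - z t β‖ ≤ √(2 * A) * v := by
            calc √‖y - z t β‖ ≤ √(2 * A * v ^ 4) := by gcongr
              _ = √(2 * A) * (v * v) := by rw [Real.sqrt_mul (by positivity), show v ^ 4 = (v * v) ^ 2 by ring, Real.sqrt_sq (by positivity)]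
              _ ≤ _ := by gcongr; nlinarith
          have a2 : √√h ≤ v := by
            calc √√h ≤ √√(v ^ 4) := by gcongr; linarith
              _ = v := by rw [show v ^ 4 = (v ^ 2) ^ 2 by ring, Real.sqrt_sq (by positivity), Real.sqrt_sq p.le]
          calc _ ≤ K * (√(2 * A) * v + v) := by gcongr
            _ = _ := by simp only [K']; ring)
      rw [(O.Dg hs ht (cen v hv).1 (cen v hv).2).deriv] at e
      rw [norm_mul, norm_mul, norm_mul, norm_mul, norm_I, one_mul, norm_real, norm_real, Real.norm_eq_abs, Real.norm_eq_abs, (O.ge t ht).e, one_mul, abs_of_pos (by positivity)]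
      calc _ ≤ 16 * (K' * v) / (v ^ 4 * m / 2) * (4 * v ^ 3 * A) := by gcongr; exact S.ba β
        _ = _ := by field_simp; ring) vh ⟨le_rfl, hle⟩ v0 ⟨hle, le_rfl⟩
  simp only [hvh] at this
  refine this.trans ?_
  gcongr
  rw [abs_of_nonneg (by linarith)]; linarith

lemma e7 {t : ℝ} (ht : t ∈ Ioo 0 T) (α : ℝ) : HasDerivAt (fun s => (Wb s α).re)
    ((f t (z t α) * zt t α).re - B t (z t α) - ((f t (z t 0) * zt t 0).re - B t (z t 0))) t := by
  have hA := O.A1; have hm := O.m0; have hr1 := O.rr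
  have ht' := Ioo_subset_Icc_self ht
  have S := O.sf t ht'
  have hm1 := S.hm1
  have E := O.ge t ht'
  obtain ⟨K1, h1, hK1, hh1, H1⟩ := O.e6a0 (A * (3 * A / m)) (by positivity)
  obtain ⟨K2, h2, hK2, hh2, H2⟩ := O.e7a
  obtain ⟨K3, h3, hK3, hh3, H3⟩ := O.e6e
  rw [hasDerivAt_iff_tendsto_slope, Metric.tendsto_nhds]
  intro η hη
  have hB : ∀ β, ∀ᶠ r in 𝓝[>] (0:ℝ), |B t (XX (z t) (za t) (ε t) r β) - B t (z t β)| < η / 10 := fun β => by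
    have := ((O.Bc t ht (z t β) (S.zcl β)).mono_left (nhdsWithin_mono _ subset_closure)).comp (S.XXtend E β)
    exact (Metric.tendsto_nhds.1 this (η / 10) (by positivity))
  have hv : ∀ᶠ r in 𝓝[>] (0:ℝ), K2 * √√r < η / 10 := by
    have : Continuous fun r => K2 * √√r := by fun_prop
    exact ((this.tendsto 0).mono_left (nhdsWithin_le_nhds (s := Ioi 0))).eventually (gt_mem_nhds (by simp; positivity))
  obtain ⟨r0, ⟨⟨hBα, hB0⟩, hv0⟩, hr0⟩ := (((hB α).and (hB 0)).and hv).and (Ioc_mem_nhdsGT hr1 : ∀ᶠ r in 𝓝[>] (0:ℝ), r ∈ Ioc 0 (r1 A m)) |>.exists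
  set v0 := √√r0
  have hv4 : v0 ^ 4 = r0 := s44 hr0.1.le
  have hvp : 0 < v0 := Real.sqrt_pos.2 (Real.sqrt_pos.2 hr0.1)
  have ev1 : ∀ᶠ s in 𝓝[≠] t, (K1 * √√|s - t| + (K3 * √√|s - t| / (r0 * m) * (2 * A)) * |α| + |s - t|) < min (min (min (η / 10) h1) (min h2 h3)) (min (r0 * m / (3 * A)) (r1 A m * m / (3 * A))) := by
    have : Continuous fun s => (K1 * √√|s - t| + (K3 * √√|s - t| / (r0 * m) * (2 * A)) * |α| + |s - t|) := by fun_prop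
    have hp := hr0.1
    refine ((this.tendsto t).mono_left nhdsWithin_le_nhds).eventually (gt_mem_nhds ?_)
    simp only [sub_self, abs_zero, Real.sqrt_zero, mul_zero, zero_div, zero_mul, add_zero, lt_min_iff]
    exact ⟨⟨⟨by positivity, hh1⟩, hh2, hh3⟩, by positivity, by positivity⟩
  filter_upwards [ev1, self_mem_nhdsWithin, nhdsWithin_le_nhds (Icc_mem_nhds ht.1 ht.2)] with s hs1 hne hs
  change s ≠ t at hne
  simp only [lt_min_iff] at hs1
  have p1 : 0 ≤ K1 * √√|s - t| := by positivity
  have p2 : 0 ≤ K3 * √√|s - t| / (r0 * m) * (2 * A) * |α| := by have := hr0.1; positivity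
  have p3 : 0 < |s - t| := abs_pos.2 (sub_ne_zero.2 hne)
  obtain ⟨⟨⟨c1, c2⟩, c3, c4⟩, c5, c6⟩ := hs1
  rw [lt_div_iff₀ (by positivity)] at c5 c6
  have hch : 3 * A / m * |s - t| ≤ r0 := by rw [div_mul_eq_mul_div, div_le_iff₀ hm]; nlinarith
  have hch2 : 2 * A * |s - t| < r0 * m := by nlinarith
  set rh := 3 * A / m * |s - t| with hrh
  have hrhp : 0 < rh := by positivity
  have inh : ∀ β, XX (z t) (za t) (ε t) rh β ∈ Ω s := fun β => O.XXb hs ht' hrhp (hch.trans hr0.2) (by rw [hrh]; field_simp; nlinarith) β (mem_ball_self (by positivity))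
  have inh' : ∀ β, XX (z t) (za t) (ε t) rh β ∈ Ω t := fun β => S.XXin E hrhp (hch.trans hr0.2) β
  have in0 : ∀ β, XX (z t) (za t) (ε t) r0 β ∈ Ω s := fun β => O.XXb hs ht' hr0.1 hr0.2 hch2 β (mem_ball_self (by have := hr0.1; positivity))
  have in0' : ∀ β, XX (z t) (za t) (ε t) r0 β ∈ Ω t := fun β => S.XXin E hr0.1 hr0.2 β
  have hst : (s - t : ℂ) ≠ 0 := by rw [← ofReal_sub]; exact_mod_cast sub_ne_zero.2 hne
  have nst : ‖(s - t : ℂ)‖ = |s - t| := by rw [← ofReal_sub, norm_real, Real.norm_eq_abs]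
  set D : ℂ → ℂ := fun y => (W s y - W t y) / (s - t : ℂ) with hD
  have i1 : ∀ β, |(D (XX (z t) (za t) (ε t) rh β)).re - ((Wb s β).re - (Wb t β).re) / (s - t) + (f t (z t β) * zt t β).re| ≤ K1 * √√|s - t| := fun β => by
    have e := H1 s hs t ht' (by linarith) _ (inh β) (inh' β) β (by
      refine (S.XXn E β).trans (le_of_eq ?_); rw [abs_of_pos hrhp, hrh]; ring)
    have e2 : (D (XX (z t) (za t) (ε t) rh β)).re - ((Wb s β).re - (Wb t β).re) / (s - t) + (f t (z t β) * zt t β).re =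
      ((W s (XX (z t) (za t) (ε t) rh β) - W t (XX (z t) (za t) (ε t) rh β) - (Wb s β - Wb t β) + (s - t) * (f t (z t β) * zt t β)) / (s - t : ℂ)).re := by
      rw [← sub_re, ← div_ofReal_re, ← sub_re, ← add_re]
      congr 1; simp only [hD, ofReal_sub]; field_simp
    rw [e2]
    refine (abs_re_le_norm _).trans ?_
    rw [norm_div, nst, div_le_iff₀ p3]; linarith
  have i2 : ∀ β, |(D (XX (z t) (za t) (ε t) r0 β)).re - (D (XX (z t) (za t) (ε t) rh β)).re| ≤ K2 * v0 := fun β => by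
    have e := H2 s hs t ht' hne (by linarith) β v0 hvp (by rw [hv4]; exact hr0.2) (by rw [hv4]; exact hch)
    rw [hv4] at e
    rw [← sub_re]; exact (abs_re_le_norm _).trans e
  have hdist : ∀ β β', r0 * m ≤ ‖XX (z t) (za t) (ε t) r0 β - z t β'‖ := fun β β' => by
    by_contra hc
    push Not at hc
    refine S.nf (E.b β r0 hr0.1 hr0.2 (?_ : z t β' ∈ _)) (mem_range_self _)
    rwa [mem_ball, dist_eq_norm, norm_sub_rev]
  have i3 := lip1 (g := fun β => (D (XX (z t) (za t) (ε t) r0 β)).re + B t (XX (z t) (za t) (ε t) r0 β)) (C := K3 * √√|s - t| / (r0 * m) * (2 * A)) convex_univ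
    (g' := fun β => deriv (fun β => (D (XX (z t) (za t) (ε t) r0 β)).re + B t (XX (z t) (za t) (ε t) r0 β)) β)
    (fun β _ => by
      obtain ⟨k, hk, _⟩ := H3 t ht _ (in0' β) (r0 * m) (by have := hr0.1; positivity) (hdist β)
      exact (((hre ((O.Dg hs ht' (in0 β) (in0' β)).comp β (S.XXd (ε t) r0 β))).add ((O.Bd t ht _ (in0' β) k hk).comp_hasDerivAt β (S.XXd (ε t) r0 β))).differentiableAt.hasDerivAt).hasDerivWithinAt)
    (fun β _ => by
      obtain ⟨k, hk, hk2⟩ := H3 t ht _ (in0' β) (r0 * m) (by have := hr0.1; positivity) (hdist β)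
      have e := (hre ((O.Dg hs ht' (in0 β) (in0' β)).comp β (S.XXd (ε t) r0 β))).add ((O.Bd t ht _ (in0' β) k hk).comp_hasDerivAt β (S.XXd (ε t) r0 β))
      refine (le_of_eq (congrArg _ e.deriv)).trans ?_
      set X' := za t β + r0 * (ε t * (I * zaa t β))
      have hX : ‖X'‖ ≤ 2 * A := by
        refine (norm_add_le _ _).trans ?_
        rw [norm_mul, norm_mul, norm_mul, norm_I, one_mul, norm_real, norm_real, Real.norm_eq_abs, Real.norm_eq_abs, E.e, one_mul, abs_of_pos hr0.1]
        have := S.ba β; have := S.baa β; have := S.r1le; have := hr0.2; have := hr0.1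
        nlinarith [norm_nonneg (zaa t β)]
      have : ((f s (XX (z t) (za t) (ε t) r0 β) - f t (XX (z t) (za t) (ε t) r0 β)) / (s - t : ℂ) * X').re + (-(reCLM ∘L (ContinuousLinearMap.mul ℝ ℂ k))) X' =
        (((f s (XX (z t) (za t) (ε t) r0 β) - f t (XX (z t) (za t) (ε t) r0 β)) / (s - t : ℂ) - k) * X').re := by
        simp [sub_mul]; ring
      rw [this]
      refine (abs_re_le_norm _).trans ?_
      rw [norm_mul]
      have := hk2 s hs hne (by linarith) hch2
      have := hr0.1
      exact mul_le_mul (by assumption) hX (norm_nonneg _) (by positivity)) 0 (mem_univ _) α (mem_univ _)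
  rw [Real.norm_eq_abs, sub_zero] at i3
  have i1α := abs_le.1 (i1 α); have i10 := abs_le.1 (i1 0); have i2α := abs_le.1 (i2 α); have i20 := abs_le.1 (i2 0)
  have i3 := abs_le.1 i3; have hBα := abs_lt.1 hBα; have hB0 := abs_lt.1 hB0
  rw [(O.st s hs).Wb0, (O.st t ht').Wb0, sub_self, zero_div] at i10
  rw [slope_def_field, Real.dist_eq, abs_lt]
  constructor <;> linarith [i1α.1, i1α.2, i10.1, i10.2, i2α.1, i2α.2, i20.1, i20.2, i3.1, i3.2, hBα.1, hBα.2, hB0.1, hB0.2]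

end OD
end NS

namespace NS
open Complex Topology Metric ComplexConjugate

lemma lip0 {E : Type*} [NormedAddCommGroup E] [NormedSpace ℝ E] {g g' : ℝ → E} {C : ℝ} {x : ℝ} (hx : 0 ≤ x) (h : ∀ y, HasDerivAt g (g' y) y) (h0 : g 0 = 0)
    (hC : ∀ y ∈ Icc 0 x, ‖g' y‖ ≤ C) : ‖g x‖ ≤ C * x := by
  have := lip1 (convex_Icc 0 x) (fun y _ => (h y).hasDerivWithinAt) hC 0 ⟨le_rfl, hx⟩ x ⟨hx, le_rfl⟩
  simpa [h0, abs_of_nonneg hx] using this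

lemma odd3 {E : Type*} [NormedAddCommGroup E] [NormedSpace ℝ E] {g g' g'' : ℝ → E} {D : ℝ} (hD : 0 ≤ D) (h : ∀ y, HasDerivAt g (g' y) y) (h' : ∀ y, HasDerivAt g' (g'' y) y)
    (hL : ∀ x y, ‖g'' x - g'' y‖ ≤ D * |x - y|) {x : ℝ} (hx : 0 ≤ x) : ‖g x - g (-x) - (2 * x) • g' 0‖ ≤ 2 * D * x ^ 3 := by
  have n1 : ∀ y, HasDerivAt (fun y => g (-y)) (-g' (-y)) y := fun y => by simpa [Function.comp_def] using (h (-y)).scomp y (hasDerivAt_neg y)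
  have n2 : ∀ y, HasDerivAt (fun y => g' (-y)) (-g'' (-y)) y := fun y => by simpa [Function.comp_def] using (h' (-y)).scomp y (hasDerivAt_neg y)
  have s1 : ∀ u, 0 ≤ u → ‖g' u + g' (-u) - (2:ℝ) • g' 0‖ ≤ 2 * D * u * u := fun u hu =>
    lip0 (g := fun u => g' u + g' (-u) - (2:ℝ) • g' 0) hu (fun y => ((h' y).add (n2 y)).sub_const _) (by simp [two_smul]) (fun y hy => by
      rw [← sub_eq_add_neg]
      refine (hL _ _).trans ?_
      rw [sub_neg_eq_add, abs_of_nonneg (by linarith [hy.1])]; nlinarith [hy.2])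
  have := lip0 (C := 2 * D * x * x) (g := fun u => g u - g (-u) - (2 * u) • g' 0) (g' := fun u => g' u + g' (-u) - (2:ℝ) • g' 0) hx
    (fun y => (((h y).sub (n1 y)).sub (((hasDerivAt_id y).const_mul (2:ℝ)).smul_const (g' 0))).congr_deriv (by simp)) (by simp)
    (fun y hy => (s1 y hy.1).trans (by have := hy.1; have := hy.2; gcongr))
  refine this.trans (le_of_eq (by ring))

/-- data of the two walls of a neck -/
structure NW (N c d : ℝ) (z za zaa : ℝ → ℂ) (Ω : Set ℂ) (f : ℂ → ℂ) (p q qa : ℝ → ℝ) (α0 β0 lam mu : ℝ) (τ : ℂ) : Prop where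
  hN : 1 ≤ N
  hd : 0 < d
  hz : ∀ α, HasDerivAt z (za α) α
  hza : ∀ α, HasDerivAt za (zaa α) α
  ba : ∀ α, ‖za α‖ ≤ N
  baa : ∀ α, ‖zaa α‖ ≤ N
  Laa : ∀ α β, ‖zaa β - zaa α‖ ≤ N * |β - α|
  pq : ∀ α, f (z α) * za α = p α + q α * I
  hq : ∀ α, HasDerivAt q (qa α) α
  bq : ∀ α, |q α| ≤ N
  bqa : ∀ α, |qa α| ≤ N
  Lqa : ∀ α β, |qa β - qa α| ≤ N * |β - α|
  bp : ∀ α, |p α| ≤ N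
  Lp : ∀ α β, α ≤ β → p β - p α ≤ N * (β - α)
  M : ∀ x ∈ Ω, ‖f x‖ ≤ N
  loc : ∀ α β, |α - β| ≤ c → |α - β| ≤ 2 * N * ‖z α - z β‖
  far : ∀ α β, c ≤ |α - β| → d ≤ ‖z α - z β‖
  blam : |lam| ≤ N
  bmu : |mu| ≤ N
  nτ : ‖τ‖ = 1
  tb : lam * za α0 = τ
  tT : mu * za β0 = τ
  dd : z β0 - z α0 = I * τ * d
  seg : ∀ s ∈ Ioo (0:ℝ) 1, z α0 + s * (z β0 - z α0) ∈ Ω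

namespace NW
variable {N c d : ℝ} {z za zaa : ℝ → ℂ} {Ω : Set ℂ} {f : ℂ → ℂ} {p q qa : ℝ → ℝ} {α0 β0 lam mu : ℝ} {τ : ℂ}
  (H : NW N c d z za zaa Ω f p q qa α0 β0 lam mu τ)
include H

lemma bd (γ l x : ℝ) : HasDerivAt (fun x => z (γ + l * x)) (l * za (γ + l * x)) x := by
  simpa [Function.comp_def] using (H.hz (γ + l * x)).scomp x (((hasDerivAt_id x).const_mul l).const_add γ)
lemma bdd (γ l x : ℝ) : HasDerivAt (fun x => (l : ℂ) * za (γ + l * x)) (l * (l * zaa (γ + l * x))) x := by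
  have := ((H.hza (γ + l * x)).scomp x (((hasDerivAt_id x).const_mul l).const_add γ)).const_mul (l : ℂ)
  simpa [Function.comp_def] using this
lemma bdb {l : ℝ} (γ : ℝ) (hl : |l| ≤ N) (x : ℝ) : ‖(l : ℂ) * za (γ + l * x) - l * za γ‖ ≤ N ^ 3 * |x| := by
  have hN := H.hN
  have := lip1 convex_univ (fun x _ => (H.bdd γ l x).hasDerivWithinAt) (C := N ^ 3) (fun x _ => by
    rw [norm_mul, norm_mul, norm_real, Real.norm_eq_abs]
    calc _ ≤ N * (N * N) := by gcongr; exact H.baa _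
      _ = _ := by ring) 0 (mem_univ _) x (mem_univ _)
  simpa using this
lemma bLL {l : ℝ} (γ : ℝ) (hl : |l| ≤ N) (x y : ℝ) : ‖(l : ℂ) * (l * zaa (γ + l * x)) - l * (l * zaa (γ + l * y))‖ ≤ N ^ 4 * |x - y| := by
  have hN := H.hN
  rw [← mul_sub, ← mul_sub, norm_mul, norm_mul, norm_real, Real.norm_eq_abs]
  have : |γ + l * x - (γ + l * y)| ≤ N * |x - y| := by rw [add_sub_add_left_eq_sub, ← mul_sub, abs_mul]; gcongr
  calc _ ≤ N * (N * (N * (N * |x - y|))) := by gcongr; exact (H.Laa _ _).trans (by gcongr)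
    _ = _ := by ring

/-- displacement function -/
lemma w1 (x : ℝ) : HasDerivAt (fun x => conj τ * (z (β0 + mu * x) - z (α0 + lam * x)) - I * d)
    (conj τ * (mu * za (β0 + mu * x) - lam * za (α0 + lam * x))) x :=
  (((H.bd β0 mu x).sub (H.bd α0 lam x)).const_mul _).sub_const _
lemma w2 (x : ℝ) : HasDerivAt (fun x => conj τ * (mu * za (β0 + mu * x) - lam * za (α0 + lam * x)))
    (conj τ * (mu * (mu * zaa (β0 + mu * x)) - lam * (lam * zaa (α0 + lam * x)))) x :=
  ((H.bdd β0 mu x).sub (H.bdd α0 lam x)).const_mul _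

lemma nc : ‖conj τ‖ = 1 := by rw [norm_conj]; exact H.nτ
lemma cc : conj τ * τ = 1 := by rw [mul_comm, mul_conj, normSq_eq_norm_sq, H.nτ]; norm_num

lemma w0 : conj τ * (z (β0 + mu * 0) - z (α0 + lam * 0)) - I * d = 0 := by
  simp only [mul_zero, add_zero, H.dd]
  linear_combination (I * d) * H.cc

lemma w1b (x : ℝ) : ‖conj τ * (mu * za (β0 + mu * x) - lam * za (α0 + lam * x))‖ ≤ 2 * N ^ 3 * |x| := by
  rw [norm_mul, H.nc, one_mul]
  have e1 := H.bdb β0 H.bmu x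
  have e2 := H.bdb α0 H.blam x
  rw [H.tT] at e1; rw [H.tb] at e2
  calc _ = ‖(mu * za (β0 + mu * x) - τ) - (lam * za (α0 + lam * x) - τ)‖ := by rw [sub_sub_sub_cancel_right]
    _ ≤ _ := (norm_sub_le _ _).trans (by linarith)

lemma wb {x : ℝ} : ‖conj τ * (z (β0 + mu * x) - z (α0 + lam * x)) - I * d‖ ≤ 2 * N ^ 3 * x ^ 2 := by
  have hN := H.hN
  have := lip1 (convex_Icc (-|x|) |x|) (fun x _ => (H.w1 x).hasDerivWithinAt) (C := 2 * N ^ 3 * |x|) (fun y hy => (H.w1b y).trans (mul_le_mul_of_nonneg_left (abs_le.2 hy) (by positivity)))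
    0 (by simp) x ⟨neg_abs_le x, le_abs_self x⟩
  rw [H.w0, sub_zero, sub_zero] at this
  refine this.trans (le_of_eq ?_); rw [mul_assoc, ← sq, sq_abs]

lemma wodd {x : ℝ} (hx : 0 ≤ x) : ‖(conj τ * (z (β0 + mu * x) - z (α0 + lam * x)) - I * d) - (conj τ * (z (β0 + mu * (-x)) - z (α0 + lam * (-x))) - I * d)‖ ≤ 4 * N ^ 4 * x ^ 3 := by
  have hN := H.hN
  have := odd3 (D := 2 * N ^ 4) (by positivity) H.w1 H.w2 (fun x y => by
    rw [← mul_sub, norm_mul, H.nc, one_mul]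
    have e1 := H.bLL β0 H.bmu x y
    have e2 := H.bLL α0 H.blam x y
    rw [sub_sub_sub_comm]
    refine (norm_sub_le _ _).trans (by linarith)) hx
  have e : conj τ * (mu * za (β0 + mu * 0) - lam * za (α0 + lam * 0)) = 0 := by
    rw [mul_zero, mul_zero, add_zero, add_zero, H.tT, H.tb, sub_self, mul_zero]
  rw [e, smul_zero, sub_zero] at this
  refine this.trans (le_of_eq (by ring))

/-- segments stay in the fluid -/
lemma segs (hcl : ∀ S : Set ℂ, IsPreconnected S → (∀ x ∈ S, x ∉ range z) → ∀ x ∈ S, x ∈ Ω → S ⊆ Ω) {R : ℝ} (hR0 : 0 < R)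
    (hR : 100 * N ^ 6 * R ^ 2 ≤ d) (hR2 : 100 * N ^ 6 * R ≤ 1) (hd2 : 100 * N ^ 6 * d ≤ 1) {x s : ℝ} (hx : x ∈ Icc (-R) R) (hs : s ∈ Ioo (0:ℝ) 1) :
    z (α0 + lam * x) + s * (z (β0 + mu * x) - z (α0 + lam * x)) ∈ Ω := by
  have hN := H.hN; have hd := H.hd
  let F : ℝ × ℝ → ℂ := fun y => z (α0 + lam * y.1) + y.2 * (z (β0 + mu * y.1) - z (α0 + lam * y.1))
  have hzc : Continuous z := continuous_iff_continuousAt.2 fun α => (H.hz α).continuousAt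
  have hF : Continuous F := by fun_prop
  have hpre : IsPreconnected (F '' (Icc (-R) R ×ˢ Ioo 0 1)) := ((convex_Icc (-R) R).prod (convex_Ioo 0 1)).isPreconnected.image F hF.continuousOn
  refine hcl _ hpre ?_ (F (0, 1/2)) ⟨(0, 1/2), ⟨⟨by simpa using hR0.le, hR0.le⟩, by norm_num, by norm_num⟩, rfl⟩ ?_ ⟨(x, s), ⟨hx, hs⟩, rfl⟩
  · rintro _ ⟨⟨y, s⟩, ⟨hy, hs⟩, rfl⟩ ⟨γ, hγ⟩
    simp only [F] at hγ
    have hyR : |y| ≤ R := abs_le.2 hy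
    have hw := H.wb (x := y)
    set w := conj τ * (z (β0 + mu * y) - z (α0 + lam * y)) - I * d with hwd
    have hw' : ‖w‖ ≤ d / 50 := by
      refine hw.trans ?_
      have h1 : y ^ 2 ≤ R ^ 2 := by rw [← sq_abs]; gcongr
      have h2 : N ^ 3 ≤ N ^ 6 := pow_le_pow_right₀ hN (by norm_num)
      have : 2 * N ^ 3 * y ^ 2 ≤ 2 * N ^ 6 * R ^ 2 := by gcongr
      linarith
    have hTb : z (β0 + mu * y) - z (α0 + lam * y) = τ * (I * d + w) := by rw [hwd]; linear_combination (-(z (β0 + mu * y) - z (α0 + lam * y))) * H.cc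
    have key : ∀ (g0 l s1 : ℝ), |l| ≤ N → l * za g0 = τ → 0 < s1 → s1 ≤ 1/2 → ∀ σ : ℝ, |σ| = 1 → z γ - z (g0 + l * y) = s1 * (σ * (τ * (I * d + w))) → False := by
      intro g0 l s1 hl ht hs1 hs2 σ hσ he
      have n0 : ‖I * d + w‖ ≤ 51/50 * d := by
        refine (norm_add_le _ _).trans ?_
        rw [norm_mul, norm_I, one_mul, norm_real, Real.norm_eq_abs, abs_of_pos hd]; linarith
      have n1 : ‖z γ - z (g0 + l * y)‖ ≤ s1 * (51/50 * d) := by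
        rw [he, norm_mul, norm_mul, norm_mul, norm_real, norm_real, Real.norm_eq_abs, Real.norm_eq_abs, hσ, H.nτ, abs_of_pos hs1, one_mul, one_mul]; gcongr
      have n2 : |γ - (g0 + l * y)| ≤ 2 * N * (s1 * (51/50 * d)) := by
        have : |γ - (g0 + l * y)| ≤ c := by
          by_contra hc
          push Not at hc
          have := H.far _ _ hc.le
          nlinarith
        refine (H.loc _ _ this).trans (by gcongr)
      set δ := γ - (g0 + l * y)
      have ty := tay1 (by positivity) convex_univ (fun x _ => (H.hz x).hasDerivWithinAt) (C := N) (fun x _ y _ => by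
        exact lip1 convex_univ (fun x _ => (H.hza x).hasDerivWithinAt) (fun x _ => H.baa x) x (mem_univ _) y (mem_univ _)) (g0 + l * y) (mem_univ _) γ (mem_univ _)
      have tb := H.bdb g0 hl y
      rw [ht] at tb
      have hlz : ∃ l' : ℝ, za g0 = l' * τ ∧ |l'| ≤ N := by
        have l0 : l ≠ 0 := fun h => by rw [h] at ht; simp at ht; have := H.nτ; rw [← ht] at this; simp at this
        have e : za g0 = ((l⁻¹ : ℝ) : ℂ) * τ := by rw [← ht]; push_cast; have : (l:ℂ) ≠ 0 := by exact_mod_cast l0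
                                                   field_simp
        refine ⟨l⁻¹, e, ?_⟩
        have := H.ba g0
        rwa [e, norm_mul, H.nτ, mul_one, norm_real] at this
      obtain ⟨l', hl1, hl2⟩ := hlz
      have zg : ‖za (g0 + l * y) - za g0‖ ≤ N * (N * R) := by
        refine (lip1 convex_univ (fun x _ => (H.hza x).hasDerivWithinAt) (fun x _ => H.baa x) g0 (mem_univ _) _ (mem_univ _)).trans ?_
        rw [add_sub_cancel_left, abs_mul]; gcongr
      have big : ‖z γ - z (g0 + l * y) - (δ * l' : ℝ) * τ‖ ≤ N * |δ| ^ 2 + |δ| * (N * (N * R)) := by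
        have : z γ - z (g0 + l * y) - (δ * l' : ℝ) * τ = (z γ - z (g0 + l * y) - δ • za (g0 + l * y)) + δ • (za (g0 + l * y) - za g0) := by
          rw [hl1]; simp only [real_smul]; push_cast; ring
        rw [this]
        refine (norm_add_le _ _).trans (add_le_add ty ?_)
        rw [norm_smul, Real.norm_eq_abs]; gcongr
      have low : s1 * (49/50 * d) ≤ ‖z γ - z (g0 + l * y) - (δ * l' : ℝ) * τ‖ := by
        have e : z γ - z (g0 + l * y) - (δ * l' : ℝ) * τ = τ * ((s1 * σ : ℝ) * (I * d + w) - (δ * l' : ℝ)) := by rw [he]; push_cast; ring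
        rw [e, norm_mul, H.nτ, one_mul]
        refine le_trans ?_ (abs_im_le_norm _)
        rw [sub_im, ofReal_im, sub_zero, im_ofReal_mul, abs_mul, abs_mul, hσ, mul_one, abs_of_pos hs1]
        gcongr
        have : (I * d + w).im = d + w.im := by simp
        rw [this]
        have := (abs_le.1 ((abs_im_le_norm w).trans hw')).1
        exact le_trans (by linarith) (le_abs_self _)
      have f1 : N * |δ| ^ 2 ≤ N * (2 * N * (s1 * (51/50 * d))) ^ 2 := by gcongr
      have f2 : |δ| * (N * (N * R)) ≤ 2 * N * (s1 * (51/50 * d)) * (N * (N * R)) := by gcongr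
      have n6 : N ^ 3 ≤ N ^ 6 := pow_le_pow_right₀ hN (by norm_num)
      have g1 : 100 * (N ^ 3 * d) ≤ 1 := le_trans (by nlinarith) hd2
      have g2 : 100 * (N ^ 3 * R) ≤ 1 := le_trans (by nlinarith) hR2
      have sd : 0 < s1 * d := by positivity
      have e1 : N * (2 * N * (s1 * (51/50 * d))) ^ 2 = (s1 * d) * (s1 * (10404/2500 * (N ^ 3 * d))) := by ring
      have e2 : 2 * N * (s1 * (51/50 * d)) * (N * (N * R)) = (s1 * d) * (102/50 * (N ^ 3 * R)) := by ring
      have e3 : s1 * (10404/2500 * (N ^ 3 * d)) ≤ 1/2 * (10404/2500 * (N ^ 3 * d)) := by gcongr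
      have e4 := mul_le_mul_of_nonneg_left e3 sd.le
      have e5 : (s1 * d) * (102/50 * (N ^ 3 * R)) ≤ (s1 * d) * (102/5000) := mul_le_mul_of_nonneg_left (by linarith) sd.le
      have e6 : (s1 * d) * (1/2 * (10404/2500 * (N ^ 3 * d))) ≤ (s1 * d) * (10404/500000) := mul_le_mul_of_nonneg_left (by linarith) sd.le
      rw [e1] at f1; rw [e2] at f2
      linarith
    rcases le_total s (1/2) with h | h
    · refine key α0 lam s H.blam H.tb hs.1 h 1 (by simp) ?_
      rw [hγ, hTb]; push_cast; ring
    · refine key β0 mu (1 - s) H.bmu H.tT (by linarith [hs.2]) (by linarith) (-1) (by simp) ?_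
      rw [hγ, ← hTb]; push_cast; ring
  · have := H.seg (1/2) ⟨by norm_num, by norm_num⟩
    simpa [F] using this

end NW
end NS

namespace NS
open Complex Topology Metric ComplexConjugate

lemma apx {Wd Wb T b Δ F G : ℂ} {η e1 e2 e3 N n D : ℝ} (h0 : 0 ≤ η) (h1 : η ≤ 1/2) (hn : 0 ≤ n) (hN : 0 ≤ N) (a1 : ‖Wd - Wb‖ ≤ e1) (a2 : ‖Wb‖ ≤ e2) (a3 : ‖F - G‖ ≤ e3)
    (a4 : ‖F‖ ≤ N) (a5 : ‖T‖ ≤ n) (a6 : ‖b‖ ≤ n) (a7 : ‖Δ‖ ≤ D) :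
    ‖(Wd * (T - η * (T - b)) - F * (b + η * (T - b)) * ((1 - 2 * η) * Δ)) - (Wb * T - G * b * Δ)‖ ≤ e1 * n + e2 * (η * (2 * n)) + e3 * n * D + N * (4 * n * η) * D := by
  have e0 : (Wd * (T - η * (T - b)) - F * (b + η * (T - b)) * ((1 - 2 * η) * Δ)) - (Wb * T - G * b * Δ)
      = (Wd - Wb) * (T - η * (T - b)) - Wb * (η * (T - b)) - (F - G) * b * Δ - F * (η * (T - b) * (1 - 2 * η) - 2 * η * b) * Δ := by ring
  have e10 := (norm_nonneg _).trans a1; have e20 := (norm_nonneg _).trans a2; have e30 := (norm_nonneg _).trans a3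
  have hη : ‖(η:ℂ)‖ = η := by rw [norm_real, Real.norm_eq_abs, abs_of_nonneg h0]
  have hη1 : ‖(1:ℂ) - η‖ = 1 - η := by rw [← ofReal_one, ← ofReal_sub, norm_real, Real.norm_eq_abs, abs_of_nonneg (by linarith)]
  have hη2 : ‖(1:ℂ) - 2 * η‖ ≤ 1 := by
    have : (1:ℂ) - 2 * η = ((1 - 2 * η : ℝ) : ℂ) := by push_cast; ring
    rw [this, norm_real, Real.norm_eq_abs, abs_of_nonneg (by linarith)]; linarith
  have t1 : ‖T - η * (T - b)‖ ≤ n := by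
    have : T - η * (T - b) = (1 - η) * T + η * b := by ring
    rw [this]
    refine (norm_add_le _ _).trans ?_
    rw [norm_mul, norm_mul, hη, hη1]
    nlinarith
  have t2 : ‖η * (T - b)‖ ≤ η * (2 * n) := by
    rw [norm_mul, hη]; gcongr; exact (norm_sub_le _ _).trans (by linarith)
  have t3 : ‖η * (T - b) * (1 - 2 * η) - 2 * η * b‖ ≤ 4 * n * η := by
    refine (norm_sub_le _ _).trans ?_
    rw [norm_mul, norm_mul (2 * (η:ℂ)), norm_mul (2:ℂ), hη]
    have : ‖(2:ℂ)‖ = 2 := by simp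
    rw [this]
    have := mul_le_mul t2 hη2 (norm_nonneg _) (by positivity)
    have : 2 * η * ‖b‖ ≤ 2 * η * n := by gcongr
    linarith
  rw [e0]
  refine (norm_sub_le _ _).trans (add_le_add ((norm_sub_le _ _).trans (add_le_add ((norm_sub_le _ _).trans (add_le_add ?_ ?_)) ?_)) ?_)
  · rw [norm_mul]; gcongr
  · rw [norm_mul]; gcongr
  · rw [norm_mul, norm_mul]; gcongr
  · rw [norm_mul, norm_mul]; gcongr

/-- the algebra behind the derivative lower bound -/
lemma alg {N d x P lam p1 p2 q1 q2 : ℝ} {Y1 Y2 th1 th2 w1 w2 : ℂ} (hN : 1 ≤ N) (hx : 0 ≤ x) (hd : 0 < d)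
    (hP : 2 * x * P - 4 * N ^ 4 * x ^ 3 ≤ Y1.im - Y2.im) (hY1 : ‖Y1‖ ≤ N * (2 * d)) (hY2 : ‖Y2‖ ≤ N * (2 * d)) (ht1 : ‖th1‖ ≤ N ^ 3 * x) (ht2 : ‖th2‖ ≤ N ^ 3 * x)
    (hw1 : ‖w1‖ ≤ 2 * N ^ 3 * x ^ 2) (hwd : ‖w1‖ ≤ d) (hw : ‖w1 - w2‖ ≤ 4 * N ^ 4 * x ^ 3) (hl : |lam| ≤ N) (hp2 : |p2| ≤ N) (hq2 : |q2| ≤ N)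
    (hp : lam * (p1 - p2) ≤ 2 * N ^ 3 * x) (hq : |q1 - q2| ≤ 2 * N ^ 2 * x) :
    2 * x * P - 8 * N ^ 4 * d * x - 16 * N ^ 6 * x ^ 3 ≤ (Y1 * (1 + th1) - lam * (p1 + q1 * I) * (I * d + w1) - (Y2 * (1 + th2) - lam * (p2 + q2 * I) * (I * d + w2))).im := by
  have e : (Y1 * (1 + th1) - lam * (p1 + q1 * I) * (I * d + w1) - (Y2 * (1 + th2) - lam * (p2 + q2 * I) * (I * d + w2))).im
      = (Y1.im - Y2.im) + (Y1 * th1).im - (Y2 * th2).im - lam * (p1 - p2) * (d + w1.im) - lam * p2 * (w1 - w2).im - lam * (q1 - q2) * w1.re - lam * q2 * (w1 - w2).re := by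
    simp; ring
  have b1 : |(Y1 * th1).im| ≤ 2 * N ^ 4 * d * x := by
    refine (abs_im_le_norm _).trans ?_
    rw [norm_mul]
    calc _ ≤ (N * (2 * d)) * (N ^ 3 * x) := by gcongr
      _ = _ := by ring
  have b2 : |(Y2 * th2).im| ≤ 2 * N ^ 4 * d * x := by
    refine (abs_im_le_norm _).trans ?_
    rw [norm_mul]
    calc _ ≤ (N * (2 * d)) * (N ^ 3 * x) := by gcongr
      _ = _ := by ring
  have c1 := abs_le.1 ((abs_im_le_norm w1).trans hwd)
  have b3 : lam * (p1 - p2) * (d + w1.im) ≤ 4 * N ^ 4 * d * x := by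
    have n4 : N ^ 3 ≤ N ^ 4 := pow_le_pow_right₀ hN (by norm_num)
    calc _ ≤ 2 * N ^ 3 * x * (d + w1.im) := mul_le_mul_of_nonneg_right hp (by linarith)
      _ ≤ 2 * N ^ 3 * x * (2 * d) := by gcongr; linarith
      _ ≤ 2 * N ^ 4 * x * (2 * d) := by gcongr
      _ = _ := by ring
  have b4 : |lam * p2 * (w1 - w2).im| ≤ 4 * N ^ 6 * x ^ 3 := by
    rw [abs_mul, abs_mul]
    calc _ ≤ N * N * (4 * N ^ 4 * x ^ 3) := by gcongr; exact (abs_im_le_norm _).trans hw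
      _ = _ := by ring
  have b5 : |lam * q2 * (w1 - w2).re| ≤ 4 * N ^ 6 * x ^ 3 := by
    rw [abs_mul, abs_mul]
    calc _ ≤ N * N * (4 * N ^ 4 * x ^ 3) := by gcongr; exact (abs_re_le_norm _).trans hw
      _ = _ := by ring
  have b6 : |lam * (q1 - q2) * w1.re| ≤ 4 * N ^ 6 * x ^ 3 := by
    rw [abs_mul, abs_mul]
    calc _ ≤ N * (2 * N ^ 2 * x) * (2 * N ^ 3 * x ^ 2) := by gcongr; exact (abs_re_le_norm _).trans hw1
      _ = _ := by ring
  have b7 : 4 * N ^ 4 * x ^ 3 ≤ 4 * N ^ 6 * x ^ 3 := by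
    have n4 : N ^ 4 ≤ N ^ 6 := pow_le_pow_right₀ hN (by norm_num)
    gcongr
  rw [e]
  have := abs_le.1 b1; have := abs_le.1 b2; have := abs_le.1 b4; have := abs_le.1 b5; have := abs_le.1 b6
  linarith

namespace NW
variable {N c d : ℝ} {z za zaa : ℝ → ℂ} {Ω : Set ℂ} {f : ℂ → ℂ} {p q qa : ℝ → ℝ} {α0 β0 lam mu : ℝ} {τ : ℂ}
  (H : NW N c d z za zaa Ω f p q qa α0 β0 lam mu τ)
include H

lemma nb {γ l : ℝ} (hl : |l| ≤ N) : ‖(l:ℂ) * za γ‖ ≤ N ^ 2 := by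
  have hN := H.hN
  rw [norm_mul, norm_real, Real.norm_eq_abs, sq]; gcongr; exact H.ba γ

lemma wd {R : ℝ} (hR : 100 * N ^ 6 * R ^ 2 ≤ d) {x : ℝ} (hx : x ∈ Icc (-R) R) : ‖conj τ * (z (β0 + mu * x) - z (α0 + lam * x)) - I * d‖ ≤ d := by
  have hN := H.hN
  refine H.wb.trans ?_
  have h1 : x ^ 2 ≤ R ^ 2 := by rw [← sq_abs]; have := abs_le.2 hx; gcongr
  have h2 : N ^ 3 ≤ N ^ 6 := pow_le_pow_right₀ hN (by norm_num)
  have : 2 * N ^ 3 * x ^ 2 ≤ 2 * N ^ 6 * R ^ 2 := by gcongr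
  have : 0 ≤ N ^ 6 * R ^ 2 := by positivity
  linarith

lemma dTb {R : ℝ} (hR : 100 * N ^ 6 * R ^ 2 ≤ d) {x : ℝ} (hx : x ∈ Icc (-R) R) : ‖z (β0 + mu * x) - z (α0 + lam * x)‖ ≤ 2 * d := by
  have h := H.wd hR hx
  have : ‖z (β0 + mu * x) - z (α0 + lam * x)‖ = ‖(conj τ * (z (β0 + mu * x) - z (α0 + lam * x)) - I * d) + I * d‖ := by
    rw [sub_add_cancel, norm_mul, H.nc, one_mul]
  rw [this]
  refine (norm_add_le _ _).trans ?_
  rw [norm_mul, norm_I, one_mul, norm_real, Real.norm_eq_abs, abs_of_pos H.hd]; linarith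

variable {W V : ℂ → ℂ} {Wb : ℝ → ℂ} {C r R : ℝ} (hcl : ∀ S : Set ℂ, IsPreconnected S → (∀ x ∈ S, x ∉ range z) → ∀ x ∈ S, x ∈ Ω → S ⊆ Ω)
  (hW : ∀ x ∈ Ω, HasDerivAt W (f x) x) (hV : ∀ x ∈ Ω, HasDerivAt V (W x) x) (hWb : ∀ α, HasDerivAt Wb (f (z α) * za α) α) (hC : 0 ≤ C) (hr : 0 < r)
  (lim : ∀ x ∈ Ω, ∀ α, ‖x - z α‖ < r → ‖W x - Wb α‖ ≤ C * ‖x - z α‖) (fH : ∀ x ∈ Ω, ∀ α, ‖f x - f (z α)‖ ≤ C * √‖x - z α‖)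
  (hR0 : 0 < R) (hR : 100 * N ^ 6 * R ^ 2 ≤ d) (hR2 : 100 * N ^ 6 * R ≤ 1) (hd2 : 100 * N ^ 6 * d ≤ 1)
include hcl hR0 hR hR2 hd2

lemma dd1 : d ≤ 1 := by
  have := H.hd; have h2 : 1 ≤ N ^ 6 := one_le_pow₀ H.hN
  nlinarith

include hW hC lim
lemma Wap {x η : ℝ} (hx : x ∈ Icc (-R) R) (h0 : 0 < η) (h1 : η < 1/2) (h2 : η * (2 * d) < r) :
    ‖(W (z (β0 + mu * x) - η * (z (β0 + mu * x) - z (α0 + lam * x))) - W (z (α0 + lam * x) + η * (z (β0 + mu * x) - z (α0 + lam * x)))) - (Wb (β0 + mu * x) - Wb (α0 + lam * x))‖ ≤ 2 * (C * (η * (2 * d))) ∧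
    ‖W (z (β0 + mu * x) - η * (z (β0 + mu * x) - z (α0 + lam * x))) - W (z (α0 + lam * x) + η * (z (β0 + mu * x) - z (α0 + lam * x)))‖ ≤ N * (2 * d) := by
  have sg := fun s hs => H.segs hcl hR0 hR hR2 hd2 (s := s) hx hs
  have nn := H.dTb hR hx
  set T := z (β0 + mu * x) with hT
  set b := z (α0 + lam * x) with hb
  have hη : ‖(η:ℂ)‖ = η := by rw [norm_real, Real.norm_eq_abs, abs_of_pos h0]
  have n1 : ‖(η:ℂ) * (T - b)‖ ≤ η * (2 * d) := by rw [norm_mul, hη]; gcongr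
  have m1 : T - η * (T - b) ∈ Ω := by
    have := sg (1 - η) ⟨by linarith, by linarith⟩
    convert this using 1; push_cast; ring
  have m2 : b + η * (T - b) ∈ Ω := sg η ⟨h0, by linarith⟩
  have l1 : ‖T - η * (T - b) - z (β0 + mu * x)‖ = ‖(η:ℂ) * (T - b)‖ := by rw [← hT, sub_sub_cancel_left, norm_neg]
  have l2 : ‖b + η * (T - b) - z (α0 + lam * x)‖ = ‖(η:ℂ) * (T - b)‖ := by rw [← hb, add_sub_cancel_left]
  have u1 := lim _ m1 (β0 + mu * x) (by rw [l1]; linarith)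
  have u2 := lim _ m2 (α0 + lam * x) (by rw [l2]; linarith)
  rw [l1] at u1; rw [l2] at u2
  have hC1 : C * ‖(η:ℂ) * (T - b)‖ ≤ C * (η * (2 * d)) := by gcongr
  have hN := H.hN; have hd := H.hd
  constructor
  · rw [sub_sub_sub_comm]
    refine (norm_sub_le _ _).trans ?_
    linarith
  · have hg : ∀ s ∈ Icc η (1 - η), HasDerivWithinAt (fun s : ℝ => W (b + s * (T - b))) (f (b + s * (T - b)) * (T - b)) (Icc η (1 - η)) s := fun s hs => by
      have h1 := hW _ (sg s ⟨h0.trans_le hs.1, by linarith [hs.2]⟩)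
      have h2 : HasDerivAt (fun s : ℝ => b + s * (T - b)) (T - b) s := by
        simpa using ((hasDerivAt_id s).ofReal_comp.mul_const (T - b)).const_add b
      exact (h1.comp s h2).hasDerivWithinAt
    have := lip1 (C := N * (2 * d)) (convex_Icc η (1 - η)) hg (fun s hs => by
      rw [norm_mul]; gcongr; exact H.M _ (sg s ⟨h0.trans_le hs.1, by linarith [hs.2]⟩)) η ⟨le_rfl, by linarith⟩ (1 - η) ⟨by linarith, le_rfl⟩
    have e : T - η * (T - b) = b + ((1 - η : ℝ):ℂ) * (T - b) := by push_cast; ring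
    rw [e]
    refine this.trans ?_
    rw [abs_of_nonneg (by linarith)]
    have : 0 ≤ N * (2 * d) := by positivity
    nlinarith

include hr
lemma WbD {x : ℝ} (hx : x ∈ Icc (-R) R) : ‖Wb (β0 + mu * x) - Wb (α0 + lam * x)‖ ≤ N * (2 * d) := by
  have hd := H.hd
  have t : Tendsto (fun η : ℝ => N * (2 * d) + 2 * (C * (η * (2 * d)))) (𝓝[>] 0) (𝓝 (N * (2 * d) + 2 * (C * (0 * (2 * d))))) :=
    (Continuous.tendsto (by fun_prop) 0).mono_left inf_le_left
  rw [zero_mul, mul_zero, mul_zero, add_zero] at t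
  refine ge_of_tendsto t ?_
  have : (0:ℝ) < min (1/2) (r / (2 * d)) := by positivity
  filter_upwards [Ioo_mem_nhdsGT this] with η hη
  obtain ⟨a1, a2⟩ := H.Wap hcl hW hC lim hR0 hR hR2 hd2 hx hη.1 (hη.2.trans_le (min_le_left _ _)) (by have := hη.2.trans_le (min_le_right _ _); rwa [lt_div_iff₀ (by positivity)] at this)
  calc _ = ‖(W (z (β0 + mu * x) - η * (z (β0 + mu * x) - z (α0 + lam * x))) - W (z (α0 + lam * x) + η * (z (β0 + mu * x) - z (α0 + lam * x)))) - ((W (z (β0 + mu * x) - η * (z (β0 + mu * x) - z (α0 + lam * x))) - W (z (α0 + lam * x) + η * (z (β0 + mu * x) - z (α0 + lam * x)))) - (Wb (β0 + mu * x) - Wb (α0 + lam * x)))‖ := by rw [sub_sub_cancel]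
    _ ≤ _ := (norm_sub_le _ _).trans (add_le_add a2 a1)

include hV fH
lemma Eap {x η : ℝ} (hx : x ∈ Icc (-R) R) (h0 : 0 < η) (h1 : η < 1/2) (h2 : η * (2 * d) < r) :
    ∃ e, HasDerivAt (fun x => V (z (β0 + mu * x) - η * (z (β0 + mu * x) - z (α0 + lam * x))) - V (z (α0 + lam * x) + η * (z (β0 + mu * x) - z (α0 + lam * x)))
      - W (z (α0 + lam * x) + η * (z (β0 + mu * x) - z (α0 + lam * x))) * ((1 - 2 * η) * (z (β0 + mu * x) - z (α0 + lam * x)))) e x ∧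
    ‖e - ((Wb (β0 + mu * x) - Wb (α0 + lam * x)) * (mu * za (β0 + mu * x)) - f (z (α0 + lam * x)) * (lam * za (α0 + lam * x)) * (z (β0 + mu * x) - z (α0 + lam * x)))‖ ≤ (8 * C * N ^ 2 + 12 * N ^ 3) * √η ∧
    ‖V (z (β0 + mu * x) - η * (z (β0 + mu * x) - z (α0 + lam * x))) - V (z (α0 + lam * x) + η * (z (β0 + mu * x) - z (α0 + lam * x)))
      - W (z (α0 + lam * x) + η * (z (β0 + mu * x) - z (α0 + lam * x))) * ((1 - 2 * η) * (z (β0 + mu * x) - z (α0 + lam * x)))‖ ≤ 4 * N * d ^ 2 := by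
  have hN := H.hN; have hd := H.hd
  have d1 := H.dd1 hcl hR0 hR hR2 hd2
  have sg := fun s hs => H.segs hcl hR0 hR hR2 hd2 (s := s) hx hs
  have nn := H.dTb hR hx
  obtain ⟨a1, a2⟩ := H.Wap hcl hW hC lim hR0 hR hR2 hd2 hx h0 h1 h2
  have a3 := H.WbD hcl hW hC hr lim hR0 hR hR2 hd2 hx
  have hT' := H.bd β0 mu x
  have hb' := H.bd α0 lam x
  have m1 : z (β0 + mu * x) - η * (z (β0 + mu * x) - z (α0 + lam * x)) ∈ Ω := by
    have := sg (1 - η) ⟨by linarith, by linarith⟩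
    convert this using 1; push_cast; ring
  have m2 : z (α0 + lam * x) + η * (z (β0 + mu * x) - z (α0 + lam * x)) ∈ Ω := sg η ⟨h0, by linarith⟩
  have dT := hT'.sub ((hT'.sub hb').const_mul (η:ℂ))
  have db := hb'.add ((hT'.sub hb').const_mul (η:ℂ))
  have D := (((hV _ m1).comp x dT).sub ((hV _ m2).comp x db)).sub (((hW _ m2).comp x db).mul ((hT'.sub hb').const_mul ((1:ℂ) - 2 * η)))
  have fh := fH _ m2 (α0 + lam * x)
  rw [add_sub_cancel_left] at fh
  have hη : ‖(η:ℂ)‖ = η := by rw [norm_real, Real.norm_eq_abs, abs_of_pos h0]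
  have fh2 : ‖f (z (α0 + lam * x) + η * (z (β0 + mu * x) - z (α0 + lam * x))) - f (z (α0 + lam * x))‖ ≤ C * (2 * √η) := by
    refine fh.trans (mul_le_mul_of_nonneg_left ?_ hC)
    rw [norm_mul, hη]
    refine Real.sqrt_le_iff.2 ⟨by positivity, ?_⟩
    rw [mul_pow, Real.sq_sqrt h0.le]; nlinarith
  refine ⟨_, D, ?_, ?_⟩
  · have ap := apx h0.le h1.le (by positivity : (0:ℝ) ≤ N ^ 2) (by positivity) a1 a3 fh2 (H.M _ m2) (H.nb H.bmu (γ := β0 + mu * x)) (H.nb H.blam (γ := α0 + lam * x)) nn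
    have sη : η ≤ √η := by rw [Real.le_sqrt h0.le h0.le]; nlinarith
    refine le_trans (le_of_eq ?_) (ap.trans ?_)
    · congr 1; simp only [Function.comp, Pi.sub_apply, Pi.add_apply]; ring
    · have q1 : 0 ≤ C * N ^ 2 := by positivity
      have q2 : 0 ≤ N ^ 3 := by positivity
      have s0 := Real.sqrt_nonneg η
      have r1 : η * d ≤ √η := by nlinarith
      have r2 : √η * d ≤ √η := by nlinarith
      have p1 := mul_le_mul_of_nonneg_left r1 q1
      have p2 := mul_le_mul_of_nonneg_left r2 q1
      have p3 := mul_le_mul_of_nonneg_left r1 q2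
      linear_combination 4 * p1 + 4 * p2 + 12 * p3
  · set T := z (β0 + mu * x)
    set b := z (α0 + lam * x)
    have hl : ∀ s : ℝ, HasDerivAt (fun s : ℝ => b + s * (T - b)) (T - b) s := fun s => by
        simpa using ((hasDerivAt_id s).ofReal_comp.mul_const (T - b)).const_add b
    have hg : ∀ s ∈ Icc η (1 - η), HasDerivWithinAt (fun s : ℝ => V (b + s * (T - b))) (W (b + s * (T - b)) * (T - b)) (Icc η (1 - η)) s := fun s hs =>
      ((hV _ (sg s ⟨h0.trans_le hs.1, by linarith [hs.2]⟩)).comp s (hl s)).hasDerivWithinAt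
    have hg2 : ∀ s ∈ Icc η (1 - η), HasDerivWithinAt (fun s : ℝ => W (b + s * (T - b)) * (T - b)) (f (b + s * (T - b)) * (T - b) * (T - b)) (Icc η (1 - η)) s := fun s hs =>
      (((hW _ (sg s ⟨h0.trans_le hs.1, by linarith [hs.2]⟩)).comp s (hl s)).mul_const _).hasDerivWithinAt
    have hh := tay1 (C := N * (2 * d) * (2 * d)) (by positivity) (convex_Icc η (1 - η)) hg (lip1 (convex_Icc η (1 - η)) hg2 (fun s hs => by
      rw [norm_mul, norm_mul]; gcongr; exact H.M _ (sg s ⟨h0.trans_le hs.1, by linarith [hs.2]⟩))) η ⟨le_rfl, by linarith⟩ (1 - η) ⟨by linarith, le_rfl⟩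
    have e : T - η * (T - b) = b + ((1 - η : ℝ):ℂ) * (T - b) := by push_cast; ring
    rw [e]
    refine le_trans (le_of_eq ?_) (hh.trans ?_)
    · congr 1; rw [real_smul]; push_cast; ring
    · have : |1 - η - η| ^ 2 ≤ 1 := by rw [sq_abs]; nlinarith
      calc _ ≤ N * (2 * d) * (2 * d) * 1 := by gcongr
        _ = _ := by ring

omit hV fH hC
include hWb
lemma Dlow {x : ℝ} (hx : x ∈ Icc 0 R) (hY : ∀ x ∈ Icc (-R) R, ‖Wb (β0 + mu * x) - Wb (α0 + lam * x)‖ ≤ N * (2 * d)) {D : ℝ → ℂ}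
    (hD : ∀ x, D x = (Wb (β0 + mu * x) - Wb (α0 + lam * x)) * (mu * za (β0 + mu * x)) - f (z (α0 + lam * x)) * (lam * za (α0 + lam * x)) * (z (β0 + mu * x) - z (α0 + lam * x))) :
    2 * x * (mu * q β0 - lam * q α0) - 8 * N ^ 4 * d * x - 16 * N ^ 6 * x ^ 3 ≤ (conj τ * (D x - D (-x))).im := by
  have hN := H.hN; have hd := H.hd
  have i1 : x ∈ Icc (-R) R := ⟨by linarith [hx.1], hx.2⟩
  have i2 : -x ∈ Icc (-R) R := ⟨by linarith [hx.2], by linarith [hx.1]⟩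
  have th : ∀ y, ‖conj τ * (mu * za (β0 + mu * y)) - 1‖ ≤ N ^ 3 * |y| := fun y => by
    have := H.bdb β0 H.bmu y
    rw [H.tT] at this
    calc _ = ‖conj τ * (mu * za (β0 + mu * y) - τ)‖ := by rw [mul_sub, H.cc]
      _ ≤ _ := by rw [norm_mul, H.nc, one_mul]; exact this
  have q1 : ∀ γ l y, HasDerivAt (fun y => l * q (γ + l * y)) (l * (l * qa (γ + l * y))) y := fun γ l y => by
    have := ((H.hq (γ + l * y)).comp y (((hasDerivAt_id y).const_mul l).const_add γ)).const_mul l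
    exact this.congr_deriv (by ring)
  have hΦ : ∀ y, HasDerivAt (fun y => (Wb (β0 + mu * y) - Wb (α0 + lam * y)).im) (mu * q (β0 + mu * y) - lam * q (α0 + lam * y)) y := fun y => by
    have := him (((hWb (β0 + mu * y)).scomp y (((hasDerivAt_id y).const_mul mu).const_add β0)).sub ((hWb (α0 + lam * y)).scomp y (((hasDerivAt_id y).const_mul lam).const_add α0)))
    exact this.congr_deriv (by simp only [H.pq]; simp)
  have o := odd3 (D := 2 * N ^ 4) (by positivity) hΦ (fun y => (q1 β0 mu y).sub (q1 α0 lam y)) (fun u v => by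
    have k : ∀ γ l : ℝ, |l| ≤ N → |l * (l * qa (γ + l * u)) - l * (l * qa (γ + l * v))| ≤ N ^ 4 * |u - v| := fun γ l hl => by
      rw [← mul_sub, ← mul_sub, abs_mul, abs_mul]
      have : |γ + l * u - (γ + l * v)| ≤ N * |u - v| := by rw [add_sub_add_left_eq_sub, ← mul_sub, abs_mul]; gcongr
      calc _ ≤ N * (N * (N * (N * |u - v|))) := by gcongr; exact (H.Lqa _ _).trans (by gcongr)
        _ = _ := by ring
    rw [Real.norm_eq_abs, sub_sub_sub_comm]
    refine (abs_sub _ _).trans ?_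
    linarith [k β0 mu H.bmu, k α0 lam H.blam]) hx.1
  simp only [mul_zero, add_zero, Real.norm_eq_abs, smul_eq_mul] at o
  have hp : lam * (p (α0 + lam * x) - p (α0 + lam * (-x))) ≤ 2 * N ^ 3 * x := by
    have l2 : lam ^ 2 ≤ N ^ 2 := by rw [← sq_abs]; have := H.blam; gcongr
    have l3 : N * (lam ^ 2 * (2 * x)) ≤ N * (N ^ 2 * (2 * x)) := by have := hx.1; gcongr
    rcases le_total 0 lam with h | h
    · have := mul_le_mul_of_nonneg_left (H.Lp (α0 + lam * (-x)) (α0 + lam * x) (by nlinarith [hx.1])) h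
      linarith
    · have := mul_le_mul_of_nonneg_left (H.Lp (α0 + lam * x) (α0 + lam * (-x)) (by nlinarith [hx.1])) (neg_nonneg.2 h)
      linarith
  have hq : |q (α0 + lam * x) - q (α0 + lam * (-x))| ≤ 2 * N ^ 2 * x := by
    have := lip1 convex_univ (fun y _ => (H.hq y).hasDerivWithinAt) (fun y _ => H.bqa y) (α0 + lam * (-x)) (mem_univ _) (α0 + lam * x) (mem_univ _)
    refine this.trans ?_
    have e : α0 + lam * x - (α0 + lam * (-x)) = 2 * (lam * x) := by ring
    rw [e, abs_mul, abs_mul, abs_of_nonneg hx.1, abs_two]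
    have := mul_le_mul_of_nonneg_right H.blam hx.1
    nlinarith
  have t1 := th x; have t2 := th (-x)
  rw [abs_neg] at t2; rw [abs_of_nonneg hx.1] at t1 t2
  have key := alg (P := mu * q β0 - lam * q α0) (d := d) hN hx.1 hd (by linarith [(abs_le.1 o).1]) (hY x i1) (hY (-x) i2) t1 t2 H.wb (H.wd hR i1) (H.wodd hx.1) H.blam (H.bp _) (H.bq _) hp hq
  refine key.trans (le_of_eq ?_)
  congr 1
  rw [hD, hD]
  have p1 := H.pq (α0 + lam * x); have p2 := H.pq (α0 + lam * (-x))
  linear_combination (lam * (conj τ * (z (β0 + mu * x) - z (α0 + lam * x)))) * p1 - (lam * (conj τ * (z (β0 + mu * (-x)) - z (α0 + lam * (-x))))) * p2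
include hV fH hC
lemma necR : R ^ 2 * (mu * q β0 - lam * q α0) ≤ 4 * N ^ 4 * d * R ^ 2 + 4 * N ^ 6 * R ^ 4 + 16 * N * d ^ 2 := by
  have hN := H.hN; have hd := H.hd
  set K := 8 * C * N ^ 2 + 12 * N ^ 3 with hK
  set D : ℝ → ℂ := fun x => (Wb (β0 + mu * x) - Wb (α0 + lam * x)) * (mu * za (β0 + mu * x)) - f (z (α0 + lam * x)) * (lam * za (α0 + lam * x)) * (z (β0 + mu * x) - z (α0 + lam * x)) with hD
  set P := mu * q β0 - lam * q α0
  have main : ∀ η : ℝ, 0 < η → η < 1/2 → η * (2 * d) < r → R ^ 2 * P ≤ 4 * N ^ 4 * d * R ^ 2 + 4 * N ^ 6 * R ^ 4 + 16 * N * d ^ 2 + 2 * K * √η * R := by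
    intro η h0 h1 h2
    set E : ℝ → ℂ := fun x => V (z (β0 + mu * x) - η * (z (β0 + mu * x) - z (α0 + lam * x))) - V (z (α0 + lam * x) + η * (z (β0 + mu * x) - z (α0 + lam * x)))
      - W (z (α0 + lam * x) + η * (z (β0 + mu * x) - z (α0 + lam * x))) * ((1 - 2 * η) * (z (β0 + mu * x) - z (α0 + lam * x)))
    have hE : ∀ x ∈ Icc (-R) R, ∃ e, HasDerivAt E e x ∧ ‖e - D x‖ ≤ K * √η ∧ ‖E x‖ ≤ 4 * N * d ^ 2 := fun x hx =>
      H.Eap hcl hW hV hC hr lim fH hR0 hR hR2 hd2 hx h0 h1 h2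
    set G : ℝ → ℝ := fun x => (conj τ * (E x + E (-x))).im - (x ^ 2 * P - 4 * N ^ 4 * d * x ^ 2 - 4 * N ^ 6 * x ^ 4 - 2 * K * √η * x)
    have hG : ∀ x ∈ Icc 0 R, ∃ g, HasDerivAt G g x ∧ 0 ≤ g := fun x hx => by
      obtain ⟨e, a1, a2, -⟩ := hE x ⟨by linarith [hx.1], hx.2⟩
      obtain ⟨e', b1, b2, -⟩ := hE (-x) ⟨by linarith [hx.2], by linarith [hx.1]⟩
      have d1 := him ((a1.add (b1.scomp x (hasDerivAt_neg x))).const_mul (conj τ))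
      have d2 := (((((hasDerivAt_pow 2 x).mul_const P).sub ((hasDerivAt_pow 2 x).const_mul (4 * N ^ 4 * d))).sub ((hasDerivAt_pow 4 x).const_mul (4 * N ^ 6))).sub ((hasDerivAt_id x).const_mul (2 * K * √η)))
      refine ⟨_, d1.sub d2, ?_⟩
      have lo := H.Dlow hcl hW hWb hr lim hR0 hR hR2 hd2 hx (fun x hx => H.WbD hcl hW hC hr lim hR0 hR hR2 hd2 hx) (D := D) (fun x => rfl)
      have er : |(conj τ * ((e - D x) - (e' - D (-x)))).im| ≤ 2 * (K * √η) := by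
        refine (abs_im_le_norm _).trans ?_
        rw [norm_mul, H.nc, one_mul]
        exact (norm_sub_le _ _).trans (by linarith)
      have er := (abs_le.1 er).1
      have ee : (conj τ * (e + (-1:ℝ) • e')).im = (conj τ * (D x - D (-x))).im + (conj τ * ((e - D x) - (e' - D (-x)))).im := by
        rw [← add_im]; congr 1; rw [real_smul]; push_cast; ring
      rw [ee]
      generalize (conj τ * (D x - D (-x))).im = u1 at *
      generalize (conj τ * ((e - D x) - (e' - D (-x)))).im = u2 at *
      norm_num
      linarith
    have mono : G 0 ≤ G R := by
      choose! g hg using hG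
      refine monotoneOn_of_deriv_nonneg (convex_Icc 0 R) (fun x hx => (hg x hx).1.continuousAt.continuousWithinAt) (fun x hx => (hg x (interior_subset hx)).1.differentiableAt.differentiableWithinAt)
        (fun x hx => by rw [(hg x (interior_subset hx)).1.deriv]; exact (hg x (interior_subset hx)).2) ⟨le_rfl, hR0.le⟩ ⟨hR0.le, le_rfl⟩ hR0.le
    have nE : ∀ x ∈ Icc (-R) R, |(conj τ * E x).im| ≤ 4 * N * d ^ 2 := fun x hx => by
      obtain ⟨e, -, -, a3⟩ := hE x hx
      refine (abs_im_le_norm _).trans ?_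
      rw [norm_mul, H.nc, one_mul]; exact a3
    have n0 := abs_le.1 (nE 0 ⟨by linarith, hR0.le⟩)
    have n1 := abs_le.1 (nE R ⟨by linarith, le_rfl⟩)
    have n2 := abs_le.1 (nE (-R) ⟨le_rfl, by linarith⟩)
    simp only [G, mul_add, add_im, neg_zero] at mono
    generalize (conj τ * E 0).im = v0 at *
    generalize (conj τ * E R).im = v1 at *
    generalize (conj τ * E (-R)).im = v2 at *
    norm_num at mono
    linarith [n0.1, n1.2, n2.2]
  have t : Tendsto (fun η : ℝ => 4 * N ^ 4 * d * R ^ 2 + 4 * N ^ 6 * R ^ 4 + 16 * N * d ^ 2 + 2 * K * √η * R) (𝓝[>] 0) (𝓝 (4 * N ^ 4 * d * R ^ 2 + 4 * N ^ 6 * R ^ 4 + 16 * N * d ^ 2 + 2 * K * √0 * R)) :=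
    (Continuous.tendsto (by fun_prop) 0).mono_left inf_le_left
  rw [Real.sqrt_zero, mul_zero, zero_mul, add_zero] at t
  refine ge_of_tendsto t ?_
  have : (0:ℝ) < min (1/2) (r / (2 * d)) := by positivity
  filter_upwards [Ioo_mem_nhdsGT this] with η hη
  exact main η hη.1 (hη.2.trans_le (min_le_left _ _)) (by have := hη.2.trans_le (min_le_right _ _); rwa [lt_div_iff₀ (by positivity)] at this)

omit hR0 hR hR2 in
lemma neck : mu * q β0 - lam * q α0 ≤ 2000 * N ^ 7 * d := by
  have hN := H.hN; have hd := H.hd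
  have n6 : 1 ≤ N ^ 6 := one_le_pow₀ hN
  have hR2 : √(d / (100 * N ^ 6)) ^ 2 = d / (100 * N ^ 6) := Real.sq_sqrt (by positivity)
  have hRp : 0 < √(d / (100 * N ^ 6)) := Real.sqrt_pos.2 (by positivity)
  have h := H.necR (R := √(d / (100 * N ^ 6))) hcl hW hV hWb hC hr lim fH hRp (le_of_eq (by rw [hR2]; field_simp)) (by
    rw [← abs_of_pos (by positivity : 0 < 100 * N ^ 6 * √(d / (100 * N ^ 6))), ← sq_le_one_iff_abs_le_one, mul_pow, hR2]
    calc _ = 100 * N ^ 6 * d := by field_simp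
      _ ≤ 1 := hd2) hd2
  have e4 : √(d / (100 * N ^ 6)) ^ 4 = (d / (100 * N ^ 6)) ^ 2 := by
    calc _ = (√(d / (100 * N ^ 6)) ^ 2) ^ 2 := by ring
      _ = _ := by rw [hR2]
  rw [e4, hR2] at h
  have h2 : mu * q β0 - lam * q α0 ≤ 4 * N ^ 4 * d + d / 25 + 1600 * N ^ 7 * d := by
    have p : 0 < d / (100 * N ^ 6) := by positivity
    refine le_of_mul_le_mul_left (h.trans (le_of_eq ?_)) p
    field_simp; ring
  have n4 : N ^ 4 ≤ N ^ 7 := pow_le_pow_right₀ hN (by norm_num)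
  have n0 : 1 ≤ N ^ 7 := one_le_pow₀ hN
  have := mul_le_mul_of_nonneg_right n4 hd.le
  have := mul_le_mul_of_nonneg_right n0 hd.le
  linarith
end NW
end NS

namespace NS
open Complex Topology Metric ComplexConjugate

lemma dle {g : ℝ → ℝ} {g' x r : ℝ} (h : HasDerivAt g g' x) (hr : 0 < r) (h1 : ∀ y ∈ Ioo 0 r, g (x + y) ≤ g x) : g' ≤ 0 := by
  have := h.tendsto_slope_zero_right
  refine le_of_tendsto this ?_
  filter_upwards [Ioo_mem_nhdsGT hr] with y hy
  rw [smul_eq_mul]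
  exact mul_nonpos_of_nonneg_of_nonpos (inv_nonneg.2 hy.1.le) (by linarith [h1 y hy])

lemma aper {g : ℝ → ℝ} {P : ℝ} (h : ∀ α, g (α + 2 * Real.pi) = g α + P) (α y : ℝ) : g (α + 2 * Real.pi + y) - g (α + 2 * Real.pi) = g (α + y) - g α := by
  have e : α + 2 * Real.pi + y = (α + y) + 2 * Real.pi := by ring
  rw [e, h, h]; ring

structure LM (T C sm κ A : ℝ) (Λ p c G S σ St : ℝ → ℝ → ℝ) : Prop where
  T0 : 0 < T
  C0 : 0 ≤ C
  sm0 : 0 < sm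
  A0 : 0 ≤ A
  hΛ : ∀ t ∈ Icc 0 T, ∀ α, HasDerivAt (Λ t) (p t α) α
  Λp : ∀ t ∈ Icc 0 T, ∀ α, Λ t (α + 2 * Real.pi) = Λ t α
  Λt : ∀ t ∈ Ioo 0 T, ∀ α, HasDerivAt (fun s => Λ s α) ((κ * (p t α / σ t α) ^ 2 + c t α * p t α + G t α) - (κ * (p t 0 / σ t 0) ^ 2 + c t 0 * p t 0 + G t 0)) t
  Λc : ContinuousOn (fun x : ℝ × ℝ => Λ x.1 x.2) (Icc 0 T ×ˢ univ)
  hS : ∀ t ∈ Icc 0 T, ∀ α, HasDerivAt (S t) (σ t α) α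
  hSt : ∀ t ∈ Ioo 0 T, ∀ α, HasDerivAt (fun s => S s α) (St t α) t
  StL : ∀ t ∈ Icc 0 T, ∀ α β, |St t β - St t α| ≤ C * |β - α|
  Sc : ContinuousOn (fun x : ℝ × ℝ => S x.1 x.2) (Icc 0 T ×ˢ univ)
  Sp : ∀ t ∈ Icc 0 T, ∃ P, ∀ α, S t (α + 2 * Real.pi) = S t α + P
  hσ : ∀ t ∈ Icc 0 T, ∀ α, sm ≤ σ t α
  cL : ∀ t ∈ Icc 0 T, ∀ α β, |c t β * σ t β - c t α * σ t α| ≤ C * |β - α|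
  hGL : ∀ t ∈ Icc 0 T, ∀ α β, |G t β - G t α| ≤ C * |β - α|
  hp0 : ∀ α, p 0 α ≤ A * σ 0 α

lemma LM.main {T C sm κ A : ℝ} {Λ p c G S σ St : ℝ → ℝ → ℝ} (H : LM T C sm κ A Λ p c G S σ St) :
    ∀ t ∈ Icc 0 T, ∀ α, p t α ≤ (A + 1) * Real.exp ((3 * C + 1) / sm * t) * σ t α := by
  have hpi := Real.pi_pos
  have C0 := H.C0; have A0 := H.A0; have sm0 := H.sm0
  set L : ℝ → ℝ := fun t => (A + 1) * Real.exp ((3 * C + 1) / sm * t) with hL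
  have hL' : ∀ t, HasDerivAt L ((3 * C + 1) / sm * L t) t := fun t => by
    have := (((hasDerivAt_id t).const_mul ((3 * C + 1) / sm)).exp).const_mul (A + 1)
    exact this.congr_deriv (by simp [hL]; ring)
  have L1 : ∀ t ∈ Icc 0 T, 1 ≤ L t := fun t ht => by
    have := Real.one_le_exp (mul_nonneg (by positivity : 0 ≤ (3 * C + 1) / sm) ht.1)
    simp only [hL]; nlinarith
  set D : ℝ × ℝ → ℝ → ℝ := fun x t => Λ t (x.1 + x.2) - Λ t x.1 - L t * (S t (x.1 + x.2) - S t x.1) with hD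
  have Smono : ∀ t ∈ Icc 0 T, ∀ α y, 0 ≤ y → sm * y ≤ S t (α + y) - S t α := fun t ht α y hy => by
    have hm : MonotoneOn (fun x => S t x - sm * x) (Icc α (α + y)) := by
      have hd : ∀ x, HasDerivAt (fun x => S t x - sm * x) (σ t x - sm) x := fun x => by
        exact ((H.hS t ht x).sub ((hasDerivAt_id x).const_mul sm)).congr_deriv (by simp)
      exact monotoneOn_of_deriv_nonneg (convex_Icc _ _) (fun x _ => (hd x).continuousAt.continuousWithinAt) (fun x _ => (hd x).differentiableAt.differentiableWithinAt)
        (fun x _ => by rw [(hd x).deriv]; linarith [H.hσ t ht x])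
    have := hm ⟨le_rfl, by linarith⟩ ⟨by linarith, le_rfl⟩ (by linarith : α ≤ α + y)
    simp only at this; linarith
  have dy : ∀ t ∈ Icc 0 T, ∀ α y, HasDerivAt (fun y => D (α, y) t) (p t (α + y) - L t * σ t (α + y)) y := fun t ht α y =>
    (((H.hΛ t ht (α + y)).comp_const_add α y).sub_const (Λ t α)).sub ((((H.hS t ht (α + y)).comp_const_add α y).sub_const (S t α)).const_mul (L t))
  have dα : ∀ t ∈ Icc 0 T, ∀ α y, HasDerivAt (fun α => D (α, y) t) (p t (α + y) - p t α - L t * (σ t (α + y) - σ t α)) α := fun t ht α y =>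
    (((H.hΛ t ht (α + y)).comp_add_const α y).sub (H.hΛ t ht α)).sub ((((H.hS t ht (α + y)).comp_add_const α y).sub (H.hS t ht α)).const_mul (L t))
  have per : ∀ t ∈ Icc 0 T, ∀ y, Function.Periodic (fun α => D (α, y) t) (2 * Real.pi) := fun t ht y α => by
    obtain ⟨P, hP⟩ := H.Sp t ht
    simp only [hD]
    rw [aper hP, aper (P := 0) (fun α => by rw [add_zero]; exact H.Λp t ht α)]
  have D0 : ∀ α t, D (α, 0) t = 0 := fun α t => by simp [hD]
  have hcont : ContinuousOn (fun x : (ℝ × ℝ) × ℝ => D x.1 x.2) ((Icc 0 (2 * Real.pi) ×ˢ Icc 0 (2 * Real.pi)) ×ˢ Icc 0 T) := by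
    have cp : ∀ (F : ℝ → ℝ → ℝ), ContinuousOn (fun x : ℝ × ℝ => F x.1 x.2) (Icc 0 T ×ˢ univ) → ∀ g : ℝ × ℝ → ℝ, Continuous g →
        ContinuousOn (fun x : (ℝ × ℝ) × ℝ => F x.2 (g x.1)) ((Icc 0 (2 * Real.pi) ×ˢ Icc 0 (2 * Real.pi)) ×ˢ Icc 0 T) := fun F hF g hg =>
      hF.comp (f := fun x : (ℝ × ℝ) × ℝ => (x.2, g x.1)) (by fun_prop) (fun x hx => ⟨hx.2, mem_univ _⟩)
    have Lc : Continuous L := continuous_iff_continuousAt.2 fun t => (hL' t).continuousAt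
    exact ((cp Λ H.Λc (fun x => x.1 + x.2) (by fun_prop)).sub (cp Λ H.Λc (fun x => x.1) (by fun_prop))).sub
      ((Lc.comp continuous_snd).continuousOn.mul ((cp S H.Sc (fun x => x.1 + x.2) (by fun_prop)).sub (cp S H.Sc (fun x => x.1) (by fun_prop))))
  have res := ENV (T := T) (isCompact_Icc.prod isCompact_Icc) D hcont (fun x hx => by
      have t0 : (0:ℝ) ∈ Icc 0 T := ⟨le_rfl, H.T0.le⟩
      have hm : AntitoneOn (fun y => D (x.1, y) 0) (Icc 0 (2 * Real.pi)) :=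
        antitoneOn_of_deriv_nonpos (convex_Icc _ _) (fun y _ => (dy 0 t0 x.1 y).continuousAt.continuousWithinAt) (fun y _ => (dy 0 t0 x.1 y).differentiableAt.differentiableWithinAt)
          (fun y _ => by
            rw [(dy 0 t0 x.1 y).deriv]
            have := H.hp0 (x.1 + y)
            have := H.hσ 0 t0 (x.1 + y)
            simp only [hL, mul_zero, Real.exp_zero]; nlinarith)
      have := hm ⟨le_rfl, by positivity⟩ hx.2 hx.2.1
      simp only [D0] at this
      exact this) (fun t ht x hx hpos hmax => by
      obtain ⟨β, y⟩ := x
      have htc : t ∈ Icc 0 T := ⟨ht.1.le, ht.2.le⟩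
      obtain ⟨hβ, hy⟩ := hx
      simp only at hβ hy
      have y0 : 0 < y := lt_of_le_of_ne hy.1 (fun h => by rw [← h, D0] at hpos; exact lt_irrefl _ hpos)
      have L1 := L1 t htc
      have y1 : y < 2 * Real.pi := lt_of_le_of_ne hy.2 (fun h => by
        rw [h] at hpos
        simp only [hD, H.Λp t htc, sub_self, zero_sub] at hpos
        have := Smono t htc β (2 * Real.pi) (by positivity)
        have : 0 ≤ S t (β + 2 * Real.pi) - S t β := le_trans (by positivity) this
        nlinarith)
      have e1 : p t (β + y) - L t * σ t (β + y) = 0 := IsLocalMax.hasDerivAt_eq_zero (by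
        filter_upwards [Icc_mem_nhds y0 y1] with v hv
        exact hmax (β, v) ⟨hβ, hv⟩) (dy t htc β y)
      have e2 : p t (β + y) - p t β - L t * (σ t (β + y) - σ t β) = 0 := IsLocalMax.hasDerivAt_eq_zero (by
        filter_upwards with v
        obtain ⟨v', hv', e⟩ := (per t htc y).exists_mem_Ico₀ (by positivity) v
        rw [e]
        exact hmax (v', y) ⟨⟨hv'.1, hv'.2.le⟩, hy⟩) (dα t htc β y)
      have p1 : p t (β + y) = L t * σ t (β + y) := by linarith
      have p2 : p t β = L t * σ t β := by linarith
      refine ⟨_, ?_, ((H.Λt t ht (β + y)).sub (H.Λt t ht β)).sub ((hL' t).mul ((H.hSt t ht (β + y)).sub (H.hSt t ht β)))⟩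
      have s1 := H.hσ t htc (β + y); have s2 := H.hσ t htc β
      simp only [Pi.sub_apply]
      rw [p1, p2, mul_div_cancel_right₀ _ (by linarith : σ t (β + y) ≠ 0), mul_div_cancel_right₀ _ (by linarith : σ t β ≠ 0)]
      have q1 := (abs_le.1 (H.cL t htc β (β + y))).2
      have q2 := (abs_le.1 (H.hGL t htc β (β + y))).2
      have q3 := (abs_le.1 (H.StL t htc β (β + y))).1
      rw [add_sub_cancel_left, abs_of_pos y0] at q1 q2 q3
      have q4 := Smono t htc β y y0.le
      have q5 : (3 * C + 1) / sm * L t * (sm * y) ≤ (3 * C + 1) / sm * L t * (S t (β + y) - S t β) := by gcongr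
      have q6 : (3 * C + 1) / sm * L t * (sm * y) = (3 * C + 1) * L t * y := by field_simp
      have q7 : L t * (c t (β + y) * σ t (β + y) - c t β * σ t β) ≤ L t * (C * y) := by gcongr
      have q8 : L t * -(C * y) ≤ L t * (St t (β + y) - St t β) := by gcongr
      have q9 : 0 ≤ C * y * (L t - 1) := by have : 0 ≤ L t - 1 := by linarith
                                            positivity
      have q10 : 0 < L t * y := by positivity
      nlinarith)
  intro t ht α
  have h := dle (dy t ht α 0) (r := 2 * Real.pi) (by positivity) (fun y hy => by
    simp only [zero_add, D0]
    obtain ⟨v', hv', e⟩ := (per t ht y).exists_mem_Ico₀ (by positivity) α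
    rw [e]
    exact res t ht (v', y) ⟨⟨hv'.1, hv'.2.le⟩, hy.1.le, hy.2.le⟩)
  rw [add_zero] at h
  linarith
end NS

namespace NS
open Complex Topology Metric ComplexConjugate

structure LN (T C am P : ℝ) (Λ p a c G : ℝ → ℝ → ℝ) : Prop where
  T0 : 0 < T
  C0 : 0 ≤ C
  am0 : 0 < am
  P0 : 0 ≤ P
  hΛ : ∀ t ∈ Icc 0 T, ∀ α, HasDerivAt (Λ t) (p t α) α
  Λp : ∀ t ∈ Icc 0 T, ∀ α, Λ t (α + 2 * Real.pi) = Λ t α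
  Λt : ∀ t ∈ Ioo 0 T, ∀ α, HasDerivAt (fun s => Λ s α) ((-(1/2) * (a t α * p t α ^ 2) + c t α * p t α + G t α) - (-(1/2) * (a t 0 * p t 0 ^ 2) + c t 0 * p t 0 + G t 0)) t
  Λc : ContinuousOn (fun x : ℝ × ℝ => Λ x.1 x.2) (Icc 0 T ×ˢ univ)
  bP : ∀ t ∈ Icc 0 T, ∀ α, |p t α| ≤ P
  ham : ∀ t ∈ Icc 0 T, ∀ α, am ≤ a t α
  aL : ∀ t ∈ Icc 0 T, ∀ α β, |a t β - a t α| ≤ C * |β - α|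
  cL : ∀ t ∈ Icc 0 T, ∀ α β, |c t β - c t α| ≤ C * |β - α|
  a2 : ∀ t ∈ Icc 0 T, ∀ α y, 0 ≤ y → |a t (α + y) + a t (α - y) - 2 * a t α| ≤ C * y ^ 2
  c2 : ∀ t ∈ Icc 0 T, ∀ α y, 0 ≤ y → |c t (α + y) + c t (α - y) - 2 * c t α| ≤ C * y ^ 2
  G2 : ∀ t ∈ Icc 0 T, ∀ α y, 0 ≤ y → |G t (α + y) + G t (α - y) - 2 * G t α| ≤ C * y ^ 2
  p0 : ∃ L0, ∀ α β, |p 0 β - p 0 α| ≤ L0 * |β - α|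
  pd : ∀ t ∈ Icc 0 T, ∀ α, ∃ p', HasDerivAt (p t) p' α

def CLN (C am P : ℝ) : ℝ := (2 * (C * (P ^ 2 + 2 * P + 2)) + 2) / am + 2 * P + 1

lemma lnalg {C am P K y a1 a2 a0 c1 c2 c0 G1 G2 G0 p : ℝ} (hy : 0 ≤ y) (hK : 0 ≤ K) (C0 : 0 ≤ C) (hp : |p| ≤ P) (h1 : am ≤ a1) (h2 : am ≤ a2)
    (ha : |a1 - a2| ≤ C * (2 * y)) (hc : |c1 - c2| ≤ C * (2 * y)) (ha2 : |a1 + a2 - 2 * a0| ≤ C * y ^ 2) (hc2 : |c1 + c2 - 2 * c0| ≤ C * y ^ 2) (hG2 : |G1 + G2 - 2 * G0| ≤ C * y ^ 2) :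
    (-(1/2) * (a1 * (p + K * y) ^ 2) + c1 * (p + K * y) + G1) + (-(1/2) * (a2 * (p - K * y) ^ 2) + c2 * (p - K * y) + G2) - 2 * (-(1/2) * (a0 * p ^ 2) + c0 * p + G0)
      ≤ (C * (P ^ 2 + 2 * P + 2) * (1 + K) - am * K ^ 2) * y ^ 2 := by
  have e : (-(1/2) * (a1 * (p + K * y) ^ 2) + c1 * (p + K * y) + G1) + (-(1/2) * (a2 * (p - K * y) ^ 2) + c2 * (p - K * y) + G2) - 2 * (-(1/2) * (a0 * p ^ 2) + c0 * p + G0)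
     = -(1/2) * (p ^ 2 * (a1 + a2 - 2 * a0)) - p * (K * y) * (a1 - a2) - (1/2) * (K ^ 2 * y ^ 2) * (a1 + a2) + p * (c1 + c2 - 2 * c0) + K * y * (c1 - c2) + (G1 + G2 - 2 * G0) := by ring
  have P0 := (abs_nonneg _).trans hp
  have b1 : |p ^ 2 * (a1 + a2 - 2 * a0)| ≤ P ^ 2 * (C * y ^ 2) := by rw [abs_mul, abs_pow]; gcongr
  have b2 : |p * (K * y) * (a1 - a2)| ≤ P * (K * y) * (C * (2 * y)) := by rw [abs_mul, abs_mul, abs_of_nonneg (by positivity : 0 ≤ K * y)]; gcongr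
  have b3 : (1/2) * (K ^ 2 * y ^ 2) * (2 * am) ≤ (1/2) * (K ^ 2 * y ^ 2) * (a1 + a2) := by gcongr; linarith
  have b4 : |p * (c1 + c2 - 2 * c0)| ≤ P * (C * y ^ 2) := by rw [abs_mul]; gcongr
  have b5 : |K * y * (c1 - c2)| ≤ K * y * (C * (2 * y)) := by rw [abs_mul, abs_of_nonneg (by positivity : 0 ≤ K * y)]; gcongr
  have r0 : 0 ≤ C * y ^ 2 := by positivity
  have r1 : 0 ≤ C * y ^ 2 * P ^ 2 := by positivity
  have r2 : 0 ≤ C * y ^ 2 * P := by positivity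
  have r3 : 0 ≤ C * y ^ 2 * P ^ 2 * K := by positivity
  rw [e]
  linarith [(abs_le.1 b1).1, (abs_le.1 b2).1, (abs_le.1 b4).2, (abs_le.1 b5).2, (abs_le.1 hG2).2]

lemma LN.main {T C am P : ℝ} {Λ p a c G : ℝ → ℝ → ℝ} (H : LN T C am P Λ p a c G) :
    ∀ t ∈ Ioc 0 T, ∀ α β, α ≤ β → p t β - p t α ≤ CLN C am P * (1 + 1 / t) * (β - α) := by
  have hpi := Real.pi_pos
  have C0 := H.C0; have P0 := H.P0; have am0 := H.am0
  obtain ⟨L0, hL0⟩ := H.p0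
  set C1 := C * (P ^ 2 + 2 * P + 2) with hC1
  have C10 : 0 ≤ C1 := by positivity
  set B := CLN C am P with hB
  have B1 : 2 * P + 1 ≤ B := by
    have : 0 ≤ (2 * C1 + 2) / am := by positivity
    simp only [hB, CLN]; linarith
  have B2 : 2 * C1 + 2 ≤ am * B := by
    have : am * ((2 * C1 + 2) / am) = 2 * C1 + 2 := by field_simp
    have : 0 ≤ am * (2 * P + 1) := by positivity
    have e : am * B = am * ((2 * C1 + 2) / am) + am * (2 * P + 1) := by simp only [hB, CLN]; ring
    linarith
  have B0 : 0 < B := by linarith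
  set ε := 1 / (|L0| + 1) with hε
  have ε0 : 0 < ε := by have := abs_nonneg L0; positivity
  have εi : 1 / ε = |L0| + 1 := by rw [hε, one_div_one_div]
  set K : ℝ → ℝ := fun t => B * (1 + 1 / (t + ε)) with hK
  have K0 : ∀ t ∈ Icc 0 T, B ≤ K t := fun t ht => by
    have : 0 ≤ 1 / (t + ε) := by have := ht.1; positivity
    simp only [hK]; nlinarith
  have hK' : ∀ t ∈ Icc 0 T, HasDerivAt K (-(B * (1 / (t + ε)) ^ 2)) t := fun t ht => by
    have h1 : t + ε ≠ 0 := by have := ht.1; positivity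
    have := ((((hasDerivAt_id t).add_const ε).fun_inv h1).const_add 1).const_mul B
    simp only [hK, one_div]
    exact this.congr_deriv (by simp only [id]; field_simp)
  have hKd : ∀ t ∈ Icc 0 T, C1 * (1 + K t) - am * K t ^ 2 + B * (1 / (t + ε)) ^ 2 < 0 := fun t ht => by
    have hs : 0 ≤ 1 / (t + ε) := by have := ht.1; positivity
    simp only [hK]
    generalize 1 / (t + ε) = s at hs
    have k1 : (2 * C1 + 2) * (B * (1 + s) ^ 2) ≤ am * B * (B * (1 + s) ^ 2) := by gcongr
    have k2 : 1 + B * (1 + s) ≤ 2 * (B * (1 + s) ^ 2) := by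
      have h1 : 1 ≤ B * (1 + s) := by nlinarith
      have h2 : B * (1 + s) ≤ B * (1 + s) * (1 + s) := by nlinarith
      nlinarith
    have k3 := mul_le_mul_of_nonneg_left k2 C10
    have k40 : s ^ 2 ≤ (1 + s) ^ 2 := by nlinarith
    have k4 : B * s ^ 2 ≤ B * (1 + s) ^ 2 := by gcongr
    have k5 : 0 < B * (1 + s) ^ 2 := by positivity
    linarith
  set D : ℝ × ℝ → ℝ → ℝ := fun x t => Λ t (x.1 + x.2) + Λ t (x.1 - x.2) - 2 * Λ t x.1 - K t * x.2 ^ 2 with hD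
  have dy : ∀ t ∈ Icc 0 T, ∀ α y, HasDerivAt (fun y => D (α, y) t) (p t (α + y) - p t (α - y) - K t * (2 * y)) y := fun t ht α y =>
    (((((H.hΛ t ht (α + y)).comp_const_add α y).add ((H.hΛ t ht (α - y)).comp_const_sub α y)).sub_const (2 * Λ t α)).sub ((hasDerivAt_pow 2 y).const_mul (K t))).congr_deriv (by norm_num; ring)
  have dα : ∀ t ∈ Icc 0 T, ∀ α y, HasDerivAt (fun α => D (α, y) t) (p t (α + y) + p t (α - y) - 2 * p t α) α := fun t ht α y =>
    ((((H.hΛ t ht (α + y)).comp_add_const α y).add ((H.hΛ t ht (α - y)).comp_sub_const α y)).sub ((H.hΛ t ht α).const_mul 2)).sub_const (K t * y ^ 2)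
  have per : ∀ t ∈ Icc 0 T, ∀ y, Function.Periodic (fun α => D (α, y) t) (2 * Real.pi) := fun t ht y α => by
    simp only [hD]
    rw [show α + 2 * Real.pi + y = (α + y) + 2 * Real.pi by ring, show α + 2 * Real.pi - y = (α - y) + 2 * Real.pi by ring, H.Λp t ht, H.Λp t ht, H.Λp t ht]
  have D0 : ∀ α t, D (α, 0) t = 0 := fun α t => by simp [hD]; ring
  have hcont : ContinuousOn (fun x : (ℝ × ℝ) × ℝ => D x.1 x.2) ((Icc 0 (2 * Real.pi) ×ˢ Icc 0 1) ×ˢ Icc 0 T) := by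
    have cp : ∀ g : ℝ × ℝ → ℝ, Continuous g → ContinuousOn (fun x : (ℝ × ℝ) × ℝ => Λ x.2 (g x.1)) ((Icc 0 (2 * Real.pi) ×ˢ Icc 0 1) ×ˢ Icc 0 T) := fun g hg =>
      H.Λc.comp (f := fun x : (ℝ × ℝ) × ℝ => (x.2, g x.1)) (by fun_prop) (fun x hx => ⟨hx.2, mem_univ _⟩)
    have Kc : ContinuousOn K (Icc 0 T) := fun t ht => (hK' t ht).continuousAt.continuousWithinAt
    exact (((cp (fun x => x.1 + x.2) (by fun_prop)).add (cp (fun x => x.1 - x.2) (by fun_prop))).sub (continuousOn_const.mul (cp (fun x => x.1) (by fun_prop)))).sub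
      ((Kc.comp continuousOn_snd (fun x hx => hx.2)).mul (by fun_prop))
  have res := ENV (T := T) (isCompact_Icc.prod isCompact_Icc) D hcont (fun x hx => by
      have t0 : (0:ℝ) ∈ Icc 0 T := ⟨le_rfl, H.T0.le⟩
      have hm : AntitoneOn (fun y => D (x.1, y) 0) (Icc 0 1) :=
        antitoneOn_of_deriv_nonpos (convex_Icc _ _) (fun y _ => (dy 0 t0 x.1 y).continuousAt.continuousWithinAt) (fun y _ => (dy 0 t0 x.1 y).differentiableAt.differentiableWithinAt)
          (fun y hy => by
            rw [(dy 0 t0 x.1 y).deriv]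
            rw [interior_Icc] at hy
            have h1 := (abs_le.1 (hL0 (x.1 - y) (x.1 + y))).2
            rw [show x.1 + y - (x.1 - y) = 2 * y by ring, abs_of_pos (by linarith [hy.1])] at h1
            have h2 : L0 ≤ K 0 := by
              simp only [hK, zero_add, εi]
              have := le_abs_self L0; have := abs_nonneg L0
              nlinarith
            have := hy.1
            nlinarith)
      have := hm ⟨le_rfl, by positivity⟩ hx.2 hx.2.1
      simp only [D0] at this
      exact this) (fun t ht x hx hpos hmax => by
      obtain ⟨β, y⟩ := x
      have htc : t ∈ Icc 0 T := ⟨ht.1.le, ht.2.le⟩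
      obtain ⟨hβ, hy⟩ := hx
      simp only at hβ hy
      have y0 : 0 < y := lt_of_le_of_ne hy.1 (fun h => by rw [← h, D0] at hpos; exact lt_irrefl _ hpos)
      have K1 := K0 t htc
      have y1 : y < 1 := lt_of_le_of_ne hy.2 (fun h => by
        rw [h] at hpos
        simp only [hD] at hpos
        have l1 := lip1 convex_univ (fun y _ => (H.hΛ t htc y).hasDerivWithinAt) (fun y _ => H.bP t htc y) β (mem_univ _) (β + 1) (mem_univ _)
        have l2 := lip1 convex_univ (fun y _ => (H.hΛ t htc y).hasDerivWithinAt) (fun y _ => H.bP t htc y) β (mem_univ _) (β - 1) (mem_univ _)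
        rw [Real.norm_eq_abs] at l1 l2
        norm_num at l1 l2 hpos
        linarith [(abs_le.1 l1).2, (abs_le.1 l2).2])
      have e1 : p t (β + y) - p t (β - y) - K t * (2 * y) = 0 := IsLocalMax.hasDerivAt_eq_zero (by
        filter_upwards [Icc_mem_nhds y0 y1] with v hv
        exact hmax (β, v) ⟨hβ, hv⟩) (dy t htc β y)
      have e2 : p t (β + y) + p t (β - y) - 2 * p t β = 0 := IsLocalMax.hasDerivAt_eq_zero (by
        filter_upwards with v
        obtain ⟨v', hv', e⟩ := (per t htc y).exists_mem_Ico₀ (by positivity) v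
        rw [e]
        exact hmax (v', y) ⟨⟨hv'.1, hv'.2.le⟩, hy⟩) (dα t htc β y)
      have p1 : p t (β + y) = p t β + K t * y := by linarith
      have p2 : p t (β - y) = p t β - K t * y := by linarith
      refine ⟨_, ?_, (((H.Λt t ht (β + y)).add (H.Λt t ht (β - y))).sub ((H.Λt t ht β).const_mul 2)).sub ((hK' t htc).mul_const (y ^ 2))⟩
      rw [p1, p2]
      have q1 := H.aL t htc (β - y) (β + y)
      have q2 := H.cL t htc (β - y) (β + y)
      rw [show β + y - (β - y) = 2 * y by ring, abs_of_pos (by linarith : 0 < 2 * y)] at q1 q2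
      have key := lnalg (K := K t) y0.le (by linarith) C0 (H.bP t htc β) (H.ham t htc (β + y)) (H.ham t htc (β - y)) q1 q2 (H.a2 t htc β y y0.le) (H.c2 t htc β y y0.le) (H.G2 t htc β y y0.le)
      have y2 : 0 < y ^ 2 := by positivity
      have := mul_neg_of_neg_of_pos (hKd t htc) y2
      linarith)
  intro t ht α β hαβ
  have htc : t ∈ Icc 0 T := ⟨ht.1.le, ht.2⟩
  choose p' hp' using H.pd t htc
  have hle : ∀ α, p' α ≤ K t := fun α => by
    by_contra hc
    push Not at hc
    have hg : HasDerivAt (fun y => p t (α + y) - p t (α - y) - K t * (2 * y)) (2 * (p' α - K t)) 0 := by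
      have h1 := (show HasDerivAt (p t) (p' α) (α + 0) by rw [add_zero]; exact hp' α).comp_const_add α 0
      have h2 := (show HasDerivAt (p t) (p' α) (α - 0) by rw [sub_zero]; exact hp' α).comp_const_sub α 0
      exact ((h1.sub h2).sub (((hasDerivAt_id (0:ℝ)).const_mul 2).const_mul (K t))).congr_deriv (by ring)
    have ev : ∀ᶠ y in 𝓝[>] (0:ℝ), 0 < p t (α + y) - p t (α - y) - K t * (2 * y) := by
      have := hg.tendsto_slope_zero_right.eventually (lt_mem_nhds (by linarith : (0:ℝ) < 2 * (p' α - K t)))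
      filter_upwards [this, self_mem_nhdsWithin] with y hy hy0
      simp only [zero_add, add_zero, sub_zero, sub_self, mul_zero, smul_eq_mul] at hy
      exact pos_of_mul_pos_right hy (inv_nonneg.2 (le_of_lt hy0))
    obtain ⟨r, hr, hr2⟩ := (mem_nhdsGT_iff_exists_Ioo_subset).1 ev
    have hr : 0 < r := hr
    have sm : StrictMonoOn (fun y => D (α, y) t) (Icc 0 (min r 1)) := strictMonoOn_of_deriv_pos (convex_Icc _ _) (fun y _ => (dy t htc α y).continuousAt.continuousWithinAt)
      (fun y hy => by
        rw [(dy t htc α y).deriv]; rw [interior_Icc] at hy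
        exact hr2 ⟨hy.1, hy.2.trans_le (min_le_left _ _)⟩)
    have m0 : 0 < min r 1 := by positivity
    have := sm ⟨le_rfl, m0.le⟩ ⟨m0.le, le_rfl⟩ m0
    simp only [D0] at this
    obtain ⟨v', hv', e⟩ := (per t htc (min r 1)).exists_mem_Ico₀ (by positivity) α
    rw [e] at this
    exact absurd (res t htc (v', min r 1) ⟨⟨hv'.1, hv'.2.le⟩, m0.le, min_le_right _ _⟩) (not_le.2 this)
  have hKt : K t ≤ B * (1 + 1 / t) := by
    have := ht.1
    simp only [hK]; gcongr; linarith
  have hm : AntitoneOn (fun x => p t x - B * (1 + 1 / t) * x) (Icc α β) := by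
    have hd : ∀ x, HasDerivAt (fun x => p t x - B * (1 + 1 / t) * x) (p' x - B * (1 + 1 / t)) x := fun x =>
      ((hp' x).sub ((hasDerivAt_id x).const_mul _)).congr_deriv (by simp)
    exact antitoneOn_of_deriv_nonpos (convex_Icc _ _) (fun x _ => (hd x).continuousAt.continuousWithinAt) (fun x _ => (hd x).differentiableAt.differentiableWithinAt)
      (fun x _ => by rw [(hd x).deriv]; linarith [hle x])
  have := hm ⟨le_rfl, hαβ⟩ ⟨hαβ, le_rfl⟩ hαβ
  simp only at this
  linarith
end NS

namespace NS
open Complex Topology Metric ComplexConjugate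

section ub
variable {ι F F' : Type*} [NormedAddCommGroup F] [NormedSpace ℝ F] [NormedAddCommGroup F'] [NormedSpace ℝ F'] {T : ℝ}

def B0 (T : ℝ) (g : ι → ℝ → ℝ → F) : Prop := (∃ C, ∀ i, ∀ t ∈ Icc 0 T, ∀ α, ‖g i t α‖ ≤ C) ∧
  ∀ i, ContinuousOn (fun x : ℝ × ℝ => g i x.1 x.2) (Icc 0 T ×ˢ univ)
def RR (T : ℝ) (g ga gt : ι → ℝ → ℝ → F) : Prop := ∀ i, ∀ t ∈ Icc 0 T, ∀ α, HasDerivAt (g i t) (ga i t α) α ∧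
  HasDerivWithinAt (fun s => g i s α) (gt i t α) (Icc 0 T) t
/-- uniformly bounded derivatives up to order `n` -/
def UB (T : ℝ) : ℕ → (ι → ℝ → ℝ → F) → Prop
  | 0, g => B0 T g
  | n + 1, g => B0 T g ∧ ∃ ga gt, RR T g ga gt ∧ UB T n ga ∧ UB T n gt

lemma UB.b {n : ℕ} {g : ι → ℝ → ℝ → F} (h : UB T n g) : B0 T g := by
  cases n with
  | zero => exact h
  | succ n => exact h.1
lemma UB.d {n : ℕ} {g : ι → ℝ → ℝ → F} (h : UB T (n + 1) g) : UB T n g := by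
  induction n generalizing g with
  | zero => exact h.1
  | succ n ih =>
    obtain ⟨h1, ga, gt, h2, h3, h4⟩ := h
    exact ⟨h1, ga, gt, h2, ih h3, ih h4⟩
lemma UB.add {n : ℕ} {g h : ι → ℝ → ℝ → F} (hg : UB T n g) (hh : UB T n h) : UB T n (fun i t α => g i t α + h i t α) := by
  have key : ∀ {g h : ι → ℝ → ℝ → F}, B0 T g → B0 T h → B0 T (fun i t α => g i t α + h i t α) := by
    rintro g h ⟨⟨C, h1⟩, h2⟩ ⟨⟨D, h3⟩, h4⟩
    exact ⟨⟨C + D, fun i t ht α => (norm_add_le _ _).trans (add_le_add (h1 i t ht α) (h3 i t ht α))⟩, fun i => (h2 i).add (h4 i)⟩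
  induction n generalizing g h with
  | zero => exact key hg hh
  | succ n ih =>
    obtain ⟨h1, ga, gt, h2, h3, h4⟩ := hg
    obtain ⟨k1, ha, ht, k2, k3, k4⟩ := hh
    exact ⟨key h1 k1, _, _, fun i t hi α => ⟨(h2 i t hi α).1.add (k2 i t hi α).1, (h2 i t hi α).2.add (k2 i t hi α).2⟩, ih h3 k3, ih h4 k4⟩
lemma UB.clm {n : ℕ} {g : ι → ℝ → ℝ → F} (hg : UB T n g) (L : F →L[ℝ] F') : UB T n (fun i t α => L (g i t α)) := by
  have key : ∀ {g : ι → ℝ → ℝ → F}, B0 T g → B0 T (fun i t α => L (g i t α)) := by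
    rintro g ⟨⟨C, h1⟩, h2⟩
    exact ⟨⟨‖L‖ * C, fun i t ht α => (L.le_opNorm _).trans (by gcongr; exact h1 i t ht α)⟩, fun i => L.continuous.comp_continuousOn (h2 i)⟩
  induction n generalizing g with
  | zero => exact key hg
  | succ n ih =>
    obtain ⟨h1, ga, gt, h2, h3, h4⟩ := hg
    exact ⟨key h1, _, _, fun i t hi α => ⟨L.hasFDerivAt.comp_hasDerivAt _ (h2 i t hi α).1, L.hasFDerivAt.comp_hasDerivWithinAt _ (h2 i t hi α).2⟩, ih h3, ih h4⟩
lemma UB.cst (n : ℕ) (c : F) : UB T n (fun (_ : ι) _ _ => c) := by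
  have key : ∀ c : F, B0 T (fun (_ : ι) _ _ => c) := fun c => ⟨⟨‖c‖, fun _ _ _ _ => le_rfl⟩, fun _ => continuousOn_const⟩
  induction n generalizing c with
  | zero => exact key c
  | succ n ih => exact ⟨key c, _, _, fun i t hi α => ⟨hasDerivAt_const _ _, hasDerivWithinAt_const _ _ _⟩, ih 0, ih 0⟩
lemma UB.mul {R : Type*} [NormedRing R] [NormedAlgebra ℝ R] {n : ℕ} {g h : ι → ℝ → ℝ → R} (hg : UB T n g) (hh : UB T n h) : UB T n (fun i t α => g i t α * h i t α) := by
  have key : ∀ {g h : ι → ℝ → ℝ → R}, B0 T g → B0 T h → B0 T (fun i t α => g i t α * h i t α) := by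
    rintro g h ⟨⟨C, h1⟩, h2⟩ ⟨⟨D, h3⟩, h4⟩
    refine ⟨⟨C * D, fun i t ht α => (norm_mul_le _ _).trans ?_⟩, fun i => (h2 i).mul (h4 i)⟩
    exact mul_le_mul (h1 i t ht α) (h3 i t ht α) (norm_nonneg _) ((norm_nonneg _).trans (h1 i t ht α))
  induction n generalizing g h with
  | zero => exact key hg hh
  | succ n ih =>
    have hg' := hg.d; have hh' := hh.d
    obtain ⟨h1, ga, gt, h2, h3, h4⟩ := hg
    obtain ⟨k1, ha, ht, k2, k3, k4⟩ := hh
    exact ⟨key h1 k1, _, _, fun i t hi α => ⟨(h2 i t hi α).1.mul (k2 i t hi α).1, (h2 i t hi α).2.mul (k2 i t hi α).2⟩, (ih h3 hh').add (ih hg' k3), (ih h4 hh').add (ih hg' k4)⟩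
lemma UB.inv {n : ℕ} {g : ι → ℝ → ℝ → ℝ} (hg : UB T n g) {c : ℝ} (hc : 0 < c) (h : ∀ i, ∀ t ∈ Icc 0 T, ∀ α, c ≤ g i t α) : UB T n (fun i t α => (g i t α)⁻¹) := by
  have key : B0 T (fun i t α => (g i t α)⁻¹) := by
    refine ⟨⟨c⁻¹, fun i t ht α => ?_⟩, fun i => (hg.b.2 i).inv₀ fun x hx => (hc.trans_le (h i x.1 hx.1 x.2)).ne'⟩
    have := h i t ht α
    rw [norm_inv, Real.norm_of_nonneg (hc.le.trans this)]; gcongr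
  induction n with
  | zero => exact key
  | succ n ih =>
    have I := ih hg.d
    obtain ⟨h1, ga, gt, h2, h3, h4⟩ := hg
    refine ⟨key, fun i t α => -1 * (ga i t α * ((g i t α)⁻¹ * (g i t α)⁻¹)), fun i t α => -1 * (gt i t α * ((g i t α)⁻¹ * (g i t α)⁻¹)), fun i t hi α => ?_, (UB.cst n _).mul (h3.mul (I.mul I)), (UB.cst n _).mul (h4.mul (I.mul I))⟩
    have h0 := (hc.trans_le (h i t hi α)).ne'
    exact ⟨((h2 i t hi α).1.fun_inv h0).congr_deriv (by field_simp), ((h2 i t hi α).2.fun_inv h0).congr_deriv (by field_simp)⟩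
lemma UB.sqrt {n : ℕ} {g : ι → ℝ → ℝ → ℝ} (hg : UB T n g) {c : ℝ} (hc : 0 < c) (h : ∀ i, ∀ t ∈ Icc 0 T, ∀ α, c ≤ g i t α) : UB T n (fun i t α => √(g i t α)) := by
  have key : B0 T (fun i t α => √(g i t α)) := by
    obtain ⟨⟨C, hC⟩, h2⟩ := hg.b
    refine ⟨⟨√C, fun i t ht α => ?_⟩, fun i => (h2 i).sqrt⟩
    rw [Real.norm_of_nonneg (Real.sqrt_nonneg _)]
    exact Real.sqrt_le_sqrt ((le_abs_self _).trans (hC i t ht α))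
  induction n with
  | zero => exact key
  | succ n ih =>
    have I := (ih hg.d).inv (Real.sqrt_pos.2 hc) (fun i t ht α => Real.sqrt_le_sqrt (h i t ht α))
    obtain ⟨h1, ga, gt, h2, h3, h4⟩ := hg
    refine ⟨key, fun i t α => 1/2 * (ga i t α * (√(g i t α))⁻¹), fun i t α => 1/2 * (gt i t α * (√(g i t α))⁻¹), fun i t hi α => ?_, (UB.cst n _).mul (h3.mul I), (UB.cst n _).mul (h4.mul I)⟩
    have h0 := (hc.trans_le (h i t hi α)).ne'
    exact ⟨((h2 i t hi α).1.sqrt h0).congr_deriv (by ring), ((h2 i t hi α).2.sqrt h0).congr_deriv (by ring)⟩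

/-- Lipschitz and second difference bounds -/
lemma UB.lip {g : ι → ℝ → ℝ → F} (hg : UB T 1 g) : ∃ C, 0 ≤ C ∧ ∀ i, ∀ t ∈ Icc 0 T, ∀ α β, ‖g i t β - g i t α‖ ≤ C * |β - α| := by
  obtain ⟨h1, ga, gt, h2, ⟨⟨C, h3⟩, -⟩, h4⟩ := hg
  exact ⟨|C|, abs_nonneg _, fun i t ht α β => lip1 convex_univ (fun x _ => (h2 i t ht x).1.hasDerivWithinAt) (fun x _ => (h3 i t ht x).trans (le_abs_self _)) α (mem_univ _) β (mem_univ _)⟩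
lemma UB.lipt {g : ι → ℝ → ℝ → F} (hg : UB T 1 g) : ∃ C, 0 ≤ C ∧ ∀ i, ∀ s ∈ Icc 0 T, ∀ t ∈ Icc 0 T, ∀ α, ‖g i s α - g i t α‖ ≤ C * |s - t| := by
  obtain ⟨h1, ga, gt, h2, -, ⟨⟨C, h3⟩, -⟩⟩ := hg
  exact ⟨|C|, abs_nonneg _, fun i s hs t ht α => lip1 (convex_Icc 0 T) (fun x hx => (h2 i x hx α).2) (fun x hx => (h3 i x hx α).trans (le_abs_self _)) t ht s hs⟩
lemma sdd {g g' : ℝ → F} {C : ℝ} (hC : 0 ≤ C) (h : ∀ x, HasDerivAt g (g' x) x) (hL : ∀ x y, ‖g' y - g' x‖ ≤ C * |y - x|) (α y : ℝ) :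
    ‖g (α + y) + g (α - y) - (2:ℝ) • g α‖ ≤ 2 * C * y ^ 2 := by
  have t := fun v => tay1 hC convex_univ (fun x _ => (h x).hasDerivWithinAt) (fun x _ y _ => hL x y) α (mem_univ _) v (mem_univ _)
  have a1 := t (α + y); have a2 := t (α - y)
  have e : g (α + y) + g (α - y) - (2:ℝ) • g α = (g (α + y) - g α - (α + y - α) • g' α) + (g (α - y) - g α - (α - y - α) • g' α) := by
    module
  rw [e]
  refine (norm_add_le _ _).trans ?_
  simp only [sq_abs, add_sub_cancel_left, sub_sub_cancel_left, neg_sq] at a1 a2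
  simp only [add_sub_cancel_left, sub_sub_cancel_left]
  linarith
lemma UB.sd {g : ι → ℝ → ℝ → F} (hg : UB T 2 g) : ∃ C, 0 ≤ C ∧ ∀ i, ∀ t ∈ Icc 0 T, ∀ α y, ‖g i t (α + y) + g i t (α - y) - (2:ℝ) • g i t α‖ ≤ C * y ^ 2 := by
  obtain ⟨h1, ga, gt, h2, h3, h4⟩ := hg
  obtain ⟨C, hC, h5⟩ := UB.lip h3
  exact ⟨2 * C, by positivity, fun i t ht α y => sdd hC (fun x => (h2 i t ht x).1) (h5 i t ht) α y⟩

lemma UB.of {n : ℕ} {h : ι → ℝ × ℝ → F} (hT : 0 < T) (h1 : ∀ i, ContDiffOn ℝ n (h i) (univ ×ˢ Icc 0 T))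
    (h2 : ∃ C, ∀ i, ∀ p ∈ (univ ×ˢ Icc 0 T : Set (ℝ × ℝ)), ∀ k ≤ n, ‖iteratedFDerivWithin ℝ k (h i) (univ ×ˢ Icc 0 T) p‖ ≤ C) : UB T n (fun i t α => h i (α, t)) := by
  set s : Set (ℝ × ℝ) := univ ×ˢ Icc 0 T with hs
  have us : UniqueDiffOn ℝ s := uniqueDiffOn_univ.prod (uniqueDiffOn_Icc hT)
  have key : ∀ {n : ℕ} {h : ι → ℝ × ℝ → F}, (∀ i, ContDiffOn ℝ n (h i) s) → (∃ C, ∀ i, ∀ p ∈ s, ∀ k ≤ n, ‖iteratedFDerivWithin ℝ k (h i) s p‖ ≤ C) → B0 T (fun i t α => h i (α, t)) := by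
    rintro n h h1 ⟨C, h2⟩
    refine ⟨⟨C, fun i t ht α => ?_⟩, fun i => (h1 i).continuousOn.comp (f := fun x : ℝ × ℝ => (x.2, x.1)) (by fun_prop) (fun x hx => ⟨mem_univ _, hx.1⟩)⟩
    have := h2 i (α, t) ⟨mem_univ _, ht⟩ 0 (Nat.zero_le _)
    rwa [norm_iteratedFDerivWithin_zero] at this
  induction n generalizing h with
  | zero => exact key h1 h2
  | succ n ih =>
    have hd : ∀ i, ∀ p ∈ s, HasFDerivWithinAt (h i) (fderivWithin ℝ (h i) s p) s p := fun i p hp =>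
      ((h1 i).differentiableOn (by simp) p hp).hasFDerivWithinAt
    have hv : ∀ v : ℝ × ℝ, UB T n (fun i t α => fderivWithin ℝ (h i) s (α, t) v) := by
      intro v
      have hc : ∀ i, ContDiffOn ℝ n (fderivWithin ℝ (h i) s) s := fun i => (h1 i).fderivWithin us (by norm_cast)
      refine ih (h := fun i p => fderivWithin ℝ (h i) s p v) (fun i => (hc i).clm_apply contDiffOn_const) ?_
      obtain ⟨C, h2⟩ := h2
      refine ⟨‖ContinuousLinearMap.apply ℝ F v‖ * C, fun i p hp k hk => ?_⟩
      refine ((ContinuousLinearMap.apply ℝ F v).norm_iteratedFDerivWithin_comp_left (hc i p hp) us hp (by exact_mod_cast hk)).trans ?_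
      gcongr
      rw [norm_iteratedFDerivWithin_fderivWithin us hp]; exact h2 i p hp (k+1) (by omega)
    refine ⟨key h1 h2, fun i t α => fderivWithin ℝ (h i) s (α, t) (1, 0), fun i t α => fderivWithin ℝ (h i) s (α, t) (0, 1), fun i t ht α => ⟨?_, ?_⟩, hv _, hv _⟩
    · have := (hd i (α, t) ⟨mem_univ _, ht⟩).comp_hasDerivWithinAt (s := univ) α (f := fun x => (x, t)) ((hasDerivAt_id α).prodMk (hasDerivAt_const α t)).hasDerivWithinAt (fun x _ => ⟨mem_univ _, ht⟩)
      exact this.hasDerivAt univ_mem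
    · exact (hd i (α, t) ⟨mem_univ _, ht⟩).comp_hasDerivWithinAt (s := Icc 0 T) t (f := fun x => (α, x)) ((hasDerivAt_const t α).prodMk (hasDerivAt_id t)).hasDerivWithinAt (fun x hx => ⟨mem_univ _, hx⟩)
end ub
end NS

namespace NS
open Complex Topology Metric ComplexConjugate

section
variable {ι : Type*} {T : ℝ} {g ga gt : ι → ℝ → ℝ → ℝ}
/-- primitive in the space variable -/
def JJ (g : ι → ℝ → ℝ → ℝ) (i : ι) (t α : ℝ) : ℝ := ∫ s in (0:ℝ)..α, g i t s

lemma B0.cc' {F : Type*} [NormedAddCommGroup F] [NormedSpace ℝ F] {g : ι → ℝ → ℝ → F} (h : B0 T g) (i : ι) {t : ℝ} (ht : t ∈ Icc 0 T) : Continuous (g i t) := by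
  have := (h.2 i).comp (f := fun s : ℝ => (t, s)) (s := univ) (by fun_prop) (fun s _ => ⟨ht, mem_univ _⟩)
  exact continuousOn_univ.1 this
lemma B0.cc (h : B0 T g) (i : ι) {t : ℝ} (ht : t ∈ Icc 0 T) : Continuous (g i t) := B0.cc' h i ht
lemma B0.J1 (h : B0 T g) (i : ι) {t : ℝ} (ht : t ∈ Icc 0 T) (α : ℝ) : HasDerivAt (JJ g i t) (g i t α) α :=
  ((h.cc i ht).integral_hasStrictDerivAt 0 α).hasDerivAt
lemma B0.J2 (hT : 0 ≤ T) (h : B0 T g) (i : ι) : ContinuousOn (fun x : ℝ × ℝ => JJ g i x.1 x.2) (Icc 0 T ×ˢ univ) := by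
  have h1 : Continuous (Function.uncurry fun t s => g i (projIcc 0 T hT t) s) := by
    have := (h.2 i).comp_continuous (f := fun x : ℝ × ℝ => ((projIcc 0 T hT x.1 : ℝ), x.2)) (by fun_prop) (fun x => ⟨(projIcc 0 T hT x.1).2, mem_univ _⟩)
    exact this
  refine (intervalIntegral.continuous_parametric_primitive_of_continuous (a₀ := 0) (μ := volume) h1).continuousOn.congr fun x hx => ?_
  simp only [JJ, projIcc_of_mem hT hx.1]
lemma B0.J3 (h : B0 T g) : ∃ C, 0 ≤ C ∧ ∀ i, ∀ t ∈ Icc 0 T, ∀ α β, |JJ g i t β - JJ g i t α| ≤ C * |β - α| := by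
  obtain ⟨C, hC⟩ := h.1
  exact ⟨|C|, abs_nonneg _, fun i t ht α β => lip1 convex_univ (fun x _ => (h.J1 i ht x).hasDerivWithinAt) (fun x _ => (hC i t ht x).trans (le_abs_self _)) α (mem_univ _) β (mem_univ _)⟩
lemma J4 (h : B0 T g) (hr : RR T g ga gt) (h2 : B0 T gt) (i : ι) {t : ℝ} (ht : t ∈ Ioo 0 T) (α : ℝ) :
    HasDerivAt (fun s => JJ g i s α) (JJ gt i t α) t := by
  obtain ⟨C, hC⟩ := h2.1
  have hI : ∀ s ∈ Ioo 0 T, s ∈ Icc 0 T := fun s hs => Ioo_subset_Icc_self hs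
  refine (intervalIntegral.hasDerivAt_integral_of_dominated_loc_of_deriv_le (s := Ioo 0 T) (F := fun s x => g i s x) (F' := fun s x => gt i s x) (bound := fun _ => C) (isOpen_Ioo.mem_nhds ht) ?_ ?_ ?_ ?_ ?_ ?_).2
  · filter_upwards [isOpen_Ioo.mem_nhds ht] with s hs
    exact (h.cc i (hI s hs)).aestronglyMeasurable
  · exact (h.cc i (hI t ht)).intervalIntegrable _ _
  · exact (h2.cc i (hI t ht)).aestronglyMeasurable
  · exact .of_forall fun x _ s hs => hC i s (hI s hs) x
  · exact intervalIntegrable_const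
  · exact .of_forall fun x _ s hs => (hr i s (hI s hs) x).2.hasDerivAt (Icc_mem_nhds hs.1 hs.2)
end
end NS

namespace NS
open Complex Topology Metric ComplexConjugate

/-- one fluid at one time, in real coordinates -/
structure FL (e : E2 ≃ₗᵢ[ℝ] ℂ) (s ρ g a : ℝ) (z : ℝ → E2) (Ω Ω' : Set E2) (u ut : E2 → E2) (P : E2 → ℝ) : Prop where
  ss : s * s = 1
  ere : ∀ x, (e x).re = x 0
  eim : ∀ x, (e x).im = s * x 1
  hρ : 0 < ρ
  o1 : IsOpen Ω
  o2 : IsOpen Ω'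
  c1 : IsConnected Ω
  c2 : IsConnected Ω'
  sc : SimplyConnectedSpace Ω
  un : Ω ∪ Ω' ∪ range z = univ
  dj : Disjoint Ω Ω'
  f1 : frontier Ω = range z
  f2 : frontier Ω' = range z
  s1 : ∀ x : E2, a ≤ s * x 1 → x ∈ Ω
  s2 : ∀ x : E2, s * x 1 ≤ -a → x ∈ Ω'
  hu : ContDiffOn ℝ 3 u (closure Ω)
  hP : ContDiffOn ℝ 1 P (closure Ω)
  eul : ∀ x ∈ Ω, ρ • (ut x + fderiv ℝ u x (u x)) = -gradient P x - (g * ρ) • e2vec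
  hdiv : ∀ x ∈ Ω, fderiv ℝ u x (EuclideanSpace.single 0 1) 0 + fderiv ℝ u x (EuclideanSpace.single 1 1) 1 = 0
  hcurl : ∀ x ∈ Ω, fderiv ℝ u x (EuclideanSpace.single 0 1) 1 - fderiv ℝ u x (EuclideanSpace.single 1 1) 0 = 0
  pz : ∀ α, z (α + 2 * Real.pi) = z α + transl
  pΩ : (fun x => x + transl) '' Ω = Ω
  pu : ∀ x ∈ Ω, u (x + transl) = u x
  L2 : IntegrableOn (fun x => ‖u x‖ ^ 2) (Ω ∩ {x : E2 | x 0 ∈ Icc 0 (2 * Real.pi)})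

namespace FL
variable {e : E2 ≃ₗᵢ[ℝ] ℂ} {s ρ g a : ℝ} {z : ℝ → E2} {Ω Ω' : Set E2} {u ut : E2 → E2} {P : E2 → ℝ} (H : FL e s ρ g a z Ω Ω' u ut P)
include H

lemma du {x : E2} (hx : x ∈ Ω) : HasFDerivAt u (fderiv ℝ u x) x :=
  ((H.hu.contDiffAt (mem_of_superset (H.o1.mem_nhds hx) subset_closure)).differentiableAt (by norm_num)).hasFDerivAt
lemma vec (v : E2) : v = v 0 • EuclideanSpace.single 0 1 + v 1 • EuclideanSpace.single 1 1 := by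
  ext i; fin_cases i <;> simp
lemma etr : e transl = 2 * Real.pi := by
  apply Complex.ext
  · rw [H.ere]; simp [transl]
  · rw [H.eim]; simp [transl]
lemma e0 : e.symm 1 = EuclideanSpace.single 0 1 := by
  rw [LinearIsometryEquiv.symm_apply_eq]; apply Complex.ext <;> simp [H.ere, H.eim]
lemma e1 : e.symm I = s • EuclideanSpace.single 1 1 := by
  rw [LinearIsometryEquiv.symm_apply_eq]; apply Complex.ext <;> simp [H.ere, H.eim, H.ss]
lemma ecl : closure (e.symm ⁻¹' Ω) = e.symm ⁻¹' closure Ω := (e.symm.toHomeomorph.preimage_closure Ω).symm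
lemma fd : DifferentiableOn ℂ (fun y => conj (e (u (e.symm y)))) (e.symm ⁻¹' Ω) := by
  intro y hy
  have h1 := H.du hy
  have h2 : HasFDerivAt (fun y => conj (e (u (e.symm y)))) (conjCLE.toContinuousLinearMap ∘L e.toContinuousLinearEquiv.toContinuousLinearMap ∘L (fderiv ℝ u (e.symm y)) ∘L e.symm.toContinuousLinearEquiv.toContinuousLinearMap) y :=
    (conjCLE.hasFDerivAt (x := _)).comp y ((e.toContinuousLinearEquiv.hasFDerivAt (x := _)).comp y (h1.comp y (e.symm.toContinuousLinearEquiv.hasFDerivAt (x := y))))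
  refine (differentiableAt_complex_iff_differentiableAt_real.2 ⟨h2.differentiableAt, ?_⟩).differentiableWithinAt
  rw [h2.fderiv]
  have d := H.hdiv _ hy; have c := H.hcurl _ hy
  have := H.ss
  apply Complex.ext
  · simp [H.e0, H.e1, H.ere, H.eim]; left; linarith
  · simp [H.e0, H.e1, H.ere, H.eim]; linear_combination (-1) * d - (fderiv ℝ u (e.symm y) (EuclideanSpace.single 1 1) 1) * this
lemma fc : ContinuousOn (fun y => conj (e (u (e.symm y)))) (closure (e.symm ⁻¹' Ω)) := by
  rw [H.ecl]
  exact (continuous_conj.comp e.continuous).comp_continuousOn (H.hu.continuousOn.comp e.symm.continuous.continuousOn fun x hx => hx)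
/-- Bernoulli function -/
lemma Bd {y k : ℂ} (hy : e.symm y ∈ Ω) (hk : e (ut (e.symm y)) = conj k) :
    HasFDerivAt (fun y => 1/2 * ‖u (e.symm y)‖ ^ 2 + P (e.symm y) / ρ + g * (e.symm y) 1) (-(reCLM ∘L (ContinuousLinearMap.mul ℝ ℂ k))) y := by
  set x := e.symm y
  have h1 := H.du hy
  have hP : HasGradientAt P (gradient P x) x := ((H.hP.contDiffAt (mem_of_superset (H.o1.mem_nhds hy) subset_closure)).differentiableAt (by norm_num)).hasGradientAt
  have h2 := ((h1.norm_sq.const_mul (1/2)).add ((hP.hasFDerivAt).mul_const ρ⁻¹)).add (((EuclideanSpace.proj (𝕜 := ℝ) (1 : Fin 2)).hasFDerivAt (x := x)).const_mul g)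
  refine (h2.comp y (e.symm.toContinuousLinearEquiv.hasFDerivAt (x := y))).congr_fderiv ?_
  ext h
  set v := e.symm h with hv
  have ev : h = e v := by simp [hv]
  have eu := H.eul x hy
  have hc := H.hcurl x hy
  have k1 : k = conj (e (ut x)) := by rw [hk]; simp
  have q0 := congrArg (fun w : E2 => w 0) eu
  have q1 := congrArg (fun w : E2 => w 1) eu
  have Lv := congrArg (fderiv ℝ u x) (H.vec v)
  have Lu := congrArg (fderiv ℝ u x) (H.vec (u x))
  simp only [map_add, map_smul] at Lv Lu
  have L0 := congrArg (fun w : E2 => w 0) Lv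
  have L1 := congrArg (fun w : E2 => w 1) Lv
  have M0 := congrArg (fun w : E2 => w 0) Lu
  have M1 := congrArg (fun w : E2 => w 1) Lu
  have hg : fderiv ℝ P x v = gradient P x 0 * v 0 + gradient P x 1 * v 1 := by
    rw [hP.hasFDerivAt.fderiv, InnerProductSpace.toDual_apply_apply, PiLp.inner_apply, Fin.sum_univ_two]
    simp only [RCLike.inner_apply, conj_trivial]; ring
  have hρ := H.hρ.ne'
  have hss := H.ss
  simp [e2vec] at q0 q1 L0 L1 M0 M1
  simp [ev, k1, H.ere, H.eim, EuclideanSpace.inner_eq_star_dotProduct, Fin.sum_univ_two, dotProduct]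
  generalize gradient P x 0 = p0 at *
  generalize gradient P x 1 = p1 at *
  rw [L0, L1]; rw [M0] at q0; rw [M1] at q1
  field_simp
  generalize (fderiv ℝ u x (EuclideanSpace.single 0 1)) 0 = d00 at *
  generalize (fderiv ℝ u x (EuclideanSpace.single 0 1)) 1 = d01 at *
  generalize (fderiv ℝ u x (EuclideanSpace.single 1 1)) 0 = d10 at *
  generalize (fderiv ℝ u x (EuclideanSpace.single 1 1)) 1 = d11 at *
  generalize ut x 0 = t0 at *
  generalize ut x 1 = t1 at *
  generalize u x 0 = u0 at *
  generalize u x 1 = u1 at *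
  generalize v 0 = v0 at *
  generalize v 1 = v1 at *
  have : d01 = d10 := by linarith
  subst this
  linear_combination v0 * q0 + v1 * q1 + ρ*t1 * v1 * hss + hg
end FL
end NS

namespace NS
open Complex Topology Metric ComplexConjugate

section
variable {e : E2 ≃ₗᵢ[ℝ] ℂ} {s ρ g a : ℝ}
lemma FL.sf {A m q0 : ℝ} {za zaa : ℝ → ℂ} {z : ℝ → E2} {Ω Ω' : Set E2} {u ut : E2 → E2} {P : E2 → ℝ} (H : FL e s ρ g a z Ω Ω' u ut P)
    (hA : 1 ≤ A) (hm : 0 < m) (hm1 : m ≤ 1) (hz : ∀ α, HasDerivAt (fun α => e (z α)) (za α) α) (hza : ∀ α, HasDerivAt za (zaa α) α)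
    (ba : ∀ α, ‖za α‖ ≤ A) (baa : ∀ α, ‖zaa α‖ ≤ A) (ch : ∀ α β, m * |α - β| ≤ ‖e (z α) - e (z β)‖) {Q : ℝ → ℝ} (q0p : 0 ≤ q0) (hQ : ∀ α, |Q α| ≤ q0)
    (hQL : ∀ α β, |Q β - Q α| ≤ q0 * |β - α|) (Qe : ∀ α, Q α = (conj (e (u (z α))) * za α).im) :
    SF A m a q0 (fun α => e (z α)) za zaa (e.symm ⁻¹' Ω) (e.symm ⁻¹' Ω') (fun y => conj (e (u (e.symm y)))) := by
  have hr : range (fun α => e (z α)) = e.symm ⁻¹' range z := by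
    ext x; constructor
    · rintro ⟨α, rfl⟩; simp
    · rintro ⟨α, h⟩; exact ⟨α, by simp [h]⟩
  have hc : ∀ O : Set E2, IsConnected O → IsConnected (e.symm ⁻¹' O) := fun O h => by
    rw [← e.image_eq_preimage_symm]; exact h.image _ e.continuous.continuousOn
  have hf : ∀ O : Set E2, frontier (e.symm ⁻¹' O) = e.symm ⁻¹' frontier O := fun O => (e.symm.toHomeomorph.preimage_frontier O).symm
  have ep : ∀ x : ℂ, e.symm (x + 2 * Real.pi) = e.symm x + transl := fun x => by rw [← H.etr]; simp
  have px : ∀ x, x ∈ Ω ↔ x + transl ∈ Ω := fun x => by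
    constructor
    · intro h; rw [← H.pΩ]; exact ⟨x, h, rfl⟩
    · intro h; rw [← H.pΩ] at h; obtain ⟨y, hy, h⟩ := h; rwa [← add_right_cancel h]
  have im1 : ∀ x : ℂ, s * (e.symm x) 1 = x.im := fun x => by rw [← H.eim]; simp
  have re1 : ∀ x : ℂ, (e.symm x) 0 = x.re := fun x => by rw [← H.ere]; simp
  have pf : ∀ x : ℂ, e.symm x ∈ Ω → conj (e (u (e.symm (x + 2 * Real.pi)))) = conj (e (u (e.symm x))) := fun x hx => by rw [ep, H.pu _ hx]
  have hs1 : ∀ x : ℂ, a < x.im → e.symm x ∈ Ω := fun x hx => H.s1 _ (by rw [im1]; exact hx.le)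
  refine { hA, hm, hm1, hz, hza, ba, baa, chord := ch, q0p, per := fun α => ?_, o1 := H.o1.preimage e.symm.continuous, o2 := H.o2.preimage e.symm.continuous, c1 := hc _ H.c1, c2 := hc _ H.c2, un := ?_, dj := H.dj.preimage _, f1 := ?_, f2 := ?_, s1 := ?_, s2 := ?_, sc := ?_, fd := H.fd, fc := H.fc, pΩ := ?_, pf := pf, dec := ?_, hq := ?_, hqL := ?_ }
  · rw [H.pz, map_add, H.etr]
  · rw [hr, ← preimage_union, ← preimage_union, H.un, preimage_univ]
  · rw [hf, hr, H.f1]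
  · rw [hf, hr, H.f2]
  · intro x hx; exact H.s1 _ (by rwa [im1])
  · intro x hx; exact H.s2 _ (by rwa [im1])
  · have := H.sc
    have h : (e.symm ⁻¹' Ω) ≃ₜ Ω := (e.symm.toHomeomorph.sets (s := e.symm ⁻¹' Ω) (t := Ω) rfl)
    exact h.toHomotopyEquiv.simplyConnectedSpace
  · intro x; show e.symm x ∈ Ω ↔ e.symm (x + 2 * Real.pi) ∈ Ω
    rw [ep]; exact px _
  · refine decay (H.fd.mono fun x hx => hs1 x hx) (fun x hx => pf x (hs1 x hx)) ?_
    have h2 := (e.symm.measurePreserving.integrableOn_comp_preimage e.symm.toHomeomorph.measurableEmbedding).2 H.L2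
    refine (h2.mono_set (fun x hx => ⟨hs1 x hx.1, ?_⟩)).congr_fun_ae (.of_forall fun x => ?_)
    · show (e.symm x) 0 ∈ Icc 0 (2 * Real.pi)
      rw [re1]; exact hx.2
    · simp
  · intro α; have := hQ α; rw [Qe] at this; simpa using this
  · intro α β; have := hQL α β; rw [Qe, Qe] at this; simpa using this

lemma FL.of {ι : Type*} {T m : ℝ} {Z za zaa zt zat : ι → ℝ → ℝ → ℂ} {Q : ι → ℝ → ℝ → ℝ} {z : ℝ → ℝ → E2} {Ω Ω' : ℝ → Set E2} {u : E2 → ℝ → E2} {P : E2 → ℝ → ℝ} (i : ι)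
    (hT : 0 < T) (H : ∀ t ∈ Icc 0 T, FL e s ρ g a (fun α => z α t) (Ω t) (Ω' t) (fun x => u x t) (fun x => deriv (fun s => u x s) t) (fun x => P x t))
    (Ze : ∀ t α, Z i t α = e (z α t)) (r1 : RR T Z za zt) (r2 : RR T za zaa zat) (b1 : B0 T za) (b2 : B0 T zaa) (b3 : UB T 1 zt) (b4 : B0 T zat)
    (hm : 0 < m) (ch : ∀ t ∈ Icc 0 T, ∀ α β, m * |α - β| ≤ ‖Z i t α - Z i t β‖) (hQ : UB T 2 Q)
    (Qe : ∀ t ∈ Icc 0 T, ∀ α, Q i t α = (conj (e (u (z α t) t)) * za i t α).im) :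
    ∃ A m q0 qt, OF A m a q0 T (Z i) (za i) (zaa i) (zt i) (zat i) qt (fun t => e.symm ⁻¹' Ω t) (fun t => e.symm ⁻¹' Ω' t) (fun t y => conj (e (u (e.symm y) t)))
      (fun t y => 1/2 * ‖u (e.symm y) t‖ ^ 2 + P (e.symm y) t / ρ + g * (e.symm y) 1) := by
  obtain ⟨C1, h1⟩ := b1.1
  obtain ⟨C2, h2⟩ := b2.1
  obtain ⟨C3, h3⟩ := b3.b.1
  obtain ⟨C4, h4⟩ := b4.1
  obtain ⟨C5, h50, h5⟩ := b3.lip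
  obtain ⟨C6, h60, h6⟩ := b3.lipt
  obtain ⟨C7, h70, h7⟩ := hQ.d.lip
  obtain ⟨C8, h8⟩ := hQ.b.1
  obtain ⟨-, Qa, Qt, hr, -, hQt⟩ := hQ
  obtain ⟨C9, h9⟩ := hQt.b.1
  obtain ⟨C0, h00, h0⟩ := hQt.lipt
  set A := 1 + |C1| + |C2| + |C3| + |C4| + C5 + C6 with hA
  set q0 := |C8| + |C9| + C0 + C7 with hq0
  have n1 := abs_nonneg C1; have n2 := abs_nonneg C2; have n3 := abs_nonneg C3; have n4 := abs_nonneg C4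
  have n8 := abs_nonneg C8; have n9 := abs_nonneg C9
  have l1 := le_abs_self C1; have l2 := le_abs_self C2; have l3 := le_abs_self C3; have l4 := le_abs_self C4
  have l8 := le_abs_self C8; have l9 := le_abs_self C9
  have Zf : Z i = fun t α => e (z α t) := by ext t α; exact Ze t α
  have Qf : ∀ t ∈ Icc 0 T, ∀ α, (conj (e (u (e.symm (Z i t α)) t)) * za i t α).im = Q i t α := fun t ht α => by rw [Qe t ht, Ze]; simp
  refine ⟨A, min m 1, q0, Qt i, ?_⟩
  refine { T0 := hT, sf := fun t ht => ?_, hzt := fun α t ht => (r1 i t ht α).2, bt := fun t ht α => (h3 i t ht α).trans (by linarith), ztt := fun s hs t ht α => (h6 i s hs t ht α).trans ?_, zta := fun t ht α β => (h5 i t ht α β).trans ?_, hzat := fun α t ht => (r2 i t ht α).2, bat := fun t ht α => (h4 i t ht α).trans (by linarith), qtc := fun t ht => hQt.b.cc i ht, qtb := fun t ht α => (h9 i t ht α).trans (by linarith), qtt := fun s hs t ht α => ?_, Bc := fun t ht => ?_, Bd := fun t ht x hx k hk => ?_ }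
  · rw [Zf]
    refine (H t ht).sf (Q := Q i t) (by linarith) (lt_min hm one_pos) (min_le_right _ _) (fun α => ?_) (fun α => (r2 i t ht α).1) (fun α => (h1 i t ht α).trans (by linarith)) (fun α => (h2 i t ht α).trans (by linarith)) (fun α β => ?_) (by positivity) (fun α => (h8 i t ht α).trans (by linarith)) (fun α β => (h7 i t ht α β).trans ?_) (fun α => Qe t ht α)
    · have := (r1 i t ht α).1
      rwa [Zf] at this
    · rw [← Ze, ← Ze]
      exact (mul_le_mul_of_nonneg_right (min_le_left _ _) (abs_nonneg _)).trans (ch t ht α β)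
    · exact mul_le_mul_of_nonneg_right (by linarith) (abs_nonneg _)
  · exact mul_le_mul_of_nonneg_right (by linarith) (abs_nonneg _)
  · exact mul_le_mul_of_nonneg_right (by linarith) (abs_nonneg _)
  · rw [Qf s hs, Qf t ht]
    have := tay1 h00 (convex_Icc 0 T) (fun x hx => (hr i x hx α).2) (fun x hx y hy => h0 i y hy x hx α) t ht s hs
    rw [sq_abs] at this
    exact this.trans (mul_le_mul_of_nonneg_right (by linarith) (sq_nonneg _))
  · have Ht := H t (Ioo_subset_Icc_self ht)
    rw [Ht.ecl]
    have c1 := Ht.hu.continuousOn.comp e.symm.continuous.continuousOn (s := e.symm ⁻¹' closure (Ω t)) (fun x hx => hx)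
    have c2 := Ht.hP.continuousOn.comp e.symm.continuous.continuousOn (s := e.symm ⁻¹' closure (Ω t)) (fun x hx => hx)
    have c3 : Continuous fun y : ℂ => (e.symm y) 1 := (EuclideanSpace.proj (𝕜 := ℝ) (1 : Fin 2)).continuous.comp e.symm.continuous
    exact (((c1.norm.pow 2).const_mul (1/2)).add (c2.div_const ρ)).add (c3.continuousOn.const_mul g)
  · refine (H t (Ioo_subset_Icc_self ht)).Bd hx ?_
    have h1 := (conjCLE.hasFDerivAt (x := _)).comp_hasDerivAt t hk
    have h2 := (e.symm.toContinuousLinearEquiv.hasFDerivAt (x := _)).comp_hasDerivAt t h1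
    have h3 : HasDerivAt (fun s => u (e.symm x) s) (e.symm (conj k)) t := by
      refine h2.congr_of_eventuallyEq (.of_forall fun s => ?_)
      simp
    rw [h3.deriv]; simp
end
end NS

namespace NS
open Complex Topology Metric ComplexConjugate

def EE : E2 ≃ₗᵢ[ℝ] ℂ := Complex.orthonormalBasisOneI.repr.symm
def EC : E2 ≃ₗᵢ[ℝ] ℂ := EE.trans conjLIE
lemma EEr (x : E2) : (EE x).re = x 0 := by simp [EE]
lemma EEi (x : E2) : (EE x).im = x 1 := by simp [EE]
lemma ECe (x : E2) : EC x = conj (EE x) := rfl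

section
variable {ρ1 ρ2 σ g T A : ℝ}

lemma fl2 (hρ : 0 < ρ2) (D : TwoFluid ρ1 ρ2 σ g T A) : ∃ a, ∀ t ∈ Icc 0 T, FL EE 1 ρ2 g a (fun α => D.z α t) (D.Ω2 t) (D.Ω1 t) (fun x => D.u2 x t) (fun x => deriv (fun s => D.u2 x s) t) (fun x => D.P2 x t) := by
  obtain ⟨a, -, h⟩ := D.hStrip
  exact ⟨a, fun t ht => { ss := by norm_num, ere := EEr, eim := fun x => by simp [EEi], hρ, o1 := D.hΩ2_open t ht, o2 := D.hΩ1_open t ht, c1 := D.hΩ2_conn t ht, c2 := D.hΩ1_conn t ht, sc := D.hΩ2_sc t ht, un := by rw [union_comm (D.Ω2 t)]; exact D.hUnion t ht, dj := (D.hDisj12 t ht).symm, f1 := D.hFront2 t ht, f2 := D.hFront1 t ht, s1 := fun x hx => (h t ht).2 (by simpa using hx), s2 := fun x hx => (h t ht).1 (by simpa using hx), hu := D.hu2_reg t ht, hP := D.hP2_reg t ht, eul := D.hEuler2 t ht, hdiv := D.hdiv2 t ht, hcurl := D.hcurl2 t ht, pz := D.hper_z t ht, pΩ := D.hper_Ω2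 t ht, pu := D.hper_u2 t ht, L2 := D.hL2_2 t ht }⟩
lemma fl1 (hρ : 0 < ρ1) (D : TwoFluid ρ1 ρ2 σ g T A) : ∃ a, ∀ t ∈ Icc 0 T, FL EC (-1) ρ1 g a (fun α => D.z α t) (D.Ω1 t) (D.Ω2 t) (fun x => D.u1 x t) (fun x => deriv (fun s => D.u1 x s) t) (fun x => D.P1 x t) := by
  obtain ⟨a, -, h⟩ := D.hStrip
  exact ⟨a, fun t ht => { ss := by norm_num, ere := fun x => by simp [ECe, EEr], eim := fun x => by simp [ECe, EEi], hρ, o1 := D.hΩ1_open t ht, o2 := D.hΩ2_open t ht, c1 := D.hΩ1_conn t ht, c2 := D.hΩ2_conn t ht, sc := D.hΩ1_sc t ht, un := D.hUnion t ht, dj := (D.hDisj12 t ht), f1 := D.hFront1 t ht, f2 := D.hFront2 t ht, s1 := fun x hx => (h t ht).1 (by simp only [mem_setOf_eq]; linarith), s2 := fun x hx => (h t ht).2 (by simp only [mem_setOf_eq]; linarith), hu := D.hu1_reg t ht, hP := D.hP1_reg t ht, eul := D.hEuler1 t ht, hdiv := D.hdiv1 t ht, hcurl := D.hcurl1 t ht,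 pz := D.hper_z t ht, pΩ := D.hper_Ω1 t ht, pu := D.hper_u1 t ht, L2 := D.hL2_1 t ht }⟩

def ZZ (D : TwoFluid ρ1 ρ2 σ g T A) (t α : ℝ) : ℂ := EE (D.z α t)
def VV (D : TwoFluid ρ1 ρ2 σ g T A) (t α : ℝ) : ℂ := EE (D.u1 (D.z α t) t)
def V2 (D : TwoFluid ρ1 ρ2 σ g T A) (t α : ℝ) : ℂ := EE (D.u2 (D.z α t) t)

structure FM (za zt zaa zat : TwoFluid ρ1 ρ2 σ g T A → ℝ → ℝ → ℂ) : Prop where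
  T0 : 0 < T
  A1 : 1 ≤ A
  r1 : RR T ZZ za zt
  r2 : RR T za zaa zat
  ua : UB T 3 za
  ut : UB T 3 zt
  uaa : UB T 2 zaa
  uat : UB T 2 zat
  uv : UB T 3 (VV : TwoFluid ρ1 ρ2 σ g T A → ℝ → ℝ → ℂ)
  uy : UB T 3 (fun (D : TwoFluid ρ1 ρ2 σ g T A) t α => (ZZ D t α).im)
  uw : B0 T (fun (D : TwoFluid ρ1 ρ2 σ g T A) t α => ZZ D t α - α)
  lo : ∀ D, ∀ t ∈ Icc 0 T, ∀ α, A⁻¹ ≤ ‖za D t α‖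
  dz : ∀ D, ∀ t ∈ Icc 0 T, ∀ α, deriv (fun a => D.z a t) α = EE.symm (za D t α)
  daa : ∀ D, ∀ t ∈ Icc 0 T, ∀ α, deriv (fun a => deriv (fun b => D.z b t) a) α = EE.symm (zaa D t α)
  dt : ∀ D, ∀ t ∈ Ioo 0 T, ∀ α, deriv (fun s => D.z α s) t = EE.symm (zt D t α)

lemma exFM (hT : 0 < T) (hA : 1 ≤ A) : ∃ za zt zaa zat : TwoFluid ρ1 ρ2 σ g T A → ℝ → ℝ → ℂ, FM za zt zaa zat := by
  have u1 : UB T 4 (fun (D : TwoFluid ρ1 ρ2 σ g T A) t α => D.z α t - α • xvec) :=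
    UB.of (h := fun (D : TwoFluid ρ1 ρ2 σ g T A) p => D.z p.1 p.2 - p.1 • xvec) hT (fun D => D.hz_smooth) ⟨A, fun D p hp k hk => D.hz_bound p hp k hk⟩
  have u2 : UB T 3 (fun (D : TwoFluid ρ1 ρ2 σ g T A) t α => D.u1 (D.z α t) t) :=
    UB.of (h := fun (D : TwoFluid ρ1 ρ2 σ g T A) p => D.u1 (D.z p.1 p.2) p.2) hT (fun D => D.hv1_smooth) ⟨A, fun D p hp k hk => D.hv1_bound p hp k hk⟩
  have w := u1.clm (EE.toContinuousLinearEquiv.toContinuousLinearMap)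
  have wi := (w.clm imCLM).d
  have ex : EE xvec = 1 := by apply Complex.ext <;> simp [EEr, EEi, xvec]
  have we : ∀ (D : TwoFluid ρ1 ρ2 σ g T A) t α, EE.toContinuousLinearEquiv.toContinuousLinearMap (D.z α t - α • xvec) = ZZ D t α - α := fun D t α => by
    show EE _ = _
    simp [ZZ, ex]
  simp only [we] at w wi
  have uw := w.b
  obtain ⟨-, wa, wt, hr, ha, ht⟩ := w
  have ha1 := ha.add (UB.cst 3 (1:ℂ))
  have ha2 := ha1
  obtain ⟨-, zaa, zat, hr2, haa, hat⟩ := ha1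
  have r1 : RR T (ZZ : TwoFluid ρ1 ρ2 σ g T A → ℝ → ℝ → ℂ) (fun D t α => wa D t α + 1) wt := by
    intro D t h α
    constructor
    · exact ((hr D t h α).1.add (Complex.ofRealCLM.hasDerivAt (x := α))).congr_of_eventuallyEq (.of_forall fun x => by simp) |>.congr_deriv (by simp)
    · exact ((hr D t h α).2.add_const (α:ℂ)).congr_of_mem (fun x _ => by simp) h
  have dz : ∀ D : TwoFluid ρ1 ρ2 σ g T A, ∀ t ∈ Icc 0 T, ∀ α, deriv (fun a => D.z a t) α = EE.symm (wa D t α + 1) := fun D t h α => by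
    have := (EE.symm.toContinuousLinearEquiv.hasFDerivAt (x := _)).comp_hasDerivAt α (r1 D t h α).1
    refine (this.congr_of_eventuallyEq (.of_forall fun x => ?_)).deriv
    simp [ZZ]
  refine ⟨fun D t α => wa D t α + 1, wt, zaa, zat, { T0 := hT, A1 := hA, r1, r2 := hr2, ua := ha2, ut := ht, uaa := haa, uat := hat, uv := u2.clm (EE.toContinuousLinearEquiv.toContinuousLinearMap), uy := by simpa using wi, uw, lo := fun D t h α => ?_, dz, daa := fun D t h α => ?_, dt := fun D t h α => ?_ }⟩
  · have := D.hz_lower t h α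
    rwa [dz D t h, LinearIsometryEquiv.norm_map] at this
  · have e : (fun a => deriv (fun b => D.z b t) a) = fun a => EE.symm (wa D t a + 1) := funext fun a => dz D t h a
    rw [e]
    exact ((EE.symm.toContinuousLinearEquiv.hasFDerivAt (x := _)).comp_hasDerivAt α (hr2 D t h α).1).deriv
  · have := (EE.symm.toContinuousLinearEquiv.hasFDerivAt (x := _)).comp_hasDerivAt t ((r1 D t (Ioo_subset_Icc_self h) α).2.hasDerivAt (Icc_mem_nhds h.1 h.2))
    refine (this.congr_of_eventuallyEq (.of_forall fun x => ?_)).deriv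
    simp [ZZ]
end
end NS

namespace NS
open Complex Topology Metric ComplexConjugate

lemma RR.clm {ι F F' : Type*} [NormedAddCommGroup F] [NormedSpace ℝ F] [NormedAddCommGroup F'] [NormedSpace ℝ F'] {T : ℝ} {g ga gt : ι → ℝ → ℝ → F} (h : RR T g ga gt) (L : F →L[ℝ] F') :
    RR T (fun i t α => L (g i t α)) (fun i t α => L (ga i t α)) (fun i t α => L (gt i t α)) := fun i t hi α =>
  ⟨L.hasFDerivAt.comp_hasDerivAt _ (h i t hi α).1, L.hasFDerivAt.comp_hasDerivWithinAt _ (h i t hi α).2⟩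

section
variable {ρ1 ρ2 σ g T A : ℝ}
def F2 (D : TwoFluid ρ1 ρ2 σ g T A) (t : ℝ) (y : ℂ) : ℂ := conj (EE (D.u2 (EE.symm y) t))
def F1 (D : TwoFluid ρ1 ρ2 σ g T A) (t : ℝ) (y : ℂ) : ℂ := conj (EC (D.u1 (EC.symm y) t))
def QQ (za : TwoFluid ρ1 ρ2 σ g T A → ℝ → ℝ → ℂ) (D : TwoFluid ρ1 ρ2 σ g T A) (t α : ℝ) : ℝ := (conj (VV D t α) * za D t α).im
def p1 (za : TwoFluid ρ1 ρ2 σ g T A → ℝ → ℝ → ℂ) (D : TwoFluid ρ1 ρ2 σ g T A) (t α : ℝ) : ℝ := (VV D t α * conj (za D t α)).re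
def p2 (za : TwoFluid ρ1 ρ2 σ g T A → ℝ → ℝ → ℂ) (D : TwoFluid ρ1 ρ2 σ g T A) (t α : ℝ) : ℝ := (conj (V2 D t α) * za D t α).re
def CH (m : ℝ) (D : TwoFluid ρ1 ρ2 σ g T A) : Prop := 0 < m ∧ ∀ t ∈ Icc 0 T, ∀ α β, m * |α - β| ≤ ‖ZZ D t α - ZZ D t β‖
lemma F2e (D : TwoFluid ρ1 ρ2 σ g T A) (t α : ℝ) : F2 D t (ZZ D t α) = conj (V2 D t α) := by simp [F2, ZZ, V2]
lemma ECZ (D : TwoFluid ρ1 ρ2 σ g T A) (t α : ℝ) : conj (ZZ D t α) = EC (D.z α t) := rfl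
lemma F1e (D : TwoFluid ρ1 ρ2 σ g T A) (t α : ℝ) : F1 D t (conj (ZZ D t α)) = VV D t α := by
  rw [ECZ, F1, LinearIsometryEquiv.symm_apply_apply, ECe, conj_conj]; rfl
lemma kim (w v : E2) : rinner w (perpv v) = -(conj (EE w) * EE v).im := by
  simp [rinner, perpv, EEr, EEi, PiLp.inner_apply, Fin.sum_univ_two]; ring

variable {za zt zaa zat : TwoFluid ρ1 ρ2 σ g T A → ℝ → ℝ → ℂ} (M : FM za zt zaa zat)
include M
namespace FM
lemma kin (D : TwoFluid ρ1 ρ2 σ g T A) {t : ℝ} (ht : t ∈ Ioo 0 T) (α : ℝ) : (conj (zt D t α) * za D t α).im = QQ za D t α := by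
  have := D.hkin1 t (Ioo_subset_Icc_self ht) α
  rw [M.dz D t (Ioo_subset_Icc_self ht), M.dt D t ht, kim, map_sub] at this
  simp only [LinearIsometryEquiv.apply_symm_apply, map_sub, sub_mul, sub_im] at this
  rw [QQ, VV]; linarith
lemma q2 (D : TwoFluid ρ1 ρ2 σ g T A) {t : ℝ} (ht : t ∈ Icc 0 T) (α : ℝ) : (conj (V2 D t α) * za D t α).im = QQ za D t α := by
  have h1 := D.hkin1 t ht α
  have h2 := D.hkin2 t ht α
  rw [M.dz D t ht, kim, map_sub] at h1 h2
  simp only [LinearIsometryEquiv.apply_symm_apply, map_sub, sub_mul, sub_im] at h1 h2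
  rw [QQ, VV, V2]; linarith
lemma q1 (D : TwoFluid ρ1 ρ2 σ g T A) (t α : ℝ) : (VV D t α * conj (za D t α)).im = -QQ za D t α := by
  simp [QQ]; ring
lemma uQ : UB T 3 (QQ za) := (((M.uv.clm conjCLE.toContinuousLinearMap)).mul M.ua).clm imCLM
lemma ucj : UB T 3 (fun D t α => conj (za D t α)) := M.ua.clm conjCLE.toContinuousLinearMap
lemma up1 : UB T 3 (p1 za) := (M.uv.mul M.ucj).clm reCLM

lemma od2 (hρ : 0 < ρ2) (D : TwoFluid ρ1 ρ2 σ g T A) {m : ℝ} (h : CH m D) : ∃ C A' m' a q0 qt ε W Wb, OD C A' m' a q0 T (ZZ D) (za D) (zaa D) (zt D) (zat D) qt (fun t => EE.symm ⁻¹' D.Ω2 t) (fun t => EE.symm ⁻¹' D.Ω1 t) (F2 D)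
    (fun t y => 1/2 * ‖D.u2 (EE.symm y) t‖ ^ 2 + D.P2 (EE.symm y) t / ρ2 + g * (EE.symm y) 1) ε W Wb := by
  obtain ⟨a, ha⟩ := fl2 hρ D
  obtain ⟨A', m', q0, qt, hO⟩ := FL.of (Z := ZZ) D M.T0 ha (fun t α => rfl) M.r1 M.r2 M.ua.b M.uaa.b M.ut.d.d M.uat.b h.1 h.2 M.uQ.d (fun t ht α => (M.q2 D ht α).symm)
  obtain ⟨C, ε, W, Wb, h⟩ := exOD hO
  exact ⟨_, _, _, _, _, _, _, _, _, h⟩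
lemma od1 (hρ : 0 < ρ1) (D : TwoFluid ρ1 ρ2 σ g T A) {m : ℝ} (h : CH m D) : ∃ C A' m' a q0 qt ε W Wb, OD C A' m' a q0 T (fun t α => conj (ZZ D t α)) (fun t α => conj (za D t α)) (fun t α => conj (zaa D t α)) (fun t α => conj (zt D t α)) (fun t α => conj (zat D t α)) qt (fun t => EC.symm ⁻¹' D.Ω1 t) (fun t => EC.symm ⁻¹' D.Ω2 t) (F1 D)
    (fun t y => 1/2 * ‖D.u1 (EC.symm y) t‖ ^ 2 + D.P1 (EC.symm y) t / ρ1 + g * (EC.symm y) 1) ε W Wb := by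
  obtain ⟨a, ha⟩ := fl1 hρ D
  have L := conjCLE.toContinuousLinearMap
  obtain ⟨A', m', q0, qt, hO⟩ := FL.of (Z := fun D t α => conj (ZZ D t α)) (Q := fun D t α => (VV D t α * conj (za D t α)).im) D M.T0 ha (fun t α => rfl) (M.r1.clm conjCLE.toContinuousLinearMap) (M.r2.clm conjCLE.toContinuousLinearMap) M.ucj.b (M.uaa.clm conjCLE.toContinuousLinearMap).b (M.ut.clm conjCLE.toContinuousLinearMap).d.d (M.uat.clm conjCLE.toContinuousLinearMap).b h.1 (fun t ht α β => by
    rw [← map_sub, norm_conj]; exact h.2 t ht α β) ((M.uv.mul M.ucj).clm imCLM).d (fun t ht α => by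
    rw [ECe, conj_conj]; rfl)
  obtain ⟨C, ε, W, Wb, h⟩ := exOD hO
  exact ⟨_, _, _, _, _, _, _, _, _, h⟩

def na (_ : FM za zt zaa zat) (D : TwoFluid ρ1 ρ2 σ g T A) (t α : ℝ) : ℝ := (za D t α).re * (za D t α).re + (za D t α).im * (za D t α).im
def kap (D : TwoFluid ρ1 ρ2 σ g T A) (t α : ℝ) : ℝ := (conj (za D t α) * zaa D t α).im * ((M.na D t α)⁻¹ * (√(M.na D t α))⁻¹)
def cf (D : TwoFluid ρ1 ρ2 σ g T A) (t α : ℝ) : ℝ := (zt D t α * conj (za D t α)).re * (M.na D t α)⁻¹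
def H1 (_ : FM za zt zaa zat) (D : TwoFluid ρ1 ρ2 σ g T A) (t α : ℝ) : ℝ := (VV D t α * conj (zt D t α)).re + -(1/2) * (VV D t α * conj (VV D t α)).re + -g * (ZZ D t α).im
def Gs (D : TwoFluid ρ1 ρ2 σ g T A) (t α : ℝ) : ℝ :=
  -1 * (QQ za D t α * ((zt D t α * conj (za D t α)).im * (M.na D t α)⁻¹)) + -(1/2) * ((M.na D t α)⁻¹ * (QQ za D t α * QQ za D t α)) + -g * (ZZ D t α).im + σ/ρ2 * M.kap D t α + -(ρ1/ρ2) * M.H1 D t α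

lemma nae (D : TwoFluid ρ1 ρ2 σ g T A) (t α : ℝ) : M.na D t α = ‖za D t α‖ ^ 2 := by
  rw [na, Complex.sq_norm, Complex.normSq_apply]
lemma nlo (D : TwoFluid ρ1 ρ2 σ g T A) (t : ℝ) (ht : t ∈ Icc 0 T) (α : ℝ) : (A⁻¹)^2 ≤ M.na D t α := by
  rw [nae]; have := M.lo D t ht α
  have := M.A1
  gcongr
lemma nl0 : 0 < (A⁻¹)^2 := by have := M.A1; positivity
lemma una : UB T 3 M.na := ((M.ua.clm reCLM).mul (M.ua.clm reCLM)).add ((M.ua.clm imCLM).mul (M.ua.clm imCLM))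
lemma uni : UB T 3 (fun D t α => (M.na D t α)⁻¹) := M.una.inv M.nl0 M.nlo
lemma usg : UB T 3 (fun D t α => √(M.na D t α)) := M.una.sqrt M.nl0 M.nlo
lemma ukap : UB T 2 M.kap := ((M.ucj.d.mul M.uaa).clm imCLM).mul (M.uni.d.mul (M.usg.inv (Real.sqrt_pos.2 M.nl0) (fun i t ht α => Real.sqrt_le_sqrt (M.nlo i t ht α))).d)
lemma ucf : UB T 3 M.cf := ((M.ut.mul M.ucj).clm reCLM).mul M.uni
lemma uH1 : UB T 3 M.H1 := (((M.uv.mul (M.ut.clm conjCLE.toContinuousLinearMap)).clm reCLM).add ((UB.cst 3 _).mul ((M.uv.mul (M.uv.clm conjCLE.toContinuousLinearMap)).clm reCLM))).add ((UB.cst 3 _).mul M.uy)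
lemma uGs : UB T 2 M.Gs := (((((UB.cst 2 _).mul (M.uQ.d.mul ((((M.ut.mul M.ucj).clm imCLM).mul M.uni).d))).add ((UB.cst 2 _).mul (M.uni.d.mul (M.uQ.mul M.uQ).d))).add ((UB.cst 2 _).mul M.uy.d)).add ((UB.cst 2 _).mul M.ukap)).add ((UB.cst 2 _).mul M.uH1.d)
lemma jump (D : TwoFluid ρ1 ρ2 σ g T A) {t : ℝ} (ht : t ∈ Icc 0 T) (α : ℝ) : D.P2 (D.z α t) t = D.P1 (D.z α t) t - σ * M.kap D t α := by
  have h := D.hjump t ht α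
  rw [M.dz D t ht, M.daa D t ht] at h
  have e0 : ∀ w : ℂ, (EE.symm w) 0 = w.re := fun w => by rw [← EEr]; simp
  have e1 : ∀ w : ℂ, (EE.symm w) 1 = w.im := fun w => by rw [← EEi]; simp
  simp only [e0, e1] at h
  have hn : (za D t α).re ^ 2 + (za D t α).im ^ 2 = M.na D t α := by rw [na]; ring
  have n0 := M.nl0.trans_le (M.nlo D t ht α)
  have hp : M.na D t α ^ ((3:ℝ)/2) = M.na D t α * √(M.na D t α) := by
    rw [Real.sqrt_eq_rpow, ← Real.rpow_one_add' n0.le (by norm_num)]; norm_num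
  rw [hn, hp] at h
  have : M.kap D t α = ((za D t α).re * (zaa D t α).im - (za D t α).im * (zaa D t α).re) / (M.na D t α * √(M.na D t α)) := by
    rw [kap, div_eq_mul_inv, mul_inv]; simp; left; ring
  rw [this]
  linear_combination h
end FM
end
end NS

namespace NS
open Complex Topology Metric ComplexConjugate

lemma alg1 (v w x : ℂ) {n : ℝ} (hn : n = w.re * w.re + w.im * w.im) (h0 : 0 < n) :
    (v * x).re - 1/2 * ‖v‖ ^ 2 = -(1/2) * (n⁻¹ * (v * w).re ^ 2) + (x * conj w).re * n⁻¹ * (v * w).re + (-1 * ((v * w).im * ((x * conj w).im * n⁻¹)) + -(1/2) * (n⁻¹ * ((v * w).im * (v * w).im))) := by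
  rw [Complex.sq_norm, Complex.normSq_apply]
  simp only [mul_re, mul_im, conj_re, conj_im]
  field_simp
  rw [hn]; ring

section
variable {ρ1 ρ2 σ g T A : ℝ} {za zt zaa zat : TwoFluid ρ1 ρ2 σ g T A → ℝ → ℝ → ℂ}
lemma FM.lam (M : FM za zt zaa zat) (hρ1 : 0 < ρ1) (hρ2 : 0 < ρ2) (D : TwoFluid ρ1 ρ2 σ g T A) {m : ℝ} (h : CH m D) {pa pt : TwoFluid ρ1 ρ2 σ g T A → ℝ → ℝ → ℝ} (hr : RR T (p1 za) pa pt) (hpt : B0 T pt) :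
    ∃ Λ : ℝ → ℝ → ℝ, (∀ t ∈ Icc 0 T, ∀ α, HasDerivAt (Λ t) (p2 za D t α) α) ∧ (∀ t ∈ Icc 0 T, ∀ α, Λ t (α + 2 * Real.pi) = Λ t α) ∧
      (∀ t ∈ Ioo 0 T, ∀ α, HasDerivAt (fun s => Λ s α) ((-(1/2) * ((M.na D t α)⁻¹ * p2 za D t α ^ 2) + M.cf D t α * p2 za D t α + (M.Gs D t α + ρ1/ρ2 * JJ pt D t α)) - (-(1/2) * ((M.na D t 0)⁻¹ * p2 za D t 0 ^ 2) + M.cf D t 0 * p2 za D t 0 + (M.Gs D t 0 + ρ1/ρ2 * JJ pt D t 0))) t) ∧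
      ContinuousOn (fun x : ℝ × ℝ => Λ x.1 x.2) (Icc 0 T ×ˢ univ) := by
  obtain ⟨C, A', m', a, q0, qt, ε, W, Wb, O⟩ := M.od2 hρ2 D h
  obtain ⟨C', A'', m'', a', q0', qt', ε', W', Wb', O'⟩ := M.od1 hρ1 D h
  have hd : ∀ t ∈ Icc 0 T, ∀ α, HasDerivAt (fun α => (Wb t α).re) (p2 za D t α) α := fun t ht α => by
    have := hre ((O.st t ht).Wb' α)
    rwa [F2e] at this
  have hI : ∀ t ∈ Ioo 0 T, t ∈ Icc 0 T := fun t ht => Ioo_subset_Icc_self ht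
  refine ⟨fun t α => (Wb t α).re, hd, fun t ht α => congrArg re ((O.st t ht).Wbp α), fun t ht α => ?_, ?_⟩
  · have i0 : JJ pt D t 0 = 0 := by simp [JJ]
    have e1 : ∀ s ∈ Icc 0 T, (Wb' s α).re = JJ (p1 za) D s α := fun s hs => by
      have d1 : ∀ x ∈ (univ : Set ℝ), HasDerivWithinAt (fun x => (Wb' s x).re - JJ (p1 za) D s x) 0 univ x := fun x _ => by
        have := hre ((O'.st s hs).Wb' x)
        rw [F1e] at this
        exact ((this.sub (M.up1.b.J1 D hs x)).congr_deriv (by simp [p1])).hasDerivWithinAt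
      have := lip1 convex_univ d1 (C := 0) (by simp) 0 (mem_univ _) α (mem_univ _)
      simp only [(O'.st s hs).Wb0, zero_mul, norm_le_zero_iff] at this
      simpa [JJ, sub_eq_zero] using this
    have e2 := (O'.e7 ht α).unique ((J4 M.up1.b hr hpt D ht α).congr_of_eventuallyEq (by
      filter_upwards [isOpen_Ioo.mem_nhds ht] with s hs; exact e1 s (hI s hs)))
    refine (O.e7 ht α).congr_deriv ?_
    have X1 : ∀ α, (F1 D t (conj (ZZ D t α)) * conj (zt D t α)).re - (1/2 * ‖D.u1 (EC.symm (conj (ZZ D t α))) t‖ ^ 2 + D.P1 (EC.symm (conj (ZZ D t α))) t / ρ1 + g * (EC.symm (conj (ZZ D t α))) 1) = M.H1 D t α - D.P1 (D.z α t) t / ρ1 := fun α => by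
      rw [F1e, ECZ, LinearIsometryEquiv.symm_apply_apply, FM.H1]
      have n1 : ‖D.u1 (D.z α t) t‖ = ‖VV D t α‖ := (EE.norm_map _).symm
      have n2 : (VV D t α * conj (VV D t α)).re = ‖VV D t α‖ ^ 2 := by rw [mul_conj, ofReal_re, Complex.sq_norm]
      have n3 : (ZZ D t α).im = (D.z α t) 1 := EEi _
      rw [n1, n2, n3]; ring
    have X2 : ∀ α, (F2 D t (ZZ D t α) * zt D t α).re - (1/2 * ‖D.u2 (EE.symm (ZZ D t α)) t‖ ^ 2 + D.P2 (EE.symm (ZZ D t α)) t / ρ2 + g * (EE.symm (ZZ D t α)) 1) = -(1/2) * ((M.na D t α)⁻¹ * p2 za D t α ^ 2) + M.cf D t α * p2 za D t α + (M.Gs D t α + ρ1/ρ2 * (M.H1 D t α - D.P1 (D.z α t) t / ρ1)) := fun α => by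
      have n1 : ‖D.u2 (D.z α t) t‖ = ‖conj (V2 D t α)‖ := by rw [norm_conj]; exact (EE.norm_map _).symm
      have n3 : (ZZ D t α).im = (D.z α t) 1 := EEi _
      have n4 : EE.symm (ZZ D t α) = D.z α t := by simp [ZZ]
      have := alg1 (conj (V2 D t α)) (za D t α) (zt D t α) (n := M.na D t α) rfl (M.nl0.trans_le (M.nlo D t (hI t ht) α))
      rw [M.q2 D (hI t ht)] at this
      rw [F2e, n4, M.jump D (hI t ht), n1, FM.Gs, n3, FM.cf, p2]
      have r1 := hρ1.ne'; have r2 := hρ2.ne'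
      have : (D.P1 (D.z α t) t - σ * M.kap D t α) / ρ2 = ρ1 / ρ2 * (D.P1 (D.z α t) t / ρ1) - σ / ρ2 * M.kap D t α := by field_simp
      linarith
    rw [X1, X1] at e2
    rw [X2, X2, i0, ← e2]; ring
  · rintro ⟨t, α⟩ ⟨ht, -⟩
    obtain ⟨K, h0, hK, hh0, hW⟩ := O.WbL
    have c1 : ContinuousAt (fun x : ℝ × ℝ => (Wb t x.2).re) (t, α) := ContinuousAt.comp (x := (t, α)) (g := fun α => (Wb t α).re) (f := Prod.snd) (hd t ht α).continuousAt continuousAt_snd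
    have c2 : Tendsto (fun x : ℝ × ℝ => K * √√|x.1 - t| * |x.2|) (𝓝 (t, α)) (𝓝 0) := by
      have : ContinuousAt (fun x : ℝ × ℝ => K * √√|x.1 - t| * |x.2|) (t, α) := by fun_prop
      simpa [ContinuousAt] using this
    have c3 : Tendsto (fun x : ℝ × ℝ => (Wb x.1 x.2).re - (Wb t x.2).re) (𝓝[Icc 0 T ×ˢ univ] (t, α)) (𝓝 0) := by
      refine squeeze_zero_norm' ?_ (c2.mono_left nhdsWithin_le_nhds)
      have : ∀ᶠ x : ℝ × ℝ in 𝓝 (t, α), |x.1 - t| < h0 := by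
        have : ContinuousAt (fun x : ℝ × ℝ => |x.1 - t|) (t, α) := by fun_prop
        exact this.eventually_lt continuousAt_const (by simpa using hh0)
      filter_upwards [self_mem_nhdsWithin, this.filter_mono nhdsWithin_le_nhds] with x hx hx2
      have := hW x.1 hx.1 t ht hx2 x.2
      rw [← sub_re]
      exact (abs_re_le_norm _).trans this
    have := c3.add (c1.tendsto.mono_left nhdsWithin_le_nhds)
    simpa [ContinuousWithinAt] using this
end
end NS

namespace NS
open Complex Topology Metric ComplexConjugate

lemma cd1 {F : Type*} [NormedAddCommGroup F] [NormedSpace ℝ F] {f f' : ℝ → F} (h : ∀ x, HasDerivAt f (f' x) x) (hc : Continuous f') : ContDiff ℝ 1 f := by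
  rw [contDiff_one_iff_deriv]
  exact ⟨fun x => (h x).differentiableAt, by rwa [show deriv f = f' from funext fun x => (h x).deriv]⟩
lemma perL {p : ℝ → ℝ} (h : ContDiff ℝ 1 p) (hp : ∀ x, p (x + 2 * Real.pi) = p x) : ∃ L, ∀ α β, |p β - p α| ≤ L * |β - α| := by
  have hd := contDiff_one_iff_deriv.1 h
  have pd : Function.Periodic (deriv p) (2 * Real.pi) := fun x => by
    rw [← deriv_comp_add_const]; congr 1; exact funext hp
  obtain ⟨C, hC⟩ := isCompact_Icc (a := (0:ℝ)) (b := 2 * Real.pi) |>.exists_bound_of_continuousOn hd.2.continuousOn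
  refine ⟨C, fun α β => lip1 convex_univ (fun x _ => (hd.1 x).hasDerivAt.hasDerivWithinAt) (fun x _ => ?_) α (mem_univ _) β (mem_univ _)⟩
  obtain ⟨y, hy, e⟩ := pd.exists_mem_Ico₀ Real.two_pi_pos x
  rw [e]; exact hC y (Ico_subset_Icc_self hy)

section
variable {ρ1 ρ2 σ g T A : ℝ} {za zt zaa zat : TwoFluid ρ1 ρ2 σ g T A → ℝ → ℝ → ℂ}
lemma FM.Zp (_ : FM za zt zaa zat) (D : TwoFluid ρ1 ρ2 σ g T A) {t : ℝ} (ht : t ∈ Icc 0 T) (α : ℝ) : ZZ D t (α + 2 * Real.pi) = ZZ D t α + 2 * Real.pi := by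
  rw [ZZ, D.hper_z t ht, map_add]; congr 1
  apply Complex.ext <;> simp [EEr, EEi, transl]
lemma FM.zap (M : FM za zt zaa zat) (D : TwoFluid ρ1 ρ2 σ g T A) {t : ℝ} (ht : t ∈ Icc 0 T) (α : ℝ) : za D t (α + 2 * Real.pi) = za D t α := by
  have h1 := (M.r1 D t ht (α + 2 * Real.pi)).1.comp_add_const α (2 * Real.pi)
  have h2 := (M.r1 D t ht α).1.add_const (2 * Real.pi : ℂ)
  exact h1.unique (h2.congr_of_eventuallyEq (.of_forall fun x => M.Zp D ht x))
lemma FM.pcd (M : FM za zt zaa zat) (D : TwoFluid ρ1 ρ2 σ g T A) {t : ℝ} (ht : t ∈ Icc 0 T) : ContDiff ℝ 1 (p2 za D t) := by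
  have h1 : ContDiff ℝ 1 (ZZ D t) := cd1 (fun x => (M.r1 D t ht x).1) (M.ua.b.cc' D ht)
  have h2 : ContDiff ℝ 1 (za D t) := cd1 (fun x => (M.r2 D t ht x).1) (M.uaa.b.cc' D ht)
  have h3 : ContDiff ℝ 1 (fun α => D.z α t) := by
    have e : (fun α => D.z α t) = EE.symm ∘ ZZ D t := by ext1 α; simp [ZZ]
    rw [e]; exact EE.symm.toContinuousLinearEquiv.contDiff.comp h1
  have h4 : ContDiff ℝ 1 (fun α => D.u2 (D.z α t) t) := by
    rw [← contDiffOn_univ]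
    refine ((D.hu2_reg t ht).of_le (by norm_num)).comp h3.contDiffOn fun α _ => frontier_subset_closure ?_
    rw [D.hFront2 t ht]; exact ⟨α, rfl⟩
  have h5 : ContDiff ℝ 1 (fun α => conj (V2 D t α)) := conjCLE.contDiff.comp (EE.toContinuousLinearEquiv.contDiff.comp h4)
  exact reCLM.contDiff.comp (h5.mul h2)

lemma FM.bd (M : FM za zt zaa zat) (hρ1 : 0 < ρ1) (hρ2 : 0 < ρ2) : ∃ P K, 0 ≤ P ∧ 0 ≤ K ∧ ∀ D m, CH m D → (∀ t ∈ Icc 0 T, ∀ α, |p2 za D t α| ≤ P) ∧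
    ∀ t ∈ Ioc 0 T, ∀ α β, α ≤ β → p2 za D t β - p2 za D t α ≤ K * (1 + 1 / t) * (β - α) := by
  obtain ⟨-, pa, pt, hr, -, hpt⟩ := M.up1
  have usg := M.usg
  obtain ⟨-, sa, st, hrs, -, hst⟩ := M.usg
  obtain ⟨C1, c1, h1⟩ := hst.b.J3
  obtain ⟨C2, c2, h2⟩ := (M.ucf.mul M.usg).d.d.lip
  obtain ⟨C3, c3, h3⟩ := M.uGs.d.lip
  obtain ⟨C4, c4, h4⟩ := hpt.b.J3
  obtain ⟨C5, h5⟩ := M.usg.b.1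
  obtain ⟨C6, h6⟩ := M.una.b.1
  obtain ⟨C7, c7, h7⟩ := M.uni.d.d.lip
  obtain ⟨C8, c8, h8⟩ := M.ucf.d.d.lip
  obtain ⟨C9, c9, h9⟩ := M.uni.d.sd
  obtain ⟨Ca, ca, ha⟩ := M.ucf.d.sd
  obtain ⟨Cb, cb, hb⟩ := M.uGs.sd
  obtain ⟨Cc, cc, hc⟩ := hpt.d.lip
  have hρ : 0 < ρ1 / ρ2 := by positivity
  have hA := M.A1; have hT := M.T0
  set C := C1 + C2 + (C3 + ρ1/ρ2 * C4)
  set sm := √((A⁻¹)^2)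
  have sm0 : 0 < sm := Real.sqrt_pos.2 M.nl0
  set P := (A + 1) * Real.exp ((3 * C + 1) / sm * T) * |C5|
  set C' := C7 + C8 + C9 + Ca + (Cb + ρ1/ρ2 * (2 * Cc))
  set am := (|C6| + 1)⁻¹
  have P0 : 0 ≤ P := by positivity
  have r4 := mul_nonneg hρ.le c4
  have r5 := mul_nonneg hρ.le cc
  have hC0 : 0 ≤ C := by positivity
  have hC0' : 0 ≤ C' := by positivity
  refine ⟨P, |CLN C' am P|, P0, abs_nonneg _, fun D m h => ?_⟩
  obtain ⟨Λ, l1, l2, l3, l4⟩ := M.lam hρ1 hρ2 D h hr hpt.b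
  have np : ∀ t ∈ Icc 0 T, ∀ α, 0 < M.na D t α := fun t ht α => M.nl0.trans_le (M.nlo D t ht α)
  have hI : ∀ t ∈ Ioo 0 T, t ∈ Icc 0 T := fun t ht => Ioo_subset_Icc_self ht
  have Sp : ∀ t ∈ Icc 0 T, ∃ P, ∀ α, JJ (fun D t α => √(M.na D t α)) D t (α + 2 * Real.pi) = JJ (fun D t α => √(M.na D t α)) D t α + P := fun t ht => by
    have hp : Function.Periodic (fun α => √(M.na D t α)) (2 * Real.pi) := fun α => by simp only [FM.na, M.zap D ht]
    exact ⟨_, fun α => hp.intervalIntegral_add_eq_add 0 α (fun _ _ => (M.usg.b.cc D ht).intervalIntegrable _ _)⟩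
  have GLp : ∀ t ∈ Icc 0 T, ∀ α β, |M.Gs D t β + ρ1/ρ2 * JJ pt D t β - (M.Gs D t α + ρ1/ρ2 * JJ pt D t α)| ≤ C * |β - α| := fun t ht α β => by
    have a1 := h3 D t ht α β
    have a2 := mul_le_mul_of_nonneg_left (h4 D t ht α β) hρ.le
    rw [Real.norm_eq_abs] at a1
    rw [← abs_of_pos hρ, ← abs_mul, abs_of_pos hρ] at a2
    have := abs_add_le (M.Gs D t β - M.Gs D t α) (ρ1/ρ2 * (JJ pt D t β - JJ pt D t α))
    calc _ = |(M.Gs D t β - M.Gs D t α) + ρ1/ρ2 * (JJ pt D t β - JJ pt D t α)| := by congr 1; ring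
      _ ≤ (C3 + ρ1/ρ2 * C4) * |β - α| := by linarith
      _ ≤ _ := by gcongr; linarith
  have p0 : ∀ α, |p2 za D 0 α| ≤ A * √(M.na D 0 α) := fun α => by
    rw [M.nae, Real.sqrt_sq (norm_nonneg _)]
    refine (abs_re_le_norm _).trans ?_
    rw [norm_mul, norm_conj]
    have : ‖V2 D 0 α‖ = ‖D.u2 (D.z α 0) 0‖ := EE.norm_map _
    rw [this]; gcongr; exact D.hu2_init α
  have sq : ∀ t ∈ Icc 0 T, ∀ α, ∀ x, (x / √(M.na D t α)) ^ 2 = (M.na D t α)⁻¹ * x ^ 2 := fun t ht α x => by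
    rw [div_pow, Real.sq_sqrt (np t ht α).le]; ring
  have LA : LM T C sm (-(1/2)) A Λ (p2 za D) (M.cf D) (fun t α => M.Gs D t α + ρ1/ρ2 * JJ pt D t α) (JJ (fun D t α => √(M.na D t α)) D) (fun t α => √(M.na D t α)) (JJ st D) :=
    { T0 := hT, C0 := hC0, sm0, A0 := by linarith, hΛ := l1, Λp := l2, Λt := fun t ht α => (l3 t ht α).congr_deriv (by rw [sq t (hI t ht), sq t (hI t ht)]), Λc := l4, hS := fun t ht α => usg.b.J1 D ht α, hSt := fun t ht α => J4 usg.b hrs hst.b D ht α, StL := fun t ht α β => (h1 D t ht α β).trans (by gcongr; linarith), Sc := usg.b.J2 hT.le D, Sp, hσ := fun t ht α => Real.sqrt_le_sqrt (M.nlo D t ht α), cL := fun t ht α β => (h2 D t ht α β).trans (by gcongr; linarith), hGL := GLp, hp0 := fun α => (le_abs_self _).trans (p0 α) }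
  have LB : LM T C sm (1/2) A (fun t α => -Λ t α) (fun t α => -p2 za D t α) (M.cf D) (fun t α => -(M.Gs D t α + ρ1/ρ2 * JJ pt D t α)) (JJ (fun D t α => √(M.na D t α)) D) (fun t α => √(M.na D t α)) (JJ st D) :=
    { T0 := hT, C0 := hC0, sm0, A0 := by linarith, hΛ := fun t ht α => (l1 t ht α).neg, Λp := fun t ht α => congrArg Neg.neg (l2 t ht α), Λt := fun t ht α => (l3 t ht α).neg.congr_deriv (by rw [sq t (hI t ht), sq t (hI t ht)]; ring), Λc := l4.neg, hS := LA.hS, hSt := LA.hSt, StL := LA.StL, Sc := LA.Sc, Sp := Sp, hσ := LA.hσ, cL := LA.cL, hGL := fun t ht α β => by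
        rw [← neg_sub', abs_neg]; exact GLp t ht α β
      hp0 := fun α => (neg_le_abs _).trans (p0 α) }
  have bP : ∀ t ∈ Icc 0 T, ∀ α, |p2 za D t α| ≤ P := fun t ht α => by
    have : (A + 1) * Real.exp ((3 * C + 1) / sm * t) * √(M.na D t α) ≤ P := by
      have h5' := (le_abs_self _).trans (h5 D t ht α)
      have : t ≤ T := ht.2
      show _ ≤ (A + 1) * Real.exp ((3 * C + 1) / sm * T) * |C5|
      have h5'' := h5'.trans (le_abs_self _)
      have hc : 0 ≤ (3 * C + 1) / sm := by positivity
      have he : Real.exp ((3 * C + 1) / sm * t) ≤ Real.exp ((3 * C + 1) / sm * T) := Real.exp_le_exp.2 (mul_le_mul_of_nonneg_left this hc)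
      exact mul_le_mul (mul_le_mul_of_nonneg_left he (by linarith)) h5'' (by positivity) (by positivity)
    rw [abs_le]
    exact ⟨by linarith [LB.main t ht α], (LA.main t ht α).trans this⟩
  refine ⟨bP, ?_⟩
  have pper : ∀ x, p2 za D 0 (x + 2 * Real.pi) = p2 za D 0 x := fun x => by
    have h0 : (0:ℝ) ∈ Icc 0 T := ⟨le_rfl, hT.le⟩
    exact ((l1 0 h0 (x + 2 * Real.pi)).comp_add_const x (2 * Real.pi)).unique ((l1 0 h0 x).congr_of_eventuallyEq (.of_forall fun y => l2 0 h0 y))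
  have LL : LN T C' am P Λ (p2 za D) (fun t α => (M.na D t α)⁻¹) (M.cf D) (fun t α => M.Gs D t α + ρ1/ρ2 * JJ pt D t α) :=
    { T0 := hT, C0 := hC0', am0 := by positivity, P0, hΛ := l1, Λp := l2, Λt := l3, Λc := l4, bP, ham := fun t ht α => by
        have := h6 D t ht α
        have n := np t ht α
        rw [Real.norm_of_nonneg n.le] at this
        exact inv_anti₀ n (this.trans (by linarith [le_abs_self C6]))
      aL := fun t ht α β => (h7 D t ht α β).trans (by gcongr; linarith)
      cL := fun t ht α β => (h8 D t ht α β).trans (by gcongr; linarith)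
      a2 := fun t ht α y _ => (h9 D t ht α y).trans (by gcongr; linarith)
      c2 := fun t ht α y _ => (ha D t ht α y).trans (by gcongr; linarith)
      G2 := fun t ht α y _ => by
        have a1 := hb D t ht α y
        have a2 := mul_le_mul_of_nonneg_left (sdd cc (fun x => hpt.b.J1 D ht x) (hc D t ht) α y) hρ.le
        rw [Real.norm_eq_abs, smul_eq_mul] at a1 a2
        rw [← abs_of_pos hρ, ← abs_mul, abs_of_pos hρ] at a2
        have := abs_add_le (M.Gs D t (α + y) + M.Gs D t (α - y) - 2 * M.Gs D t α) (ρ1/ρ2 * (JJ pt D t (α + y) + JJ pt D t (α - y) - 2 * JJ pt D t α))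
        calc _ = |(M.Gs D t (α + y) + M.Gs D t (α - y) - 2 * M.Gs D t α) + ρ1/ρ2 * (JJ pt D t (α + y) + JJ pt D t (α - y) - 2 * JJ pt D t α)| := by congr 1; ring
          _ ≤ (Cb + ρ1/ρ2 * (2 * Cc)) * y ^ 2 := by linarith
          _ ≤ _ := by gcongr; linarith
      p0 := perL (M.pcd D ⟨le_rfl, hT.le⟩) pper
      pd := fun t ht α => ⟨_, ((M.pcd D ht).differentiable (by norm_num) α).hasDerivAt⟩ }
  intro t ht α β hab
  refine (LL.main t ht α β hab).trans ?_
  have : 0 < t := ht.1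
  have := sub_nonneg.2 hab
  gcongr; exact le_abs_self _
end
end NS

namespace NS
open Complex Topology Metric ComplexConjugate

lemma SF.fbN {A m a q0 N : ℝ} {z za zaa : ℝ → ℂ} {Ω Ω' : Set ℂ} {f : ℂ → ℂ} (S : SF A m a q0 z za zaa Ω Ω' f) (h : ∀ α, ‖f (z α)‖ ≤ N) : ∀ x ∈ Ω, ‖f x‖ ≤ N := by
  obtain ⟨M, M0, hM⟩ := S.bdd
  obtain ⟨y0, hy0⟩ := S.c2.nonempty
  obtain ⟨ρ, hρ, hb⟩ := Metric.isOpen_iff.1 S.o2 y0 hy0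
  intro x hx
  obtain ⟨w, hw, e⟩ : ∃ w : ℂ, ‖w‖ = 1 ∧ w * f x = ‖f x‖ := by
    by_cases h0 : f x = 0
    · exact ⟨1, by simp, by simp [h0]⟩
    · have : (‖f x‖ : ℂ) ≠ 0 := by simpa using h0
      refine ⟨conj (f x) / ‖f x‖, by simp [h0], ?_⟩
      rw [div_mul_eq_mul_div, mul_comm, Complex.mul_conj, Complex.normSq_eq_norm_sq]; push_cast; field_simp
  have le : ∀ y, (w * f y).re ≤ ‖f y‖ := fun y => (re_le_norm _).trans (by rw [norm_mul, hw, one_mul])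
  have := MP (G := fun y => w * f y) (M := M) (c := N) S.o1 hρ (y0 := y0) (fun y hy => by
      by_contra hlt
      exact Set.disjoint_left.1 S.dj hy (hb (by rw [mem_ball, dist_eq_norm]; linarith))) (S.fd.const_mul w) (fun y hy => (le y).trans (hM y (subset_closure hy))) (fun y hy ε hε => by
    have hy' := hy; rw [S.f1] at hy'
    obtain ⟨α, rfl⟩ := hy'
    have hc : Tendsto (fun y => ‖f y‖) (𝓝[Ω] (z α)) (𝓝 ‖f (z α)‖) := ((S.fc _ (frontier_subset_closure hy)).mono subset_closure).norm
    filter_upwards [hc.eventually_lt_const (show ‖f (z α)‖ < N + ε by linarith [h α])] with y hy using (le y).trans hy.le) x hx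
  simpa [e] using this

lemma OD.nk {C A m a q0 T t N c d α0 β0 lam mu : ℝ} {z za zaa zt zat : ℝ → ℝ → ℂ} {qt : ℝ → ℝ → ℝ} {Ω Ω' : ℝ → Set ℂ} {f : ℝ → ℂ → ℂ} {B : ℝ → ℂ → ℝ} {ε : ℝ → ℝ} {W : ℝ → ℂ → ℂ} {Wb : ℝ → ℝ → ℂ} {p q qa : ℝ → ℝ} {τ : ℂ}
    (O : OD C A m a q0 T z za zaa zt zat qt Ω Ω' f B ε W Wb) (ht : t ∈ Icc 0 T) (H : NW N c d (z t) (za t) (zaa t) (Ω t) (f t) p q qa α0 β0 lam mu τ) (hd : 100 * N ^ 6 * d ≤ 1) :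
    mu * q β0 - lam * q α0 ≤ 2000 * N ^ 7 * d := by
  have S := O.sf t ht
  have K := O.st t ht
  obtain ⟨V, hV⟩ := prim S.o1 S.sc (fun x hx => (K.hW x hx).differentiableAt.differentiableWithinAt)
  exact H.neck (fun S' h1 h2 x h3 h4 => S.miss h1 h2 h3 h4) K.hW hV K.Wb' O.C0.le (mul_pos O.m0 O.rr) K.lim K.fH hd
end NS

namespace NS
open Complex Topology Metric ComplexConjugate
section
variable {ρ1 ρ2 σ g T A : ℝ} {za zt zaa zat : TwoFluid ρ1 ρ2 σ g T A → ℝ → ℝ → ℂ}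
lemma ECs (y : ℂ) : EC.symm (conj y) = EE.symm y := by rw [EC.symm_apply_eq, ECe]; simp
lemma FM.nn (M : FM za zt zaa zat) (hρ1 : 0 < ρ1) (hρ2 : 0 < ρ2) {t0 : ℝ} (h0 : 0 < t0) (N0 : ℝ) : ∃ N, 1 ≤ N ∧ N0 ≤ N ∧ ∀ D m, CH m D → ∀ t ∈ Icc 0 T, t0 ≤ t → ∀ c d α0 β0 lam mu : ℝ, ∀ τ : ℂ, 0 < d →
    (∀ α β, |α - β| ≤ c → |α - β| ≤ 2 * N0 * ‖ZZ D t α - ZZ D t β‖) → (∀ α β, c ≤ |α - β| → d ≤ ‖ZZ D t α - ZZ D t β‖) → |lam| ≤ N0 → |mu| ≤ N0 → ‖τ‖ = 1 → lam * za D t α0 = τ → mu * za D t β0 = τ →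
    ZZ D t β0 - ZZ D t α0 = I * τ * d → (∀ s ∈ Ioo (0:ℝ) 1, ZZ D t α0 + s * (ZZ D t β0 - ZZ D t α0) ∉ range (ZZ D t)) → 100 * N ^ 6 * d ≤ 1 → mu * QQ za D t β0 - lam * QQ za D t α0 ≤ 2000 * N ^ 7 * d := by
  obtain ⟨P, K, P0, K0, hPK⟩ := M.bd hρ1 hρ2
  obtain ⟨C1, h1⟩ := M.ua.b.1
  obtain ⟨C2, h2⟩ := M.uaa.b.1
  obtain ⟨C3, -, h3⟩ := M.uaa.d.lip
  have uQ := M.uQ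
  obtain ⟨⟨⟨C4, h4⟩, -⟩, qa, qt, hQ, hqa, -⟩ := uQ
  obtain ⟨C5, h5⟩ := hqa.b.1
  obtain ⟨C6, -, h6⟩ := hqa.d.lip
  obtain ⟨C7, h7⟩ := M.up1.b.1
  obtain ⟨C8, -, h8⟩ := M.up1.d.d.lip
  obtain ⟨C9, h9⟩ := M.uv.b.1
  simp only [Real.norm_eq_abs] at h4 h5 h6 h7 h8
  have A1 := M.A1
  have k0 : 0 ≤ K * (1 + 1 / t0) := by positivity
  refine ⟨1 + |N0| + |C1| + |C2| + |C3| + |C4| + |C5| + |C6| + |C7| + |C8| + |C9| + (P + |C4|) * A + P + K * (1 + 1 / t0), ?_⟩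
  have e : 0 ≤ (P + |C4|) * A := by positivity
  set N := 1 + |N0| + |C1| + |C2| + |C3| + |C4| + |C5| + |C6| + |C7| + |C8| + |C9| + (P + |C4|) * A + P + K * (1 + 1 / t0) with hNd
  have a0 := abs_nonneg N0; have a1 := abs_nonneg C1; have a2 := abs_nonneg C2; have a3 := abs_nonneg C3; have a4 := abs_nonneg C4; have a5 := abs_nonneg C5; have a6 := abs_nonneg C6; have a7 := abs_nonneg C7; have a8 := abs_nonneg C8; have a9 := abs_nonneg C9
  have b0 := le_abs_self N0; have b1 := le_abs_self C1; have b2 := le_abs_self C2; have b3 := le_abs_self C3; have b4 := le_abs_self C4; have b5 := le_abs_self C5; have b6 := le_abs_self C6; have b7 := le_abs_self C7; have b8 := le_abs_self C8; have b9 := le_abs_self C9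
  have n0 : N0 ≤ N := by linarith
  have n1 : C1 ≤ N := by linarith
  have n2 : C2 ≤ N := by linarith
  have n3 : C3 ≤ N := by linarith
  have n4 : C4 ≤ N := by linarith
  have n5 : C5 ≤ N := by linarith
  have n6 : C6 ≤ N := by linarith
  have n7 : C7 ≤ N := by linarith
  have n8 : C8 ≤ N := by linarith
  have n9 : C9 ≤ N := by linarith
  have na : (P + |C4|) * A ≤ N := by linarith
  have nb : P ≤ N := by linarith
  have nc : K * (1 + 1 / t0) ≤ N := by linarith
  have hN : 1 ≤ N := by linarith
  clear_value N
  clear a0 a1 a2 a3 a5 a6 a7 a8 a9 b0 b1 b2 b3 b5 b6 b7 b8 b9 hNd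
  refine ⟨hN, n0, fun D m h t ht htt c d α0 β0 lam mu τ hd loc far bl bm nτ tb tT dd seg hd2 => ?_⟩
  obtain ⟨bP, bK⟩ := hPK D m h
  have tp : 0 < t := h0.trans_le htt
  have loc' : ∀ α β, |α - β| ≤ c → |α - β| ≤ 2 * N * ‖ZZ D t α - ZZ D t β‖ := fun α β hc => (loc α β hc).trans (by gcongr)
  obtain ⟨Ca, A', m', a, q0, qt2, ε, W, Wb, O⟩ := M.od2 hρ2 D h
  obtain ⟨Cb, A1', m1, a', q0', qt1, ε1, W1, Wb1, O1⟩ := M.od1 hρ1 D h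
  have pc : IsPreconnected ((fun s : ℝ => ZZ D t α0 + s * (ZZ D t β0 - ZZ D t α0)) '' Ioo 0 1) :=
    isPreconnected_Ioo.image _ (by fun_prop)
  have ms : ∀ x ∈ ((fun s : ℝ => ZZ D t α0 + s * (ZZ D t β0 - ZZ D t α0)) '' Ioo 0 1), x ∉ range (ZZ D t) := by
    rintro _ ⟨s, hs, rfl⟩; exact seg s hs
  have S := O.sf t ht
  have hm : (1/2:ℝ) ∈ Ioo (0:ℝ) 1 := by norm_num
  rcases S.swap' (ZZ D t α0 + (1/2:ℝ) * (ZZ D t β0 - ZZ D t α0)) with hh | hh | hh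
  · have sub := S.miss pc ms ⟨_, hm, rfl⟩ hh
    have fe : ∀ α, F2 D t (ZZ D t α) * za D t α = p2 za D t α + QQ za D t α * I := fun α => by
      rw [F2e, ← M.q2 D ht, p2, re_add_im]
    refine O.nk ht (c := c) (p := p2 za D t) (qa := qa D t) (τ := τ) { hN, hd, hz := S.hz, hza := S.hza, ba := fun α => (h1 D t ht α).trans n1, baa := fun α => (h2 D t ht α).trans n2, Laa := fun α β => (h3 D t ht α β).trans (by gcongr), pq := fe, hq := fun α => (hQ D t ht α).1, bq := fun α => (h4 D t ht α).trans n4, bqa := fun α => (h5 D t ht α).trans n5, Lqa := fun α β => (h6 D t ht α β).trans (by gcongr), bp := fun α => (bP t ht α).trans nb, Lp := fun α β hab => (bK t ⟨tp, ht.2⟩ α β hab).trans ?_, M := S.fbN fun α => ?_, loc := loc', far, blam := bl.trans n0, bmu := bm.trans n0, nτ, tb, tT, dd, seg := fun s hs => sub ⟨s, hs, rfl⟩ } hd2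
    · have := sub_nonneg.2 hab
      refine mul_le_mul_of_nonneg_right (le_trans ?_ nc) this
      gcongr
    · have l := M.lo D t ht α
      have e1 : ‖F2 D t (ZZ D t α)‖ * ‖za D t α‖ ≤ P + |C4| := by
        rw [← norm_mul, fe]
        refine (norm_add_le _ _).trans (add_le_add ?_ ?_)
        · simpa using bP t ht α
        · simpa using (h4 D t ht α).trans b4
      refine le_trans ?_ na
      have : ‖F2 D t (ZZ D t α)‖ * A⁻¹ ≤ P + |C4| := (mul_le_mul_of_nonneg_left l (norm_nonneg _)).trans e1
      rwa [← div_eq_mul_inv, div_le_iff₀ (by linarith)] at this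
  · have sub := S.miss' pc ms ⟨_, hm, rfl⟩ hh
    have S1 := O1.sf t ht
    have := O1.nk ht (c := c) (N := N) (d := d) (p := p1 za D t) (q := fun α => -QQ za D t α) (qa := fun α => -qa D t α) (α0 := α0) (β0 := β0) (lam := -lam) (mu := -mu) (τ := -conj τ) {
      hN, hd, hz := S1.hz, hza := S1.hza
      ba := fun α => by rw [norm_conj]; exact (h1 D t ht α).trans n1
      baa := fun α => by rw [norm_conj]; exact (h2 D t ht α).trans n2
      Laa := fun α β => by rw [← map_sub, norm_conj]; exact (h3 D t ht α β).trans (by gcongr)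
      pq := fun α => by rw [F1e, ← M.q1 D t, p1, re_add_im]
      hq := fun α => (hQ D t ht α).1.neg, bq := fun α => by rw [abs_neg]; exact (h4 D t ht α).trans n4
      bqa := fun α => by rw [abs_neg]; exact (h5 D t ht α).trans n5
      Lqa := fun α β => by rw [← neg_sub', abs_neg]; exact (h6 D t ht α β).trans (by gcongr)
      bp := fun α => (h7 D t ht α).trans n7, Lp := fun α β hab => (le_abs_self _).trans ((h8 D t ht α β).trans (by rw [abs_of_nonneg (sub_nonneg.2 hab)]; have := sub_nonneg.2 hab; gcongr)), M := S1.fbN fun α => by rw [F1e]; exact (h9 D t ht α).trans n9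
      loc := fun α β => by rw [← map_sub, norm_conj]; exact loc' α β
      far := fun α β => by rw [← map_sub, norm_conj]; exact far α β
      blam := by rw [abs_neg]; exact bl.trans n0
      bmu := by rw [abs_neg]; exact bm.trans n0
      nτ := by simpa using nτ
      tb := by rw [← tb]; simp
      tT := by rw [← tT]; simp
      dd := by rw [← map_sub, dd]; simp
      seg := fun s hs => by
        have := sub ⟨s, hs, rfl⟩
        rw [mem_preimage, ← ECs] at this
        simpa using this } hd2
    linarith
  · exact absurd hh (seg _ hm)
end
end NS

namespace NS
open Complex Topology Metric ComplexConjugate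

lemma nrmD {w : ℝ → ℂ} {w' : ℂ} {t : ℝ} (h : HasDerivAt w w' t) (h0 : 0 < ‖w t‖) : HasDerivAt (fun s => ‖w s‖) ((conj (w t) * w').re / ‖w t‖) t := by
  have := h.norm_sq.sqrt (by positivity)
  simp only [Real.sqrt_sq (norm_nonneg _)] at this
  refine this.congr_deriv ?_
  rw [Complex.inner, mul_div_mul_left _ _ two_ne_zero, mul_comm]
lemma tang {v τ : ℂ} (nτ : ‖τ‖ = 1) (h : (conj τ * v).im = 0) (hv : v ≠ 0) : ∃ l : ℝ, l * v = τ ∧ |l| = ‖v‖⁻¹ := by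
  have e : conj τ * v = ((conj τ * v).re : ℝ) := by apply Complex.ext <;> simp [h]
  have t1 : τ * conj τ = 1 := by rw [Complex.mul_conj, Complex.normSq_eq_norm_sq, nτ]; norm_num
  generalize (conj τ * v).re = r at e
  have hv' : v = r * τ := by linear_combination (-v) * t1 + τ * e
  have r0 : (r:ℂ) ≠ 0 := by rintro h; rw [h] at hv'; exact hv (by simpa using hv')
  refine ⟨r⁻¹, ?_, ?_⟩
  · rw [hv']; push_cast; field_simp
  · rw [hv', norm_mul, nτ, mul_one, Complex.norm_real, abs_inv, Real.norm_eq_abs]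

lemma shift {S : ℝ → ℝ → Prop} (hp : ∀ α β, S α β ↔ S (α + 2 * Real.pi) (β + 2 * Real.pi)) {R : ℝ → Prop} (h : ∀ α ∈ Icc 0 (2 * Real.pi), ∀ β, R (α - β) → S α β) (α β : ℝ) (hR : R (α - β)) : S α β := by
  have p : Function.Periodic (fun x => S x (x - (α - β))) (2 * Real.pi) := fun x => by
    show S _ _ = S _ _
    rw [hp x, add_sub_right_comm]
  obtain ⟨y, hy, e⟩ := p.exists_mem_Ico₀ Real.two_pi_pos α
  have := h y (Ico_subset_Icc_self hy) (y - (α - β)) (by rwa [sub_sub_cancel])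
  have e' : S α (α - (α - β)) = S y (y - (α - β)) := e
  rw [← e', sub_sub_cancel] at this
  exact this

section
variable {ρ1 ρ2 σ g T A : ℝ} {za zt zaa zat : TwoFluid ρ1 ρ2 σ g T A → ℝ → ℝ → ℂ}
lemma cae (D : TwoFluid ρ1 ρ2 σ g T A) (t : ℝ) {α β : ℝ} (h : α ≠ β) : chordArcT D.z α β t = ‖ZZ D t α - ZZ D t β‖ / |α - β| := by
  rw [chordArcT, if_neg h, ZZ, ZZ, ← map_sub, EE.norm_map]

/-- elementary geometric bounds -/
lemma FM.gb (M : FM za zt zaa zat) : ∃ N, 1 ≤ N ∧ A ≤ N ∧ ∀ D : TwoFluid ρ1 ρ2 σ g T A, ∀ t ∈ Icc 0 T, (∀ α β, |α - β| ≤ 1 / (2 * N ^ 2) → |α - β| ≤ 2 * N * ‖ZZ D t α - ZZ D t β‖) ∧ (∀ α β, 4 * N ≤ |α - β| → |α - β| ≤ 2 * ‖ZZ D t α - ZZ D t β‖) ∧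
    ∀ α β, t ≤ 1 / (8 * N ^ 4) → 1 / (2 * N ^ 2) ≤ |α - β| → 1 / (4 * N ^ 3) ≤ ‖ZZ D t α - ZZ D t β‖ := by
  obtain ⟨C1, c1, h1⟩ := M.ua.d.d.lip
  obtain ⟨C2, h2⟩ := M.ut.b.1
  obtain ⟨C3, h3⟩ := M.uw.1
  have A1 := M.A1
  have a2 := abs_nonneg C2; have a3 := abs_nonneg C3
  have b2 := le_abs_self C2; have b3 := le_abs_self C3
  obtain ⟨N, hN⟩ : ∃ N, N = A + C1 + |C2| + |C3| := ⟨_, rfl⟩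
  have n0 : A ≤ N := by linarith
  have n1 : C1 ≤ N := by linarith
  have n2 : C2 ≤ N := by linarith
  have n3 : C3 ≤ N := by linarith
  have hN1 : 1 ≤ N := A1.trans n0
  have N0 : 0 < N := by linarith
  have iA : N⁻¹ ≤ A⁻¹ := inv_anti₀ (by linarith) n0
  clear hN
  refine ⟨N, hN1, n0, fun D t ht => ⟨fun α β hc => ?_, fun α β hc => ?_, fun α β hs hc => ?_⟩⟩
  · have h := tay1 c1 convex_univ (fun x _ => (M.r1 D t ht x).1.hasDerivWithinAt) (fun x _ y _ => h1 D t ht x y) β (mem_univ _) α (mem_univ _)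
    have l := (iA.trans (M.lo D t ht β))
    have k : ‖((α - β : ℝ)) • za D t β‖ ≤ ‖ZZ D t α - ZZ D t β‖ + C1 * |α - β| ^ 2 := by
      have := norm_sub_le (ZZ D t α - ZZ D t β) (ZZ D t α - ZZ D t β - (α - β) • za D t β)
      rw [sub_sub_cancel] at this; linarith
    rw [norm_smul, Real.norm_eq_abs] at k
    have x0 := abs_nonneg (α - β)
    generalize |α - β| = x at *
    generalize ‖ZZ D t α - ZZ D t β‖ = y at *
    have e1 : x * N⁻¹ ≤ y + N * x ^ 2 := (mul_le_mul_of_nonneg_left l x0).trans (k.trans (by gcongr))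
    rw [le_div_iff₀ (by positivity)] at hc
    have e2 : x ≤ (y + N * x ^ 2) * N := by rwa [← div_eq_mul_inv, div_le_iff₀ N0] at e1
    nlinarith
  · have k1 := (h3 D t ht α).trans n3
    have k2 := (h3 D t ht β).trans n3
    have : ‖((α - β : ℝ) : ℂ)‖ ≤ ‖ZZ D t α - ZZ D t β‖ + (N + N) := by
      calc _ = ‖ZZ D t α - ZZ D t β - ((ZZ D t α - α) - (ZZ D t β - β))‖ := by congr 1; push_cast; ring
        _ ≤ _ := (norm_sub_le _ _).trans (add_le_add le_rfl ((norm_sub_le _ _).trans (add_le_add k1 k2)))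
    rw [Complex.norm_real, Real.norm_eq_abs] at this
    linarith
  · have hT := M.T0
    have z0 : (0:ℝ) ∈ Icc 0 T := ⟨le_rfl, hT.le⟩
    have L : ∀ α, ‖ZZ D t α - ZZ D 0 α‖ ≤ N * t := fun α => by
      have := lip1 (convex_Icc 0 T) (fun s hs => (M.r1 D s hs α).2) (fun s hs => (h2 D s hs α).trans n2) 0 z0 t ht
      simpa [abs_of_nonneg ht.1] using this
    have ne : α ≠ β := by
      rintro rfl
      have : 0 < 1 / (2 * N ^ 2) := by positivity
      rw [sub_self, abs_zero] at hc; linarith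
    have ch := D.hchord0 α β
    rw [cae D 0 ne, le_div_iff₀ (abs_pos.2 (sub_ne_zero.2 ne))] at ch
    have : ‖ZZ D 0 α - ZZ D 0 β‖ ≤ ‖ZZ D t α - ZZ D t β‖ + (N * t + N * t) := by
      calc _ = ‖ZZ D t α - ZZ D t β - ((ZZ D t α - ZZ D 0 α) - (ZZ D t β - ZZ D 0 β))‖ := by congr 1; ring
        _ ≤ _ := (norm_sub_le _ _).trans (add_le_add le_rfl ((norm_sub_le _ _).trans (add_le_add (L α) (L β))))
    have e1 : N⁻¹ * (1 / (2 * N ^ 2)) ≤ A⁻¹ * |α - β| := mul_le_mul iA hc (by positivity) (by positivity)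
    have e2 : N * t ≤ N * (1 / (8 * N ^ 4)) := by gcongr
    have e3 : N⁻¹ * (1 / (2 * N ^ 2)) = 1 / (4 * N ^ 3) + 2 * (N * (1 / (8 * N ^ 4))) := by field_simp; norm_num
    linarith
end
end NS

namespace NS
open Complex Topology Metric ComplexConjugate
section
variable {ρ1 ρ2 σ g T A : ℝ} {za zt zaa zat : TwoFluid ρ1 ρ2 σ g T A → ℝ → ℝ → ℂ}
/-- the distance of the two walls at a critical pair -/
lemma FM.cr (M : FM za zt zaa zat) (D : TwoFluid ρ1 ρ2 σ g T A) {t N c d L α0 β0 : ℝ} (ht : t ∈ Ioo 0 T) (hA : A ≤ N) (hd : 0 < d) (dd : ‖ZZ D t β0 - ZZ D t α0‖ = d) (hc : c < |α0 - β0|) (hdc : 2 * N * d < c)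
    (loc : ∀ α β, |α - β| ≤ c → |α - β| ≤ 2 * N * ‖ZZ D t α - ZZ D t β‖) (far : ∀ α β, c ≤ |α - β| → d ≤ ‖ZZ D t α - ZZ D t β‖)
    (nk : ∀ lam mu : ℝ, ∀ τ : ℂ, |lam| ≤ N → |mu| ≤ N → ‖τ‖ = 1 → lam * za D t α0 = τ → mu * za D t β0 = τ → ZZ D t β0 - ZZ D t α0 = I * τ * d →
      (∀ s ∈ Ioo (0:ℝ) 1, ZZ D t α0 + s * (ZZ D t β0 - ZZ D t α0) ∉ range (ZZ D t)) → mu * QQ za D t β0 - lam * QQ za D t α0 ≤ L) :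
    ∃ d', -L ≤ d' ∧ HasDerivAt (fun s => ‖ZZ D s β0 - ZZ D s α0‖) d' t := by
  have ht' := Ioo_subset_Icc_self ht
  have A1 := M.A1
  have N0 : 0 < N := by linarith
  have hz : ∀ α, HasDerivAt (ZZ D t) (za D t α) α := fun α => (M.r1 D t ht' α).1
  have htt : ∀ α, HasDerivAt (fun s => ZZ D s α) (zt D t α) t := fun α => (M.r1 D t ht' α).2.hasDerivAt (Icc_mem_nhds ht.1 ht.2)
  have cβ : (conj (ZZ D t β0 - ZZ D t α0) * za D t β0).re = 0 := by
    have h1 := nrmD ((hz β0).sub_const (ZZ D t α0)) (by rw [dd]; exact hd)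
    have h2 : IsLocalMin (fun β => ‖ZZ D t β - ZZ D t α0‖) β0 := by
      have : ∀ᶠ β in 𝓝 β0, c < |α0 - β| := (Continuous.tendsto (by fun_prop) β0).eventually_const_lt hc
      filter_upwards [this] with β hβ
      rw [dd, norm_sub_rev]; exact far _ _ hβ.le
    have := h2.hasDerivAt_eq_zero h1
    rw [dd] at this
    simpa [hd.ne'] using this
  have cα : (conj (ZZ D t β0 - ZZ D t α0) * za D t α0).re = 0 := by
    have h1 := nrmD ((hz α0).const_sub (ZZ D t β0)) (by rw [dd]; exact hd)
    have h2 : IsLocalMin (fun α => ‖ZZ D t β0 - ZZ D t α‖) α0 := by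
      have : ∀ᶠ α in 𝓝 α0, c < |α - β0| := (Continuous.tendsto (by fun_prop) α0).eventually_const_lt hc
      filter_upwards [this] with α hα
      rw [dd, norm_sub_rev]; exact far _ _ hα.le
    have := h2.hasDerivAt_eq_zero h1
    rw [dd] at this
    rw [mul_neg, neg_re] at this
    simpa only [div_eq_zero_iff, neg_eq_zero, hd.ne', or_false] using this
  have D1 := nrmD ((htt β0).sub (htt α0)) (by rw [Pi.sub_apply, dd]; exact hd)
  refine ⟨_, ?_, D1⟩
  simp only [Pi.sub_apply]
  have dC : (d:ℂ) ≠ 0 := by exact_mod_cast hd.ne'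
  obtain ⟨τ, hτ⟩ : ∃ τ : ℂ, τ = -I * (ZZ D t β0 - ZZ D t α0) / d := ⟨_, rfl⟩
  have hw : ZZ D t β0 - ZZ D t α0 = I * τ * d := by
    rw [hτ]; field_simp; linear_combination (ZZ D t β0 - ZZ D t α0) * I_sq
  have nτ : ‖τ‖ = 1 := by rw [hτ, norm_div, norm_mul, dd]; simp [abs_of_pos hd, hd.ne']
  have tm : ∀ v, (conj (ZZ D t β0 - ZZ D t α0) * v).re = d * (conj τ * v).im := fun v => by
    rw [hw]; simp; ring
  rw [tm] at cα cβ
  have lo : ∀ α, 0 < ‖za D t α‖ ∧ ‖za D t α‖⁻¹ ≤ N := fun α => by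
    have h := M.lo D t ht' α
    have h0 : 0 < A⁻¹ := by positivity
    exact ⟨h0.trans_le h, (inv_le_of_inv_le₀ (by linarith) h).trans hA⟩
  obtain ⟨lam, l1, l2⟩ := tang nτ (by simpa [hd.ne'] using cα) (norm_pos_iff.1 (lo α0).1)
  obtain ⟨mu, m1, m2⟩ := tang nτ (by simpa [hd.ne'] using cβ) (norm_pos_iff.1 (lo β0).1)
  have key := nk lam mu τ (by rw [l2]; exact (lo _).2) (by rw [m2]; exact (lo _).2) nτ l1 m1 hw (by
    rintro s hs ⟨γ, hγ⟩
    have e1 : ‖ZZ D t γ - ZZ D t α0‖ = s * d := by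
      rw [hγ, add_sub_cancel_left, norm_mul, dd, Complex.norm_real, Real.norm_of_nonneg hs.1.le]
    have e2 : ‖ZZ D t γ - ZZ D t β0‖ = (1 - s) * d := by
      rw [hγ, show ZZ D t α0 + s * (ZZ D t β0 - ZZ D t α0) - ZZ D t β0 = ((s - 1 : ℝ) : ℂ) * (ZZ D t β0 - ZZ D t α0) by push_cast; ring, norm_mul, dd, Complex.norm_real, Real.norm_of_nonpos (by linarith [hs.2])]; ring
    have k1 := mul_lt_mul_of_pos_right hs.2 hd
    have k2 := mul_pos hs.1 hd
    have f1 := loc γ α0 (by by_contra h; have := far γ α0 (not_le.1 h).le; linarith)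
    have f2 := loc γ β0 (by by_contra h; have := far γ β0 (not_le.1 h).le; linarith)
    rw [e1] at f1; rw [e2] at f2
    have := abs_sub_le α0 γ β0
    rw [abs_sub_comm α0 γ] at this
    have : 2 * N * (s * d) + 2 * N * ((1 - s) * d) = 2 * N * d := by ring
    linarith)
  have kq : ∀ α, (conj τ * zt D t α).im = -(conj (zt D t α) * τ).im := fun α => by simp; ring
  have k3 : ∀ (α l : ℝ), l * za D t α = τ → (conj (zt D t α) * τ).im = l * QQ za D t α := fun α l h => by
    rw [← h, ← M.kin D ht, show conj (zt D t α) * (l * za D t α) = l * (conj (zt D t α) * za D t α) by ring, Complex.im_ofReal_mul]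
  rw [dd, tm, mul_div_cancel_left₀ _ hd.ne', mul_sub, sub_im, kq, kq, k3 _ _ l1, k3 _ _ m1]
  linarith
end
end NS

namespace NS
open Complex Topology Metric ComplexConjugate
section
variable {ρ1 ρ2 σ g T A : ℝ} {za zt zaa zat : TwoFluid ρ1 ρ2 σ g T A → ℝ → ℝ → ℂ}
lemma FM.fin (M : FM za zt zaa zat) (hρ1 : 0 < ρ1) (hρ2 : 0 < ρ2) : ∃ c, 0 < c ∧ ∀ D : TwoFluid ρ1 ρ2 σ g T A, ∀ m, CH m D → ∀ t ∈ Icc 0 T, ∀ α β, c * |α - β| ≤ ‖ZZ D t α - ZZ D t β‖ := by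
  obtain ⟨N0, h1, hAN, gb⟩ := M.gb
  have np : 0 < N0 := by linarith
  obtain ⟨N, hN1, hN0, nn⟩ := M.nn hρ1 hρ2 (t0 := 1 / (8 * N0 ^ 4)) (by positivity) N0
  obtain ⟨c0, hc0⟩ : ∃ c0, c0 = 1 / (2 * N0 ^ 2) := ⟨_, rfl⟩
  have c0p : 0 < c0 := by rw [hc0]; positivity
  have Np : 0 < N := by linarith
  obtain ⟨d1, hd1⟩ : ∃ d1, d1 = 1 / (100 * N ^ 6) := ⟨_, rfl⟩
  obtain ⟨L, hL⟩ : ∃ L, L = 2000 * N ^ 7 := ⟨_, rfl⟩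
  have d1p : 0 < d1 := by rw [hd1]; positivity
  have Lp : 0 < L := by rw [hL]; positivity
  have d1N : 100 * N ^ 6 * d1 = 1 := by rw [hd1]; field_simp
  have d1a : d1 ≤ 1 / (4 * N0 ^ 3) := by
    rw [hd1]; apply one_div_le_one_div_of_le (by positivity)
    have : N0 ^ 3 ≤ N ^ 3 := by gcongr
    have : N ^ 3 ≤ N ^ 6 := pow_le_pow_right₀ hN1 (by norm_num)
    have : 0 < N ^ 6 := by positivity
    linarith
  have d1b : 1 / (4 * N0 ^ 3) = c0 / (2 * N0) := by rw [hc0]; field_simp; norm_num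
  have d1c : d1 ≤ 1 := d1a.trans (by
    rw [div_le_one (by positivity)]; have : 1 ≤ N0 ^ 3 := one_le_pow₀ h1
    linarith)
  rw [← hc0] at gb
  have far : ∀ (D : TwoFluid ρ1 ρ2 σ g T A) (m : ℝ), CH m D → ∀ t ∈ Icc 0 T, ∀ α β, c0 ≤ |α - β| → d1 * Real.exp (-((L + 1) * t)) ≤ ‖ZZ D t α - ZZ D t β‖ := by
    intro D m hm
    have ex : ∀ t ∈ Icc 0 T, d1 * Real.exp (-((L + 1) * t)) ≤ d1 := fun t ht => by
      have : 0 ≤ (L + 1) * t := mul_nonneg (by linarith) ht.1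
      exact mul_le_of_le_one_right d1p.le (Real.exp_le_one_iff.2 (by linarith))
    have big : ∀ t ∈ Icc 0 T, ∀ α β, 4 * N0 ≤ |α - β| → d1 ≤ ‖ZZ D t α - ZZ D t β‖ := fun t ht α β h => by
      linarith [(gb D t ht).2.1 α β h]
    have nc : ∀ t ∈ Icc 0 T, ∀ α β, |α - β| = c0 → d1 ≤ ‖ZZ D t α - ZZ D t β‖ := fun t ht α β h => by
      have := (gb D t ht).1 α β h.le
      rw [h] at this
      refine d1a.trans ?_
      rw [d1b, div_le_iff₀ (by positivity)]; linarith
    have sh : ∀ t ∈ Icc 0 T, ∀ d, (∀ α ∈ Icc 0 (2 * Real.pi), ∀ β, c0 ≤ |α - β| ∧ |α - β| ≤ 4 * N0 → d ≤ ‖ZZ D t α - ZZ D t β‖) → d ≤ d1 → ∀ α β, c0 ≤ |α - β| → d ≤ ‖ZZ D t α - ZZ D t β‖ := fun t ht d h hd α β hab => by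
      rcases le_total (4 * N0) |α - β| with h' | h'
      · exact hd.trans (big t ht α β h')
      · exact shift (S := fun α β => d ≤ ‖ZZ D t α - ZZ D t β‖) (R := fun x => c0 ≤ |x| ∧ |x| ≤ 4 * N0) (fun α β => by rw [M.Zp D ht, M.Zp D ht, add_sub_add_right_eq_sub]) h α β ⟨hab, h'⟩
    have hK : IsCompact {x : ℝ × ℝ | x.1 ∈ Icc 0 (2 * Real.pi) ∧ c0 ≤ |x.1 - x.2| ∧ |x.1 - x.2| ≤ 4 * N0} := by
      refine ((isCompact_Icc (a := (0:ℝ)) (b := 2 * Real.pi)).prod (isCompact_Icc (a := -(4 * N0)) (b := 2 * Real.pi + 4 * N0))).of_isClosed_subset ?_ ?_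
      · exact (isClosed_Icc.preimage continuous_fst).inter ((isClosed_le (f := fun _ : ℝ × ℝ => c0) (g := fun x : ℝ × ℝ => |x.1 - x.2|) (by fun_prop) (by fun_prop)).inter (isClosed_le (f := fun x : ℝ × ℝ => |x.1 - x.2|) (g := fun _ => 4 * N0) (by fun_prop) (by fun_prop)))
      · rintro ⟨a, b⟩ ⟨h1, -, h3⟩
        have h4 := abs_le.1 h3
        simp only at h1 h4
        exact ⟨h1, by simp only; linarith [h1.1, h4.2], by simp only; linarith [h1.2, h4.1]⟩
    have Zc : ContinuousOn (fun x : ℝ × ℝ => ZZ D x.1 x.2) (Icc 0 T ×ˢ univ) := by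
      refine ((M.uw.2 D).add (f := fun x : ℝ × ℝ => ZZ D x.1 x.2 - x.2) (g := fun x : ℝ × ℝ => (x.2 : ℂ)) (by fun_prop)).congr fun x _ => by simp
    have E := ENV hK (T := T) (fun x t => d1 * Real.exp (-((L + 1) * t)) - ‖ZZ D t x.1 - ZZ D t x.2‖) (by
      refine ContinuousOn.sub (by fun_prop) (ContinuousOn.norm (ContinuousOn.sub ?_ ?_))
      · exact Zc.comp (f := fun p : (ℝ × ℝ) × ℝ => (p.2, p.1.1)) (by fun_prop) (fun p hp => ⟨hp.2, mem_univ _⟩)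
      · exact Zc.comp (f := fun p : (ℝ × ℝ) × ℝ => (p.2, p.1.2)) (by fun_prop) (fun p hp => ⟨hp.2, mem_univ _⟩))
      (fun x hx => by
        have h0 : (0:ℝ) ∈ Icc 0 T := ⟨le_rfl, M.T0.le⟩
        have := (gb D 0 h0).2.2 x.1 x.2 (by positivity) hx.2.1
        have := ex 0 h0
        linarith) (fun t ht x hx hpos hmax => by
        have ht' := Ioo_subset_Icc_self ht
        obtain ⟨α0, β0⟩ := x
        simp only at hpos hmax
        have e1 := ex t ht'
        have dd : ‖ZZ D t β0 - ZZ D t α0‖ = ‖ZZ D t α0 - ZZ D t β0‖ := norm_sub_rev _ _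
        obtain ⟨d, hd⟩ : ∃ d, d = ‖ZZ D t α0 - ZZ D t β0‖ := ⟨_, rfl⟩
        rw [← hd] at hpos hmax dd
        have hdd : d < d1 := by linarith
        have dp : 0 < d := by
          rw [hd]
          exact (mul_pos hm.1 (c0p.trans_le hx.2.1)).trans_le (hm.2 t ht' α0 β0)
        have hcl : c0 < |α0 - β0| := lt_of_le_of_ne hx.2.1 fun h => by
          have := nc t ht' α0 β0 h.symm
          linarith
        have fr : ∀ α β, c0 ≤ |α - β| → d ≤ ‖ZZ D t α - ZZ D t β‖ := sh t ht' d (fun α hα β hab => by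
          have := hmax (α, β) ⟨hα, hab⟩
          simp only at this; linarith) hdd.le
        have tt : 1 / (8 * N0 ^ 4) ≤ t := by
          by_contra h
          have := (gb D t ht').2.2 α0 β0 (not_le.1 h).le hx.2.1
          linarith
        have d2 : 2 * N0 * d < c0 := by
          have := hdd.trans_le d1a
          rw [d1b, lt_div_iff₀ (by positivity)] at this; linarith
        have d3 : 100 * N ^ 6 * d ≤ 1 := by
          rw [← d1N]; gcongr
        obtain ⟨d', hd', hD⟩ := M.cr D (L := L * d) ht hAN dp dd hcl d2 (gb D t ht').1 fr (fun lam mu τ bl bm nτ tb tT hw seg => by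
          rw [hL]
          exact nn D m hm t ht' tt c0 d α0 β0 lam mu τ dp (gb D t ht').1 fr bl bm nτ tb tT hw seg d3)
        have hE : HasDerivAt (fun t => d1 * Real.exp (-((L + 1) * t))) (d1 * (Real.exp (-((L + 1) * t)) * -((L + 1) * 1))) t :=
          (((hasDerivAt_id t).const_mul (L + 1)).neg.exp).const_mul d1
        refine ⟨_, ?_, (hE.sub hD).congr_of_eventuallyEq (.of_forall fun s => by simp [norm_sub_rev (ZZ D s β0)])⟩
        have := mul_lt_mul_of_pos_left (show d < d1 * Real.exp (-((L + 1) * t)) by linarith) Lp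
        have : 0 < d1 * Real.exp (-((L + 1) * t)) := by positivity
        linarith)
    intro t ht
    refine sh t ht _ (fun α hα β hab => ?_) (ex t ht)
    have := E t ht (α, β) ⟨hα, hab⟩
    simp only at this; linarith
  obtain ⟨e, he⟩ : ∃ e, e = Real.exp (-((L + 1) * T)) := ⟨_, rfl⟩
  have ep : 0 < e := by rw [he]; positivity
  refine ⟨min (1 / (2 * N0)) (d1 * e / (4 * N0)), by positivity, fun D m hm t ht α β => ?_⟩
  have i1 : min (1 / (2 * N0)) (d1 * e / (4 * N0)) * |α - β| ≤ |α - β| / (2 * N0) := by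
    refine (mul_le_mul_of_nonneg_right (min_le_left _ _) (abs_nonneg _)).trans (le_of_eq (by ring))
  have i2 : min (1 / (2 * N0)) (d1 * e / (4 * N0)) * |α - β| ≤ d1 * e * |α - β| / (4 * N0) := by
    refine (mul_le_mul_of_nonneg_right (min_le_right _ _) (abs_nonneg _)).trans (le_of_eq (by ring))
  rcases le_total |α - β| c0 with h | h
  · refine i1.trans ?_
    rw [div_le_iff₀ (by positivity)]; linarith [(gb D t ht).1 α β h]
  · rcases le_total |α - β| (4 * N0) with h' | h'
    · refine i2.trans (le_trans ?_ (far D m hm t ht α β h))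
      have : e ≤ Real.exp (-((L + 1) * t)) := by
        rw [he]; apply Real.exp_le_exp.2
        have := mul_le_mul_of_nonneg_left ht.2 (show 0 ≤ L + 1 by linarith)
        linarith
      rw [div_le_iff₀ (by positivity)]
      gcongr
    · refine i1.trans ?_
      rw [div_le_iff₀ (by positivity)]
      have := (gb D t ht).2.1 α β h'
      have := mul_le_mul_of_nonneg_left h1 (norm_nonneg (ZZ D t α - ZZ D t β))
      linarith
end
end NS

theorem no_splash_two_fluid (ρ1 ρ2 σ grav T A : ℝ)
    (hρ1 : 0 < ρ1) (hρ2 : 0 < ρ2) (hσ : 0 ≤ σ) (hgrav : 0 ≤ grav) (hT : 0 < T) (hA : 1 ≤ A) :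
    ∃ c : ℝ, 0 < c ∧
      ∀ D : TwoFluid ρ1 ρ2 σ grav T A,
        (∃ m : ℝ, 0 < m ∧ ∀ α β : ℝ, ∀ t ∈ Icc (0:ℝ) T, m ≤ chordArcT D.z α β t) →
        ∀ α β : ℝ, ∀ t ∈ Icc (0:ℝ) T, c ≤ chordArcT D.z α β t := by
  obtain ⟨za, zt, zaa, zat, M⟩ := NS.exFM (ρ1 := ρ1) (ρ2 := ρ2) (σ := σ) (g := grav) hT hA
  obtain ⟨c, hc, h⟩ := M.fin hρ1 hρ2
  refine ⟨min c A⁻¹, lt_min hc (by positivity), fun D ⟨m, hm, hmm⟩ α β t ht => ?_⟩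
  have C : NS.CH m D := ⟨hm, fun t ht α β => by
    by_cases e : α = β
    · simp [e]
    · have := hmm α β t ht
      rwa [NS.cae D t e, le_div_iff₀ (abs_pos.2 (sub_ne_zero.2 e))] at this⟩
  by_cases e : α = β
  · rw [chordArcT, if_pos e]
    exact (min_le_right _ _).trans (D.hz_lower t ht α)
  · rw [NS.cae D t e, le_div_iff₀ (abs_pos.2 (sub_ne_zero.2 e))]
    exact (mul_le_mul_of_nonneg_right (min_le_left _ _) (abs_nonneg _)).trans (h D m C t ht α β)
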